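/- Let F be a field of characteristic p > 0 and let Π be a finitely generated free abelian group of rank q. For n ≥ 1 define the Poincaré series θ(Π,n,t) = Σ_s dim_F H_s(K(Π,n); F) t^s. Then θ(Π,n,t) has radius of convergence at least 1 (it converges on the open unit disc). -/

import Mathlib

open CategoryTheory AlgebraicTopology

/-- The singular chain complex of a topological space with coefficients in a
field `F`: the alternating-face-map complex of the levelwise free `F`-module
on the singular simplicial set of `X`. -/
noncomputable def singularChains (F : Type) [Field F] (X : TopCat) :
    ChainComplex (ModuleCat F) ℕ :=
  (alternatingFaceMapComplex (ModuleCat F)).obj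
    (((SimplicialObject.whiskering _ _).obj (ModuleCat.free F)).obj
      (TopCat.toSSet.obj X))

/-- Singular homology `H_s(X; F)` with coefficients in the field `F`. -/
noncomputable def singularHomologyF (F : Type) [Field F] (X : TopCat) (s : ℕ) :
    ModuleCat F :=
  (singularChains F X).homology s

/-- `X` is an Eilenberg–MacLane space `K(ℤ^q, n)` (`n ≥ 1`): it is
path-connected, all homotopy groups in degrees `≠ n` are trivial, and the
`n`-th homotopy group is (the multiplicative version of) the free abelian
group `ℤ^q`. -/
def IsEilenbergMacLane (X : TopCat) (q n : ℕ) : Prop :=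
  Nonempty X ∧ PathConnectedSpace X ∧
    (∀ (x : X) (i : ℕ), i ≠ n → Nonempty (HomotopyGroup (Fin i) X x ≃ PUnit.{1})) ∧
    (∀ x : X, ∃ m : ℕ, n = m + 1 ∧
      Nonempty (HomotopyGroup (Fin (m + 1)) X x ≃* Multiplicative (Fin q → ℤ)))

section PrismHomotopy
open Opposite Simplicial

/-- A homotopy between morphisms of simplicial objects, given by a family of maps indexed
by the simplices of `Δ[1]`. -/
structure PrismHomotopy {C : Type*} [Category C] {A B : SimplicialObject C} (f g : A ⟶ B) where
  h (X : SimplexCategoryᵒᵖ) (τ : X.unop ⟶ ⦋1⦌) : A.obj X ⟶ B.obj X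
  nat {X Y : SimplexCategoryᵒᵖ} (φ : X ⟶ Y) (τ : X.unop ⟶ ⦋1⦌) :
    A.map φ ≫ h Y (φ.unop ≫ τ) = h X τ ≫ B.map φ
  left (X : SimplexCategoryᵒᵖ) (τ : X.unop ⟶ ⦋1⦌) (hτ : ∀ i, τ i = 0) : h X τ = f.app X
  right (X : SimplexCategoryᵒᵖ) (τ : X.unop ⟶ ⦋1⦌) (hτ : ∀ i, τ i = 1) : h X τ = g.app X

/-- The map `⦋n + 1⦌ ⟶ ⦋1⦌` sending exactly the vertices `≤ i` to `0`. -/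
def cutMap {n : ℕ} (i : Fin (n + 1)) : ⦋n + 1⦌ ⟶ ⦋1⦌ :=
  SimplexCategory.Hom.mk
    ⟨fun j => if j ≤ i.castSucc then 0 else 1, by
      intro a b hab
      dsimp only
      split_ifs with h1 h2
      · exact le_rfl
      · exact Fin.zero_le _
      · exact absurd (hab.trans (by assumption)) h1
      · exact le_rfl⟩

lemma cutMap_apply {n : ℕ} (i : Fin (n + 1)) (j : Fin (n + 2)) :
    cutMap i j = if j ≤ i.castSucc then 0 else 1 := rfl

lemma cut_ext {X : SimplexCategory} {a b : X ⟶ ⦋1⦌} (h : ∀ k, a k = b k) : a = b :=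
  SimplexCategory.Hom.ext _ _ (OrderHom.ext _ _ (funext h))

namespace PrismHomotopy
variable {C : Type*} [Category C] {A B : SimplicialObject C} {f g : A ⟶ B}

lemma hδ (H : PrismHomotopy f g) {n : ℕ} (i : Fin (n + 2)) (τ : ⦋n + 1⦌ ⟶ ⦋1⦌) :
    H.h (op ⦋n + 1⦌) τ ≫ B.δ i = A.δ i ≫ H.h (op ⦋n⦌) (SimplexCategory.δ i ≫ τ) :=
  (H.nat (SimplexCategory.δ i).op τ).symm

lemma hσ (H : PrismHomotopy f g) {n : ℕ} (i : Fin (n + 1)) (τ : ⦋n⦌ ⟶ ⦋1⦌) :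
    H.h (op ⦋n⦌) τ ≫ B.σ i = A.σ i ≫ H.h (op ⦋n + 1⦌) (SimplexCategory.σ i ≫ τ) :=
  (H.nat (SimplexCategory.σ i).op τ).symm

/-- The combinatorial simplicial homotopy attached to a prism homotopy. -/
noncomputable def toHomotopy (H : PrismHomotopy f g) : SimplicialObject.Homotopy f g where
  h {n} i := A.σ i ≫ H.h (op ⦋n + 1⦌) (cutMap i)
  h_zero_comp_δ_zero n := by
    have e := A.δ_comp_σ_self (i := (0 : Fin (n + 1)))
    rw [Category.assoc, H.hδ]
    erw [reassoc_of% e]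
    refine H.right _ _ fun j => ?_
    change cutMap 0 (Fin.succAbove 0 j) = 1
    rw [cutMap_apply]; simp
  h_last_comp_δ_last n := by
    have e := A.δ_comp_σ_succ (i := Fin.last n)
    rw [Category.assoc, H.hδ]
    rw [← Fin.succ_last]
    erw [reassoc_of% e]
    refine H.left _ _ fun j => ?_
    change cutMap (Fin.last n) (Fin.succAbove (Fin.last n).succ j) = 0
    rw [cutMap_apply, if_pos]
    simp [Fin.le_def]; omega
  h_succ_comp_δ_castSucc_of_lt i j hij := by
    rw [Category.assoc, H.hδ, ← Category.assoc, A.δ_comp_σ_of_le hij, Category.assoc]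
    congr 3
    refine cut_ext fun (k : Fin (_ + 1)) => ?_
    change cutMap j.succ (Fin.succAbove i.castSucc k) = cutMap j k
    simp only [cutMap_apply, Fin.succAbove, Fin.le_def, Fin.lt_def] at *
    congr 1
    split_ifs <;> simp at * <;> omega
  h_succ_comp_δ_castSucc_succ j := by
    have e1 := A.δ_comp_σ_self (i := j.succ)
    have e2 := A.δ_comp_σ_succ (i := j.castSucc)
    rw [Category.assoc, H.hδ, Category.assoc, H.hδ]
    rw [← Category.assoc, ← Category.assoc]
    rw [← Fin.succ_castSucc] at e1
    erw [e1, e2]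
    rw [Category.id_comp, Category.id_comp]
    congr 1
    refine cut_ext fun (k : Fin (_ + 1)) => ?_
    change cutMap j.succ (Fin.succAbove j.castSucc.succ k) =
      cutMap j.castSucc (Fin.succAbove j.castSucc.succ k)
    simp only [cutMap_apply, Fin.succAbove, Fin.le_def, Fin.lt_def] at *
    congr 1
    split_ifs <;> simp at * <;> omega
  h_castSucc_comp_δ_succ_of_lt i j hji := by
    rw [Category.assoc, H.hδ, ← Category.assoc, A.δ_comp_σ_of_gt hji, Category.assoc]
    congr 3
    refine cut_ext fun (k : Fin (_ + 1)) => ?_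
    change cutMap j.castSucc (Fin.succAbove i.succ k) = cutMap j k
    simp only [cutMap_apply, Fin.succAbove, Fin.le_def, Fin.lt_def] at *
    congr 1
    split_ifs <;> simp at * <;> omega
  h_comp_σ_castSucc_of_le i j hij := by
    rw [Category.assoc, H.hσ, ← Category.assoc, A.σ_comp_σ hij, Category.assoc]
    congr 3
    refine cut_ext fun (k : Fin (_ + 1)) => ?_
    change cutMap j (Fin.predAbove i.castSucc k) = cutMap j.succ k
    simp only [cutMap_apply]
    congr 1
    rcases lt_or_ge (i.castSucc).castSucc k with hk | hk
    · have hk' : (i : ℕ) < k := hk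
      rw [Fin.predAbove_of_castSucc_lt _ _ hk]
      simp only [Fin.le_def, Fin.val_castSucc, Fin.val_succ, Fin.val_pred, eq_iff_iff] at *
      omega
    · have hk' : (k : ℕ) ≤ (i : ℕ) := hk
      rw [Fin.predAbove_of_le_castSucc _ _ hk]
      simp only [Fin.le_def, Fin.val_castSucc, Fin.val_succ, Fin.coe_castPred, eq_iff_iff] at *
      omega
  h_comp_σ_succ_of_lt i j hji := by
    rw [Category.assoc, H.hσ, ← Category.assoc, ← A.σ_comp_σ hji, Category.assoc]
    congr 3
    refine cut_ext fun (k : Fin (_ + 1)) => ?_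
    change cutMap j (Fin.predAbove i.succ k) = cutMap j.castSucc k
    simp only [cutMap_apply]
    congr 1
    rcases lt_or_ge (i.succ).castSucc k with hk | hk
    · have hk' : (i : ℕ) + 1 < k := hk
      rw [Fin.predAbove_of_castSucc_lt _ _ hk]
      simp only [Fin.le_def, Fin.val_castSucc, Fin.val_pred, eq_iff_iff] at *
      omega
    · have hk' : (k : ℕ) ≤ (i : ℕ) + 1 := hk
      rw [Fin.predAbove_of_le_castSucc _ _ hk]
      simp only [Fin.le_def, Fin.val_castSucc, Fin.coe_castPred] at *

/-- Apply a functor to a prism homotopy. -/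
def whisker (H : PrismHomotopy f g) {D : Type*} [Category D] (F : C ⥤ D) :
    PrismHomotopy (((SimplicialObject.whiskering C D).obj F).map f)
      (((SimplicialObject.whiskering C D).obj F).map g) where
  h X τ := F.map (H.h X τ)
  nat φ τ := by
    have := congrArg F.map (H.nat φ τ)
    rw [F.map_comp, F.map_comp] at this
    exact this
  left X τ hτ := congrArg F.map (H.left X τ hτ)
  right X τ hτ := congrArg F.map (H.right X τ hτ)

end PrismHomotopy
end PrismHomotopy

section Homology
open Opposite Simplicial
variable {F : Type} [Field F]

/-- The dimension of the `s`-th homology of a simplicial vector space. -/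
noncomputable def hdim (A : SimplicialObject (ModuleCat.{0} F)) (s : ℕ) : ENNReal :=
  ((Cardinal.toENat (Module.rank F
    (((alternatingFaceMapComplex (ModuleCat.{0} F)).obj A).homology s)) : ℕ∞) : ENNReal)

lemma toENat_rank_le_of_injective {V W : Type} [AddCommGroup V] [Module F V] [AddCommGroup W]
    [Module F W] (f : V →ₗ[F] W) (hf : Function.Injective f) :
    ((Cardinal.toENat (Module.rank F V) : ℕ∞) : ENNReal) ≤
      ((Cardinal.toENat (Module.rank F W) : ℕ∞) : ENNReal) :=
  ENat.toENNReal_mono (OrderHomClass.mono Cardinal.toENat (LinearMap.rank_le_of_injective f hf))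

lemma toENat_rank_le_of_exact {U V W : Type} [AddCommGroup U] [Module F U] [AddCommGroup V]
    [Module F V] [AddCommGroup W] [Module F W] (f : U →ₗ[F] V) (g : V →ₗ[F] W)
    (h : LinearMap.ker g ≤ LinearMap.range f) :
    ((Cardinal.toENat (Module.rank F V) : ℕ∞) : ENNReal) ≤
      ((Cardinal.toENat (Module.rank F U) : ℕ∞) : ENNReal) +
      ((Cardinal.toENat (Module.rank F W) : ℕ∞) : ENNReal) := by
  rw [← ENat.toENNReal_add, ← map_add]
  refine ENat.toENNReal_mono (OrderHomClass.mono Cardinal.toENat ?_)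
  rw [← g.rank_range_add_rank_ker, add_comm]
  exact add_le_add ((Submodule.rank_mono h).trans (rank_range_le f)) (Submodule.rank_le _)

/-- A levelwise short exact sequence of simplicial vector spaces. -/
structure IsSES {A B C : SimplicialObject (ModuleCat.{0} F)} (f : A ⟶ B) (g : B ⟶ C) : Prop where
  inj (X : SimplexCategoryᵒᵖ) : Function.Injective (f.app X).hom
  exact (X : SimplexCategoryᵒᵖ) : Function.Exact (f.app X).hom (g.app X).hom
  surj (X : SimplexCategoryᵒᵖ) : Function.Surjective (g.app X).hom

lemma IsSES.comp_eq_zero {A B C : SimplicialObject (ModuleCat.{0} F)} {f : A ⟶ B} {g : B ⟶ C}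
    (h : IsSES f g) : f ≫ g = 0 := by
  ext X x
  exact (h.exact X).apply_apply_eq_zero x

/-- The short exact sequence of chain complexes of a short exact sequence. -/
noncomputable def chainSES {A B C : SimplicialObject (ModuleCat.{0} F)} (f : A ⟶ B) (g : B ⟶ C)
    (h : IsSES f g) : ShortComplex (ChainComplex (ModuleCat.{0} F) ℕ) :=
  ShortComplex.mk ((alternatingFaceMapComplex (ModuleCat.{0} F)).map f)
    ((alternatingFaceMapComplex (ModuleCat.{0} F)).map g)
    (by
      rw [← Functor.map_comp, h.comp_eq_zero]
      ext i : 1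
      simp)

lemma chainSES_shortExact {A B C : SimplicialObject (ModuleCat.{0} F)} {f : A ⟶ B} {g : B ⟶ C}
    (h : IsSES f g) : (chainSES f g h).ShortExact := by
  refine HomologicalComplex.shortExact_of_degreewise_shortExact _ fun i => ?_
  refine
    { exact := ?_
      mono_f := ?_
      epi_g := ?_ }
  · rw [ShortComplex.ShortExact.moduleCat_exact_iff_function_exact]
    exact h.exact _
  · exact (ModuleCat.mono_iff_injective _).2 (h.inj _)
  · exact (ModuleCat.epi_iff_surjective _).2 (h.surj _)

lemma exact_toENat_le {S : ShortComplex (ModuleCat.{0} F)} (h : S.Exact) :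
    ((Cardinal.toENat (Module.rank F S.X₂) : ℕ∞) : ENNReal) ≤
      ((Cardinal.toENat (Module.rank F S.X₁) : ℕ∞) : ENNReal) +
      ((Cardinal.toENat (Module.rank F S.X₃) : ℕ∞) : ENNReal) :=
  toENat_rank_le_of_exact S.f.hom S.g.hom h.moduleCat_range_eq_ker.ge

variable {A B C : SimplicialObject (ModuleCat.{0} F)}

lemma IsSES.hdim_mid_le {f : A ⟶ B} {g : B ⟶ C} (h : IsSES f g) (s : ℕ) :
    hdim B s ≤ hdim A s + hdim C s :=
  exact_toENat_le ((chainSES_shortExact h).homology_exact₂ s)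

lemma IsSES.hdim_right_succ_le {f : A ⟶ B} {g : B ⟶ C} (h : IsSES f g) (s : ℕ) :
    hdim C (s + 1) ≤ hdim B (s + 1) + hdim A s :=
  exact_toENat_le ((chainSES_shortExact h).homology_exact₃ (s + 1) s (by simp))

lemma IsSES.hdim_right_zero_le {f : A ⟶ B} {g : B ⟶ C} (h : IsSES f g) :
    hdim C 0 ≤ hdim B 0 := by
  have := (chainSES_shortExact h).epi_g
  have h1 : Epi (HomologicalComplex.homologyMap (chainSES f g h).g 0) :=
    HomologicalComplex.epi_homologyMap_of_epi_of_not_rel _ 0 (by simp)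
  rw [ModuleCat.epi_iff_surjective] at h1
  exact ENat.toENNReal_mono (OrderHomClass.mono Cardinal.toENat
    (LinearMap.rank_le_of_surjective _ h1))

lemma hdim_le_of_retract {f : A ⟶ B} {g : B ⟶ A} (H : PrismHomotopy (𝟙 A) (f ≫ g)) (s : ℕ) :
    hdim A s ≤ hdim B s := by
  refine toENat_rank_le_of_injective
    (HomologicalComplex.homologyMap ((alternatingFaceMapComplex (ModuleCat.{0} F)).map f) s).hom ?_
  have e := H.toHomotopy.map_homology_eq s
  rw [Functor.map_comp, Functor.map_comp, CategoryTheory.Functor.map_id,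
    CategoryTheory.Functor.map_id] at e
  refine Function.LeftInverse.injective
    (g := (HomologicalComplex.homologyMap
      ((alternatingFaceMapComplex (ModuleCat.{0} F)).map g) s).hom) fun x => ?_
  exact congrArg (fun k => k.hom x) e.symm

/-- The truncated Poincaré series of a simplicial vector space, evaluated at `t`. -/
noncomputable def truncSeries (t : ENNReal) (N : ℕ) (A : SimplicialObject (ModuleCat.{0} F)) :
    ENNReal :=
  ∑ s ∈ Finset.range N, hdim A s * t ^ s

lemma truncSeries_mono (t : ENNReal) {M N : ℕ} (h : M ≤ N)
    (A : SimplicialObject (ModuleCat.{0} F)) : truncSeries t M A ≤ truncSeries t N A :=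
  Finset.sum_le_sum_of_subset (Finset.range_mono h)

lemma truncSeries_le_of_retract {f : A ⟶ B} {g : B ⟶ A} (H : PrismHomotopy (𝟙 A) (f ≫ g))
    (t : ENNReal) (N : ℕ) : truncSeries t N A ≤ truncSeries t N B :=
  Finset.sum_le_sum fun s _ => mul_le_mul_left (hdim_le_of_retract H s) _

lemma IsSES.truncSeries_mid_le {f : A ⟶ B} {g : B ⟶ C} (h : IsSES f g) (t : ENNReal) (N : ℕ) :
    truncSeries t N B ≤ truncSeries t N A + truncSeries t N C := by
  rw [truncSeries, truncSeries, truncSeries, ← Finset.sum_add_distrib]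
  refine Finset.sum_le_sum fun s _ => ?_
  rw [← add_mul]
  exact mul_le_mul_left (h.hdim_mid_le s) _

lemma IsSES.truncSeries_right_le {f : A ⟶ B} {g : B ⟶ C} (h : IsSES f g) (t : ENNReal) (N : ℕ) :
    truncSeries t (N + 1) C ≤ truncSeries t (N + 1) B + t * truncSeries t N A := by
  rw [truncSeries, truncSeries, truncSeries, Finset.sum_range_succ', Finset.sum_range_succ',
    Finset.mul_sum]
  have h0 := h.hdim_right_zero_le
  calc _ ≤ ∑ s ∈ Finset.range N, (hdim B (s + 1) * t ^ (s + 1) + t * (hdim A s * t ^ s)) +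
        hdim B 0 * t ^ 0 := by
        gcongr with s
        calc _ ≤ (hdim B (s + 1) + hdim A s) * t ^ (s + 1) :=
              mul_le_mul_left (h.hdim_right_succ_le s) _
          _ = _ := by ring
    _ = _ := by rw [Finset.sum_add_distrib]; ring

/-- The homotopy from the identity to itself. -/
def PrismHomotopy.ofEq {D : Type*} [Category D] {A B : SimplicialObject D} {f g : A ⟶ B}
    (h : f = g) : PrismHomotopy f g where
  h X _ := f.app X
  nat φ _ := f.naturality φ
  left _ _ _ := rfl
  right _ _ _ := by rw [h]

/-- The levelwise tensor product of simplicial vector spaces. -/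
noncomputable def tens (A B : SimplicialObject (ModuleCat.{0} F)) :
    SimplicialObject (ModuleCat.{0} F) where
  obj X := ModuleCat.of F (TensorProduct F (A.obj X) (B.obj X))
  map φ := ModuleCat.ofHom (TensorProduct.map (A.map φ).hom (B.map φ).hom)
  map_id X := by
    ext : 1
    simp
  map_comp φ ψ := by
    ext : 1
    simp [TensorProduct.map_comp]

/-- Functoriality of the levelwise tensor product. -/
noncomputable def tensMap {A A' B B' : SimplicialObject (ModuleCat.{0} F)} (f : A ⟶ A')
    (g : B ⟶ B') : tens A B ⟶ tens A' B' where
  app X := ModuleCat.ofHom (TensorProduct.map (f.app X).hom (g.app X).hom)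
  naturality X Y φ := by
    ext : 1
    have h1 := congrArg ModuleCat.Hom.hom (f.naturality φ)
    have h2 := congrArg ModuleCat.Hom.hom (g.naturality φ)
    simp only [ModuleCat.hom_comp] at h1 h2
    simp only [tens, ModuleCat.hom_comp, ModuleCat.hom_ofHom, ← TensorProduct.map_comp, h1, h2]
    rfl

lemma IsSES.tens {f : A ⟶ B} {g : B ⟶ C} (h : IsSES f g) (M : SimplicialObject (ModuleCat.{0} F)) :
    IsSES (tensMap f (𝟙 M)) (tensMap g (𝟙 M)) where
  inj X := Module.Flat.rTensor_preserves_injective_linearMap _ (h.inj X)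
  exact X := rTensor_exact _ (h.exact X) (h.surj X)
  surj X := LinearMap.rTensor_surjective _ (h.surj X)

/-- Tensoring a homotopy with a simplicial vector space. -/
noncomputable def PrismHomotopy.tens {f g : A ⟶ B} (H : PrismHomotopy f g)
    (M : SimplicialObject (ModuleCat.{0} F)) :
    PrismHomotopy (tensMap f (𝟙 M)) (tensMap g (𝟙 M)) where
  h X τ := ModuleCat.ofHom (TensorProduct.map (H.h X τ).hom LinearMap.id)
  nat {X Y} φ τ := by
    ext : 1
    have h1 := congrArg ModuleCat.Hom.hom (H.nat φ τ)
    simp only [ModuleCat.hom_comp] at h1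
    simp only [_root_.tens, ModuleCat.hom_comp, ModuleCat.hom_ofHom, ← TensorProduct.map_comp, h1,
      LinearMap.id_comp, LinearMap.comp_id]
    rfl
  left X τ hτ := by rw [H.left X τ hτ]; rfl
  right X τ hτ := by rw [H.right X τ hτ]; rfl

end Homology

section Bound
open Opposite Simplicial
variable {F : Type} [Field F] {A B C : SimplicialObject (ModuleCat.{0} F)}

/-- `A` multiplies Poincaré series at `t` by at most `c` under tensor product. -/
def TensorBound (t : ENNReal) (A : SimplicialObject (ModuleCat.{0} F)) (c : ENNReal) : Prop :=
  ∀ (M : SimplicialObject (ModuleCat.{0} F)) (N : ℕ),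
    truncSeries t N (tens A M) ≤ c * truncSeries t N M

lemma TensorBound.mono {t c c' : ENNReal} (h : TensorBound t A c) (hc : c ≤ c') :
    TensorBound t A c' :=
  fun M N => (h M N).trans (mul_le_mul_left hc _)

lemma TensorBound.of_retract {t c : ENNReal} {f : A ⟶ B} {g : B ⟶ A}
    (H : PrismHomotopy (𝟙 A) (f ≫ g)) (h : TensorBound t B c) : TensorBound t A c := by
  intro M N
  refine (truncSeries_le_of_retract (f := tensMap f (𝟙 M)) (g := tensMap g (𝟙 M)) ?_ t N).trans
    (h M N)
  have e1 : tensMap (f ≫ g) (𝟙 M) = tensMap f (𝟙 M) ≫ tensMap g (𝟙 M) := by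
    ext X : 2
    exact TensorProduct.ext' fun a b => rfl
  have e2 : tensMap (𝟙 A) (𝟙 M) = 𝟙 (tens A M) := by
    ext X : 3
    simp [tensMap, tens]
  rw [← e1, ← e2]
  exact H.tens M

lemma TensorBound.of_iso {t c : ENNReal} {f : A ⟶ B} {g : B ⟶ A} (H : f ≫ g = 𝟙 A)
    (h : TensorBound t B c) : TensorBound t A c :=
  h.of_retract (PrismHomotopy.ofEq H.symm)

lemma truncSeries_eq_zero {f : A ⟶ A} (H : PrismHomotopy (𝟙 A) f) (hf : f = 0) (t : ENNReal)
    (N : ℕ) : truncSeries t N A = 0 := by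
  refine Finset.sum_eq_zero fun s _ => ?_
  have e := H.toHomotopy.map_homology_eq s
  have e0 : (alternatingFaceMapComplex (ModuleCat.{0} F)).map f = 0 := by
    subst hf
    ext i : 1
    simp
  rw [CategoryTheory.Functor.map_id, CategoryTheory.Functor.map_id, e0, Functor.map_zero] at e
  have : Subsingleton (((alternatingFaceMapComplex (ModuleCat.{0} F)).obj A).homology s) := by
    refine ModuleCat.subsingleton_of_isZero ?_
    exact (Limits.IsZero.iff_id_eq_zero _).2 e
  rw [hdim, rank_subsingleton']
  simp

lemma TensorBound.zero {t : ENNReal} {f : A ⟶ A} (H : PrismHomotopy (𝟙 A) f) (hf : f = 0) :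
    TensorBound t A 0 := by
  intro M N
  have e2 : tensMap (𝟙 A) (𝟙 M) = 𝟙 (tens A M) := by
    ext X : 3
    simp [tensMap, tens]
  have H' := H.tens M
  rw [e2] at H'
  rw [truncSeries_eq_zero H', zero_mul]
  subst hf
  ext X : 3
  simp [tensMap]
  rfl

/-- Associativity of the levelwise tensor product. -/
noncomputable def tensAssoc (A B C : SimplicialObject (ModuleCat.{0} F)) :
    tens (tens A B) C ≅ tens A (tens B C) :=
  NatIso.ofComponents
    (fun X => (TensorProduct.assoc F (A.obj X) (B.obj X) (C.obj X)).toModuleIso)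
    (fun {X Y} φ => by
      ext : 1
      exact TensorProduct.ext_threefold fun a b c => rfl)

lemma TensorBound.tens {t c c' : ENNReal} (h : TensorBound t A c) (h' : TensorBound t B c') :
    TensorBound t (tens A B) (c * c') := by
  intro M N
  refine (truncSeries_le_of_retract
    (PrismHomotopy.ofEq (tensAssoc A B M).hom_inv_id.symm) t N).trans ?_
  refine (h _ N).trans ?_
  rw [mul_assoc]
  exact mul_le_mul_right (h' M N) _

lemma TensorBound.mid {t c c' : ENNReal} {f : A ⟶ B} {g : B ⟶ C} (h : IsSES f g)
    (hA : TensorBound t A c) (hC : TensorBound t C c') : TensorBound t B (c + c') := by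
  intro M N
  refine ((h.tens M).truncSeries_mid_le t N).trans ?_
  rw [add_mul]
  exact add_le_add (hA M N) (hC M N)

lemma TensorBound.right_of_mid_zero {t c : ENNReal} {f : A ⟶ B} {g : B ⟶ C} (h : IsSES f g)
    (hA : TensorBound t A c) (hB : TensorBound t B 0) : TensorBound t C (t * c) := by
  intro M N
  cases N with
  | zero => simp [truncSeries]
  | succ N =>
    refine ((h.tens M).truncSeries_right_le t N).trans ?_
    have h1 := hB M (N + 1)
    rw [zero_mul, nonpos_iff_eq_zero] at h1
    rw [h1, zero_add, mul_assoc]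
    refine mul_le_mul_right ((hA M N).trans ?_) _
    exact mul_le_mul_right (truncSeries_mono t (Nat.le_succ N) M) _

/-- A resolution `⋯ → K 1 → K 0 → Z 0`, cut into short exact sequences, bounds `Z 0`. -/
lemma TensorBound.of_resolution {t : ENNReal} (Z K : ℕ → SimplicialObject (ModuleCat.{0} F))
    (f : ∀ j, Z (j + 1) ⟶ K j) (g : ∀ j, K j ⟶ Z j) (h : ∀ j, IsSES (f j) (g j))
    (c : ℕ → ENNReal) (hK : ∀ j, TensorBound t (K j) (c j)) :
    TensorBound t (Z 0) (∑' j, t ^ j * c j) := by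
  intro M N
  have key : ∀ (n : ℕ) (i : ℕ), truncSeries t n (_root_.tens (Z i) M) ≤
      (∑ j ∈ Finset.range n, t ^ j * c (i + j)) * truncSeries t n M := by
    intro n
    induction n with
    | zero => intro i; simp [truncSeries]
    | succ n ih =>
      intro i
      refine (((h i).tens M).truncSeries_right_le t n).trans ?_
      rw [Finset.sum_range_succ', add_comm, add_mul]
      refine add_le_add ?_ ?_
      · calc _ ≤ t * ((∑ j ∈ Finset.range n, t ^ j * c (i + 1 + j)) * truncSeries t n M) :=
              mul_le_mul_right (ih (i + 1)) _
          _ ≤ t * ((∑ j ∈ Finset.range n, t ^ j * c (i + 1 + j)) * truncSeries t (n + 1) M) := by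
              gcongr
              exact truncSeries_mono t (Nat.le_succ n) M
          _ = _ := by
              rw [← mul_assoc, Finset.mul_sum]
              congr 1
              refine Finset.sum_congr rfl fun j _ => ?_
              rw [pow_succ, show i + 1 + j = i + (j + 1) by ring]
              ring
      · simpa using hK i M (n + 1)
  refine (key N 0).trans ?_
  simp only [zero_add]
  exact mul_le_mul_left (ENNReal.sum_le_tsum _) _

/-- The constant simplicial vector space. -/
noncomputable abbrev constS (V : ModuleCat.{0} F) : SimplicialObject (ModuleCat.{0} F) :=
  (SimplicialObject.const _).obj V

lemma TensorBound.const_field (t : ENNReal) :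
    TensorBound t (constS (ModuleCat.of F F)) 1 := by
  intro M N
  rw [one_mul]
  refine truncSeries_le_of_retract
    (f := { app := fun X => ModuleCat.ofHom (TensorProduct.lid F (M.obj X)).toLinearMap
            naturality := fun X Y φ => ?_ })
    (g := { app := fun X => ModuleCat.ofHom (TensorProduct.lid F (M.obj X)).symm.toLinearMap
            naturality := fun X Y φ => ?_ }) (PrismHomotopy.ofEq (Eq.symm ?_)) t N
  · refine ModuleCat.hom_ext (TensorProduct.ext' fun a b => ?_)
    exact ((M.map φ).hom.map_smul a b).symm
  · refine ModuleCat.hom_ext (LinearMap.ext fun x => rfl)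
  · ext X : 2
    exact LinearMap.ext fun x => (TensorProduct.lid F _).symm_apply_apply x

lemma TensorBound.const_pi (t : ENNReal) (r : ℕ) :
    TensorBound t (constS (ModuleCat.of F (Fin r → F))) r := by
  induction r with
  | zero =>
    refine TensorBound.mono (TensorBound.zero (PrismHomotopy.ofEq (g := 0) ?_) rfl) bot_le
    ext X : 2
    exact LinearMap.ext fun x => funext fun (i : Fin 0) => i.elim0
  | succ r ih =>
    rw [Nat.cast_succ]
    refine TensorBound.mid
      (f := (SimplicialObject.const _).map
        (ModuleCat.ofHom (LinearMap.pi (Fin.lastCases 0 fun i => LinearMap.proj i))))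
      (g := (SimplicialObject.const _).map
        (ModuleCat.ofHom (LinearMap.proj (Fin.last r)))) ?_ ih (TensorBound.const_field t)
    refine ⟨fun X => ?_, fun X => ?_, fun X => ?_⟩
    · intro a b hab
      refine funext fun i => ?_
      simpa using congrFun hab i.castSucc
    · intro b
      constructor
      · intro hb
        refine ⟨fun i => b i.castSucc, ?_⟩
        refine funext fun i => ?_
        refine Fin.lastCases ?_ (fun i => ?_) i
        · simpa using hb.symm
        · simp
      · rintro ⟨a, rfl⟩
        simp
    · intro x
      exact ⟨fun _ => x, rfl⟩

lemma TensorBound.const (t : ENNReal) (V : ModuleCat.{0} F) [FiniteDimensional F V] :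
    TensorBound t (constS V) (Module.finrank F V) := by
  refine (TensorBound.const_pi t _).of_iso
    (f := (SimplicialObject.const _).map (ModuleCat.ofHom
      (Module.finBasis F V).equivFun.toLinearMap))
    (g := (SimplicialObject.const _).map (ModuleCat.ofHom
      (Module.finBasis F V).equivFun.symm.toLinearMap)) ?_
  rw [← Functor.map_comp, ← ModuleCat.ofHom_comp]
  simp

end Bound

section PartialSets
open Opposite Simplicial

/-- Finite sets, viewed as the objects of the category of finite sets and partial maps. -/
structure PFin where
  carrier : Type
  [fintype : Fintype carrier]

attribute [instance] PFin.fintype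

instance : CoeSort PFin Type := ⟨PFin.carrier⟩

/-- A partial map. -/
@[ext]
structure PFin.Hom (S T : PFin) where
  toFun : S → Option T

instance : Category PFin where
  Hom S T := PFin.Hom S T
  id S := ⟨some⟩
  comp φ ψ := ⟨fun s => (φ.toFun s).bind ψ.toFun⟩
  id_comp φ := rfl
  comp_id φ := by ext s : 2; simp
  assoc φ ψ χ := by ext s : 2; simp [Option.bind_assoc]

instance {S T : PFin} : CoeFun (S ⟶ T) (fun _ => S → Option T) := ⟨PFin.Hom.toFun⟩

@[ext]
lemma PFin.hom_ext {S T : PFin} {φ ψ : S ⟶ T} (h : ∀ s, φ s = ψ s) : φ = ψ :=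
  PFin.Hom.ext (funext h)

@[simp] lemma PFin.id_apply {S : PFin} (s : S) : (𝟙 S : S ⟶ S) s = some s := rfl

@[simp] lemma PFin.comp_apply {S T U : PFin} (φ : S ⟶ T) (ψ : T ⟶ U) (s : S) :
    (φ ≫ ψ) s = (φ s).bind ψ := rfl

/-- The nowhere defined partial map. -/
def PFin.none (S T : PFin) : S ⟶ T := ⟨fun _ => Option.none⟩

/-- A sequence with values at most `N`, monotone, attaining all values `≤ n`, with a label. -/
def IsCover (n N q : ℕ) {k : ℕ} (g : (Fin (k + 1) → ℕ) × Fin q) : Prop :=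
  Monotone g.1 ∧ (∀ i, g.1 i ≤ N) ∧ ∀ v ≤ n, ∃ i, g.1 i = v

instance (n N q k : ℕ) : Finite {g : (Fin (k + 1) → ℕ) × Fin q // IsCover n N q g} :=
  Finite.of_injective (β := (Fin (k + 1) → Fin (N + 1)) × Fin q)
    (fun g => (fun i => ⟨g.1.1 i, Nat.lt_succ_of_le (g.2.2.1 i)⟩, g.1.2)) (by
      rintro ⟨⟨g, a⟩, hg⟩ ⟨⟨g', a'⟩, hg'⟩ h
      simp only [Prod.mk.injEq, Subtype.mk.injEq] at h ⊢
      refine ⟨funext fun i => ?_, h.2⟩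
      simpa using congrFun h.1 i)

/-- The finite set of monotone maps `⦋k⦌ → {0, …, N}` whose image contains `{0, …, n}`,
times `Fin q`. -/
noncomputable def coverSet (n N q k : ℕ) : PFin :=
  @PFin.mk {g : (Fin (k + 1) → ℕ) × Fin q // IsCover n N q g} (Fintype.ofFinite _)

open Classical in
/-- The partial map between cover sets given by a partially defined operation. -/
noncomputable def coverHom {n N n' N' q k k' : ℕ} (u : (Fin (k + 1) → ℕ) → (Fin (k' + 1) → ℕ)) :
    coverSet n N q k ⟶ coverSet n' N' q k' :=
  ⟨fun g => if h : IsCover n' N' q (u g.1.1, g.1.2) then some ⟨(u g.1.1, g.1.2), h⟩ else none⟩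

lemma coverHom_eq_some {n N n' N' q k k' : ℕ} {u : (Fin (k + 1) → ℕ) → (Fin (k' + 1) → ℕ)}
    {g : coverSet n N q k} {b : coverSet n' N' q k'} :
    (coverHom (n' := n') (N' := N') u : _ ⟶ _) g = some b ↔ (u g.1.1, g.1.2) = b.1 := by
  unfold coverHom
  dsimp only
  split_ifs with h
  · exact (Option.some_inj.trans Subtype.ext_iff)
  · refine iff_of_false nofun fun hb => h (hb ▸ b.2)

lemma coverHom_comp {n N n' N' n'' N'' q k k' k'' : ℕ}
    {u : (Fin (k + 1) → ℕ) → (Fin (k' + 1) → ℕ)} {v : (Fin (k' + 1) → ℕ) → (Fin (k'' + 1) → ℕ)}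
    {w : (Fin (k + 1) → ℕ) → (Fin (k'' + 1) → ℕ)}
    (h1 : ∀ g a, IsCover n N q (g, a) → v (u g) = w g)
    (h2 : ∀ g a, IsCover n N q (g, a) → IsCover n'' N'' q (w g, a) → IsCover n' N' q (u g, a)) :
    (coverHom u : coverSet n N q k ⟶ coverSet n' N' q k') ≫
      (coverHom v : _ ⟶ coverSet n'' N'' q k'') = coverHom w := by
  ext g b
  rw [PFin.comp_apply, Option.bind_eq_some_iff, coverHom_eq_some]
  constructor
  · rintro ⟨c, hc, hb⟩
    rw [coverHom_eq_some] at hc hb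
    rw [← hb, ← hc]
    simp [h1 g.1.1 g.1.2 g.2]
  · intro hb
    have hc := h2 g.1.1 g.1.2 g.2 (hb ▸ b.2)
    refine ⟨⟨_, hc⟩, coverHom_eq_some.2 rfl, coverHom_eq_some.2 ?_⟩
    rw [← hb]
    simp [h1 g.1.1 g.1.2 g.2]

/-- The simplicial partial set of monotone maps `⦋k⦌ → {0, …, N}` whose image contains
`{0, …, n}`, times `Fin q`. -/
noncomputable def coverSpace (n N q : ℕ) : SimplicialObject PFin where
  obj X := coverSet n N q X.unop.len
  map φ := coverHom fun g => g ∘ φ.unop.toOrderHom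
  map_id X := by
    ext g b
    rw [coverHom_eq_some]
    exact Subtype.ext_iff.symm.trans Option.some_inj.symm
  map_comp φ ψ := by
    symm
    refine coverHom_comp (fun g a _ => rfl) fun g a hg h => ?_
    refine ⟨hg.1.comp φ.unop.toOrderHom.monotone, fun i => hg.2.1 _, fun v hv => ?_⟩
    obtain ⟨i, hi⟩ := h.2.2 v hv
    exact ⟨_, hi⟩

/-- The quotient of the cone by the base. -/
noncomputable def coverQuot (n q : ℕ) : coverSpace n (n + 1) q ⟶ coverSpace (n + 1) (n + 1) q where
  app X := coverHom id
  naturality X Y φ := by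
    refine Eq.trans (b := coverHom fun g => g ∘ φ.unop.toOrderHom)
      (@coverHom_comp n (n + 1) n (n + 1) (n + 1) (n + 1) q X.unop.len Y.unop.len Y.unop.len
        (fun g => g ∘ φ.unop.toOrderHom)
        id _ ?_ ?_) (Eq.symm
      (@coverHom_comp n (n + 1) (n + 1) (n + 1) (n + 1) (n + 1) q X.unop.len X.unop.len Y.unop.len
        id
        (fun g => g ∘ φ.unop.toOrderHom) _ ?_ ?_))
    · exact fun _ _ _ => rfl
    · intro g a hg h
      exact ⟨h.1, h.2.1, fun v hv => h.2.2 v (hv.trans (Nat.le_succ n))⟩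
    · exact fun _ _ _ => rfl
    · intro g a hg h
      refine ⟨hg.1, hg.2.1, fun v hv => ?_⟩
      obtain ⟨i, hi⟩ := h.2.2 v hv
      exact ⟨_, hi⟩

/-- The nowhere defined endomorphism. -/
def noneHom (A : SimplicialObject PFin) : A ⟶ A where
  app X := PFin.none _ _
  naturality X Y φ := by
    ext s : 1
    cases h : A.map φ s <;> simp [PFin.none, h]

/-- The cone is contractible. -/
noncomputable def coneHomotopy (n q : ℕ) :
    PrismHomotopy (𝟙 (coverSpace n (n + 1) q)) (noneHom (coverSpace n (n + 1) q)) where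
  h X τ := coverHom fun g j => if τ j = 0 then g j else n + 1
  nat {X Y} φ τ := by
    refine Eq.trans (b := coverHom fun g j => if τ (φ.unop j) = 0 then g (φ.unop j) else n + 1)
      (@coverHom_comp n (n + 1) n (n + 1) n (n + 1) q X.unop.len Y.unop.len Y.unop.len
        (fun g => g ∘ φ.unop.toOrderHom)
        (fun g j => if τ (φ.unop j) = 0 then g j else n + 1) _ ?_ ?_) (Eq.symm
      (@coverHom_comp n (n + 1) n (n + 1) n (n + 1) q X.unop.len X.unop.len Y.unop.len
        (fun g j => if τ j = 0 then g j else n + 1)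
        (fun g => g ∘ φ.unop.toOrderHom) _ ?_ ?_))
    · exact fun _ _ _ => rfl
    · intro g a hg h
      refine ⟨hg.1.comp φ.unop.toOrderHom.monotone, fun i => hg.2.1 _, fun v hv => ?_⟩
      obtain ⟨i, hi⟩ := h.2.2 v hv
      dsimp only at hi
      split_ifs at hi
      · exact ⟨i, hi⟩
      · omega
    · exact fun _ _ _ => rfl
    · intro g a hg h
      refine ⟨?_, ?_, ?_⟩
      · intro i j hij
        dsimp only
        have hτ : τ i ≤ τ j := τ.toOrderHom.monotone hij
        split_ifs with h1 h2 h2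
        · exact hg.1 hij
        · exact hg.2.1 _
        · rw [h2] at hτ
          exact absurd (le_antisymm hτ (Fin.zero_le _)) h1
        · exact le_rfl
      · intro i
        dsimp only
        split_ifs
        · exact hg.2.1 _
        · exact le_rfl
      · intro v hv
        obtain ⟨i, hi⟩ := h.2.2 v hv
        exact ⟨_, hi⟩
  left X τ hτ := by
    ext g b
    change _ = some b ↔ some g = some b
    rw [coverHom_eq_some]
    simp only [hτ, if_true]
    exact Subtype.ext_iff.symm.trans Option.some_inj.symm
  right X τ hτ := by
    ext g b
    change _ = some b ↔ Option.none = some b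
    rw [coverHom_eq_some]
    simp only [hτ, reduceCtorEq, iff_false]
    intro h
    obtain ⟨i, hi⟩ := b.2.2.2 0 (Nat.zero_le n)
    rw [← h] at hi
    simp at hi

end PartialSets

section ExteriorPowers

variable {F : Type} [Field F] {S T C : Type}

/-- The `j`-th exterior power of the free module on `S` (finite), as alternating forms on the
dual. -/
abbrev ExtPow (F : Type) [Field F] (j : ℕ) (S : Type) : Type := (S → F) [⋀^Fin j]→ₗ[F] F

/-- Contraction with the covector dual to `s`. -/
noncomputable def ctr (F : Type) [Field F] {S : Type} [DecidableEq S] {j : ℕ} (s : S) : ExtPow F (j + 1) S →ₗ[F] ExtPow F j S :=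
  (LinearMap.applyₗ (Pi.single s (1 : F))).comp AlternatingMap.curryLeftLinearMap

lemma ctr_apply [DecidableEq S] {j : ℕ} (s : S) (f : ExtPow F (j + 1) S) (v : Fin j → S → F) :
    ctr F s f v = f (Matrix.vecCons (Pi.single s 1) v) := rfl

/-- Exterior multiplication with `s`. -/
noncomputable def wdg (F : Type) [Field F] {S : Type} {j : ℕ} (s : S) : ExtPow F j S →ₗ[F] ExtPow F (j + 1) S :=
  AlternatingMap.alternatizeUncurryFinLM.comp
    (LinearMap.smulRightₗ (LinearMap.proj s : (S → F) →ₗ[F] F))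

lemma wdg_apply {j : ℕ} (s : S) (f : ExtPow F j S) (v : Fin (j + 1) → S → F) :
    wdg F s f v = ∑ i : Fin (j + 1), (-1) ^ (i : ℕ) * (v i s * f (i.removeNth v)) := by
  simp [wdg, AlternatingMap.alternatizeUncurryFin_apply]

lemma ctr_ctr [DecidableEq S] {j : ℕ} (s t : S) (f : ExtPow F (j + 2) S) :
    ctr F s (ctr F t f) = - ctr F t (ctr F s f) := by
  rw [eq_neg_iff_add_eq_zero]
  have h := AlternatingMap.curryLeft_same f (Pi.single s (1 : F) + Pi.single t 1)
  simp only [map_add, AlternatingMap.curryLeft_add, LinearMap.add_apply,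
    AlternatingMap.curryLeft_same, zero_add, add_zero] at h
  exact h

lemma ctr_self [DecidableEq S] {j : ℕ} (s : S) (f : ExtPow F (j + 2) S) : ctr F s (ctr F s f) = 0 :=
  AlternatingMap.curryLeft_same f _

lemma wdg_wdg {j : ℕ} (s t : S) (f : ExtPow F j S) : wdg F s (wdg F t f) = - wdg F t (wdg F s f) := by
  rw [eq_neg_iff_add_eq_zero]
  let b (s t : S) : (S → F) →ₗ[F] (S → F) →ₗ[F] ExtPow F j S :=
    (LinearMap.proj s : (S → F) →ₗ[F] F).smulRight ((LinearMap.proj t : (S → F) →ₗ[F] F).smulRight f)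
  have h := AlternatingMap.alternatizeUncurryFin_alternatizeUncurryFinLM_comp_of_symmetric
    (f := b s t + b t s) (by intro x y; simp [b, smul_smul, mul_comm, add_comm])
  rw [LinearMap.comp_add, AlternatingMap.alternatizeUncurryFin_add] at h
  have e (s t : S) : AlternatingMap.alternatizeUncurryFinLM.comp (b s t) =
      (LinearMap.proj s : (S → F) →ₗ[F] F).smulRight (wdg F t f) := by
    ext x : 1
    simp only [b, LinearMap.comp_apply, LinearMap.smulRight_apply, map_smul]
    rfl
  rw [e, e] at h
  exact h

lemma wdg_self {j : ℕ} (s : S) (f : ExtPow F j S) : wdg F s (wdg F s f) = 0 := by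
  let b : (S → F) →ₗ[F] (S → F) →ₗ[F] ExtPow F j S :=
    (LinearMap.proj s : (S → F) →ₗ[F] F).smulRight ((LinearMap.proj s : (S → F) →ₗ[F] F).smulRight f)
  have h := AlternatingMap.alternatizeUncurryFin_alternatizeUncurryFinLM_comp_of_symmetric
    (f := b) (by intro x y; simp [b, smul_smul, mul_comm])
  have e : AlternatingMap.alternatizeUncurryFinLM.comp b =
      (LinearMap.proj s : (S → F) →ₗ[F] F).smulRight (wdg F s f) := by
    ext x : 1
    simp only [b, LinearMap.comp_apply, LinearMap.smulRight_apply, map_smul]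
    rfl
  rwa [e] at h

lemma ctr_wdg_add [DecidableEq S] {j : ℕ} (s t : S) (f : ExtPow F (j + 1) S) :
    ctr F s (wdg F t f) + wdg F t (ctr F s f) = if s = t then f else 0 := by
  ext v
  rw [AlternatingMap.add_apply, ctr_apply, wdg_apply, wdg_apply, Fin.sum_univ_succ]
  have : ∀ i : Fin (j + 1), (Fin.removeNth i.succ (Matrix.vecCons (Pi.single s (1 : F)) v)) =
      Matrix.vecCons (Pi.single s (1 : F)) (i.removeNth v) := by
    intro i
    ext k : 1
    refine Fin.cases ?_ (fun k => ?_) k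
    · simp [Fin.removeNth]
    · simp [Fin.removeNth]
  simp only [ctr_apply, this]
  simp only [pow_succ, Fin.val_succ, Fin.val_zero, pow_zero, Matrix.cons_val_zero,
    Matrix.cons_val_succ, one_mul, mul_neg, mul_one, neg_mul, Finset.sum_neg_distrib]
  rw [neg_add_cancel_right]
  have h0 : Fin.removeNth 0 (Matrix.vecCons (Pi.single s (1 : F)) v) = v := by
    ext k : 1; simp [Fin.removeNth]
  rw [h0]
  split_ifs with h
  · subst h; simp
  · simp [Pi.single_eq_of_ne (Ne.symm h)]

lemma ctr_wdg_zero [DecidableEq S] (s t : S) (f : ExtPow F 0 S) :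
    ctr F s (wdg F t f) = if s = t then f else 0 := by
  ext v
  rw [ctr_apply, wdg_apply]
  have h0 : Fin.removeNth 0 (Matrix.vecCons (Pi.single s (1 : F)) v) = v := by
    ext k : 1; exact k.elim0
  rw [Fin.sum_univ_one, h0]
  split_ifs with h
  · subst h; simp
  · simp [Pi.single_eq_of_ne (Ne.symm h)]

lemma eq_zero_of_ctr [DecidableEq S] [Fintype S] {j : ℕ} (f : ExtPow F (j + 1) S)
    (h : ∀ s, ctr F s f = 0) : f = 0 := by
  have : f.curryLeft = 0 := by
    refine LinearMap.pi_ext' fun s => LinearMap.ext_ring ?_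
    exact h s
  ext v
  have h1 := congrArg (fun g => g (v 0) (Matrix.vecTail v)) this
  simp only [AlternatingMap.curryLeft_apply_apply] at h1
  have h2 : Matrix.vecCons (v 0) (Matrix.vecTail v) = v := Matrix.cons_head_tail v
  rwa [h2] at h1

/-- Precomposition with a partial map. -/
def pullCov (F : Type) [Field F] (φ : S → Option T) : (T → F) →ₗ[F] (S → F) where
  toFun v s := (φ s).elim 0 v
  map_add' v w := by ext s; cases h : φ s <;> simp [h]
  map_smul' c v := by ext s; cases h : φ s <;> simp [h]

lemma pullCov_apply (φ : S → Option T) (v : T → F) (s : S) :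
    pullCov F φ v s = (φ s).elim 0 v := rfl

/-- Functoriality of exterior powers for partial maps. -/
noncomputable def extMap (F : Type) [Field F] {S T : Type} {j : ℕ} (φ : S → Option T) : ExtPow F j S →ₗ[F] ExtPow F j T where
  toFun f := f.compLinearMap (pullCov F φ)
  map_add' _ _ := rfl
  map_smul' _ _ := rfl

lemma extMap_apply {j : ℕ} (φ : S → Option T) (f : ExtPow F j S) (v : Fin j → T → F) :
    extMap F φ f v = f (fun i => pullCov F φ (v i)) := rfl

lemma ExtPow.sum_apply {j : ℕ} {ι : Type} (s : Finset ι) (f : ι → ExtPow F j S)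
    (v : Fin j → S → F) : (∑ i ∈ s, f i) v = ∑ i ∈ s, f i v :=
  map_sum (⟨⟨fun g => g v, rfl⟩, fun _ _ => rfl⟩ : ExtPow F j S →+ F) f s

lemma ctr_extMap [DecidableEq S] [DecidableEq T] [Fintype S] {j : ℕ} (φ : S → Option T) (t : T)
    (f : ExtPow F (j + 1) S) :
    ctr F t (extMap F φ f) = ∑ s, if φ s = some t then extMap F φ (ctr F s f) else 0 := by
  ext v
  have h : pullCov F φ (Pi.single t 1) = ∑ s, if φ s = some t then Pi.single s (1 : F) else 0 := by
    ext s
    rw [Finset.sum_apply, pullCov_apply, Finset.sum_eq_single s]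
    · cases h : φ s with
      | none => simp
      | some u =>
        by_cases hu : u = t
        · subst hu; simp
        · simp [hu]
    · intro b _ hb
      split_ifs
      · exact Pi.single_eq_of_ne (Ne.symm hb) _
      · rfl
    · simp
  have h2 : (fun i => pullCov F φ (Matrix.vecCons (Pi.single t (1 : F)) v i)) =
      Matrix.vecCons (pullCov F φ (Pi.single t 1)) (fun i => pullCov F φ (v i)) := by
    ext i : 1
    refine Fin.cases rfl (fun i => rfl) i
  rw [ctr_apply, extMap_apply, h2, ← AlternatingMap.curryLeft_apply_apply, h, map_sum,
    ExtPow.sum_apply, ExtPow.sum_apply]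
  refine Finset.sum_congr rfl fun s _ => ?_
  split_ifs
  · rfl
  · simp

lemma extMap_wdg {j : ℕ} (φ : S → Option T) (s : S) (f : ExtPow F j S) :
    extMap F φ (wdg F s f) = (φ s).elim 0 (fun t => wdg F t (extMap F φ f)) := by
  cases h : φ s with
  | none =>
    ext v
    simp [extMap_apply, wdg_apply, pullCov_apply, h]
  | some t =>
    ext v
    simp only [Option.elim_some, extMap_apply, wdg_apply, pullCov_apply, h]
    rfl

lemma extMap_comp {U : Type} {j : ℕ} (φ : S → Option T) (ψ : T → Option U) (f : ExtPow F j S) :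
    extMap F (fun s => (φ s).bind ψ) f = extMap F ψ (extMap F φ f) := by
  ext v
  simp only [extMap_apply]
  congr 1
  ext i s
  simp only [pullCov_apply]
  cases φ s <;> rfl

lemma extPow_eq_zero_of_card_lt [Fintype S] {j : ℕ} (hj : Fintype.card S < j)
    (f : ExtPow F j S) : f = 0 := by
  ext v
  refine f.map_linearDependent v fun h => ?_
  have := h.fintype_card_le_finrank
  simp at this
  omega

/-- A partial map `r : C → Q` is the quotient by an injection `i : S → C`. -/
structure IsCofib {S C Q : Type} (i : S → C) (r : C → Option Q) where
  inj : Function.Injective i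
  sec : Q → C
  r_sec (a : Q) : r (sec a) = some a
  r_i (s : S) : r (i s) = none
  of_none {c : C} (h : r c = none) : ∃ s, i s = c
  of_some {c : C} {a : Q} (h : r c = some a) : sec a = c

lemma IsCofib.extMap_surjective {Q : Type} {i : S → C} {r : C → Option Q} (h : IsCofib i r)
    (j : ℕ) : Function.Surjective (extMap F (j := j) r) := fun f =>
  ⟨extMap F (fun a => some (h.sec a)) f, by
    rw [← extMap_comp]
    simp only [Option.bind_some, h.r_sec]
    rfl⟩

lemma IsCofib.ext_eq_zero {Q : Type} [Fintype C] [DecidableEq C] {i : S → C} {r : C → Option Q}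
    (h : IsCofib i r) {j : ℕ} (f : ExtPow F j C) (h1 : extMap F r f = 0)
    (h2 : ∀ (j' : ℕ) (e : j = j' + 1) (s : S), ctr F (i s) (e ▸ f : ExtPow F (j' + 1) C) = 0) :
    f = 0 := by
  classical
  refine Module.Basis.ext_alternating (Pi.basisFun F C) fun v _ => ?_
  simp only [Pi.basisFun_apply]
  by_cases hv : ∃ k s, v k = i s
  · obtain ⟨k, s, hk⟩ := hv
    obtain ⟨j', rfl⟩ : ∃ j', j = j' + 1 := ⟨j - 1, by have := k.2; omega⟩
    have h3 := h2 j' rfl s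
    rw [← Fin.insertNth_self_removeNth k (fun a => (Pi.single (v a) (1 : F) : C → F)),
      AlternatingMap.map_insertNth]
    simp only [hk]
    rw [← ctr_apply, h3]
    simp
  · push Not at hv
    have : ∀ k, ∃ a, r (v k) = some a := by
      intro k
      cases hr : r (v k) with
      | none =>
        obtain ⟨s, hs⟩ := h.of_none hr
        exact absurd hs.symm (hv k s)
      | some a => exact ⟨a, rfl⟩
    choose w hw using this
    have h3 := congrArg (fun g => g (fun k => Pi.single (w k) (1 : F))) h1
    simp only [extMap_apply, AlternatingMap.zero_apply] at h3
    rw [AlternatingMap.zero_apply, ← h3]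
    congr 1
    ext k c
    rw [pullCov_apply]
    cases hr : r c with
    | none =>
      have : c ≠ v k := fun e => by rw [e, hw] at hr; exact Option.some_ne_none _ hr
      simp [Pi.single_eq_of_ne this]
    | some a =>
      by_cases hc : c = v k
      · have : a = w k := by rw [hc, hw] at hr; exact (Option.some.inj hr).symm
        simp [hc, this]
      · have : a ≠ w k := by
          rintro rfl
          exact hc ((h.of_some hr).symm.trans (h.of_some (hw k)))
        simp [Pi.single_eq_of_ne hc, Pi.single_eq_of_ne this]

end ExteriorPowers

section Complexes
open Limits

variable {F : Type} [Field F]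

lemma injective_image_ι {A B : SimplicialObject (ModuleCat.{0} F)} (f : A ⟶ B)
    (X : SimplexCategoryᵒᵖ) : Function.Injective ((image.ι f).app X).hom :=
  (ModuleCat.mono_iff_injective _).1 (NatTrans.mono_iff_mono_app _ |>.1 inferInstance X)

lemma surjective_factorThruImage {A B : SimplicialObject (ModuleCat.{0} F)} (f : A ⟶ B)
    (X : SimplexCategoryᵒᵖ) : Function.Surjective ((factorThruImage f).app X).hom :=
  (ModuleCat.epi_iff_surjective _).1 (NatTrans.epi_iff_epi_app _ |>.1 inferInstance X)

lemma image_fac_apply {A B : SimplicialObject (ModuleCat.{0} F)} (f : A ⟶ B)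
    (X : SimplexCategoryᵒᵖ) (x : A.obj X) :
    ((image.ι f).app X).hom (((factorThruImage f).app X).hom x) = (f.app X).hom x := by
  conv_rhs => rw [← image.fac f]
  rfl

/-- Exactness at `B` gives a short exact sequence from the image of `f` to the image of `g`. -/
lemma isSES_image {A B C : SimplicialObject (ModuleCat.{0} F)} (f : A ⟶ B) (g : B ⟶ C)
    (h : ∀ X, Function.Exact (f.app X).hom (g.app X).hom) :
    IsSES (image.ι f) (factorThruImage g) where
  inj := injective_image_ι f
  surj := surjective_factorThruImage g
  exact X y := by
    have h1 : ((factorThruImage g).app X).hom y = 0 ↔ (g.app X).hom y = 0 := by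
      rw [← image_fac_apply g, map_eq_zero_iff _ (injective_image_ι g X)]
    rw [h1, h X y]
    constructor
    · rintro ⟨x, rfl⟩
      exact ⟨_, image_fac_apply f X x⟩
    · rintro ⟨x, rfl⟩
      obtain ⟨x, rfl⟩ := surjective_factorThruImage f X x
      exact ⟨x, (image_fac_apply f X x).symm⟩

lemma isSES_image_of_surjective {A B C : SimplicialObject (ModuleCat.{0} F)} (f : A ⟶ B)
    (g : B ⟶ C) (h : ∀ X, Function.Exact (f.app X).hom (g.app X).hom)
    (hg : ∀ X, Function.Surjective (g.app X).hom) : IsSES (image.ι f) g where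
  inj := injective_image_ι f
  surj := hg
  exact X y := by
    rw [h X y]
    constructor
    · rintro ⟨x, rfl⟩
      exact ⟨_, image_fac_apply f X x⟩
    · rintro ⟨x, rfl⟩
      obtain ⟨x, rfl⟩ := surjective_factorThruImage f X x
      exact ⟨x, (image_fac_apply f X x).symm⟩

/-- An exact left resolution bounds the resolved object. -/
lemma TensorBound.of_exact {t : ENNReal} {A : SimplicialObject (ModuleCat.{0} F)}
    (K : ℕ → SimplicialObject (ModuleCat.{0} F)) (d : ∀ j, K (j + 1) ⟶ K j) (ε : K 0 ⟶ A)
    (hε : ∀ X, Function.Surjective (ε.app X).hom)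
    (h0 : ∀ X, Function.Exact ((d 0).app X).hom (ε.app X).hom)
    (h : ∀ j X, Function.Exact ((d (j + 1)).app X).hom ((d j).app X).hom)
    (c : ℕ → ENNReal) (hK : ∀ j, TensorBound t (K j) (c j)) :
    TensorBound t A (∑' j, t ^ j * c j) := by
  let Z : ℕ → SimplicialObject (ModuleCat.{0} F)
    | 0 => A
    | j + 1 => image (d j)
  let g : ∀ j, K j ⟶ Z j
    | 0 => ε
    | j + 1 => factorThruImage (d j)
  refine TensorBound.of_resolution Z K (fun j => image.ι (d j)) g (fun j => ?_) c hK
  cases j with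
  | zero => exact isSES_image_of_surjective _ _ h0 hε
  | succ j => exact isSES_image _ _ (h j)

/-- An exact sequence `0 → K 0 → ⋯ → K k → A → 0` with `K 1, …, K k` of bound zero. -/
lemma TensorBound.of_coexact {t : ENNReal} {A : SimplicialObject (ModuleCat.{0} F)} (k : ℕ)
    (K : ℕ → SimplicialObject (ModuleCat.{0} F)) (d : ∀ j, K j ⟶ K (j + 1)) (ε : K (k + 1) ⟶ A)
    (hε : ∀ X, Function.Surjective (ε.app X).hom)
    (h0 : ∀ X, Function.Injective ((d 0).app X).hom)
    (h : ∀ j < k, ∀ X, Function.Exact ((d j).app X).hom ((d (j + 1)).app X).hom)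
    (hk : ∀ X, Function.Exact ((d k).app X).hom (ε.app X).hom)
    (c : ENNReal) (hc : TensorBound t (K 0) c) (hK : ∀ j, TensorBound t (K (j + 1)) 0) :
    TensorBound t A (t ^ (k + 1) * c) := by
  have key : ∀ j ≤ k, TensorBound t (image (d j)) (t ^ j * c) := by
    intro j
    induction j with
    | zero =>
      intro _
      have : Mono (d 0) := NatTrans.mono_iff_mono_app _ |>.2 fun X =>
        (ModuleCat.mono_iff_injective _).2 (h0 X)
      have : IsIso (factorThruImage (d 0)) := by
        have := mono_of_mono_fac (image.fac (d 0))
        exact isIso_of_mono_of_epi _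
      rw [pow_zero, one_mul]
      exact TensorBound.of_iso (f := inv (factorThruImage (d 0))) (g := factorThruImage (d 0))
        (IsIso.inv_hom_id _) hc
    | succ j ih =>
      intro hj
      rw [pow_succ', mul_assoc]
      exact TensorBound.right_of_mid_zero (isSES_image _ _ (h j hj)) (ih (by omega)) (hK j)
  rw [pow_succ', mul_assoc]
  exact TensorBound.right_of_mid_zero (isSES_image_of_surjective _ _ hk hε) (key k le_rfl) (hK k)

end Complexes

section Monomials

variable {F : Type} [Field F] {S T U I : Type}

/-- Push exponents forward along a partial map. -/
noncomputable def pushExp (φ : S → Option T) : (S × I →₀ ℕ) →+ (T × I →₀ ℕ) :=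
  Finsupp.liftAddHom fun x => (φ x.1).elim 0 fun t => Finsupp.singleAddHom (t, x.2)

lemma pushExp_single_some {φ : S → Option T} {s : S} {t : T} (h : φ s = some t) (i : I) (c : ℕ) :
    pushExp φ (Finsupp.single (s, i) c) = Finsupp.single (t, i) c := by
  simp [pushExp, h]

lemma pushExp_single_none {φ : S → Option T} {s : S} (h : φ s = none) (i : I) (c : ℕ) :
    pushExp φ (Finsupp.single (s, i) c) = 0 := by
  simp [pushExp, h]

lemma pushExp_id (m : S × I →₀ ℕ) : pushExp some m = m := by
  induction m using Finsupp.induction_linear with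
  | zero => simp
  | add f g hf hg => rw [map_add, hf, hg]
  | single x c => exact pushExp_single_some rfl _ _

lemma pushExp_comp (φ : S → Option T) (ψ : T → Option U) (m : S × I →₀ ℕ) :
    pushExp (fun s => (φ s).bind ψ) m = pushExp ψ (pushExp φ m) := by
  induction m using Finsupp.induction_linear with
  | zero => simp
  | add f g hf hg => simp only [map_add, hf, hg]
  | single x c =>
    obtain ⟨s, i⟩ := x
    cases h : φ s with
    | none => rw [pushExp_single_none h, pushExp_single_none (by simp [h]), map_zero]
    | some t =>
      rw [pushExp_single_some h]
      cases h' : ψ t with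
      | none => rw [pushExp_single_none h', pushExp_single_none (by simp [h, h'])]
      | some u => rw [pushExp_single_some h', pushExp_single_some (t := u) (by simp [h, h'])]

lemma pushExp_apply [Fintype S] [DecidableEq T] (φ : S → Option T) (m : S × I →₀ ℕ) (t : T) (i : I) :
    pushExp φ m (t, i) = ∑ s, if φ s = some t then m (s, i) else 0 := by
  classical
  induction m using Finsupp.induction_linear with
  | zero => simp
  | add f g hf hg =>
    rw [map_add, Finsupp.add_apply, hf, hg, ← Finset.sum_add_distrib]
    exact Finset.sum_congr rfl fun s _ => by split_ifs <;> simp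
  | single x c =>
    obtain ⟨s, j⟩ := x
    rw [Finset.sum_eq_single s]
    · cases h : φ s with
      | none => simp [pushExp_single_none h]
      | some u =>
        rw [pushExp_single_some h]
        by_cases hu : u = t
        · subst hu; simp [Finsupp.single_apply]
        · simp [hu]
    · intro b _ hb
      simp [Ne.symm hb]
    · simp

/-- The total weight of an exponent. -/
noncomputable def expWt (w : I → ℕ) : (S × I →₀ ℕ) →+ ℕ :=
  Finsupp.liftAddHom fun x => AddMonoidHom.mulRight (w x.2)

@[simp] lemma expWt_single (w : I → ℕ) (x : S × I) (c : ℕ) :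
    expWt w (Finsupp.single x c) = c * w x.2 := by
  simp [expWt]

lemma le_expWt (w : I → ℕ) (m : S × I →₀ ℕ) (x : S × I) : m x * w x.2 ≤ expWt w m := by
  obtain ⟨m', hm⟩ : ∃ m', m = Finsupp.single x (m x) + m' :=
    ⟨m.erase x, (Finsupp.single_add_erase x m).symm⟩
  conv_rhs => rw [hm]
  rw [map_add, expWt_single]
  exact Nat.le_add_right _ _

lemma expWt_pushExp_le (w : I → ℕ) (φ : S → Option T) (m : S × I →₀ ℕ) :
    expWt w (pushExp φ m) ≤ expWt w m := by
  induction m using Finsupp.induction_linear with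
  | zero => simp
  | add f g hf hg => simp only [map_add]; exact add_le_add hf hg
  | single x c =>
    obtain ⟨s, i⟩ := x
    cases h : φ s with
    | none => simp [pushExp_single_none h]
    | some t => simp [pushExp_single_some h]

lemma expWt_pushExp_lt (w : I → ℕ) (hw : ∀ i, 0 < w i) {φ : S → Option T} {m : S × I →₀ ℕ}
    {s : S} {i : I} (h : φ s = none) (hm : m (s, i) ≠ 0) :
    expWt w (pushExp φ m) < expWt w m := by
  obtain ⟨m', hm'⟩ : ∃ m', m = Finsupp.single (s, i) (m (s, i)) + m' :=
    ⟨m.erase (s, i), (Finsupp.single_add_erase _ m).symm⟩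
  rw [hm', map_add, map_add, map_add, pushExp_single_none h, map_zero, zero_add, expWt_single]
  have := expWt_pushExp_le w φ m'
  have := Nat.mul_pos (Nat.pos_of_ne_zero hm) (hw i)
  dsimp only
  omega

variable (cap : ℕ∞) (w : I → ℕ) (k : ℤ)

/-- Admissible exponents: entries less than `cap`, total weight `k`. -/
def IsAdm (m : S × I →₀ ℕ) : Prop := (∀ x, (m x : ℕ∞) < cap) ∧ (expWt w m : ℤ) = k

/-- The vector space with basis the admissible monomials. -/
abbrev MonSpace (F : Type) [Field F] (S : Type) : Type :=
  {m : S × I →₀ ℕ // IsAdm cap w k m} →₀ F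

variable (F) in
open Classical in
/-- The monomial with given exponent, or zero if this is not admissible. -/
noncomputable def mon (m : S × I →₀ ℕ) : MonSpace cap w k F S :=
  if h : IsAdm cap w k m then Finsupp.single ⟨m, h⟩ 1 else 0

variable {cap w k}

lemma mon_of_not {m : S × I →₀ ℕ} (h : ¬ IsAdm cap w k m) : mon F cap w k m = 0 := dif_neg h

lemma mon_of_wt_ne {m : S × I →₀ ℕ} (h : (expWt w m : ℤ) ≠ k) : mon F cap w k m = 0 :=
  mon_of_not fun h' => h h'.2

lemma mon_of_cap_le {m : S × I →₀ ℕ} {x : S × I} (h : cap ≤ m x) : mon F cap w k m = 0 :=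
  mon_of_not fun h' => not_le_of_gt (h'.1 x) h

variable {N : Type} [AddCommGroup N] [Module F N]

/-- Linear maps defined on monomials. -/
noncomputable def monLift (g : (S × I →₀ ℕ) → N) : MonSpace cap w k F S →ₗ[F] N :=
  Finsupp.linearCombination F fun m => g m.1

lemma monLift_mon {g : (S × I →₀ ℕ) → N} {m : S × I →₀ ℕ} (h : IsAdm cap w k m) :
    monLift g (mon F cap w k m) = g m := by
  rw [mon, dif_pos h, monLift, Finsupp.linearCombination_single, one_smul]

lemma monLift_mon' {g : (S × I →₀ ℕ) → N} {m : S × I →₀ ℕ} (h : ¬ IsAdm cap w k m → g m = 0) :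
    monLift g (mon F cap w k m) = g m := by
  by_cases hm : IsAdm cap w k m
  · exact monLift_mon hm
  · rw [mon_of_not hm, map_zero, h hm]

lemma mon_hom_ext {f g : MonSpace cap w k F S →ₗ[F] N}
    (h : ∀ m, IsAdm cap w k m → f (mon F cap w k m) = g (mon F cap w k m)) : f = g := by
  refine Finsupp.lhom_ext' fun m => LinearMap.ext_ring ?_
  have := h m.1 m.2
  rwa [mon, dif_pos m.2] at this

lemma IsAdm.wt_pushExp_of_not {φ : S → Option T} {m : S × I →₀ ℕ} {x : S × I}
    (hx : ¬ (m x : ℕ∞) < cap) (hw : ∀ i, 0 < w i) (hcap : cap ≠ 0) (hm : (expWt w m : ℤ) = k) :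
    ¬ IsAdm cap w k (pushExp φ m) := by
  obtain ⟨s, i⟩ := x
  intro h
  cases hφ : φ s with
  | none =>
    have hm0 : m (s, i) ≠ 0 := by
      intro h0
      rw [h0] at hx
      exact hx (pos_iff_ne_zero.2 hcap)
    have := expWt_pushExp_lt w hw hφ hm0
    have := h.2
    omega
  | some t =>
    refine hx (lt_of_le_of_lt ?_ (h.1 (t, i)))
    obtain ⟨m', hm'⟩ : ∃ m', m = Finsupp.single (s, i) (m (s, i)) + m' :=
      ⟨m.erase (s, i), (Finsupp.single_add_erase _ m).symm⟩
    conv_rhs => rw [hm', map_add, pushExp_single_some hφ, Finsupp.add_apply, Finsupp.single_eq_same]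
    exact_mod_cast Nat.le_add_right _ _

/-- Functoriality of monomial spaces for partial maps. -/
noncomputable def monMap (φ : S → Option T) : MonSpace cap w k F S →ₗ[F] MonSpace cap w k F T :=
  monLift fun m => mon F cap w k (pushExp φ m)

lemma monMap_mon (hw : ∀ i, 0 < w i) (hcap : cap ≠ 0) (φ : S → Option T) {m : S × I →₀ ℕ}
    (hm : (expWt w m : ℤ) = k) :
    monMap φ (mon F cap w k m) = mon F cap w k (pushExp φ m) := by
  refine monLift_mon' fun h => mon_of_not ?_
  have : ∃ x, ¬ (m x : ℕ∞) < cap := by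
    by_contra! h'
    exact h ⟨h', hm⟩
  obtain ⟨x, hx⟩ := this
  exact IsAdm.wt_pushExp_of_not hx hw hcap hm

lemma monMap_id : (monMap some : MonSpace cap w k F S →ₗ[F] _) = LinearMap.id := by
  refine mon_hom_ext fun m hm => ?_
  rw [monMap, monLift_mon hm, pushExp_id]
  rfl

lemma monMap_comp (hw : ∀ i, 0 < w i) (hcap : cap ≠ 0) (φ : S → Option T) (ψ : T → Option U) :
    (monMap (fun s => (φ s).bind ψ) : MonSpace cap w k F S →ₗ[F] _) =
      (monMap ψ).comp (monMap φ) := by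
  refine mon_hom_ext fun m hm => ?_
  rw [LinearMap.comp_apply, monMap_mon hw hcap _ hm.2, monMap_mon hw hcap _ hm.2, pushExp_comp]
  by_cases h : (expWt w (pushExp φ m) : ℤ) = k
  · rw [monMap_mon hw hcap ψ h]
  · rw [mon_of_wt_ne h, map_zero]
    apply mon_of_wt_ne
    have h1 := expWt_pushExp_le w φ m
    have h2 := expWt_pushExp_le w ψ (pushExp φ m)
    have := hm.2
    omega

end Monomials

section Koszul
open TensorProduct

variable {F : Type} [Field F] {ι : Type} [Fintype ι]
  {A₀ A₁ A₂ M₀ M₁ M₂ : Type} [AddCommGroup A₀] [AddCommGroup A₁] [AddCommGroup A₂]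
  [AddCommGroup M₀] [AddCommGroup M₁] [AddCommGroup M₂] [Module F A₀] [Module F A₁] [Module F A₂]
  [Module F M₀] [Module F M₁] [Module F M₂]

/-- The Koszul differential. -/
noncomputable def koszulD (θ : ι → A₀ →ₗ[F] A₁) (α : ι → M₀ →ₗ[F] M₁) :
    A₀ ⊗[F] M₀ →ₗ[F] A₁ ⊗[F] M₁ :=
  ∑ s, TensorProduct.map (θ s) (α s)

lemma koszulD_tmul (θ : ι → A₀ →ₗ[F] A₁) (α : ι → M₀ →ₗ[F] M₁) (a : A₀) (m : M₀) :
    koszulD θ α (a ⊗ₜ m) = ∑ s, θ s a ⊗ₜ α s m := by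
  simp [koszulD]

lemma koszulD_koszulD {θ₀ : ι → A₀ →ₗ[F] A₁} {θ₁ : ι → A₁ →ₗ[F] A₂}
    {α₀ : ι → M₀ →ₗ[F] M₁} {α₁ : ι → M₁ →ₗ[F] M₂}
    (h1 : ∀ s t a, θ₁ s (θ₀ t a) = - θ₁ t (θ₀ s a)) (h2 : ∀ s a, θ₁ s (θ₀ s a) = 0)
    (h3 : ∀ s t, s ≠ t → ∀ m, α₁ s (α₀ t m) = α₁ t (α₀ s m)) (x : A₀ ⊗[F] M₀) :
    koszulD θ₁ α₁ (koszulD θ₀ α₀ x) = 0 := by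
  classical
  induction x with
  | zero => simp
  | add x y hx hy => rw [map_add, map_add, hx, hy, add_zero]
  | tmul a m =>
    rw [koszulD_tmul, map_sum]
    simp only [koszulD_tmul]
    rw [← Finset.sum_product']
    refine Finset.sum_involution (fun x _ => (x.2, x.1)) ?_ ?_ (fun _ _ => by simp)
      (fun _ _ => rfl)
    · rintro ⟨s, t⟩ _
      by_cases hst : s = t
      · subst hst; simp [h2]
      · dsimp only
        rw [h1 t s, h3 t s (Ne.symm hst), TensorProduct.neg_tmul, neg_add_cancel]
    · rintro ⟨s, t⟩ _ hne heq
      simp only [Prod.mk.injEq] at heq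
      apply hne
      dsimp only
      rw [heq.1, h2, TensorProduct.zero_tmul]

variable {θ₀ : ι → A₀ →ₗ[F] A₁} {θ₁ : ι → A₁ →ₗ[F] A₂} {η₀ : ι → A₁ →ₗ[F] A₀}
  {η₁ : ι → A₂ →ₗ[F] A₁} {α₀ : ι → M₀ →ₗ[F] M₁} {α₁ : ι → M₁ →ₗ[F] M₂} {β₀ : ι → M₁ →ₗ[F] M₀}
  {β₁ : ι → M₂ →ₗ[F] M₁}

lemma koszul_homotopy
    (h1 : ∀ s e, s ≠ e → ∀ a, θ₀ s (η₀ e a) = - η₁ e (θ₁ s a))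
    (h2 : ∀ s e, s ≠ e → ∀ m, α₀ s (β₀ e m) = β₁ e (α₁ s m)) (e : ι) (a : A₁) (m : M₁) :
    koszulD θ₀ α₀ (TensorProduct.map (η₀ e) (β₀ e) (a ⊗ₜ m)) +
      TensorProduct.map (η₁ e) (β₁ e) (koszulD θ₁ α₁ (a ⊗ₜ m)) =
    θ₀ e (η₀ e a) ⊗ₜ α₀ e (β₀ e m) + η₁ e (θ₁ e a) ⊗ₜ β₁ e (α₁ e m) := by
  classical
  rw [TensorProduct.map_tmul, koszulD_tmul, koszulD_tmul, map_sum, ← Finset.sum_add_distrib,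
    Finset.sum_eq_single e]
  · rw [TensorProduct.map_tmul]
  · intro s _ hs
    rw [TensorProduct.map_tmul, h1 s e hs, h2 s e hs, TensorProduct.neg_tmul, neg_add_cancel]
  · simp

lemma sub_prod_mem_range {X Y Z : Type} [AddCommGroup X] [AddCommGroup Y] [AddCommGroup Z]
    [Module F X] [Module F Y] [Module F Z] {d₀ : X →ₗ[F] Y} {d₁ : Y →ₗ[F] Z}
    (hd : ∀ x, d₁ (d₀ x) = 0) (π : ι → Module.End F Y) (h₀ : ι → Y →ₗ[F] X) (h₁ : ι → Z →ₗ[F] Y)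
    (H : ∀ e y, d₀ (h₀ e y) + h₁ e (d₁ y) = y - π e y) (l : List ι) (y : Y) (hy : d₁ y = 0) :
    y - (l.map π).prod y ∈ LinearMap.range d₀ := by
  suffices h : y - (l.map π).prod y ∈ LinearMap.range d₀ ∧ d₁ ((l.map π).prod y) = 0 from h.1
  induction l with
  | nil => simpa using hy
  | cons e l ih =>
    set z := (l.map π).prod y with hz
    have h1 : ((e :: l).map π).prod y = π e z := by
      rw [List.map_cons, List.prod_cons, Module.End.mul_apply]
    have h2 : π e z = z - d₀ (h₀ e z) := by
      have := H e z
      rw [ih.2, map_zero, add_zero] at this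
      rw [this, sub_sub_cancel]
    rw [h1, h2]
    refine ⟨?_, by rw [map_sub, ih.2, hd, sub_zero]⟩
    rw [← sub_add]
    exact add_mem ih.1 ⟨_, rfl⟩

lemma prod_map_tensor (P : ι → Module.End F A₁) (E : ι → Module.End F M₁) (l : List ι) :
    (l.map fun e => TensorProduct.map (P e) (E e)).prod =
      TensorProduct.map (l.map P).prod (l.map E).prod := by
  induction l with
  | nil => simp
  | cons e l ih =>
    rw [List.map_cons, List.prod_cons, ih, List.map_cons, List.map_cons, List.prod_cons,
      List.prod_cons, TensorProduct.map_mul]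

/-- Exactness of Koszul complexes up to the product of the local projections. -/
lemma koszul_sub_mem_range
    (hd1 : ∀ s t a, θ₁ s (θ₀ t a) = - θ₁ t (θ₀ s a)) (hd2 : ∀ s a, θ₁ s (θ₀ s a) = 0)
    (hd3 : ∀ s t, s ≠ t → ∀ m, α₁ s (α₀ t m) = α₁ t (α₀ s m))
    (h1 : ∀ s e, s ≠ e → ∀ a, θ₀ s (η₀ e a) = - η₁ e (θ₁ s a))
    (h2 : ∀ s e, s ≠ e → ∀ m, α₀ s (β₀ e m) = β₁ e (α₁ s m))
    (P : ι → Module.End F A₁) (E : ι → Module.End F M₁)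
    (H : ∀ e a m, θ₀ e (η₀ e a) ⊗ₜ[F] α₀ e (β₀ e m) + η₁ e (θ₁ e a) ⊗ₜ[F] β₁ e (α₁ e m) =
      a ⊗ₜ m - P e a ⊗ₜ E e m)
    (l : List ι) (y : A₁ ⊗[F] M₁) (hy : koszulD θ₁ α₁ y = 0) :
    y - TensorProduct.map (l.map P).prod (l.map E).prod y ∈ LinearMap.range (koszulD θ₀ α₀) := by
  rw [← prod_map_tensor]
  refine sub_prod_mem_range (koszulD_koszulD hd1 hd2 hd3) _
    (fun e => TensorProduct.map (η₀ e) (β₀ e)) (fun e => TensorProduct.map (η₁ e) (β₁ e)) ?_ l y hy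
  intro e y
  induction y with
  | zero => simp
  | add x y hx hy =>
    simp only [map_add] at hx hy ⊢
    rw [add_add_add_comm, hx, hy, add_sub_add_comm]
  | tmul a m => rw [koszul_homotopy h1 h2, H]; rfl

/-- Naturality of the Koszul differential. -/
lemma koszulD_natural {ι' : Type} [Fintype ι'] {A₀' A₁' M₀' M₁' : Type} [AddCommGroup A₀']
    [AddCommGroup A₁'] [AddCommGroup M₀'] [AddCommGroup M₁'] [Module F A₀'] [Module F A₁']
    [Module F M₀'] [Module F M₁'] [DecidableEq ι'] (φ : ι → Option ι')
    (θ : ι → A₀ →ₗ[F] A₁) (α : ι → M₀ →ₗ[F] M₁) (θ' : ι' → A₀' →ₗ[F] A₁') (α' : ι' → M₀' →ₗ[F] M₁')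
    (f₀ : A₀ →ₗ[F] A₀') (f₁ : A₁ →ₗ[F] A₁') (g₀ : M₀ →ₗ[F] M₀') (g₁ : M₁ →ₗ[F] M₁')
    (h1 : ∀ t a, θ' t (f₀ a) = ∑ s, if φ s = some t then f₁ (θ s a) else 0)
    (h2 : ∀ s m, g₁ (α s m) = (φ s).elim 0 fun t => α' t (g₀ m)) (x : A₀ ⊗[F] M₀) :
    koszulD θ' α' (TensorProduct.map f₀ g₀ x) = TensorProduct.map f₁ g₁ (koszulD θ α x) := by
  induction x with
  | zero => simp
  | add x y hx hy => simp only [map_add, hx, hy]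
  | tmul a m =>
    simp only [TensorProduct.map_tmul, koszulD_tmul, map_sum, h1, h2, TensorProduct.sum_tmul]
    rw [Finset.sum_comm]
    refine Finset.sum_congr rfl fun s _ => ?_
    cases φ s with
    | none => simp
    | some t =>
      rw [Finset.sum_eq_single t]
      · simp
      · intro b _ hb
        simp [Ne.symm hb]
      · simp

/-- Naturality of the Koszul differential, with the roles of the two factors exchanged. -/
lemma koszulD_natural' {ι' : Type} [Fintype ι'] {A₀' A₁' M₀' M₁' : Type} [AddCommGroup A₀']
    [AddCommGroup A₁'] [AddCommGroup M₀'] [AddCommGroup M₁'] [Module F A₀'] [Module F A₁']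
    [Module F M₀'] [Module F M₁'] [DecidableEq ι'] (φ : ι → Option ι')
    (θ : ι → A₀ →ₗ[F] A₁) (α : ι → M₀ →ₗ[F] M₁) (θ' : ι' → A₀' →ₗ[F] A₁') (α' : ι' → M₀' →ₗ[F] M₁')
    (f₀ : A₀ →ₗ[F] A₀') (f₁ : A₁ →ₗ[F] A₁') (g₀ : M₀ →ₗ[F] M₀') (g₁ : M₁ →ₗ[F] M₁')
    (h1 : ∀ s a, f₁ (θ s a) = (φ s).elim 0 fun t => θ' t (f₀ a))
    (h2 : ∀ t m, α' t (g₀ m) = ∑ s, if φ s = some t then g₁ (α s m) else 0) (x : A₀ ⊗[F] M₀) :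
    koszulD θ' α' (TensorProduct.map f₀ g₀ x) = TensorProduct.map f₁ g₁ (koszulD θ α x) := by
  induction x with
  | zero => simp
  | add x y hx hy => simp only [map_add, hx, hy]
  | tmul a m =>
    simp only [TensorProduct.map_tmul, koszulD_tmul, map_sum, h1, h2, TensorProduct.tmul_sum]
    rw [Finset.sum_comm]
    refine Finset.sum_congr rfl fun s _ => ?_
    cases φ s with
    | none => simp
    | some t =>
      rw [Finset.sum_eq_single t]
      · simp
      · intro b _ hb
        simp [Ne.symm hb]
      · simp

end Koszul

section Resolution
open TensorProduct Opposite

variable {F : Type} [Field F]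

/-- Exterior powers as a functor on finite sets and partial maps. -/
noncomputable def extFun (F : Type) [Field F] (j : ℕ) : PFin ⥤ ModuleCat.{0} F where
  obj S := ModuleCat.of F (ExtPow F j S)
  map φ := ModuleCat.ofHom (extMap F φ)
  map_id S := rfl
  map_comp φ ψ := by
    ext f : 2
    exact extMap_comp φ ψ f

/-- The exterior power of a simplicial partial set. -/
noncomputable abbrev extS (F : Type) [Field F] (j : ℕ) (S : SimplicialObject PFin) :
    SimplicialObject (ModuleCat.{0} F) :=
  ((SimplicialObject.whiskering _ _).obj (extFun F j)).obj S

/-- A natural family of vectors-indexed operators defines a map of simplicial vector spaces. -/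
noncomputable def koszulHom {S : SimplicialObject PFin} {M M' : SimplicialObject (ModuleCat.{0} F)}
    (j : ℕ) (α : ∀ X, S.obj X → M.obj X →ₗ[F] M'.obj X)
    (nat : ∀ {X Y} (u : X ⟶ Y) (s : S.obj X) x, (M'.map u).hom (α X s x) =
      (S.map u s).elim 0 fun t => α Y t ((M.map u).hom x)) :
    tens (extS F (j + 1) S) M ⟶ tens (extS F j S) M' where
  app X := by
    classical
    exact ModuleCat.ofHom (koszulD (fun s => ctr F s) (α X) :
      ExtPow F (j + 1) (S.obj X) ⊗[F] _ →ₗ[F] ExtPow F j (S.obj X) ⊗[F] _)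
  naturality X Y u := by
    classical
    refine ModuleCat.hom_ext (LinearMap.ext fun x => ?_)
    exact koszulD_natural (S.map u) _ (α X) _ (α Y) (extMap F (S.map u)) (extMap F (S.map u))
      (M.map u).hom (M'.map u).hom (fun t a => ctr_extMap _ _ _) (fun s m => nat u s m) x

/-- The augmentation of a Koszul complex, levelwise. -/
noncomputable def koszulAugMap (S : Type) {M N : Type} [AddCommGroup M] [Module F M]
    [AddCommGroup N] [Module F N] (π : M →ₗ[F] N) : ExtPow F 0 S ⊗[F] M →ₗ[F] N :=
  TensorProduct.lift ((LinearMap.lsmul F (M →ₗ[F] N)).flip π ∘ₗ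
      (⟨⟨fun f : ExtPow F 0 S => f ![], fun _ _ => rfl⟩, fun _ _ => rfl⟩ : ExtPow F 0 S →ₗ[F] F))

lemma koszulAugMap_tmul {S : Type} {M N : Type} [AddCommGroup M] [Module F M]
    [AddCommGroup N] [Module F N] (π : M →ₗ[F] N) (f : ExtPow F 0 S) (m : M) :
    koszulAugMap S π (f ⊗ₜ m) = f ![] • π m := rfl

/-- The augmentation of a Koszul complex. -/
noncomputable def koszulAug {S : SimplicialObject PFin} {M N : SimplicialObject (ModuleCat.{0} F)}
    (π : M ⟶ N) : tens (extS F 0 S) M ⟶ N where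
  app X := ModuleCat.ofHom (koszulAugMap (S.obj X) (π.app X).hom)
  naturality X Y u := by
    refine ModuleCat.hom_ext (TensorProduct.ext' fun f m => ?_)
    change ExtPow F 0 (S.obj X) at f
    have h : (N.map u).hom ((π.app X).hom m) = (π.app Y).hom ((M.map u).hom m) :=
      (congrArg (fun k => k.hom m) (π.naturality u)).symm
    have h2 : extMap F (S.map u) f ![] = f ![] := by
      rw [extMap_apply]
      exact congrArg f (Subsingleton.elim _ _)
    change extMap F (S.map u) f ![] • (π.app Y).hom ((M.map u).hom m) =
      (N.map u).hom (f ![] • (π.app X).hom m)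
    rw [map_smul, h, h2]

lemma extPow_zero_eq {S : Type} (f : ExtPow F 0 S) :
    f = f ![] • AlternatingMap.constOfIsEmpty F (S → F) (Fin 0) (1 : F) := by
  ext v
  rw [Subsingleton.elim v ![]]
  simp

lemma extPow_zero_tensor_eq {S M : Type} [AddCommGroup M] [Module F M]
    (y : ExtPow F 0 S ⊗[F] M) : ∃ m : M,
      y = (AlternatingMap.constOfIsEmpty F (S → F) (Fin 0) (1 : F) : ExtPow F 0 S) ⊗ₜ m := by
  induction y with
  | zero => exact ⟨0, by simp⟩
  | add x y hx hy =>
    obtain ⟨m, rfl⟩ := hx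
    obtain ⟨m', rfl⟩ := hy
    exact ⟨m + m', by rw [TensorProduct.tmul_add]⟩
  | tmul f m =>
    refine ⟨f ![] • m, ?_⟩
    rw [TensorProduct.tmul_smul, TensorProduct.smul_tmul', ← extPow_zero_eq]

lemma prod_ctr_wdg_eq_zero {S : Type} [Fintype S] [DecidableEq S] {j : ℕ} (f : ExtPow F (j + 1) S) :
    (Finset.univ.toList.map fun s =>
      ((ctr F s).comp (wdg F s) : Module.End F (ExtPow F (j + 1) S))).prod f = 0 := by
  suffices h : ∀ (l : List S) (f : ExtPow F (j + 1) S), (∀ s, s ∉ l → ctr F s f = 0) →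
      (l.reverse.map fun s => ((ctr F s).comp (wdg F s) : Module.End F (ExtPow F (j + 1) S))).prod f
        = 0 by
    have := h Finset.univ.toList.reverse f (by simp)
    rwa [List.reverse_reverse] at this
  intro l
  induction l with
  | nil =>
    intro f hf
    exact eq_zero_of_ctr f fun s => hf s (by simp)
  | cons e l ih =>
    intro f hf
    rw [List.reverse_cons, List.map_append, List.prod_append, Module.End.mul_apply]
    refine ih _ fun s hs => ?_
    simp only [List.map_cons, List.map_nil, List.prod_cons, List.prod_nil, mul_one,
      LinearMap.comp_apply]
    by_cases hse : s = e
    · subst hse; exact ctr_self _ _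
    · have h0 : ctr F s f = 0 := hf s (by simp [hse, hs])
      have h1 := ctr_wdg_add s e f
      rw [if_neg hse, h0, map_zero, add_zero] at h1
      rw [ctr_ctr, h1, map_zero, neg_zero]

section Levelwise

variable {S M₀ M₁ M₂ N : Type} [Fintype S] [DecidableEq S] [AddCommGroup M₀] [Module F M₀]
  [AddCommGroup M₁] [Module F M₁] [AddCommGroup M₂] [Module F M₂] [AddCommGroup N] [Module F N]
  {α₀ : S → M₀ →ₗ[F] M₁} {α₁ : S → M₁ →ₗ[F] M₂} {β₀ : S → M₁ →ₗ[F] M₀} {β₁ : S → M₂ →ₗ[F] M₁}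
  {E : S → Module.End F M₁}

lemma koszulD_ctr_exact_zero {π : M₁ →ₗ[F] N}
    (hcomm : ∀ s t x, α₁ s (α₀ t x) = α₁ t (α₀ s x))
    (hαβ : ∀ s e, s ≠ e → ∀ x, α₀ s (β₀ e x) = β₁ e (α₁ s x))
    (hE : ∀ e x, α₀ e (β₀ e x) = x - E e x) (hπα : ∀ s x, π (α₀ s x) = 0)
    (hπE : ∀ x, π x = 0 → (Finset.univ.toList.map E).prod x = 0) :
    Function.Exact (koszulD (fun s => (ctr F s : ExtPow F 1 S →ₗ[F] ExtPow F 0 S)) α₀)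
      (koszulAugMap S π) := by
  intro y
  constructor
  · intro hy
    obtain ⟨m, rfl⟩ := extPow_zero_tensor_eq y
    rw [koszulAugMap_tmul] at hy
    simp only [AlternatingMap.constOfIsEmpty_apply, Function.const_apply, one_smul] at hy
    have key := koszul_sub_mem_range (F := F) (A₂ := PUnit) (M₂ := M₂)
      (θ₀ := fun s : S => (ctr F s : ExtPow F 1 S →ₗ[F] ExtPow F 0 S))
      (θ₁ := fun _ => 0) (η₀ := fun s => wdg F s) (η₁ := fun _ => 0) (α₀ := α₀) (α₁ := α₁)
      (β₀ := β₀) (β₁ := β₁) (fun _ _ _ => by simp) (fun _ _ => rfl)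
      (fun s t _ m => hcomm s t m) (fun s e hse a => by
        rw [ctr_wdg_zero, if_neg hse]; simp) (fun s e hse m => hαβ s e hse m)
      (fun _ => 1) E (fun e a m => by
        rw [ctr_wdg_zero, if_pos rfl, hE]; simp [TensorProduct.tmul_sub])
      Finset.univ.toList ((AlternatingMap.constOfIsEmpty F (S → F) (Fin 0) (1 : F)) ⊗ₜ m)
      (by simp [koszulD])
    rw [TensorProduct.map_tmul, hπE m hy, TensorProduct.tmul_zero] at key
    obtain ⟨x, hx⟩ := key
    exact ⟨x, hx.trans (@sub_zero (ExtPow F 0 S ⊗[F] M₁) _ _)⟩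
  · rintro ⟨x, rfl⟩
    induction x with
    | zero => simp
    | add x y hx hy => rw [map_add, map_add, hx, hy, add_zero]
    | tmul f m =>
      rw [koszulD_tmul, map_sum]
      refine Finset.sum_eq_zero fun s _ => ?_
      rw [koszulAugMap_tmul, hπα, smul_zero]

lemma koszulD_ctr_exact_succ (j : ℕ)
    (hcomm : ∀ s t x, α₁ s (α₀ t x) = α₁ t (α₀ s x))
    (hαβ : ∀ s e, s ≠ e → ∀ x, α₀ s (β₀ e x) = β₁ e (α₁ s x))
    (hβα : ∀ e x, β₁ e (α₁ e x) = x)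
    (hE : ∀ e x, α₀ e (β₀ e x) = x - E e x) :
    Function.Exact (koszulD (fun s => (ctr F s : ExtPow F (j + 2) S →ₗ[F] ExtPow F (j + 1) S)) α₀)
      (koszulD (fun s => (ctr F s : ExtPow F (j + 1) S →ₗ[F] ExtPow F j S)) α₁) := by
  intro y
  constructor
  · intro hy
    have key := koszul_sub_mem_range (F := F)
      (θ₀ := fun s : S => (ctr F s : ExtPow F (j + 2) S →ₗ[F] ExtPow F (j + 1) S))
      (θ₁ := fun s => ctr F s) (η₀ := fun s => wdg F s) (η₁ := fun s => wdg F s)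
      (α₀ := α₀) (α₁ := α₁) (β₀ := β₀) (β₁ := β₁) (fun s t f => ctr_ctr s t f)
      (fun s f => ctr_self s f)
      (fun s t _ m => hcomm s t m) (fun s e hse a => by
        have := ctr_wdg_add s e a
        rwa [if_neg hse, ← eq_neg_iff_add_eq_zero] at this)
      (fun s e hse m => hαβ s e hse m)
      (fun s => (ctr F s).comp (wdg F s)) E (fun e a m => by
        have := ctr_wdg_add e e a
        rw [if_pos rfl, ← eq_sub_iff_add_eq'] at this
        rw [hE, hβα, this, TensorProduct.tmul_sub, TensorProduct.sub_tmul, LinearMap.comp_apply]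
        abel)
      Finset.univ.toList y hy
    have h0 : (Finset.univ.toList.map fun s : S =>
        ((ctr F s).comp (wdg F s) : Module.End F (ExtPow F (j + 1) S))).prod = 0 :=
      LinearMap.ext fun f => prod_ctr_wdg_eq_zero f
    rw [h0, TensorProduct.map_zero_left, LinearMap.zero_apply] at key
    obtain ⟨x, hx⟩ := key
    exact ⟨x, hx.trans (@sub_zero (ExtPow F (j + 1) S ⊗[F] M₁) _ _)⟩
  · rintro ⟨x, rfl⟩
    exact koszulD_koszulD (fun s t f => ctr_ctr s t f) (fun s f => ctr_self s f)
      (fun s t _ m => hcomm s t m) x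

end Levelwise

/-- Koszul resolutions bound the resolved object. -/
theorem TensorBound.of_koszul {t : ENNReal} (S : SimplicialObject PFin)
    (M : ℕ → SimplicialObject (ModuleCat.{0} F)) (N : SimplicialObject (ModuleCat.{0} F))
    (π : M 1 ⟶ N)
    (α : ∀ j X, S.obj X → (M (j + 1)).obj X →ₗ[F] (M j).obj X)
    (β : ∀ j X, S.obj X → (M j).obj X →ₗ[F] (M (j + 1)).obj X)
    (E : ∀ j X, S.obj X → Module.End F ((M j).obj X))
    (nat : ∀ j {X Y} (u : X ⟶ Y) (s : S.obj X) x, ((M j).map u).hom (α j X s x) =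
      (S.map u s).elim 0 fun t => α j Y t (((M (j + 1)).map u).hom x))
    (hcomm : ∀ j X s t x, α j X s (α (j + 1) X t x) = α j X t (α (j + 1) X s x))
    (hαβ : ∀ j X s e, s ≠ e → ∀ x, α (j + 1) X s (β (j + 1) X e x) = β j X e (α j X s x))
    (hβα : ∀ j X e x, β j X e (α j X e x) = x)
    (hE : ∀ j X e x, α j X e (β j X e x) = x - E j X e x)
    (hπα : ∀ X s x, (π.app X).hom (α 1 X s x) = 0)
    (hπ : ∀ X, Function.Surjective (π.app X).hom)
    (hπE : ∀ X x, (π.app X).hom x = 0 → (Finset.univ.toList.map (E 1 X)).prod x = 0)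
    (a b : ℕ → ENNReal) (ha : ∀ j, TensorBound t (extS F j S) (a j))
    (hb : ∀ j, TensorBound t (M (j + 1)) (b j)) :
    TensorBound t N (∑' j, t ^ j * (a j * b j)) := by
  classical
  refine TensorBound.of_exact (fun j => _root_.tens (extS F j S) (M (j + 1)))
    (fun j => koszulHom j (α (j + 1)) (nat (j + 1))) (koszulAug π) (fun X n => ?_) (fun X => ?_)
    (fun j X => ?_) _ (fun j => (ha j).tens (hb j))
  · obtain ⟨m, rfl⟩ := hπ X n
    refine ⟨((AlternatingMap.constOfIsEmpty F (S.obj X → F) (Fin 0) (1 : F) :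
      ExtPow F 0 (S.obj X)) ⊗ₜ m : ExtPow F 0 (S.obj X) ⊗[F] (M 1).obj X), ?_⟩
    refine (koszulAugMap_tmul _ _ _).trans ?_
    simp
  · exact koszulD_ctr_exact_zero (S := S.obj X) (β₁ := β 0 X) (hcomm 0 X) (hαβ 0 X) (hE 1 X) (hπα X) (hπE X)
  · exact koszulD_ctr_exact_succ (S := S.obj X) j (hcomm (j + 1) X) (hαβ (j + 1) X) (hβα (j + 1) X) (hE (j + 2) X)

end Resolution

section Sym

variable {F : Type} [Field F] {S T I : Type}

lemma pushExp_eq_self {φ : S → Option S} {m : S × I →₀ ℕ}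
    (h : ∀ x, m x ≠ 0 → φ x.1 = some x.1) : pushExp φ m = m := by
  conv_rhs => rw [← Finsupp.sum_single m]
  rw [pushExp, Finsupp.liftAddHom_apply]
  refine Finsupp.sum_congr fun x hx => ?_
  rw [h x (Finsupp.mem_support_iff.1 hx)]
  rfl

/-- Symmetric powers of the free module on `S`. -/
abbrev SymSpace (F : Type) [Field F] (k : ℤ) (S : Type) : Type :=
  MonSpace (I := Unit) ⊤ 1 k F S

variable {k k' k'' : ℤ} (r : ℕ)

/-- The symmetric monomial. -/
noncomputable abbrev smon (F : Type) [Field F] (k : ℤ) (m : S × Unit →₀ ℕ) : SymSpace F k S :=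
  mon F ⊤ 1 k m

lemma smon_adm {m : S × Unit →₀ ℕ} (h : (expWt 1 m : ℤ) = k) : IsAdm ⊤ 1 k m :=
  ⟨fun _ => ENat.natCast_lt_top _, h⟩

/-- Multiplication with the `r`-th power of a basis element. -/
noncomputable def symMul (k k' : ℤ) (r : ℕ) (s : S) : SymSpace F k S →ₗ[F] SymSpace F k' S :=
  monLift fun m => smon F k' (m + Finsupp.single (s, ()) r)

/-- Division by the `r`-th power of a basis element. -/
noncomputable def symDiv (k k' : ℤ) (r : ℕ) (s : S) : SymSpace F k S →ₗ[F] SymSpace F k' S :=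
  monLift fun m => if r ≤ m (s, ()) then smon F k' (m - Finsupp.single (s, ()) r) else 0

/-- The projection to monomials not divisible by the `r`-th power of a basis element. -/
noncomputable def symEps (k : ℤ) (r : ℕ) (s : S) : Module.End F (SymSpace F k S) :=
  monLift fun m => if m (s, ()) < r then smon F k m else 0

variable {r}

lemma symMul_smon (hk : k' = k + r) (s : S) (m : S × Unit →₀ ℕ) :
    symMul k k' r s (smon F k m) = smon F k' (m + Finsupp.single (s, ()) r) := by
  refine monLift_mon' fun h => mon_of_wt_ne fun h' => h (smon_adm ?_)
  rw [map_add, expWt_single] at h'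
  push_cast at h'
  simp only [Pi.one_apply] at h'
  push_cast at h'
  omega

lemma expWt_sub_single {m : S × Unit →₀ ℕ} {s : S} (h : r ≤ m (s, ())) :
    expWt 1 m = expWt 1 (m - Finsupp.single (s, ()) r) + r := by
  have : m = (m - Finsupp.single (s, ()) r) + Finsupp.single (s, ()) r :=
    (tsub_add_cancel_of_le (Finsupp.single_le_iff.2 h)).symm
  conv_lhs => rw [this, map_add, expWt_single]
  simp

lemma symDiv_smon (hk : k = k' + r) (s : S) (m : S × Unit →₀ ℕ) :
    symDiv k k' r s (smon F k m) =
      if r ≤ m (s, ()) then smon F k' (m - Finsupp.single (s, ()) r) else 0 := by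
  refine monLift_mon' fun h => ?_
  split_ifs with h1
  · refine mon_of_wt_ne fun h' => h (smon_adm ?_)
    have := expWt_sub_single h1
    omega
  · rfl

lemma symEps_smon (s : S) (m : S × Unit →₀ ℕ) :
    symEps k r s (smon F k m) = if m (s, ()) < r then smon F k m else 0 := by
  refine monLift_mon' fun h => ?_
  rw [smon, mon_of_not h, ite_self]

lemma symDiv_symMul (hk : k' = k + r) (s : S) (x : SymSpace F k S) :
    symDiv k' k r s (symMul k k' r s x) = x := by
  suffices h : (symDiv k' k r s).comp (symMul k k' r s) = LinearMap.id (R := F) from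
    LinearMap.congr_fun h x
  refine mon_hom_ext fun m _ => ?_
  rw [LinearMap.comp_apply, symMul_smon hk, symDiv_smon hk, if_pos (by simp), add_tsub_cancel_right]
  rfl

lemma symMul_symDiv (hk : k = k' + r) (s : S) (x : SymSpace F k S) :
    symMul k' k r s (symDiv k k' r s x) = x - symEps k r s x := by
  suffices h : (symMul k' k r s).comp (symDiv k k' r s) = LinearMap.id (R := F) - symEps k r s from
    LinearMap.congr_fun h x
  refine mon_hom_ext fun m _ => ?_
  rw [LinearMap.comp_apply, LinearMap.sub_apply, symDiv_smon hk, symEps_smon]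
  by_cases h : r ≤ m (s, ())
  · rw [if_pos h, if_neg (not_lt.2 h), symMul_smon hk,
      tsub_add_cancel_of_le (Finsupp.single_le_iff.2 h), sub_zero]
    rfl
  · rw [if_neg h, if_pos (not_le.1 h), map_zero]
    exact (sub_self _).symm

lemma symMul_comm (h1 : k' = k + r) (h2 : k'' = k' + r) (s t : S) (x : SymSpace F k S) :
    symMul k' k'' r s (symMul k k' r t x) = symMul k' k'' r t (symMul k k' r s x) := by
  suffices h : (symMul k' k'' r s).comp (symMul k k' r t) =
    (symMul (F := F) k' k'' r t).comp (symMul k k' r s) from LinearMap.congr_fun h x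
  refine mon_hom_ext fun m _ => ?_
  rw [LinearMap.comp_apply, LinearMap.comp_apply]
  simp only [symMul_smon h1, symMul_smon h2]
  rw [add_right_comm]

lemma symMul_symDiv_of_ne (h1 : k' = k + r) (h2 : k'' = k' + r) {s e : S} (hse : s ≠ e)
    (x : SymSpace F k' S) :
    symMul k k' r s (symDiv k' k r e x) = symDiv k'' k' r e (symMul k' k'' r s x) := by
  suffices h : (symMul k k' r s).comp (symDiv k' k r e) =
    (symDiv (F := F) k'' k' r e).comp (symMul k' k'' r s) from LinearMap.congr_fun h x
  refine mon_hom_ext fun m _ => ?_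
  rw [LinearMap.comp_apply, LinearMap.comp_apply, symDiv_smon h1, symMul_smon h2, symDiv_smon h2]
  have : (m + Finsupp.single (s, ()) r) (e, ()) = m (e, ()) := by
    simp [hse]
  rw [this]
  split_ifs with h
  · rw [symMul_smon h1]
    congr 1
    exact (tsub_add_eq_add_tsub (Finsupp.single_le_iff.2 h)).symm ▸ rfl
  · rw [map_zero]

lemma monMap_smon (φ : S → Option T) {m : S × Unit →₀ ℕ} (hm : (expWt 1 m : ℤ) = k) :
    monMap φ (smon F k m) = smon F k (pushExp φ m) :=
  monMap_mon (fun _ => one_pos) (by simp) φ hm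

lemma monMap_symMul (hk : k' = k + r) (hr : 0 < r) (φ : S → Option T) (s : S)
    (x : SymSpace F k S) :
    monMap φ (symMul k k' r s x) = (φ s).elim 0 fun t => symMul k k' r t (monMap φ x) := by
  have h : (monMap φ).comp (symMul k k' r s) =
      (φ s).elim (0 : SymSpace F k S →ₗ[F] SymSpace F k' T)
        fun t => (symMul k k' r t).comp (monMap φ) := by
    refine mon_hom_ext fun m hm => ?_
    have hw : (expWt 1 (m + Finsupp.single (s, ()) r) : ℤ) = k' := by
      rw [map_add, expWt_single]; simp [hm.2, hk]
    rw [LinearMap.comp_apply, symMul_smon hk, monMap_smon φ hw]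
    cases hφ : φ s with
    | none =>
      refine mon_of_wt_ne ?_
      have := expWt_pushExp_lt 1 (fun _ => one_pos) (m := m + Finsupp.single (s, ()) r)
        (i := ()) hφ (by simp [hr.ne'])
      omega
    | some t =>
      rw [Option.elim_some, LinearMap.comp_apply, monMap_smon φ hm.2, symMul_smon hk, map_add,
        pushExp_single_some hφ]
  have := LinearMap.congr_fun h x
  rw [LinearMap.comp_apply] at this
  rw [this]
  cases φ s <;> rfl

lemma prod_symEps_smon {ι : Type} (i : ι → S) (l : List ι) (m : S × Unit →₀ ℕ) :
    (l.map fun e => symEps k r (i e)).prod (smon F k m) =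
      if ∀ e ∈ l, m (i e, ()) < r then smon F k m else 0 := by
  induction l with
  | nil => simp
  | cons e l ih =>
    rw [List.map_cons, List.prod_cons, Module.End.mul_apply, ih]
    by_cases h : ∀ e ∈ l, m (i e, ()) < r
    · rw [if_pos h, symEps_smon]
      exact if_congr (by rw [List.forall_mem_cons]; exact (and_iff_left h).symm) rfl rfl
    · rw [if_neg h, map_zero, if_neg fun h' => h fun e he => h' e (List.mem_cons_of_mem _ he)]

end Sym

section SymFunctor

variable {F : Type} [Field F]

/-- Spaces of monomials as functors on finite sets and partial maps. -/
noncomputable def monFun (F : Type) [Field F] {I : Type} {cap : ℕ∞} {w : I → ℕ} (k : ℤ)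
    (hw : ∀ i, 0 < w i) (hcap : cap ≠ 0) : PFin ⥤ ModuleCat.{0} F where
  obj S := ModuleCat.of F (MonSpace cap w k F S)
  map φ := ModuleCat.ofHom (monMap φ)
  map_id _ := ModuleCat.hom_ext monMap_id
  map_comp φ ψ := ModuleCat.hom_ext (monMap_comp hw hcap φ ψ)

/-- Symmetric powers as functors. -/
noncomputable abbrev symFun (F : Type) [Field F] (k : ℤ) : PFin ⥤ ModuleCat.{0} F :=
  monFun (I := Unit) (cap := ⊤) (w := 1) F k (fun _ => one_pos) (by simp)

/-- The symmetric power of a simplicial partial set. -/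
noncomputable abbrev symS (F : Type) [Field F] (k : ℤ) (S : SimplicialObject PFin) :
    SimplicialObject (ModuleCat.{0} F) :=
  ((SimplicialObject.whiskering _ _).obj (symFun F k)).obj S

theorem TensorBound.of_symKoszul {t : ENNReal} {S C : SimplicialObject PFin}
    (i : ∀ X, S.obj X → C.obj X) (hi : ∀ X, Function.Injective (i X))
    (hnat : ∀ {X Y} (u : X ⟶ Y) s, C.map u (i X s) = (S.map u s).map (i Y))
    {r : ℕ} (hr : 0 < r) (d : ℕ → ℤ) (hd : ∀ j, d j = d (j + 1) + r)
    {N : SimplicialObject (ModuleCat.{0} F)} (π : symS F (d 1) C ⟶ N)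
    (hπα : ∀ X (s : S.obj X) x, (π.app X).hom (symMul (d 2) (d 1) r (i X s) x) = 0)
    (hπ : ∀ X, Function.Surjective (π.app X).hom)
    (hπE : ∀ X x, (π.app X).hom x = 0 →
      (Finset.univ.toList.map fun e => symEps (d 1) r (i X e)).prod x = 0)
    (a b : ℕ → ENNReal) (ha : ∀ j, TensorBound t (extS F j S) (a j))
    (hb : ∀ j, TensorBound t (symS F (d (j + 1)) C) (b j)) :
    TensorBound t N (∑' j, t ^ j * (a j * b j)) := by
  refine TensorBound.of_koszul S (fun j => symS F (d j) C) N π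
    (fun j X s => symMul (d (j + 1)) (d j) r (i X s))
    (fun j X s => symDiv (d j) (d (j + 1)) r (i X s)) (fun j X s => symEps (d j) r (i X s))
    (fun j X Y u s x => ?_) (fun j X s t x => symMul_comm (hd (j + 1)) (hd j) _ _ x)
    (fun j X s e hse x => symMul_symDiv_of_ne (hd (j + 1)) (hd j) ((hi X).ne hse) x)
    (fun j X e x => symDiv_symMul (hd j) _ x) (fun j X e x => symMul_symDiv (hd j) _ x)
    hπα hπ hπE a b ha hb
  refine (monMap_symMul (hd j) hr (C.map u) (i X s) x).trans ?_
  rw [hnat]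
  cases S.map u s <;> rfl

end SymFunctor

section Cofib

/-- A levelwise cofibre sequence `S → C → Q` of simplicial partial sets, with `C` contractible. -/
structure ConeSeq (S C Q : SimplicialObject PFin) where
  i : ∀ X, S.obj X → C.obj X
  nat : ∀ {X Y} (u : X ⟶ Y) s, C.map u (i X s) = (S.map u s).map (i Y)
  ρ : C ⟶ Q
  cofib : ∀ X, IsCofib (i X) (ρ.app X)
  contr : PrismHomotopy (𝟙 C) (noneHom C)

lemma coverSpace_map_eq_some {n N q : ℕ} {X Y : SimplexCategoryᵒᵖ} (u : X ⟶ Y)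
    (g : coverSet n N q X.unop.len) (b : coverSet n N q Y.unop.len) :
    (((coverSpace n N q).map u : _ ⟶ _) g : Option (coverSet n N q Y.unop.len)) = some b ↔
      (g.1.1 ∘ u.unop.toOrderHom, g.1.2) = b.1 :=
  @coverHom_eq_some n N n N q X.unop.len Y.unop.len (fun g => g ∘ u.unop.toOrderHom) g b

/-- The cofibre sequence of the cone. -/
noncomputable def coverConeSeq (n q : ℕ) :
    ConeSeq (coverSpace n n q) (coverSpace n (n + 1) q) (coverSpace (n + 1) (n + 1) q) where
  i X g := ⟨g.1, g.2.1, fun i => (g.2.2.1 i).trans (Nat.le_succ n), g.2.2.2⟩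
  nat {X Y} u s := by
    refine Option.ext fun b => ?_
    constructor
    · intro h
      have h := (coverSpace_map_eq_some u _ b).1 h
      exact Option.map_eq_some_iff.2
        ⟨⟨b.1, b.2.1, fun i => by
          rw [← h]; exact s.2.2.1 _, b.2.2.2⟩, (coverSpace_map_eq_some u s _).2 h, rfl⟩
    · intro h
      obtain ⟨c, hc, rfl⟩ := Option.map_eq_some_iff.1 h
      exact (coverSpace_map_eq_some u _ _).2 ((coverSpace_map_eq_some u s c).1 hc)
  ρ := coverQuot n q
  cofib X :=
    { inj := fun a b h => Subtype.ext (congrArg (fun x => x.1) h)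
      sec := fun a => ⟨a.1, a.2.1, a.2.2.1, fun v hv => a.2.2.2 v (hv.trans (Nat.le_succ n))⟩
      r_sec := fun a => coverHom_eq_some.2 rfl
      r_i := fun s => by
        rw [Option.eq_none_iff_forall_ne_some]
        intro b hb
        have hb' := coverHom_eq_some.1 hb
        obtain ⟨j, hj⟩ := b.2.2.2 (n + 1) le_rfl
        rw [← hb'] at hj
        have := s.2.2.1 j
        dsimp only [id] at hj
        omega
      of_none := fun {c} h => by
        refine ⟨⟨c.1, c.2.1, fun j => ?_, c.2.2.2⟩, rfl⟩
        by_contra hlt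
        have hc : IsCover (n + 1) (n + 1) q c.1 := ⟨c.2.1, c.2.2.1, fun v hv => by
          rcases Nat.lt_or_ge v (n + 1) with h' | h'
          · exact c.2.2.2 v (by omega)
          · exact ⟨j, by have := c.2.2.1 j; omega⟩⟩
        have : (coverQuot n q).app X c = some ⟨c.1, hc⟩ := coverHom_eq_some.2 rfl
        rw [h] at this
        exact absurd this (by simp)
      of_some := fun {c a} h => Subtype.ext (coverHom_eq_some.1 h).symm }
  contr := coneHomotopy n q

lemma IsCofib.sec_comp {S C Q I : Type} {i : S → C} {r : C → Option Q} (h : IsCofib i r)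
    {m : C × I →₀ ℕ} (hm : ∀ s x, m (i s, x) = 0) :
    pushExp (fun a => some (h.sec a)) (pushExp r m) = m := by
  rw [← pushExp_comp]
  refine pushExp_eq_self fun x hx => ?_
  cases hr : r x.1 with
  | none =>
    obtain ⟨s, hs⟩ := h.of_none hr
    exact absurd (by rw [show x = (i s, x.2) from Prod.ext hs.symm rfl]; exact hm s x.2) hx
  | some a => exact congrArg some (h.of_some hr)

variable {F : Type} [Field F]

lemma IsCofib.prod_symEps {S C Q : Type} [Fintype S] {i : S → C} {r : C → Option Q}
    (h : IsCofib i r) (k : ℤ) :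
    (Finset.univ.toList.map fun e => symEps (F := F) k 1 (i e)).prod =
      (monMap (fun a => some (h.sec a))).comp (monMap r) := by
  refine mon_hom_ext fun m hm => ?_
  refine (prod_symEps_smon _ _ _).trans ?_
  rw [LinearMap.comp_apply]
  change _ = monMap _ (monMap _ (smon F k m))
  rw [monMap_smon _ hm.2]
  split_ifs with h0
  · have h1 : ∀ s x, m (i s, x) = 0 := fun s x =>
      Nat.lt_one_iff.1 (h0 s (Finset.mem_toList.2 (Finset.mem_univ s)))
    have hw : (expWt 1 (pushExp r m) : ℤ) = k := by
      refine le_antisymm ?_ ?_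
      · rw [← hm.2]
        exact_mod_cast expWt_pushExp_le _ _ _
      · rw [← hm.2]
        have := expWt_pushExp_le 1 (fun a => some (h.sec a)) (pushExp r m)
        rw [h.sec_comp h1] at this
        exact_mod_cast this
    rw [monMap_smon _ hw, h.sec_comp h1]
  · push Not at h0
    obtain ⟨s, _, hs⟩ := h0
    have := expWt_pushExp_lt 1 (fun _ => one_pos) (m := m) (h.r_i s) (i := ()) (by omega)
    have hm2 := hm.2
    rw [smon, mon_of_wt_ne (by omega), map_zero]

variable {S C Q : SimplicialObject PFin} {t : ENNReal}

/-- Symmetric powers of the quotient of a cone, in terms of exterior powers of the base. -/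
theorem TensorBound.sym_of_coneSeq (h : ConeSeq S C Q) (k : ℤ) (a b : ℕ → ENNReal)
    (ha : ∀ j, TensorBound t (extS F j S) (a j))
    (hb : ∀ j : ℕ, TensorBound t (symS F (k - j) C) (b j)) :
    TensorBound t (symS F k Q) (∑' j, t ^ j * (a j * b j)) := by
  obtain ⟨d, hd, hd1, hdk⟩ : ∃ d : ℕ → ℤ, (∀ j, d j = d (j + 1) + (1 : ℕ)) ∧ d 1 = k ∧
      ∀ j : ℕ, d (j + 1) = k - j :=
    ⟨fun j => k + 1 - j, fun j => by push_cast; ring, by push_cast; ring, fun j => by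
      push_cast; ring⟩
  subst hd1
  refine TensorBound.of_symKoszul h.i (fun X => (h.cofib X).inj) h.nat one_pos d hd
    (((SimplicialObject.whiskering _ _).obj (symFun F (d 1))).map h.ρ) (fun X s x => ?_)
    (fun X y => ?_) (fun X x hx => ?_) a b ha (fun j => by rw [hdk]; exact hb j)
  · refine (monMap_symMul (hd 1) one_pos (h.ρ.app X) (h.i X s) x).trans ?_
    rw [(h.cofib X).r_i]
    rfl
  · refine ⟨monMap (fun a => some ((h.cofib X).sec a)) y, ?_⟩
    refine (LinearMap.congr_fun (monMap_comp (fun _ => one_pos) (by simp)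
      (fun a => some ((h.cofib X).sec a)) (h.ρ.app X)) y).symm.trans ?_
    simp only [Option.bind_some, (h.cofib X).r_sec]
    exact LinearMap.congr_fun monMap_id y
  · have key := (h.cofib X).prod_symEps (F := F) (d 1)
    refine (LinearMap.congr_fun key x).trans ?_
    exact (congrArg (monMap fun a => some ((h.cofib X).sec a)) hx).trans (map_zero _)

/-- Truncated symmetric powers as functors. -/
noncomputable abbrev truncFun (F : Type) [Field F] (p : ℕ) [NeZero p] (k : ℤ) :
    PFin ⥤ ModuleCat.{0} F :=
  monFun (I := Unit) (cap := p) (w := 1) F k (fun _ => one_pos)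
    (by simpa using NeZero.ne p)

/-- The truncated symmetric power of a simplicial partial set. -/
noncomputable abbrev truncS (F : Type) [Field F] (p : ℕ) [NeZero p] (k : ℤ)
    (S : SimplicialObject PFin) : SimplicialObject (ModuleCat.{0} F) :=
  ((SimplicialObject.whiskering _ _).obj (truncFun F p k)).obj S

/-- Truncation as a natural map. -/
noncomputable def truncHom (F : Type) [Field F] (p : ℕ) [NeZero p] (k : ℤ)
    (S : SimplicialObject PFin) : symS F k S ⟶ truncS F p k S where
  app X := ModuleCat.ofHom (monLift fun m => mon F p 1 k m)
  naturality X Y u := by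
    refine ModuleCat.hom_ext (mon_hom_ext fun m hm => ?_)
    have hL : ∀ (T : Type) (m : T × Unit →₀ ℕ),
        (monLift fun m => mon F (p : ℕ∞) 1 k m : SymSpace F k T →ₗ[F] _) (smon F k m) =
          mon F (p : ℕ∞) 1 k m := fun T m =>
      monLift_mon' fun h => mon_of_not fun h' => h (smon_adm h'.2)
    change (monLift fun m => mon F (p : ℕ∞) 1 k m : SymSpace F k _ →ₗ[F] _)
      (monMap (S.map u) (smon F k m)) = monMap (S.map u)
        ((monLift fun m => mon F (p : ℕ∞) 1 k m : SymSpace F k _ →ₗ[F] _) (smon F k m))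
    rw [monMap_smon _ hm.2, hL, hL, monMap_mon (w := 1) (cap := p) (fun _ => one_pos) (by simpa using NeZero.ne p) _ hm.2]

/-- Truncated symmetric powers in terms of symmetric and exterior powers. -/
theorem TensorBound.trunc {p : ℕ} [NeZero p] (k : ℤ) (S : SimplicialObject PFin)
    (a b : ℕ → ENNReal) (ha : ∀ j, TensorBound t (extS F j S) (a j))
    (hb : ∀ j : ℕ, TensorBound t (symS F (k - p * j) S) (b j)) :
    TensorBound t (truncS F p k S) (∑' j, t ^ j * (a j * b j)) := by
  obtain ⟨d, hd, hd1, hdk⟩ : ∃ d : ℕ → ℤ, (∀ j, d j = d (j + 1) + p) ∧ d 1 = k ∧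
      ∀ j : ℕ, d (j + 1) = k - p * j :=
    ⟨fun j => k + p - p * j, fun j => by push_cast; ring, by push_cast; ring, fun j => by
      push_cast; ring⟩
  subst hd1
  have hL : ∀ (T : Type) (m : T × Unit →₀ ℕ),
      (monLift fun m => mon F (p : ℕ∞) 1 (d 1) m : SymSpace F (d 1) T →ₗ[F] _) (smon F (d 1) m) =
        mon F (p : ℕ∞) 1 (d 1) m := fun T m =>
    monLift_mon' fun h => mon_of_not fun h' => h (smon_adm h'.2)
  refine TensorBound.of_symKoszul (fun X => id) (fun X => Function.injective_id)
    (fun u s => (Option.map_id ▸ rfl : S.map u s = (S.map u s).map id)) (NeZero.pos p) d hd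
    (truncHom F p (d 1) S) (fun X s x => ?_)
    (fun X y => ?_) (fun X x hx => ?_) a b ha (fun j => by rw [hdk]; exact hb j)
  · have : ((monLift fun m => mon F (p : ℕ∞) 1 (d 1) m : SymSpace F (d 1) (S.obj X) →ₗ[F] _)).comp
        (symMul (d 2) (d 1) p s) = 0 := by
      refine mon_hom_ext fun m hm => ?_
      rw [LinearMap.comp_apply, symMul_smon (hd 1), hL]
      exact mon_of_cap_le (x := (s, ())) (by simp)
    exact LinearMap.congr_fun this x
  · refine ⟨(monLift fun m => smon F (d 1) m : MonSpace (p : ℕ∞) 1 (d 1) F (S.obj X) →ₗ[F] _) y, ?_⟩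
    have : (monLift fun m => mon F (p : ℕ∞) 1 (d 1) m : SymSpace F (d 1) (S.obj X) →ₗ[F] _).comp
      (monLift fun m => smon F (d 1) m) = LinearMap.id := by
      refine mon_hom_ext fun m hm => ?_
      rw [LinearMap.comp_apply, monLift_mon hm, hL]
      rfl
    exact LinearMap.congr_fun this y
  · have key : (Finset.univ.toList.map fun e : S.obj X => symEps (F := F) (d 1) p e).prod =
        (monLift fun m => smon F (d 1) m : MonSpace (p : ℕ∞) 1 (d 1) F (S.obj X) →ₗ[F] _).comp
        (monLift fun m => mon F (p : ℕ∞) 1 (d 1) m : SymSpace F (d 1) (S.obj X) →ₗ[F] _) := by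
      refine mon_hom_ext fun m hm => ?_
      refine (prod_symEps_smon (fun e => e) _ _).trans ?_
      rw [LinearMap.comp_apply, hL]
      split_ifs with h0
      · rw [monLift_mon]
        exact ⟨fun x => by exact_mod_cast h0 x.1 (Finset.mem_toList.2 (Finset.mem_univ _)), hm.2⟩
      · rw [mon_of_not, map_zero]
        intro h1
        exact h0 fun e _ => by exact_mod_cast h1.1 (e, ())
    refine (LinearMap.congr_fun key x).trans ?_
    exact (congrArg (monLift fun m => smon F (d 1) m) hx).trans (map_zero _)

end Cofib

section Divided
set_option linter.unusedSectionVars false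

variable {F : Type} [Field F] (p : ℕ)

/-- The degree `k` part of the divided power algebra on `S`, presented as a tensor product of
truncated polynomial algebras with generators `(s, i)` of weight `p ^ i`. -/
abbrev DivSpace (F : Type) [Field F] (k : ℤ) (S : Type) : Type :=
  MonSpace (p : ℕ∞) (fun i : ℕ => p ^ i) k F S

/-- Monomials in the divided power algebra. -/
noncomputable abbrev dmon (F : Type) [Field F] (k : ℤ) {S : Type} (m : S × ℕ →₀ ℕ) :
    DivSpace p F k S :=
  mon F (p : ℕ∞) (fun i : ℕ => p ^ i) k m

/-- The exponent whose digits below `r` in column `s` are maximal, and which is `0` elsewhere. -/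
noncomputable def lowExp {S : Type} (s : S) (r : ℕ) : S × ℕ →₀ ℕ :=
  ∑ j ∈ Finset.range r, Finsupp.single (s, j) (p - 1)

lemma lowExp_apply {S : Type} (s : S) (r : ℕ) (t : S) (j : ℕ) [Decidable (s = t)] :
    lowExp p s r (t, j) = if s = t ∧ j < r then p - 1 else 0 := by
  classical
  rw [lowExp, Finsupp.finsetSum_apply]
  simp only [Finsupp.single_apply, Prod.mk.injEq]
  by_cases h : s = t
  · simp [h]
  · simp [h]

lemma expWt_lowExp [hp : Fact p.Prime] {S : Type} (s : S) (r : ℕ) :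
    expWt (fun i : ℕ => p ^ i) (lowExp p s r) + 1 = p ^ r := by
  rw [lowExp, map_sum]
  simp only [expWt_single]
  rw [← Finset.mul_sum]
  have := Nat.geomSum_eq hp.out.two_le r
  rw [this, Nat.mul_div_cancel' (by simpa using Nat.sub_dvd_pow_sub_pow p 1 r)]
  exact Nat.sub_add_cancel (Nat.one_le_pow _ _ hp.out.pos)

lemma pushExp_lowExp_some {S T : Type} {φ : S → Option T} {s : S} {t : T} (h : φ s = some t) (r : ℕ) :
    pushExp φ (lowExp p s r) = lowExp p t r := by
  rw [lowExp, map_sum, lowExp]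
  exact Finset.sum_congr rfl fun j _ => pushExp_single_some h j _

/-- The derivation with respect to the `i`-th digit in column `s`. -/
noncomputable def digitExp {S : Type} (s : S) (i : ℕ) (m : S × ℕ →₀ ℕ) : S × ℕ →₀ ℕ :=
  m - Finsupp.single (s, i) 1 + lowExp p s i

lemma single_le_iff' {S : Type} {s : S} {i : ℕ} {m : S × ℕ →₀ ℕ} :
    Finsupp.single (s, i) 1 ≤ m ↔ m (s, i) ≠ 0 := by
  rw [Finsupp.single_le_iff, Nat.one_le_iff_ne_zero]

lemma digitExp_add {S : Type} {s : S} {i : ℕ} {m : S × ℕ →₀ ℕ} (h : m (s, i) ≠ 0) :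
    digitExp p s i m + Finsupp.single (s, i) 1 = m + lowExp p s i := by
  rw [digitExp, add_right_comm, tsub_add_cancel_of_le (single_le_iff'.2 h)]

variable [hp : Fact p.Prime]

lemma expWt_digitExp {S : Type} {s : S} {i : ℕ} {m : S × ℕ →₀ ℕ} (h : m (s, i) ≠ 0) :
    expWt (fun i : ℕ => p ^ i) (digitExp p s i m) + 1 = expWt (fun i : ℕ => p ^ i) m := by
  have h1 := congrArg (expWt fun i : ℕ => p ^ i) (digitExp_add p h)
  rw [map_add, map_add, expWt_single, one_mul, ← expWt_lowExp p s i] at h1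
  omega

/-- The coefficientwise formula for the derivation in direction `s`. -/
noncomputable def divTerm (F : Type) [Field F] {S : Type} (K : ℕ) (k' : ℤ) (s : S) (m : S × ℕ →₀ ℕ) :
    DivSpace p F k' S :=
  ∑ i ∈ Finset.range K, ((-1 : F) ^ i * (m (s, i) : F)) • dmon p F k' (digitExp p s i m)

/-- The derivation in direction `s` of the divided power algebra. -/
noncomputable def divD (k k' : ℤ) {S : Type} (s : S) : DivSpace p F k S →ₗ[F] DivSpace p F k' S :=
  monLift (divTerm p F k.toNat k' s)

variable {k k' k'' : ℤ} {S T : Type}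

lemma dmon_pushExp (φ : S → Option T) {m : S × ℕ →₀ ℕ}
    (hm : (expWt (fun i : ℕ => p ^ i) m : ℤ) = k) :
    monMap φ (dmon p F k m) = dmon p F k (pushExp φ m) :=
  monMap_mon (fun i => pow_pos hp.out.pos i) (by simpa using hp.out.ne_zero) φ hm

variable [CharP F p]

lemma divTerm_eq_zero_of_cap_le {K : ℕ} {s : S} {m : S × ℕ →₀ ℕ} {x : S × ℕ} (h : p ≤ m x) :
    divTerm p F K k' s m = 0 := by
  refine Finset.sum_eq_zero fun i _ => ?_
  by_cases hx : p ≤ digitExp p s i m x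
  · rw [dmon, mon_of_cap_le (by exact_mod_cast hx), smul_zero]
  · have hxi : x = (s, i) := by
      classical
      by_contra hne
      apply hx
      simp only [digitExp, Finsupp.add_apply, Finsupp.tsub_apply, Finsupp.single_apply,
        if_neg (Ne.symm hne)]
      omega
    subst hxi
    have h1 : m (s, i) = p := by
      classical
      simp only [digitExp, Finsupp.add_apply, Finsupp.tsub_apply, Finsupp.single_apply] at hx
      simp only [if_true] at hx
      omega
    refine (congrArg (· • _) ?_).trans (zero_smul F _)
    rw [h1, CharP.cast_eq_zero, mul_zero]

lemma divD_dmon {s : S} {m : S × ℕ →₀ ℕ} (hm : (expWt (fun i : ℕ => p ^ i) m : ℤ) = k) :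
    divD p k k' s (dmon p F k m) = divTerm p F k.toNat k' s m := by
  refine monLift_mon' fun h => ?_
  have : ∃ x, ¬ (m x : ℕ∞) < p := by
    by_contra! h'
    exact h ⟨h', hm⟩
  obtain ⟨x, hx⟩ := this
  exact divTerm_eq_zero_of_cap_le p (x := x) (by exact_mod_cast not_lt.1 hx)

lemma pushExp_digitExp {φ : S → Option T} {s : S} {t : T} (h : φ s = some t) {i : ℕ}
    {m : S × ℕ →₀ ℕ} (hm : m (s, i) ≠ 0) :
    pushExp φ (digitExp p s i m) = digitExp p t i (pushExp φ m) := by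
  have h1 := congrArg (pushExp φ) (digitExp_add p hm)
  rw [map_add, map_add, pushExp_single_some h, pushExp_lowExp_some p h] at h1
  have h2 : pushExp φ m (t, i) ≠ 0 := by
    have := congrArg (pushExp φ) (tsub_add_cancel_of_le (single_le_iff'.2 hm))
    rw [map_add, pushExp_single_some h] at this
    rw [← this]
    simp
  rw [← digitExp_add p h2] at h1
  exact add_right_cancel h1

lemma divD_monMap [Fintype S] [DecidableEq T] (hk : k = k' + 1) (φ : S → Option T) (t : T)
    (x : DivSpace p F k S) :
    divD p k k' t (monMap φ x) = ∑ s, if φ s = some t then monMap φ (divD p k k' s x) else 0 := by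
  have : (divD p k k' t).comp (monMap φ) = ∑ s, if φ s = some t then
      (monMap φ).comp (divD p k k' s) else (0 : DivSpace p F k S →ₗ[F] DivSpace p F k' T) := by
    refine mon_hom_ext fun m hm => ?_
    rw [LinearMap.comp_apply, LinearMap.sum_apply]
    refine (congrArg _ (dmon_pushExp p φ hm.2)).trans ?_
    have hR : ∀ s, (if φ s = some t then (monMap φ).comp (divD p k k' s) else
        (0 : DivSpace p F k S →ₗ[F] DivSpace p F k' T)) (dmon p F k m) =
        ∑ i ∈ Finset.range k.toNat, if φ s = some t then
          ((-1 : F) ^ i * (m (s, i) : F)) • dmon p F k' (digitExp p t i (pushExp φ m)) else 0 := by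
      intro s
      split_ifs with h
      · rw [LinearMap.comp_apply, divD_dmon p hm.2, divTerm, map_sum]
        refine Finset.sum_congr rfl fun i _ => ?_
        rw [map_smul]
        by_cases h0 : m (s, i) = 0
        · simp [h0]
        · rw [dmon_pushExp, pushExp_digitExp p h h0]
          have := expWt_digitExp p h0
          have h2 := hm.2
          omega
      · simp
    refine Eq.trans ?_ (Finset.sum_congr rfl fun s _ => (hR s).symm)
    rw [Finset.sum_comm]
    have hW : ∀ i ∈ Finset.range k.toNat, (∑ s, if φ s = some t then
          ((-1 : F) ^ i * (m (s, i) : F)) • dmon p F k' (digitExp p t i (pushExp φ m)) else 0) =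
          ((-1 : F) ^ i * (pushExp φ m (t, i) : F)) •
            dmon p F k' (digitExp p t i (pushExp φ m)) := by
      intro i _
      rw [pushExp_apply, ← Finset.sum_filter, ← Finset.sum_smul, ← Finset.mul_sum, Nat.cast_sum]
      simp only [Nat.cast_ite, Nat.cast_zero, Finset.sum_filter]
    rw [Finset.sum_congr rfl hW]
    by_cases hw : (expWt (fun i : ℕ => p ^ i) (pushExp φ m) : ℤ) = k
    · exact divD_dmon p hw
    · rw [dmon, mon_of_wt_ne hw, map_zero]
      refine (Finset.sum_eq_zero fun i _ => ?_).symm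
      by_cases h0 : pushExp φ m (t, i) = 0
      · simp [h0]
      · rw [dmon, mon_of_wt_ne, smul_zero]
        have := expWt_digitExp p h0
        omega
  have h := LinearMap.congr_fun this x
  rw [LinearMap.comp_apply, LinearMap.sum_apply] at h
  rw [h]
  refine Finset.sum_congr rfl fun s _ => ?_
  split_ifs <;> rfl

end Divided

section Divided
set_option linter.unusedSectionVars false

variable {F : Type} [Field F] (p : ℕ) [hp : Fact p.Prime] {S : Type}

/-- Column `s` of the exponent vanishes below the digit `r`, and not at `r`. -/
def LeastNonzero (m : S × ℕ →₀ ℕ) (s : S) (r : ℕ) : Prop := (∀ j < r, m (s, j) = 0) ∧ m (s, r) ≠ 0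

/-- Column `s` of the exponent is maximal below the digit `r`, and not at `r`. -/
def LeastNonmax (m : S × ℕ →₀ ℕ) (s : S) (r : ℕ) : Prop :=
  (∀ j < r, m (s, j) = p - 1) ∧ m (s, r) ≠ p - 1

lemma exists_leastNonzero {m : S × ℕ →₀ ℕ} {s : S} (h : ∃ i, m (s, i) ≠ 0) :
    ∃ r, LeastNonzero m s r := by
  classical
  exact ⟨Nat.find h, fun j hj => not_not.1 (Nat.find_min h hj), Nat.find_spec h⟩

lemma exists_leastNonmax (m : S × ℕ →₀ ℕ) (s : S) : ∃ r, LeastNonmax p m s r := by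
  classical
  have h : ∃ i, m (s, i) ≠ p - 1 := by
    by_contra! h
    have hf : (m.support : Set (S × ℕ)).Finite := m.support.finite_toSet
    refine Set.infinite_of_injective_forall_mem (f := fun i : ℕ => (s, i))
      (fun a b h => congrArg Prod.snd h) (fun i => ?_) hf
    simp only [Finset.mem_coe, Finsupp.mem_support_iff, h]
    have := hp.out.two_le
    omega
  exact ⟨Nat.find h, fun j hj => not_not.1 (Nat.find_min h hj), Nat.find_spec h⟩

lemma LeastNonmax.unique {p : ℕ} {m : S × ℕ →₀ ℕ} {s : S} {r r' : ℕ} (h : LeastNonmax p m s r)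
    (h' : LeastNonmax p m s r') : r = r' := by
  rcases lt_trichotomy r r' with hlt | rfl | hlt
  · exact absurd (h'.1 r hlt) h.2
  · rfl
  · exact absurd (h.1 r' hlt) h'.2

variable {k k' k'' : ℤ}

lemma divTerm_leastNonzero {s : S} {m : S × ℕ →₀ ℕ} {r K : ℕ} (h : LeastNonzero m s r) (hr : r < K) :
    divTerm p F K k' s m = ((-1 : F) ^ r * (m (s, r) : F)) • dmon p F k' (digitExp p s r m) := by
  refine (Finset.sum_eq_single r (fun i _ hi => ?_) fun h' => absurd (Finset.mem_range.2 hr) h').trans rfl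
  rcases lt_or_gt_of_ne hi with h' | h'
  · simp [h.1 i h']
  · have : p ≤ digitExp p s i m (s, r) := by
      classical
      have := h.2
      rw [digitExp, Finsupp.add_apply, Finsupp.tsub_apply, lowExp_apply, if_pos ⟨rfl, h'⟩,
        Finsupp.single_apply, if_neg (by simp [h'.ne'])]
      omega
    rw [dmon, mon_of_cap_le (by exact_mod_cast this), smul_zero]

lemma divTerm_zero {s : S} {m : S × ℕ →₀ ℕ} {K : ℕ} (h : ∀ i, m (s, i) = 0) :
    divTerm p F K k' s m = 0 :=
  Finset.sum_eq_zero fun i _ => by simp [h i]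

lemma lt_toNat_of_ne_zero {m : S × ℕ →₀ ℕ} (hm : (expWt (fun i : ℕ => p ^ i) m : ℤ) = k) {s : S}
    {r : ℕ} (h : m (s, r) ≠ 0) : r < k.toNat := by
  have h1 := le_expWt (fun i : ℕ => p ^ i) m (s, r)
  have h2 : r < p ^ r := Nat.lt_pow_self hp.out.one_lt
  have h3 : p ^ r ≤ m (s, r) * p ^ r := Nat.le_mul_of_pos_left _ (Nat.pos_of_ne_zero h)
  have h4 : r < expWt (fun i : ℕ => p ^ i) m := lt_of_lt_of_le h2 (h3.trans h1)
  omega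

/-- The least digit in a column that is not maximal. -/
noncomputable def nonmax (m : S × ℕ →₀ ℕ) (s : S) : ℕ := (exists_leastNonmax p m s).choose

lemma nonmax_spec (m : S × ℕ →₀ ℕ) (s : S) : LeastNonmax p m s (nonmax p m s) :=
  (exists_leastNonmax p m s).choose_spec

/-- The successor of an exponent in column `s`. -/
noncomputable def incExp (s : S) (m : S × ℕ →₀ ℕ) : S × ℕ →₀ ℕ :=
  m + Finsupp.single (s, nonmax p m s) 1 - lowExp p s (nonmax p m s)

lemma incExp_add (s : S) (m : S × ℕ →₀ ℕ) :
    incExp p s m + lowExp p s (nonmax p m s) = m + Finsupp.single (s, nonmax p m s) 1 := by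
  classical
  refine tsub_add_cancel_of_le fun ⟨t, j⟩ => ?_
  rw [lowExp_apply]
  split_ifs with h
  · rw [← h.1, Finsupp.add_apply, (nonmax_spec p m s).1 j h.2]
    exact Nat.le_add_right _ _
  · exact Nat.zero_le _

lemma expWt_incExp (s : S) (m : S × ℕ →₀ ℕ) :
    expWt (fun i : ℕ => p ^ i) (incExp p s m) = expWt (fun i : ℕ => p ^ i) m + 1 := by
  have := congrArg (expWt fun i : ℕ => p ^ i) (incExp_add p s m)
  rw [map_add, map_add, expWt_single, one_mul, ← expWt_lowExp p s (nonmax p m s)] at this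
  omega

/-- The coefficient of the integration operator. -/
noncomputable def incCoeff (F : Type) [Field F] (s : S) (m : S × ℕ →₀ ℕ) : F :=
  (-1 : F) ^ nonmax p m s * ((m (s, nonmax p m s) + 1 : ℕ) : F)⁻¹

/-- The integration operator in direction `s` of the divided power algebra. -/
noncomputable def divI (k k' : ℤ) (s : S) : DivSpace p F k S →ₗ[F] DivSpace p F k' S :=
  monLift fun m => incCoeff p F s m • dmon p F k' (incExp p s m)

open Classical in
/-- The projection onto the part of the divided power algebra not involving `s`. -/
noncomputable def divEps (k : ℤ) (s : S) : Module.End F (DivSpace p F k S) :=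
  monLift fun m => if ∀ i, m (s, i) = 0 then dmon p F k m else 0

lemma divI_dmon {s : S} {m : S × ℕ →₀ ℕ} (hm : IsAdm (p : ℕ∞) (fun i : ℕ => p ^ i) k m) :
    divI p k k' s (dmon p F k m) = incCoeff p F s m • dmon p F k' (incExp p s m) :=
  monLift_mon hm

open Classical in
lemma divEps_dmon {s : S} {m : S × ℕ →₀ ℕ} :
    divEps p k s (dmon p F k m) = if ∀ i, m (s, i) = 0 then dmon p F k m else 0 := by
  refine monLift_mon' fun h => ?_
  rw [show dmon p F k m = 0 from mon_of_not h, ite_self]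

lemma incExp_apply_of_ne {s t : S} (h : s ≠ t) (m : S × ℕ →₀ ℕ) (j : ℕ) :
    incExp p s m (t, j) = m (t, j) := by
  classical
  have := DFunLike.congr_fun (incExp_add p s m) (t, j)
  rwa [Finsupp.add_apply, Finsupp.add_apply, lowExp_apply, if_neg (by tauto), Finsupp.single_apply,
    if_neg (by simp [h]), add_zero, add_zero] at this

lemma incExp_leastNonzero (s : S) (m : S × ℕ →₀ ℕ) :
    LeastNonzero (incExp p s m) s (nonmax p m s) ∧
      incExp p s m (s, nonmax p m s) = m (s, nonmax p m s) + 1 ∧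
      ∀ j, nonmax p m s < j → incExp p s m (s, j) = m (s, j) := by
  classical
  have key := fun j => DFunLike.congr_fun (incExp_add p s m) (s, j)
  simp only [Finsupp.add_apply, lowExp_apply, Finsupp.single_apply, Prod.mk.injEq, true_and] at key
  refine ⟨⟨fun j hj => ?_, ?_⟩, ?_, fun j hj => ?_⟩
  · have := key j
    rw [if_pos hj, if_neg (by omega), (nonmax_spec p m s).1 j hj] at this
    omega
  · have := key (nonmax p m s)
    rw [if_neg (by omega), if_pos rfl] at this
    omega
  · have := key (nonmax p m s)
    rwa [if_neg (by omega), if_pos rfl] at this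
  · have := key j
    rwa [if_neg (by omega), if_neg (by omega)] at this

lemma digitExp_incExp (s : S) (m : S × ℕ →₀ ℕ) :
    digitExp p s (nonmax p m s) (incExp p s m) = m := by
  have h := digitExp_add p (incExp_leastNonzero p s m).1.2
  rw [incExp_add] at h
  exact add_right_cancel h

lemma digitExp_apply_of_ne {s t : S} (h : s ≠ t) (m : S × ℕ →₀ ℕ) (r j : ℕ) :
    digitExp p s r m (t, j) = m (t, j) := by
  classical
  rw [digitExp, Finsupp.add_apply, Finsupp.tsub_apply, lowExp_apply, if_neg (by tauto),
    Finsupp.single_apply, if_neg (by simp [h]), tsub_zero, add_zero]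

lemma digitExp_leastNonmax {s : S} {r : ℕ} {m : S × ℕ →₀ ℕ} (h : LeastNonzero m s r)
    (hm : m (s, r) < p) : LeastNonmax p (digitExp p s r m) s r ∧
      digitExp p s r m (s, r) + 1 = m (s, r) ∧
      ∀ j, r < j → digitExp p s r m (s, j) = m (s, j) := by
  classical
  have key := fun j => DFunLike.congr_fun (digitExp_add p h.2) (s, j)
  simp only [Finsupp.add_apply, lowExp_apply, Finsupp.single_apply, Prod.mk.injEq, true_and] at key
  refine ⟨⟨fun j hj => ?_, ?_⟩, ?_, fun j hj => ?_⟩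
  · have := key j
    rw [if_neg (by omega), if_pos hj, h.1 j hj] at this
    omega
  · have := key r
    rw [if_pos rfl, if_neg (by omega)] at this
    omega
  · have := key r
    rwa [if_pos rfl, if_neg (by omega)] at this
  · have := key j
    rwa [if_neg (by omega), if_neg (by omega)] at this

lemma incExp_digitExp {s : S} {r : ℕ} {m : S × ℕ →₀ ℕ} (h : LeastNonzero m s r)
    (hm : m (s, r) < p) :
    nonmax p (digitExp p s r m) s = r ∧ incExp p s (digitExp p s r m) = m := by
  have hr : nonmax p (digitExp p s r m) s = r :=
    (nonmax_spec p _ s).unique (digitExp_leastNonmax p h hm).1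
  refine ⟨hr, ?_⟩
  have h1 := incExp_add p s (digitExp p s r m)
  rw [hr, digitExp_add p h.2] at h1
  exact add_right_cancel h1

variable [CharP F p]

lemma IsAdm.lt {m : S × ℕ →₀ ℕ} (hm : IsAdm (p : ℕ∞) (fun i : ℕ => p ^ i) k m) (x) : m x < p :=
  by exact_mod_cast hm.1 x

lemma cast_ne_zero_of_lt {a : ℕ} (h0 : a ≠ 0) (h : a < p) : (a : F) ≠ 0 := by
  rw [Ne, CharP.cast_eq_zero_iff F p]
  exact Nat.not_dvd_of_pos_of_lt (Nat.pos_of_ne_zero h0) h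

lemma divD_divI (hk : k = k' + 1) (s : S) (x : DivSpace p F k' S) :
    divD p k k' s (divI p k' k s x) = x := by
  have : (divD p k k' s).comp (divI p k' k s) = (LinearMap.id : DivSpace p F k' S →ₗ[F] _) := by
    refine mon_hom_ext fun m hm => ?_
    have hw : (expWt (fun i : ℕ => p ^ i) (incExp p s m) : ℤ) = k := by
      rw [expWt_incExp, hk, ← hm.2]; push_cast; ring
    obtain ⟨h1, h2, -⟩ := incExp_leastNonzero p s m
    rw [LinearMap.comp_apply]
    refine (congrArg _ (divI_dmon p hm)).trans ?_
    rw [map_smul, divD_dmon p hw, divTerm_leastNonzero p h1 (lt_toNat_of_ne_zero p hw h1.2),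
      digitExp_incExp, h2, smul_smul, incCoeff]
    have hlt : m (s, nonmax p m s) + 1 < p := by
      have := hm.lt p (s, nonmax p m s)
      have := (nonmax_spec p m s).2
      omega
    have h0 := cast_ne_zero_of_lt (F := F) p (Nat.succ_ne_zero _) hlt
    have hs : ((-1 : F) ^ nonmax p m s) * (-1) ^ nonmax p m s = 1 := by
      rw [← mul_pow]; simp
    rw [Nat.succ_eq_add_one] at h0
    have : (-1 : F) ^ nonmax p m s * ((m (s, nonmax p m s) + 1 : ℕ) : F)⁻¹ *
      ((-1) ^ nonmax p m s * ((m (s, nonmax p m s) + 1 : ℕ) : F)) = 1 := by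
      rw [mul_mul_mul_comm, hs, inv_mul_cancel₀ h0, one_mul]
    rw [this, one_smul]
    rfl
  exact LinearMap.congr_fun this x

lemma divI_divD (hk : k = k' + 1) (s : S) (x : DivSpace p F k S) :
    divI p k' k s (divD p k k' s x) = x - divEps p k s x := by
  have : (divI p k' k s).comp (divD p k k' s) =
      (LinearMap.id : DivSpace p F k S →ₗ[F] _) - divEps p k s := by
    refine mon_hom_ext fun m hm => ?_
    rw [LinearMap.comp_apply]
    refine (congrArg _ (divD_dmon p hm.2)).trans ?_
    refine Eq.trans ?_ (congrArg (dmon p F k m - ·) (divEps_dmon p)).symm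
    split_ifs with h0
    · rw [divTerm_zero p h0, map_zero, sub_self]
    · push Not at h0
      obtain ⟨r, hr⟩ := exists_leastNonzero h0
      have hadm : IsAdm (p : ℕ∞) (fun i : ℕ => p ^ i) k' (digitExp p s r m) := by
        refine ⟨fun ⟨t, j⟩ => ?_, ?_⟩
        · have : digitExp p s r m (t, j) < p := by
            obtain ⟨h1, h2, h3⟩ := digitExp_leastNonmax p hr (hm.lt p _)
            have := hp.out.pos
            by_cases hst : s = t
            · subst hst
              rcases lt_trichotomy j r with h | rfl | h
              · rw [h1.1 j h]; omega
              · have := hm.lt p (s, j); omega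
              · rw [h3 j h]; exact hm.lt p _
            · rw [digitExp_apply_of_ne p hst]; exact hm.lt p _
          exact_mod_cast this
        · have := expWt_digitExp p hr.2
          have := hm.2
          omega
      obtain ⟨h1, h2⟩ := incExp_digitExp p hr (hm.lt p _)
      rw [divTerm_leastNonzero p hr (lt_toNat_of_ne_zero p hm.2 hr.2), map_smul, divI_dmon p hadm,
        smul_smul, h2, incCoeff, h1, (digitExp_leastNonmax p hr (hm.lt p _)).2.1]
      have h0 := cast_ne_zero_of_lt (F := F) p hr.2 (hm.lt p (s, r))
      have hs : ((-1 : F) ^ r) * (-1) ^ r = 1 := by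
        rw [← mul_pow]; simp
      have : (-1 : F) ^ r * (m (s, r) : F) * ((-1) ^ r * (m (s, r) : F)⁻¹) = 1 := by
        rw [mul_mul_mul_comm, hs, mul_inv_cancel₀ h0, one_mul]
      rw [this, one_smul]
      exact (sub_zero _).symm
  exact LinearMap.congr_fun this x

lemma divD_comm (h1 : k = k' + 1) (h2 : k' = k'' + 1) {s t : S} (hst : s ≠ t)
    (x : DivSpace p F k S) :
    divD p k' k'' s (divD p k k' t x) = divD p k' k'' t (divD p k k' s x) := by
  have aux : ∀ (s t : S) (m : S × ℕ →₀ ℕ), s ≠ t → IsAdm (p : ℕ∞) (fun i : ℕ => p ^ i) k m →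
      divD p k' k'' s (divD p k k' t (dmon p F k m)) =
        ∑ i ∈ Finset.range k.toNat, ∑ j ∈ Finset.range k'.toNat,
          (((-1 : F) ^ i * (m (t, i) : F)) * ((-1 : F) ^ j * (m (s, j) : F))) •
            dmon p F k'' (digitExp p s j (digitExp p t i m)) := by
    intro s t m hst hm
    rw [divD_dmon p hm.2, divTerm, map_sum]
    refine Finset.sum_congr rfl fun i _ => ?_
    rw [map_smul]
    by_cases h0 : m (t, i) = 0
    · simp [h0]
    · have := expWt_digitExp p h0
      have := hm.2
      rw [divD_dmon p (by omega), divTerm, Finset.smul_sum]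
      refine Finset.sum_congr rfl fun j _ => ?_
      rw [smul_smul, digitExp_apply_of_ne p hst.symm]
  have key : (divD p k' k'' s).comp (divD p k k' t : DivSpace p F k S →ₗ[F] _) =
      (divD p k' k'' t).comp (divD p k k' s) := by
    refine mon_hom_ext fun m hm => ?_
    refine (aux s t m hst hm).trans (Eq.trans ?_ (aux t s m hst.symm hm).symm)
    have hK : ∀ (s t : S), s ≠ t → ∀ i, (∑ j ∈ Finset.range k'.toNat,
        (((-1 : F) ^ i * (m (t, i) : F)) * ((-1 : F) ^ j * (m (s, j) : F))) •
            dmon p F k'' (digitExp p s j (digitExp p t i m))) = ∑ j ∈ Finset.range k.toNat,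
        (((-1 : F) ^ i * (m (t, i) : F)) * ((-1 : F) ^ j * (m (s, j) : F))) •
            dmon p F k'' (digitExp p s j (digitExp p t i m)) := by
      intro s t hst i
      refine Finset.sum_subset (Finset.range_mono (by omega)) fun j _ hj => ?_
      by_cases h0 : m (t, i) = 0
      · simp [h0]
      by_cases h0' : m (s, j) = 0
      · simp [h0']
      refine absurd (Finset.mem_range.2 (lt_toNat_of_ne_zero p (k := k') (s := s)
        (m := digitExp p t i m) ?_ ?_)) hj
      · have := expWt_digitExp p h0
        have := hm.2
        omega
      · rwa [digitExp_apply_of_ne p hst.symm]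
    simp only [hK s t hst, hK t s hst.symm]
    rw [Finset.sum_comm]
    refine Finset.sum_congr rfl fun i _ => Finset.sum_congr rfl fun j _ => ?_
    rw [mul_comm]
    by_cases h0 : m (s, i) = 0
    · simp [h0]
    by_cases h0' : m (t, j) = 0
    · simp [h0']
    have e1 := digitExp_add p h0'
    have e2 := digitExp_add p h0
    have e3 := digitExp_add p (s := s) (i := i) (m := digitExp p t j m)
      (by rwa [digitExp_apply_of_ne p hst.symm])
    have e4 := digitExp_add p (s := t) (i := j) (m := digitExp p s i m)
      (by rwa [digitExp_apply_of_ne p hst])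
    have : digitExp p s i (digitExp p t j m) = digitExp p t j (digitExp p s i m) := by
      apply add_right_cancel (b := Finsupp.single (s, i) 1 + Finsupp.single (t, j) 1)
      calc _ = digitExp p t j m + Finsupp.single (t, j) 1 + lowExp p s i := by
            rw [← add_assoc, e3]; abel
        _ = digitExp p s i m + Finsupp.single (s, i) 1 + lowExp p t j := by rw [e1, e2]; abel
        _ = _ := by rw [add_comm (Finsupp.single (s, i) 1), ← add_assoc, e4]; abel
    rw [this]
  exact LinearMap.congr_fun key x

lemma incExp_adm {s : S} {m : S × ℕ →₀ ℕ} (hk : k' = k + 1)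
    (hm : IsAdm (p : ℕ∞) (fun i : ℕ => p ^ i) k m) :
    IsAdm (p : ℕ∞) (fun i : ℕ => p ^ i) k' (incExp p s m) := by
  refine ⟨fun ⟨t, j⟩ => ?_, ?_⟩
  · have : incExp p s m (t, j) < p := by
      obtain ⟨h1, h2, h3⟩ := incExp_leastNonzero p s m
      have := hp.out.pos
      by_cases hst : s = t
      · subst hst
        rcases lt_trichotomy j (nonmax p m s) with h | rfl | h
        · rw [h1.1 j h]; omega
        · have := hm.lt p (s, nonmax p m s)
          have := (nonmax_spec p m s).2
          omega
        · rw [h3 j h]; exact hm.lt p _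
      · rw [incExp_apply_of_ne p hst]; exact hm.lt p _
    exact_mod_cast this
  · have := expWt_incExp p s m
    have := hm.2
    omega

lemma nonmax_digitExp {s e : S} (h : s ≠ e) (i : ℕ) (m : S × ℕ →₀ ℕ) :
    nonmax p (digitExp p s i m) e = nonmax p m e := by
  refine (nonmax_spec p _ e).unique ⟨fun j hj => ?_, ?_⟩
  · rw [digitExp_apply_of_ne p h]; exact (nonmax_spec p m e).1 j hj
  · rw [digitExp_apply_of_ne p h]; exact (nonmax_spec p m e).2

lemma divD_divI_of_ne (h1 : k = k' + 1) (h2 : k' = k'' + 1) {s e : S} (hse : s ≠ e)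
    (x : DivSpace p F k' S) :
    divD p k k' s (divI p k' k e x) = divI p k'' k' e (divD p k' k'' s x) := by
  have key : (divD p k k' s).comp (divI p k' k e : DivSpace p F k' S →ₗ[F] _) =
      (divI p k'' k' e).comp (divD p k' k'' s) := by
    refine mon_hom_ext fun m hm => ?_
    rw [LinearMap.comp_apply, LinearMap.comp_apply]
    refine (congrArg _ (divI_dmon p hm)).trans (Eq.trans ?_ (congrArg _ (divD_dmon p hm.2)).symm)
    rw [map_smul, divD_dmon p (incExp_adm p h1 hm).2]
    by_cases h0 : ∀ i, m (s, i) = 0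
    · rw [divTerm_zero p h0, divTerm_zero p fun i => by
        rw [incExp_apply_of_ne p hse.symm]; exact h0 i]
      simp
    push Not at h0
    obtain ⟨r, hr⟩ := exists_leastNonzero h0
    have hr' : LeastNonzero (incExp p e m) s r :=
      ⟨fun j hj => by rw [incExp_apply_of_ne p hse.symm]; exact hr.1 j hj,
        by rw [incExp_apply_of_ne p hse.symm]; exact hr.2⟩
    have hadm : IsAdm (p : ℕ∞) (fun i : ℕ => p ^ i) k'' (digitExp p s r m) := by
      refine ⟨fun ⟨t, j⟩ => ?_, ?_⟩
      · have : digitExp p s r m (t, j) < p := by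
          obtain ⟨h1, h2, h3⟩ := digitExp_leastNonmax p hr (hm.lt p _)
          have := hp.out.pos
          by_cases hst : s = t
          · subst hst
            rcases lt_trichotomy j r with h | rfl | h
            · rw [h1.1 j h]; omega
            · have := hm.lt p (s, j); omega
            · rw [h3 j h]; exact hm.lt p _
          · rw [digitExp_apply_of_ne p hst]; exact hm.lt p _
        exact_mod_cast this
      · have := expWt_digitExp p hr.2
        have := hm.2
        omega
    rw [divTerm_leastNonzero p hr (lt_toNat_of_ne_zero p hm.2 hr.2),
      divTerm_leastNonzero p hr' (lt_toNat_of_ne_zero p (incExp_adm p h1 hm).2 hr'.2), map_smul,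
      divI_dmon p hadm, smul_smul, smul_smul, incExp_apply_of_ne p hse.symm, incCoeff, incCoeff,
      nonmax_digitExp p hse, digitExp_apply_of_ne p hse, mul_comm]
    congr 2
    have e1 := incExp_add p e m
    have e2 := incExp_add p e (digitExp p s r m)
    rw [nonmax_digitExp p hse] at e2
    have e3 := digitExp_add p hr.2
    have e4 := digitExp_add p hr'.2
    apply add_right_cancel (b := Finsupp.single (s, r) 1 + lowExp p e (nonmax p m e))
    calc _ = incExp p e m + lowExp p e (nonmax p m e) + lowExp p s r := by
          rw [← add_assoc, e4]; abel
      _ = digitExp p s r m + Finsupp.single (s, r) 1 + Finsupp.single (e, nonmax p m e) 1 := by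
          rw [e1, e3]; abel
      _ = _ := by rw [add_comm (Finsupp.single (s, r) 1), ← add_assoc, e2]; abel
  exact LinearMap.congr_fun key x

open Classical in
lemma prod_divEps_dmon (l : List S) (m : S × ℕ →₀ ℕ) :
    (l.map fun e => divEps (F := F) p k e).prod (dmon p F k m) =
      if ∀ e ∈ l, ∀ i, m (e, i) = 0 then dmon p F k m else 0 := by
  induction l with
  | nil => simp
  | cons e l ih =>
    rw [List.map_cons, List.prod_cons, Module.End.mul_apply, ih]
    split_ifs with h1 h2 h2
    · rw [divEps_dmon, if_pos (h2 e (by simp))]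
    · rw [divEps_dmon, if_neg]
      intro h
      exact h2 fun e' he' => by
        rcases List.mem_cons.1 he' with rfl | h'
        · exact h
        · exact h1 e' h'
    · exact absurd (fun e' he' => h2 e' (List.mem_cons_of_mem _ he')) h1
    · rw [map_zero]

lemma prod_divEps_of_ne [Fintype S] (hk : k ≠ 0) :
    (Finset.univ.toList.map fun e : S => divEps (F := F) p k e).prod = 0 := by
  refine mon_hom_ext fun m hm => ?_
  refine (prod_divEps_dmon p _ m).trans ?_
  rw [if_neg, LinearMap.zero_apply]
  intro h
  refine hk ?_
  rw [← hm.2, show m = 0 from Finsupp.ext fun ⟨e, i⟩ => h e (by simp) i]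
  simp

lemma prod_divEps_zero [Fintype S] :
    (Finset.univ.toList.map fun e : S => divEps (F := F) p 0 e).prod = 1 := by
  refine mon_hom_ext fun m hm => ?_
  refine (prod_divEps_dmon p _ m).trans ?_
  rw [if_pos]
  · rfl
  intro e _ i
  have h := le_expWt (fun i : ℕ => p ^ i) m (e, i)
  have h0 : expWt (fun i : ℕ => p ^ i) m = 0 := by exact_mod_cast hm.2
  rw [h0] at h
  by_contra hne
  have := Nat.mul_pos (Nat.pos_of_ne_zero hne) (pow_pos hp.out.pos i)
  dsimp only at h
  omega

end Divided

section Contraction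

variable {F : Type} [Field F] {C : SimplicialObject PFin} {t : ENNReal}

/-- Functors killing the nowhere defined map send contractible objects to acyclic ones. -/
theorem TensorBound.of_contr (H : PrismHomotopy (𝟙 C) (noneHom C)) (Φ : PFin ⥤ ModuleCat.{0} F)
    (h : ∀ S : PFin, (Φ.map (PFin.none S S)).hom = 0) :
    TensorBound t (((SimplicialObject.whiskering _ _).obj Φ).obj C) 0 := by
  refine TensorBound.zero (f := ((SimplicialObject.whiskering _ _).obj Φ).map (noneHom C)) ?_ ?_
  · have := H.whisker Φ
    rwa [CategoryTheory.Functor.map_id] at this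
  · ext X : 2
    exact h _

lemma TensorBound.ext_contr (H : PrismHomotopy (𝟙 C) (noneHom C)) (j : ℕ) :
    TensorBound t (extS F (j + 1) C) 0 := by
  refine TensorBound.of_contr H (extFun F (j + 1)) fun S => ?_
  refine LinearMap.ext fun f => AlternatingMap.ext fun v => ?_
  change ExtPow F (j + 1) S at f
  change (extMap F (PFin.none S S) f) v = 0
  rw [extMap_apply]
  exact f.map_coord_zero 0 (funext fun s => by simp [pullCov_apply, PFin.none])

lemma monMap_none {I : Type} {cap : ℕ∞} {w : I → ℕ} {k : ℤ} (hw : ∀ i, 0 < w i) (hcap : cap ≠ 0)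
    {S T : Type} (hk : k ≠ 0) :
    (monMap fun _ => none : MonSpace cap w k F S →ₗ[F] MonSpace cap w k F T) = 0 := by
  refine mon_hom_ext fun m hm => ?_
  rw [monMap_mon hw hcap _ hm.2, LinearMap.zero_apply]
  refine mon_of_wt_ne ?_
  have : pushExp (fun _ : S => (none : Option T)) m = 0 := by
    induction m using Finsupp.induction_linear with
    | zero => simp
    | add a b _ _ =>
      ext x
      have hz : ∀ a : S × I →₀ ℕ, pushExp (fun _ : S => (none : Option T)) a = 0 := by
        intro a
        induction a using Finsupp.induction_linear with
        | zero => simp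
        | add a b ha hb => rw [map_add, ha, hb, add_zero]
        | single x c => exact pushExp_single_none rfl _ _
      rw [hz]
    | single x c => exact pushExp_single_none rfl _ _
  rw [this, map_zero]
  exact_mod_cast hk.symm

lemma TensorBound.sym_contr (H : PrismHomotopy (𝟙 C) (noneHom C)) {k : ℤ} (hk : k ≠ 0) :
    TensorBound t (symS F k C) 0 :=
  TensorBound.of_contr H (symFun F k) fun _ => monMap_none (fun _ => one_pos) (by simp) hk

/-- Functors with trivial zeroth term. -/
theorem TensorBound.mon_neg {I : Type} {cap : ℕ∞} {w : I → ℕ} {k : ℤ} (hw : ∀ i, 0 < w i)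
    (hcap : cap ≠ 0) (hk : k < 0) :
    TensorBound t (((SimplicialObject.whiskering _ _).obj (monFun F k hw hcap)).obj C) 0 := by
  refine TensorBound.zero (f := 0) (PrismHomotopy.ofEq ?_) rfl
  ext X : 2
  refine mon_hom_ext fun m hm => ?_
  have := hm.2
  omega

lemma expWt_eq_zero {I S : Type} {w : I → ℕ} (hw : ∀ i, 0 < w i) {m : S × I →₀ ℕ}
    (h : expWt w m = 0) : m = 0 := by
  ext x
  have h1 := le_expWt w m x
  rw [h] at h1
  by_contra hne
  have := Nat.mul_pos (Nat.pos_of_ne_zero hne) (hw x.2)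
  omega

/-- The coefficient sum on monomials. -/
noncomputable def monSum {I : Type} {cap : ℕ∞} {w : I → ℕ} {k : ℤ} {S : Type} :
    MonSpace cap w k F S →ₗ[F] F :=
  monLift fun _ => 1

lemma isAdm_zero {I S : Type} {cap : ℕ∞} {w : I → ℕ} (hcap : cap ≠ 0) :
    IsAdm cap w 0 (0 : S × I →₀ ℕ) :=
  ⟨fun _ => by simpa using pos_iff_ne_zero.2 hcap, by simp⟩

lemma monSum_mon {I : Type} {cap : ℕ∞} {w : I → ℕ} {k : ℤ} {S : Type} (hcap : cap ≠ 0)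
    (hk : k = 0) : monSum (mon F cap w k (0 : S × I →₀ ℕ)) = 1 := by
  subst hk
  exact monLift_mon (isAdm_zero hcap)

lemma monSum_smul_mon {I : Type} {cap : ℕ∞} {w : I → ℕ} {k : ℤ} {S : Type} (hw : ∀ i, 0 < w i)
    (hcap : cap ≠ 0) (hk : k = 0) (x : MonSpace cap w k F S) :
    monSum x • mon F cap w k 0 = x := by
  have : (monSum (F := F)).smulRight (mon F cap w k (0 : S × I →₀ ℕ)) = LinearMap.id := by
    refine mon_hom_ext fun m hm => ?_
    have h0 : m = 0 := expWt_eq_zero hw (by have := hm.2; omega)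
    subst h0
    rw [LinearMap.smulRight_apply, monSum_mon hcap hk, one_smul]
    rfl
  exact LinearMap.congr_fun this x

lemma monSum_monMap {I : Type} {cap : ℕ∞} {w : I → ℕ} {k : ℤ} {S T : Type} (hw : ∀ i, 0 < w i)
    (hcap : cap ≠ 0) (hk : k = 0) (φ : S → Option T) (x : MonSpace cap w k F S) :
    monSum (monMap φ x : MonSpace cap w k F T) = monSum x := by
  rw [← monSum_smul_mon hw hcap hk x, map_smul, map_smul, map_smul,
    monMap_mon hw hcap _ (by simp [hk]), map_zero, monSum_mon hcap hk, monSum_mon hcap hk]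

/-- Degree zero monomials are constant. -/
theorem TensorBound.mon_zero {I : Type} {cap : ℕ∞} {w : I → ℕ} (hw : ∀ i, 0 < w i)
    (hcap : cap ≠ 0) :
    TensorBound t (((SimplicialObject.whiskering _ _).obj (monFun F 0 hw hcap)).obj C) 1 := by
  refine (TensorBound.const_field (F := F) t).of_iso
    (f := { app := fun X => ModuleCat.ofHom (monSum : MonSpace cap w 0 F (C.obj X) →ₗ[F] F)
            naturality := fun X Y u => ?_ })
    (g := { app := fun X => ModuleCat.ofHom
              (LinearMap.toSpanSingleton F (MonSpace cap w 0 F (C.obj X)) (mon F cap w 0 0))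
            naturality := fun X Y u => ?_ }) ?_
  · exact ModuleCat.hom_ext (LinearMap.ext fun x => monSum_monMap hw hcap rfl (C.map u) x)
  · refine ModuleCat.hom_ext (LinearMap.ext fun (x : F) => ?_)
    change x • mon F cap w 0 0 = monMap (C.map u) (x • mon F cap w 0 0)
    rw [map_smul, monMap_mon hw hcap _ (by simp), map_zero]
  · ext X : 2
    exact LinearMap.ext fun (x : MonSpace cap w 0 F (C.obj X)) => monSum_smul_mon hw hcap rfl x

lemma TensorBound.ext_zero : TensorBound t (extS F 0 C) 1 := by
  refine (TensorBound.const_field (F := F) t).of_iso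
    (f := { app := fun X => ModuleCat.ofHom
              (⟨⟨fun f : ExtPow F 0 (C.obj X) => f ![], fun _ _ => rfl⟩, fun _ _ => rfl⟩ :
                ExtPow F 0 (C.obj X) →ₗ[F] F)
            naturality := fun X Y u => ?_ })
    (g := { app := fun X => ModuleCat.ofHom
              (LinearMap.toSpanSingleton F (ExtPow F 0 (C.obj X))
                (AlternatingMap.constOfIsEmpty F (C.obj X → F) (Fin 0) (1 : F)))
            naturality := fun X Y u => ?_ }) ?_
  · refine ModuleCat.hom_ext (LinearMap.ext fun f => ?_)
    change ExtPow F 0 (C.obj X) at f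
    change extMap F (C.map u) f ![] = f ![]
    rw [extMap_apply]
    exact congrArg f (Subsingleton.elim _ _)
  · refine ModuleCat.hom_ext (LinearMap.ext fun x => AlternatingMap.ext fun v => ?_)
    rfl
  · ext X : 2
    exact LinearMap.ext fun (f : ExtPow F 0 (C.obj X)) => (extPow_zero_eq f).symm

/-- Symmetric powers of a suspension. -/
theorem TensorBound.sym_succ {S Q : SimplicialObject PFin} (h : ConeSeq S C Q) (k : ℕ)
    (a : ℕ → ENNReal) (ha : ∀ j, TensorBound t (extS F j S) (a j)) :
    TensorBound t (symS F k Q) (t ^ k * a k) := by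
  refine (TensorBound.sym_of_coneSeq h k a (fun j => if j = k then 1 else 0) ha
    fun j => ?_).mono ?_
  · split_ifs with hj
    · subst hj
      rw [sub_self]
      exact TensorBound.mon_zero (fun _ => one_pos) (by simp)
    · exact TensorBound.sym_contr h.contr (by omega)
  · rw [tsum_eq_single k (fun j hj => by simp [hj])]
    simp

end Contraction

section Suspension
open TensorProduct
set_option linter.unusedSectionVars false

/-- Divided powers as functors. -/
noncomputable abbrev divFun (F : Type) [Field F] (p : ℕ) [hp : Fact p.Prime] (k : ℤ) :
    PFin ⥤ ModuleCat.{0} F :=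
  monFun (I := ℕ) (cap := p) (w := fun i => p ^ i) F k (fun i => pow_pos hp.out.pos i)
    (by simpa using hp.out.ne_zero)

/-- The divided power of a simplicial partial set. -/
noncomputable abbrev divS (F : Type) [Field F] (p : ℕ) [Fact p.Prime] (k : ℤ)
    (S : SimplicialObject PFin) : SimplicialObject (ModuleCat.{0} F) :=
  ((SimplicialObject.whiskering _ _).obj (divFun F p k)).obj S

variable {F : Type} [Field F] (p : ℕ) [hp : Fact p.Prime] [CharP F p]

section Levelwise

variable {S C Q : Type} [Fintype S] [DecidableEq S] [Fintype C] [DecidableEq C] {i : S → C}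
  {r : C → Option Q} {k k' k'' : ℤ}

/-- The levelwise differential of the coresolution of exterior powers of a quotient. -/
noncomputable def wdgDiv (i : S → C) (j : ℕ) (k k' : ℤ) :
    ExtPow F j C ⊗[F] DivSpace p F k S →ₗ[F] ExtPow F (j + 1) C ⊗[F] DivSpace p F k' S :=
  koszulD (fun s => wdg F (i s)) (fun s => divD p k k' s)

lemma divProj_relation {j : ℕ} (h1 : k = k' + 1) (h2 : k' = k'' + 1) (e : C) (s : S)
    (a : ExtPow F (j + 1) C) (m : DivSpace p F k' S) :
    wdg F e (ctr F e a) ⊗ₜ[F] (divD p k k' s (divI p k' k s m)) +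
      ctr F e (wdg F e a) ⊗ₜ[F] (divI p k'' k' s (divD p k' k'' s m)) =
    a ⊗ₜ m - ((ctr F e).comp (wdg F e) : Module.End F (ExtPow F (j + 1) C)) a ⊗ₜ
      divEps p k' s m := by
  have := ctr_wdg_add e e a
  rw [if_pos rfl, ← eq_sub_iff_add_eq] at this
  rw [divD_divI p h1, divI_divD p h2, TensorProduct.tmul_sub, LinearMap.comp_apply, this,
    TensorProduct.sub_tmul]
  abel

lemma wdg_ctr_of_ne (hi : Function.Injective i) {j : ℕ} (s e : S) (hse : s ≠ e)
    (a : ExtPow F (j + 1) C) : wdg F (i s) (ctr F (i e) a) = -ctr F (i e) (wdg F (i s) a) := by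
  have := ctr_wdg_add (i e) (i s) a
  rw [if_neg (fun h => hse (hi h).symm), ← eq_neg_iff_add_eq_zero] at this
  rw [this, neg_neg]

lemma wdgDiv_wdgDiv (j : ℕ) (h1 : k = k' + 1) (h2 : k' = k'' + 1)
    (x : ExtPow F j C ⊗[F] DivSpace p F k S) :
    wdgDiv p i (j + 1) k' k'' (wdgDiv p i j k k' x) = 0 :=
  koszulD_koszulD (fun s t f => wdg_wdg (i s) (i t) f) (fun s f => wdg_self (i s) f)
    (fun _ _ hst m => divD_comm p h1 h2 hst m) x

lemma wdgDiv_exact (hi : Function.Injective i) (j : ℕ) (h1 : k = k' + 1) (h2 : k' = k'' + 1)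
    (hk : k' ≠ 0) : Function.Exact (wdgDiv (F := F) p i j k k') (wdgDiv p i (j + 1) k' k'') := by
  intro y
  constructor
  · intro hy
    have key := koszul_sub_mem_range (F := F)
      (θ₀ := fun s : S => (wdg F (i s) : ExtPow F j C →ₗ[F] ExtPow F (j + 1) C))
      (θ₁ := fun s => wdg F (i s)) (η₀ := fun s => ctr F (i s)) (η₁ := fun s => ctr F (i s))
      (α₀ := fun s => divD p k k' s) (α₁ := fun s => divD p k' k'' s)
      (β₀ := fun s => divI p k' k s) (β₁ := fun s => divI p k'' k' s)
      (fun s t f => wdg_wdg (i s) (i t) f) (fun s f => wdg_self (i s) f)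
      (fun s t hst m => divD_comm p h1 h2 hst m)
      (fun s e hse a => wdg_ctr_of_ne hi s e hse a)
      (fun s e hse m => divD_divI_of_ne p h1 h2 hse m)
      (fun s => (ctr F (i s)).comp (wdg F (i s))) (fun s => divEps p k' s)
      (fun e a m => divProj_relation p h1 h2 (i e) e a m) Finset.univ.toList y hy
    rw [prod_divEps_of_ne p hk, TensorProduct.map_zero_right, LinearMap.zero_apply] at key
    obtain ⟨x, hx⟩ := key
    exact ⟨x, hx.trans (@sub_zero (ExtPow F (j + 1) C ⊗[F] DivSpace p F k' S) _ _)⟩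
  · rintro ⟨x, rfl⟩
    exact wdgDiv_wdgDiv p j h1 h2 x

lemma wdgDiv_injective (hi : Function.Injective i) (h2 : k' = k'' + 1) (hk : k' ≠ 0) :
    Function.Injective (wdgDiv (F := F) p i 0 k' k'') := by
  suffices H : ∀ y, wdgDiv (F := F) p i 0 k' k'' y = 0 → y = 0 from fun a b hab =>
    sub_eq_zero.1 (H _ (by rw [map_sub, hab, sub_self]))
  intro y hy
  have key := koszul_sub_mem_range (F := F) (A₀ := PUnit)
    (θ₀ := fun _ : S => (0 : PUnit →ₗ[F] ExtPow F 0 C))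
    (θ₁ := fun s => wdg F (i s)) (η₀ := fun _ => 0) (η₁ := fun s => ctr F (i s))
    (α₀ := fun s => divD p (k' + 1) k' s) (α₁ := fun s => divD p k' k'' s)
    (β₀ := fun s => divI p k' (k' + 1) s) (β₁ := fun s => divI p k'' k' s)
    (fun s t f => by simp) (fun s f => by simp)
    (fun s t hst m => divD_comm p rfl h2 hst m)
    (fun s e hse a => by
      rw [ctr_wdg_zero, if_neg fun h => hse (hi h).symm]; simp)
    (fun s e hse m => divD_divI_of_ne p rfl h2 hse m)
    (fun s => 1) (fun s => divEps p k' s)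
    (fun e a m => by
      rw [ctr_wdg_zero, if_pos rfl, divI_divD p h2, TensorProduct.tmul_sub]
      simp) Finset.univ.toList y hy
  rw [prod_divEps_of_ne p hk, TensorProduct.map_zero_right, LinearMap.zero_apply] at key
  obtain ⟨x, hx⟩ := key
  have hx' := hx.trans (@sub_zero (ExtPow F 0 C ⊗[F] DivSpace p F k' S) _ _)
  rw [← hx']
  simp [koszulD]

/-- The levelwise augmentation of the coresolution of exterior powers of a quotient. -/
noncomputable def wdgAug (r : C → Option Q) (j : ℕ) (k : ℤ) :
    ExtPow F j C ⊗[F] DivSpace p F k S →ₗ[F] ExtPow F j Q :=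
  TensorProduct.lift (((LinearMap.lsmul F (ExtPow F j Q)).flip ∘ₗ extMap F r).compl₂ monSum)

lemma wdgAug_tmul (j : ℕ) (f : ExtPow F j C) (m : DivSpace p F k S) :
    wdgAug (F := F) (S := S) p r j k (f ⊗ₜ m) = monSum m • extMap F r f := rfl

lemma wdgAug_map {T D Q' : Type} [Fintype T] [DecidableEq T] [Fintype D] [DecidableEq D]
    (hk : k = 0) (j : ℕ) (γ : C → Option D) (r : C → Option Q) (r' : D → Option Q')
    (κ : Q → Option Q') (σ : S → Option T)
    (hr : ∀ f : ExtPow F j C, extMap F r' (extMap F γ f) = extMap F κ (extMap F r f))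
    (f : ExtPow F j C) (m : DivSpace p F k S) :
    wdgAug (F := F) (S := T) p r' j k (extMap F γ f ⊗ₜ (monMap σ m : DivSpace p F k T)) =
      extMap F κ (wdgAug (F := F) (S := S) p r j k (f ⊗ₜ m)) := by
  rw [wdgAug_tmul, wdgAug_tmul, map_smul, hr, monSum_monMap (fun i => pow_pos hp.out.pos i)
    (by simpa using hp.out.ne_zero) hk]

lemma wdgAug_wdgDiv (hri : ∀ s, r (i s) = none) (j : ℕ) (x : ExtPow F j C ⊗[F] DivSpace p F k S) :
    wdgAug (F := F) (S := S) p r (j + 1) k' (wdgDiv p i j k k' x) = 0 := by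
  induction x with
  | zero => simp
  | add x y hx hy => rw [map_add, map_add, hx, hy, add_zero]
  | tmul f m =>
    rw [wdgDiv, koszulD_tmul, map_sum]
    refine Finset.sum_eq_zero fun s _ => ?_
    rw [wdgAug_tmul, extMap_wdg, hri, Option.elim_none, smul_zero]

lemma IsCofib.prod_ctr_wdg_eq_zero (h : IsCofib i r) {j : ℕ} (f : ExtPow F (j + 1) C)
    (hf : extMap F r f = 0) : (Finset.univ.toList.map fun s =>
      ((ctr F (i s)).comp (wdg F (i s)) : Module.End F (ExtPow F (j + 1) C))).prod f = 0 := by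
  suffices H : ∀ (l : List S) (f : ExtPow F (j + 1) C), extMap F r f = 0 →
      (∀ s, s ∉ l → ctr F (i s) f = 0) → (l.reverse.map fun s =>
        ((ctr F (i s)).comp (wdg F (i s)) : Module.End F (ExtPow F (j + 1) C))).prod f = 0 by
    have := H Finset.univ.toList.reverse f hf (by simp)
    rwa [List.reverse_reverse] at this
  intro l
  induction l with
  | nil =>
    intro f hr hf
    refine h.ext_eq_zero f hr fun j' e s => ?_
    obtain rfl : j = j' := by omega
    exact hf s (by simp)
  | cons e l ih =>
    intro f hr hf
    rw [List.reverse_cons, List.map_append, List.prod_append, Module.End.mul_apply]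
    simp only [List.map_cons, List.map_nil, List.prod_cons, List.prod_nil, mul_one,
      LinearMap.comp_apply]
    refine ih _ ?_ fun s hs => ?_
    · have := ctr_wdg_add (i e) (i e) f
      rw [if_pos rfl, ← eq_sub_iff_add_eq] at this
      rw [this, map_sub, hr, extMap_wdg, h.r_i, Option.elim_none, sub_zero]
    · by_cases hse : s = e
      · subst hse; exact ctr_self _ _
      · have h0 : ctr F (i s) f = 0 := hf s (by simp [hse, hs])
        have h1 := ctr_wdg_add (i s) (i e) f
        rw [if_neg (fun h' => hse (h.inj h')), h0, map_zero, add_zero] at h1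
        rw [ctr_ctr, h1, map_zero, neg_zero]

lemma divSpace_zero_tensor_eq {A : Type} [AddCommGroup A] [Module F A]
    (y : A ⊗[F] DivSpace p F 0 S) : ∃ a : A, y = a ⊗ₜ dmon p F 0 0 := by
  induction y with
  | zero => exact ⟨0, by simp⟩
  | add x y hx hy =>
    obtain ⟨m, rfl⟩ := hx
    obtain ⟨m', rfl⟩ := hy
    exact ⟨m + m', by rw [TensorProduct.add_tmul]⟩
  | tmul f m =>
    refine ⟨monSum m • f, ?_⟩
    rw [TensorProduct.smul_tmul]
    congr 1
    exact (monSum_smul_mon (fun i => pow_pos hp.out.pos i) (by simpa using hp.out.ne_zero) rfl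
      m).symm

lemma IsCofib.wdgDiv_exact_wdgAug (h : IsCofib i r) (j : ℕ) (h1 : k = k' + 1) (h0 : k' = 0) :
    Function.Exact (wdgDiv (F := F) p i j k k') (wdgAug (F := F) (S := S) p r (j + 1) k') := by
  subst h0
  obtain ⟨k'', h2⟩ : ∃ k'' : ℤ, 0 = k'' + 1 := ⟨-1, by simp⟩
  intro y
  constructor
  · intro hy
    have hw : ∀ m : DivSpace p F k'' S, m = 0 := by
      intro m
      have : (LinearMap.id : DivSpace p F k'' S →ₗ[F] DivSpace p F k'' S) = 0 :=
        mon_hom_ext fun m hm => by have := hm.2; omega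
      exact LinearMap.congr_fun this m
    have key := koszul_sub_mem_range (F := F)
      (θ₀ := fun s : S => (wdg F (i s) : ExtPow F j C →ₗ[F] ExtPow F (j + 1) C))
      (θ₁ := fun s => wdg F (i s)) (η₀ := fun s => ctr F (i s)) (η₁ := fun s => ctr F (i s))
      (α₀ := fun s => divD p k 0 s) (α₁ := fun s => divD p 0 k'' s)
      (β₀ := fun s => divI p 0 k s) (β₁ := fun s => divI p k'' 0 s)
      (fun s t f => wdg_wdg (i s) (i t) f) (fun s f => wdg_self (i s) f)
      (fun s t hst m => divD_comm p h1 h2 hst m)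
      (fun s e hse a => wdg_ctr_of_ne h.inj s e hse a)
      (fun s e hse m => divD_divI_of_ne p h1 h2 hse m)
      (fun s => (ctr F (i s)).comp (wdg F (i s))) (fun s => divEps p 0 s)
      (fun e a m => divProj_relation p h1 h2 (i e) e a m) Finset.univ.toList y (by
        obtain ⟨a, rfl⟩ := divSpace_zero_tensor_eq p y
        rw [koszulD_tmul]
        exact Finset.sum_eq_zero fun s _ => by rw [hw (divD _ _ _ _ _), TensorProduct.tmul_zero])
    obtain ⟨a, rfl⟩ := divSpace_zero_tensor_eq p y
    rw [wdgAug_tmul, dmon, monSum_mon (by simpa using hp.out.ne_zero) rfl, one_smul] at hy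
    rw [prod_divEps_zero p, TensorProduct.map_tmul, h.prod_ctr_wdg_eq_zero a hy,
      TensorProduct.zero_tmul] at key
    obtain ⟨x, hx⟩ := key
    exact ⟨x, hx.trans (@sub_zero (ExtPow F (j + 1) C ⊗[F] DivSpace p F 0 S) _ _)⟩
  · rintro ⟨x, rfl⟩
    exact wdgAug_wdgDiv p h.r_i j x

lemma IsCofib.wdgAug_surjective (h : IsCofib i r) (j : ℕ) :
    Function.Surjective (wdgAug (F := F) (S := S) p r j 0) := fun f => by
  obtain ⟨g, rfl⟩ := h.extMap_surjective j f
  refine ⟨g ⊗ₜ dmon p F 0 0, ?_⟩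
  rw [wdgAug_tmul, dmon, monSum_mon (by simpa using hp.out.ne_zero) rfl, one_smul]

end Levelwise

lemma TensorBound.tens_left_zero {t : ENNReal} {A : SimplicialObject (ModuleCat.{0} F)}
    (h : TensorBound t A 0) (B : SimplicialObject (ModuleCat.{0} F)) :
    TensorBound t (_root_.tens A B) 0 := by
  intro M N
  refine (truncSeries_le_of_retract
    (PrismHomotopy.ofEq (tensAssoc A B M).hom_inv_id.symm) t N).trans ?_
  refine (h _ N).trans ?_
  simp

/-- The differential of the coresolution of exterior powers of a quotient. -/
noncomputable def wdgDivHom {S C Q : SimplicialObject PFin} (h : ConeSeq S C Q) (j : ℕ) (k k' : ℤ)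
    (hk : k = k' + 1) :
    tens (extS F j C) (divS F p k S) ⟶ tens (extS F (j + 1) C) (divS F p k' S) where
  app X := ModuleCat.ofHom (wdgDiv p (h.i X) j k k')
  naturality X Y u := by
    classical
    refine ModuleCat.hom_ext (LinearMap.ext fun x => ?_)
    refine koszulD_natural' (S.map u : S.obj X → Option (S.obj Y)) _ _ _ _ (extMap F (C.map u))
      (extMap F (C.map u)) (monMap (S.map u)) (monMap (S.map u)) (fun s a => ?_)
      (fun s m => divD_monMap p hk (S.map u) s m) x
    rw [extMap_wdg, h.nat]
    cases S.map u s <;> rfl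

/-- The augmentation of the coresolution of exterior powers of a quotient. -/
noncomputable def wdgAugHom {S C Q : SimplicialObject PFin} (h : ConeSeq S C Q) (j : ℕ) (k : ℤ)
    (hk : k = 0) : tens (extS F j C) (divS F p k S) ⟶ extS F j Q where
  app X := ModuleCat.ofHom (wdgAug p (h.ρ.app X) j k)
  naturality X Y u := by
    classical
    refine ModuleCat.hom_ext (TensorProduct.ext' fun f m => ?_)
    exact wdgAug_map p (S := S.obj X) (T := S.obj Y) hk j (C.map u) (h.ρ.app X) (h.ρ.app Y)
      (Q.map u) (S.map u) (fun (f : ExtPow F j (C.obj X)) => congrArg (fun g => g.hom f)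
        (((extFun F j).map_comp _ _).symm.trans
        ((congrArg (extFun F j).map (h.ρ.naturality u)).trans ((extFun F j).map_comp _ _)))) f m

/-- Exterior powers of a suspension are bounded by divided powers. -/
theorem TensorBound.ext_succ {t : ENNReal} {S C Q : SimplicialObject PFin} (h : ConeSeq S C Q)
    (κ : ℕ) (c : ENNReal) (hc : TensorBound t (divS F p (κ + 1) S) c) :
    TensorBound t (extS F (κ + 1) Q) (t ^ (κ + 1) * c) := by
  classical
  have e (j : ℕ) : (κ : ℤ) + 1 - j = κ + 1 - (j + 1 : ℕ) + 1 := by push_cast; ring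
  refine TensorBound.of_coexact κ
    (fun j => _root_.tens (extS F j C) (divS F p ((κ : ℤ) + 1 - j) S))
    (fun j => wdgDivHom p h j _ _ (e j)) (wdgAugHom p h (κ + 1) _ (by simp))
    (fun X => ?_) (fun X => ?_) (fun j hj X => ?_) (fun X => ?_) c ?_ fun j =>
      (TensorBound.ext_contr h.contr j).tens_left_zero _
  · have e0 : (κ : ℤ) + 1 - (κ + 1 : ℕ) = 0 := by simp
    change Function.Surjective (wdgAug (F := F) (S := S.obj X) p (h.ρ.app X) (κ + 1)
      ((κ : ℤ) + 1 - (κ + 1 : ℕ)))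
    rw [e0]
    exact (h.cofib X).wdgAug_surjective p (κ + 1)
  · exact wdgDiv_injective (S := S.obj X) (C := C.obj X) p (h.cofib X).inj (e 0) (by push_cast; omega)
  · exact wdgDiv_exact (S := S.obj X) (C := C.obj X) p (h.cofib X).inj j (e j) (e (j + 1))
      (by push_cast; omega)
  · have e0 : (κ : ℤ) + 1 - (κ + 1 : ℕ) = 0 := by simp
    exact (h.cofib X).wdgDiv_exact_wdgAug p κ (e κ) e0
  · have := TensorBound.ext_zero (F := F) (C := C) (t := t) |>.tens hc
    rw [one_mul] at this
    simpa using this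

end Suspension

section Digits
set_option linter.unusedSectionVars false
open TensorProduct

variable {S T : Type}

lemma pushExp_single_of {I : Type} (φ : S → Option T) (s : S) (i : I) (c : ℕ) :
    pushExp φ (Finsupp.single (s, i) c) = (φ s).elim 0 fun t => Finsupp.single (t, i) c := by
  cases h : φ s with
  | none => exact pushExp_single_none h i c
  | some t => exact pushExp_single_some h i c

/-- The lowest digit of an exponent. -/
noncomputable def lowDigit : (S × ℕ →₀ ℕ) →+ (S × Unit →₀ ℕ) :=
  Finsupp.comapDomain.addMonoidHom (f := fun x : S × Unit => (x.1, (0 : ℕ)))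
    fun _ _ h => Prod.ext (Prod.mk.inj h).1 rfl

/-- The higher digits of an exponent. -/
noncomputable def highDigit : (S × ℕ →₀ ℕ) →+ (S × ℕ →₀ ℕ) :=
  Finsupp.comapDomain.addMonoidHom (f := fun x : S × ℕ => (x.1, x.2 + 1))
    fun _ _ h => Prod.ext (Prod.mk.inj h).1 (Nat.succ_injective (Prod.mk.inj h).2)

/-- The exponent with given lowest digit and no higher digits. -/
noncomputable def ofLow : (S × Unit →₀ ℕ) →+ (S × ℕ →₀ ℕ) :=
  Finsupp.mapDomain.addMonoidHom fun x => (x.1, 0)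

/-- The exponent with given higher digits and zero lowest digit. -/
noncomputable def ofHigh : (S × ℕ →₀ ℕ) →+ (S × ℕ →₀ ℕ) :=
  Finsupp.mapDomain.addMonoidHom fun x => (x.1, x.2 + 1)

lemma lowDigit_apply (m : S × ℕ →₀ ℕ) (s : S) (u : Unit) : lowDigit m (s, u) = m (s, 0) := rfl

lemma highDigit_apply (m : S × ℕ →₀ ℕ) (s : S) (i : ℕ) : highDigit m (s, i) = m (s, i + 1) := rfl

lemma ofLow_single (s : S) (u : Unit) (c : ℕ) :
    ofLow (Finsupp.single (s, u) c) = Finsupp.single (s, 0) c := Finsupp.mapDomain_single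

lemma ofHigh_single (s : S) (i c : ℕ) :
    ofHigh (Finsupp.single (s, i) c) = Finsupp.single (s, i + 1) c := Finsupp.mapDomain_single

lemma lowDigit_single_zero (s : S) (c : ℕ) :
    lowDigit (Finsupp.single (s, 0) c) = Finsupp.single (s, ()) c := by
  classical
  ext ⟨t, u⟩
  simp [lowDigit_apply, Finsupp.single_apply]

lemma lowDigit_single_succ (s : S) (i c : ℕ) :
    lowDigit (Finsupp.single (s, i + 1) c) = 0 := by
  classical
  ext ⟨t, u⟩
  simp [lowDigit_apply]

lemma highDigit_single_zero (s : S) (c : ℕ) :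
    highDigit (Finsupp.single (s, 0) c) = 0 := by
  classical
  ext ⟨t, u⟩
  simp [highDigit_apply]

lemma highDigit_single_succ (s : S) (i c : ℕ) :
    highDigit (Finsupp.single (s, i + 1) c) = Finsupp.single (s, i) c := by
  classical
  ext ⟨t, u⟩
  simp [highDigit_apply, Finsupp.single_apply]

lemma ofLow_apply_zero (m : S × Unit →₀ ℕ) (s : S) : ofLow m (s, 0) = m (s, ()) := by
  induction m using Finsupp.induction_linear with
  | zero => simp
  | add f g hf hg => rw [map_add, Finsupp.add_apply, hf, hg, Finsupp.add_apply]
  | single x c =>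
    classical
    rw [ofLow_single]
    simp [Finsupp.single_apply, Prod.ext_iff]

lemma ofHigh_apply_succ (m : S × ℕ →₀ ℕ) (s : S) (i : ℕ) : ofHigh m (s, i + 1) = m (s, i) := by
  induction m using Finsupp.induction_linear with
  | zero => simp
  | add f g hf hg => rw [map_add, Finsupp.add_apply, hf, hg, Finsupp.add_apply]
  | single x c =>
    classical
    rw [ofHigh_single]
    simp [Finsupp.single_apply, Prod.ext_iff]

lemma ofLow_add_ofHigh (m : S × ℕ →₀ ℕ) : ofLow (lowDigit m) + ofHigh (highDigit m) = m := by
  induction m using Finsupp.induction_linear with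
  | zero => simp
  | add f g hf hg =>
    simp only [map_add]
    rw [add_add_add_comm, hf, hg]
  | single x c =>
    obtain ⟨s, i⟩ := x
    cases i with
    | zero => rw [lowDigit_single_zero, highDigit_single_zero, ofLow_single, map_zero, add_zero]
    | succ i => rw [lowDigit_single_succ, highDigit_single_succ, ofHigh_single, map_zero, zero_add]

lemma pushExp_lowDigit (φ : S → Option T) (m : S × ℕ →₀ ℕ) :
    lowDigit (pushExp φ m) = pushExp φ (lowDigit m) := by
  induction m using Finsupp.induction_linear with
  | zero => simp
  | add f g hf hg => simp only [map_add, hf, hg]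
  | single x c =>
    obtain ⟨s, i⟩ := x
    cases h : φ s <;> cases i <;>
      simp [pushExp_single_of, h, lowDigit_single_zero, lowDigit_single_succ]

lemma pushExp_highDigit (φ : S → Option T) (m : S × ℕ →₀ ℕ) :
    highDigit (pushExp φ m) = pushExp φ (highDigit m) := by
  induction m using Finsupp.induction_linear with
  | zero => simp
  | add f g hf hg => simp only [map_add, hf, hg]
  | single x c =>
    obtain ⟨s, i⟩ := x
    cases h : φ s <;> cases i <;>
      simp [pushExp_single_of, h, highDigit_single_zero, highDigit_single_succ]

lemma pushExp_ofLow (φ : S → Option T) (m : S × Unit →₀ ℕ) :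
    pushExp φ (ofLow m) = ofLow (pushExp φ m) := by
  induction m using Finsupp.induction_linear with
  | zero => simp
  | add f g hf hg => simp only [map_add, hf, hg]
  | single x c =>
    obtain ⟨s, i⟩ := x
    cases h : φ s <;> simp [pushExp_single_of, h, ofLow_single]

lemma pushExp_ofHigh (φ : S → Option T) (m : S × ℕ →₀ ℕ) :
    pushExp φ (ofHigh m) = ofHigh (pushExp φ m) := by
  induction m using Finsupp.induction_linear with
  | zero => simp
  | add f g hf hg => simp only [map_add, hf, hg]
  | single x c =>
    obtain ⟨s, i⟩ := x
    cases h : φ s <;> simp [pushExp_single_of, h, ofHigh_single]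

variable (p : ℕ)

lemma expWt_ofLow_add_ofHigh (a : S × Unit →₀ ℕ) (b : S × ℕ →₀ ℕ) :
    expWt (fun i => p ^ i) (ofLow a + ofHigh b) =
      expWt 1 a + p * expWt (fun i => p ^ i) b := by
  rw [map_add]
  congr 1
  · induction a using Finsupp.induction_linear with
    | zero => simp
    | add f g hf hg => simp only [map_add, hf, hg]
    | single x c => rw [ofLow_single x.1 x.2]; simp
  · induction b using Finsupp.induction_linear with
    | zero => simp
    | add f g hf hg => simp only [map_add, hf, hg, mul_add]
    | single x c => rw [ofHigh_single, expWt_single, expWt_single]; ring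

variable {F : Type} [Field F] {a b k : ℤ}

lemma IsAdm.ofLow_add_ofHigh_iff {m : S × Unit →₀ ℕ} {m' : S × ℕ →₀ ℕ} (hk : k = a + p * b)
    (hp : 0 < p) (ha : (expWt 1 m : ℤ) ≤ a) (hb : (expWt (fun i => p ^ i) m' : ℤ) ≤ b) :
    IsAdm (p : ℕ∞) (fun i => p ^ i) k (ofLow m + ofHigh m') ↔
      IsAdm (p : ℕ∞) 1 a m ∧ IsAdm (p : ℕ∞) (fun i => p ^ i) b m' := by
  have hz (s : S) : (ofLow m + ofHigh m') (s, 0) = m (s, ()) := by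
    have : ofHigh m' (s, 0) = 0 := Finsupp.mapDomain_of_notMem_range _ _ (by simp)
    rw [Finsupp.add_apply, ofLow_apply_zero, this, add_zero]
  have hs (s : S) (i : ℕ) : (ofLow m + ofHigh m') (s, i + 1) = m' (s, i) := by
    have : ofLow m (s, i + 1) = 0 := Finsupp.mapDomain_of_notMem_range _ _ (by simp)
    rw [Finsupp.add_apply, ofHigh_apply_succ, this, zero_add]
  constructor
  · intro h
    have h2 := h.2
    rw [expWt_ofLow_add_ofHigh] at h2
    push_cast at h2
    have hb' : (expWt (fun i => p ^ i) m' : ℤ) = b := by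
      by_contra hne
      have : (p : ℤ) * (expWt (fun i => p ^ i) m' : ℤ) < p * b :=
        mul_lt_mul_of_pos_left (lt_of_le_of_ne hb hne) (by exact_mod_cast hp)
      omega
    rw [hb', hk] at h2
    exact ⟨⟨fun x => (hz x.1) ▸ h.1 (x.1, 0), by omega⟩,
      ⟨fun x => (hs x.1 x.2) ▸ h.1 (x.1, x.2 + 1), hb'⟩⟩
  · rintro ⟨h1, h2⟩
    refine ⟨?_, ?_⟩
    · rintro ⟨s, i⟩
      cases i with
      | zero => rw [hz]; exact h1.1 _
      | succ i => rw [hs]; exact h2.1 _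
    · rw [expWt_ofLow_add_ofHigh]
      push_cast
      rw [h1.2, h2.2, hk]

/-- Splitting off the lowest digit. -/
noncomputable def digitSplit (F : Type) [Field F] (k a b : ℤ) (S : Type) :
    DivSpace p F k S →ₗ[F] MonSpace (p : ℕ∞) (1 : Unit → ℕ) a F S ⊗[F] DivSpace p F b S :=
  monLift fun m => mon F p 1 a (lowDigit m) ⊗ₜ dmon p F b (highDigit m)

/-- Merging the lowest digit with the higher ones. -/
noncomputable def digitMerge (F : Type) [Field F] (k a b : ℤ) (S : Type) :
    MonSpace (p : ℕ∞) (1 : Unit → ℕ) a F S ⊗[F] DivSpace p F b S →ₗ[F] DivSpace p F k S :=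
  TensorProduct.lift (monLift fun m => monLift fun m' => dmon p F k (ofLow m + ofHigh m'))

variable {p}

lemma digitMerge_mon {m : S × Unit →₀ ℕ} {m' : S × ℕ →₀ ℕ} (hk : k = a + p * b)
    (hp : 0 < p) (ha : (expWt 1 m : ℤ) ≤ a) (hb : (expWt (fun i => p ^ i) m' : ℤ) ≤ b) :
    digitMerge p F k a b S (mon F p 1 a m ⊗ₜ dmon p F b m') = dmon p F k (ofLow m + ofHigh m') := by
  have h := IsAdm.ofLow_add_ofHigh_iff p hk hp ha hb
  rw [digitMerge, TensorProduct.lift.tmul]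
  by_cases h1 : IsAdm (p : ℕ∞) 1 a m
  · rw [monLift_mon h1]
    exact monLift_mon' fun h2 => mon_of_not fun h3 => h2 (h.1 h3).2
  · rw [mon_of_not h1, map_zero, LinearMap.zero_apply, dmon, mon_of_not fun h3 => h1 (h.1 h3).1]

lemma expWt_lowDigit_add (m : S × ℕ →₀ ℕ) :
    expWt 1 (lowDigit m) + p * expWt (fun i => p ^ i) (highDigit m) =
      expWt (fun i => p ^ i) m := by
  rw [← expWt_ofLow_add_ofHigh, ofLow_add_ofHigh]

lemma mon_tmul_dmon_of_ne {m : S × Unit →₀ ℕ} {m' : S × ℕ →₀ ℕ}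
    (h : ¬ (IsAdm (p : ℕ∞) 1 a m ∧ IsAdm (p : ℕ∞) (fun i => p ^ i) b m')) :
    mon F p 1 a m ⊗ₜ[F] dmon p F b m' = 0 := by
  by_cases h1 : IsAdm (p : ℕ∞) 1 a m
  · rw [dmon, mon_of_not fun h2 => h ⟨h1, h2⟩, TensorProduct.tmul_zero]
  · rw [mon_of_not h1, TensorProduct.zero_tmul]

lemma digitSplit_dmon (hk : k = a + p * b) (hp : 0 < p) (m : S × ℕ →₀ ℕ) :
    digitSplit p F k a b S (dmon p F k m) =
      mon F p 1 a (lowDigit m) ⊗ₜ dmon p F b (highDigit m) := by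
  refine monLift_mon' fun h => mon_tmul_dmon_of_ne fun h' => h ?_
  rw [← ofLow_add_ofHigh m]
  exact (IsAdm.ofLow_add_ofHigh_iff p hk hp h'.1.2.le h'.2.2.le).2 h'

variable [hp : Fact p.Prime]

lemma digitSplit_monMap (hk : k = a + p * b) (φ : S → Option T) (x : DivSpace p F k S) :
    digitSplit p F k a b T (monMap φ x) =
      TensorProduct.map (monMap φ) (monMap φ) (digitSplit p F k a b S x) := by
  suffices H : (digitSplit p F k a b T).comp (monMap φ : DivSpace p F k S →ₗ[F] DivSpace p F k T) =
      (TensorProduct.map (monMap φ : MonSpace (p : ℕ∞) (1 : Unit → ℕ) a F S →ₗ[F] MonSpace (p : ℕ∞) 1 a F T)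
        (monMap φ : DivSpace p F b S →ₗ[F] DivSpace p F b T)).comp (digitSplit p F k a b S) from
    LinearMap.congr_fun H x
  refine mon_hom_ext (N := MonSpace (p : ℕ∞) (1 : Unit → ℕ) a F T ⊗[F] DivSpace p F b T) fun m hm => ?_
  have h0 := hp.out.pos
  rw [LinearMap.comp_apply, LinearMap.comp_apply]
  refine (congrArg (digitSplit p F k a b T) (dmon_pushExp p φ hm.2)).trans ?_
  refine ((digitSplit_dmon hk h0 _).trans ?_).trans
    (congrArg (TensorProduct.map (monMap φ : MonSpace (p : ℕ∞) (1 : Unit → ℕ) a F S →ₗ[F] MonSpace (p : ℕ∞) 1 a F T)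
      (monMap φ : DivSpace p F b S →ₗ[F] DivSpace p F b T)) (digitSplit_dmon hk h0 m)).symm
  rw [TensorProduct.map_tmul, pushExp_lowDigit, pushExp_highDigit]
  by_cases h1 : (expWt 1 (lowDigit m) : ℤ) = a
  · have h2 : (expWt (fun i => p ^ i) (highDigit m) : ℤ) = b := by
      have h3 := hm.2
      rw [← expWt_lowDigit_add] at h3
      push_cast at h3
      rw [h1, hk] at h3
      exact mul_left_cancel₀ (by exact_mod_cast h0.ne' : (p : ℤ) ≠ 0) (by omega)
    rw [dmon_pushExp p φ h2, monMap_mon (w := 1) (fun _ => one_pos) (by simpa using hp.out.ne_zero) φ h1]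
  · rw [mon_of_wt_ne h1, map_zero, TensorProduct.zero_tmul]
    refine mon_tmul_dmon_of_ne fun h => h1 ?_
    have h2 := expWt_pushExp_le 1 φ (lowDigit m)
    have h3 := expWt_pushExp_le (fun i => p ^ i) φ (highDigit m)
    have h4 := hm.2
    rw [← expWt_lowDigit_add] at h4
    have h5 := h.1.2
    have h6 := h.2.2
    have h7 : (p : ℤ) * (expWt (fun i => p ^ i) (pushExp φ (highDigit m)) : ℤ) ≤
      p * (expWt (fun i => p ^ i) (highDigit m) : ℤ) :=
      mul_le_mul_of_nonneg_left (by exact_mod_cast h3) (by positivity)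
    rw [h6] at h7
    push_cast at h4
    omega

lemma digitMerge_monMap (hk : k = a + p * b) (φ : S → Option T)
    (x : MonSpace (p : ℕ∞) (1 : Unit → ℕ) a F S ⊗[F] DivSpace p F b S) :
    digitMerge p F k a b T (TensorProduct.map (monMap φ) (monMap φ) x) =
      monMap φ (digitMerge p F k a b S x) := by
  suffices H : (digitMerge p F k a b T).comp (TensorProduct.map (monMap φ) (monMap φ)) =
      (monMap φ).comp (digitMerge p F k a b S) from
    LinearMap.congr_fun H x
  have h0 := hp.out.pos
  refine TensorProduct.ext (mon_hom_ext fun m hm => mon_hom_ext fun m' hm' => ?_)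
  change digitMerge p F k a b T (TensorProduct.map (monMap φ) (monMap φ)
    (mon F p 1 a m ⊗ₜ dmon p F b m')) = monMap φ (digitMerge p F k a b S
    (mon F p 1 a m ⊗ₜ dmon p F b m'))
  have h2 := expWt_pushExp_le 1 φ m
  have h3 := expWt_pushExp_le (fun i => p ^ i) φ m'
  have h4 := hm.2
  have h5 := hm'.2
  rw [TensorProduct.map_tmul, dmon_pushExp p φ hm'.2, monMap_mon (w := 1) (fun _ => one_pos)
    (by simpa using hp.out.ne_zero) φ hm.2, digitMerge_mon hk h0 (by omega) (by omega),
    digitMerge_mon hk h0 h4.le h5.le, dmon_pushExp p φ, map_add, pushExp_ofLow, pushExp_ofHigh]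
  rw [expWt_ofLow_add_ofHigh]
  push_cast
  rw [h4, h5, hk]

lemma sum_digitMerge_digitSplit {κ : ℕ} (x : DivSpace p F κ S) :
    ∑ b ∈ Finset.range (κ / p + 1), digitMerge p F κ (κ - p * b) b S
      (digitSplit p F κ (κ - p * b) b S x) = x := by
  suffices H : ∑ b ∈ Finset.range (κ / p + 1), (digitMerge p F κ (κ - p * b) b S).comp
      (digitSplit p F κ (κ - p * b) b S) = LinearMap.id by
    have := LinearMap.congr_fun H x
    rwa [LinearMap.sum_apply] at this
  refine mon_hom_ext fun m hm => ?_
  have h0 := hp.out.pos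
  have hk (b : ℤ) : (κ : ℤ) = κ - p * b + p * b := by ring
  have h1 := hm.2
  rw [← expWt_lowDigit_add] at h1
  have h1' : expWt 1 (lowDigit m) + p * expWt (fun i => p ^ i) (highDigit m) = κ := by
    exact_mod_cast h1
  rw [LinearMap.sum_apply, Finset.sum_eq_single (expWt (fun i => p ^ i) (highDigit m))]
  · refine (congrArg (digitMerge _ _ _ _ _ _) (digitSplit_dmon (hk _) h0 m)).trans ?_
    rw [digitMerge_mon (hk _) h0 (by push_cast at h1; linarith) le_rfl, ofLow_add_ofHigh]
    rfl
  · intro b _ hb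
    refine (congrArg (digitMerge _ _ _ _ _ _) (digitSplit_dmon (hk _) h0 m)).trans ?_
    rw [mon_tmul_dmon_of_ne, map_zero]
    intro h
    exact hb (by exact_mod_cast h.2.2.symm)
  · intro h
    exfalso
    refine h (Finset.mem_range.2 (Nat.lt_succ_of_le ?_))
    rw [Nat.le_div_iff_mul_le h0, mul_comm]
    omega

end Digits

section DividedBound
open Limits

variable {F : Type} [Field F] {t : ENNReal}

lemma TensorBound.biprod {A B : SimplicialObject (ModuleCat.{0} F)} {c c' : ENNReal}
    (hA : TensorBound t A c) (hB : TensorBound t B c') : TensorBound t (A ⊞ B) (c + c') := by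
  refine TensorBound.mid (f := biprod.inl) (g := biprod.snd) ⟨fun X => ?_, fun X => ?_, fun X => ?_⟩
    hA hB
  · refine Function.LeftInverse.injective (g := ((biprod.fst : A ⊞ B ⟶ A).app X).hom) fun x => ?_
    exact congrArg (fun g : A ⟶ A => (g.app X).hom x) biprod.inl_fst
  · intro x
    constructor
    · intro hx
      refine ⟨((biprod.fst : A ⊞ B ⟶ A).app X).hom x, ?_⟩
      have h := congrArg (fun g : A ⊞ B ⟶ A ⊞ B => (g.app X).hom x) (biprod.total (X := A) (Y := B))
      have h2 : ((biprod.fst ≫ biprod.inl : A ⊞ B ⟶ A ⊞ B).app X).hom x +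
        ((biprod.snd ≫ biprod.inr : A ⊞ B ⟶ A ⊞ B).app X).hom x = x := h
      have h3 : ((biprod.snd ≫ biprod.inr : A ⊞ B ⟶ A ⊞ B).app X).hom x = 0 :=
        (congrArg ((biprod.inr : B ⟶ A ⊞ B).app X).hom hx).trans (map_zero _)
      rw [h3, add_zero] at h2
      exact h2
    · rintro ⟨y, rfl⟩
      exact congrArg (fun g : A ⟶ B => (g.app X).hom y) biprod.inl_snd
  · refine Function.RightInverse.surjective (g := ((biprod.inr : B ⟶ A ⊞ B).app X).hom) fun x => ?_
    exact congrArg (fun g : B ⟶ B => (g.app X).hom x) biprod.inr_snd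

/-- A retract of a finite sum is bounded by the sum of the bounds. -/
theorem TensorBound.of_sum {A : SimplicialObject (ModuleCat.{0} F)} (r : ℕ)
    (B : ℕ → SimplicialObject (ModuleCat.{0} F)) (f : ∀ b, A ⟶ B b) (g : ∀ b, B b ⟶ A)
    (h : ∑ b ∈ Finset.range r, f b ≫ g b = 𝟙 A) (c : ℕ → ENNReal)
    (hc : ∀ b < r, TensorBound t (B b) (c b)) : TensorBound t A (∑ b ∈ Finset.range r, c b) := by
  obtain ⟨D, u, v, huv, hD⟩ : ∃ (D : SimplicialObject (ModuleCat.{0} F)) (u : A ⟶ D) (v : D ⟶ A),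
      u ≫ v = ∑ b ∈ Finset.range r, f b ≫ g b ∧
        TensorBound t D (∑ b ∈ Finset.range r, c b) := by
    clear h
    induction r with
    | zero =>
      refine ⟨_root_.constS (ModuleCat.of F (Fin 0 → F)), 0, 0, by simp, ?_⟩
      simpa using TensorBound.const_pi (F := F) t 0
    | succ r ih =>
      obtain ⟨D, u, v, huv, hD⟩ := ih fun b hb => hc b (hb.trans (Nat.lt_succ_self r))
      refine ⟨D ⊞ B r, biprod.lift u (f r), biprod.desc v (g r), ?_, ?_⟩
      · rw [biprod.lift_desc, huv, Finset.sum_range_succ]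
      · rw [Finset.sum_range_succ]
        exact hD.biprod (hc r (Nat.lt_succ_self r))
  exact hD.of_iso (huv.trans h)

variable (p : ℕ) [hp : Fact p.Prime] [NeZero p]

/-- Divided powers are bounded by truncated symmetric powers. -/
theorem TensorBound.div_of_trunc (κ : ℕ) (S : SimplicialObject PFin) (τ γ : ℕ → ENNReal)
    (hτ : ∀ b : ℕ, TensorBound t (truncS F p ((κ : ℤ) - p * b) S) (τ b))
    (hγ : ∀ b ≤ κ / p, TensorBound t (divS F p b S) (γ b)) :
    TensorBound t (divS F p κ S) (∑ b ∈ Finset.range (κ / p + 1), τ b * γ b) := by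
  have hk (b : ℕ) : (κ : ℤ) = κ - p * b + p * b := by ring
  refine TensorBound.of_sum (κ / p + 1)
    (fun b => _root_.tens (truncS F p ((κ : ℤ) - p * b) S) (divS F p b S))
    (fun b =>
      { app := fun X => ModuleCat.ofHom (digitSplit p F κ (κ - p * b) b (S.obj X))
        naturality := fun X Y u => ModuleCat.hom_ext (LinearMap.ext fun x =>
          digitSplit_monMap (hk b) (S.map u) x) })
    (fun b =>
      { app := fun X => ModuleCat.ofHom (digitMerge p F κ (κ - p * b) b (S.obj X))
        naturality := fun X Y u => ModuleCat.hom_ext (LinearMap.ext fun x =>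
          digitMerge_monMap (hk b) (S.map u) x) }) ?_ _ fun b hb =>
      (hτ b).tens (hγ b (Nat.le_of_lt_succ hb))
  refine NatTrans.ext (funext fun X => ?_)
  refine (NatTrans.app_sum _ _ _).trans ?_
  refine ModuleCat.hom_ext ?_
  rw [ModuleCat.hom_sum]
  refine LinearMap.ext fun x => ?_
  rw [LinearMap.sum_apply]
  exact sum_digitMerge_digitSplit (F := F) (S := S.obj X) x

end DividedBound

section LatticeAlgebra

/-- The signed sum of `f` over the integers between `0` and `z`. -/
def zSum {V : Type*} [AddCommGroup V] (f : ℤ → V) (z : ℤ) : V :=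
  ∑ i ∈ Finset.range z.toNat, f i - ∑ i ∈ Finset.range (-z).toNat, f (-(i : ℤ) - 1)

@[simp] lemma zSum_zero {V : Type*} [AddCommGroup V] (f : ℤ → V) : zSum f 0 = 0 := by simp [zSum]

lemma zSum_add_one {V : Type*} [AddCommGroup V] (f : ℤ → V) (z : ℤ) :
    zSum f (z + 1) = zSum f z + f z := by
  rcases lt_or_ge z 0 with h | h
  · obtain ⟨n, rfl⟩ : ∃ n : ℕ, z = -(n : ℤ) - 1 := ⟨(-z - 1).toNat, by omega⟩
    have h1 : (-(n : ℤ) - 1 + 1).toNat = 0 := by omega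
    have h2 : (-(-(n : ℤ) - 1 + 1)).toNat = n := by omega
    have h3 : (-(n : ℤ) - 1).toNat = 0 := by omega
    have h4 : (-(-(n : ℤ) - 1)).toNat = n + 1 := by omega
    rw [zSum, zSum, h1, h2, h3, h4, Finset.sum_range_succ _ n]
    abel
  · lift z to ℕ using h
    have h1 : ((z : ℤ) + 1).toNat = z + 1 := by omega
    have h2 : (-((z : ℤ) + 1)).toNat = 0 := by omega
    have h3 : (-(z : ℤ)).toNat = 0 := by omega
    rw [zSum, zSum, h1, h2, h3, Int.toNat_natCast, Finset.sum_range_succ _ z]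
    simp

lemma map_zSum {V W : Type*} [AddCommGroup V] [AddCommGroup W] {G : Type*} [FunLike G V W]
    [AddMonoidHomClass G V W] (g : G) (f : ℤ → V) (z : ℤ) :
    g (zSum f z) = zSum (fun i => g (f i)) z := by
  simp [zSum, map_sub, map_sum]

lemma zSum_sub {V : Type*} [AddCommGroup V] (f g : ℤ → V) (z : ℤ) :
    zSum (fun i => f i - g i) z = zSum f z - zSum g z := by
  simp only [zSum, Finset.sum_sub_distrib]
  abel

lemma zSum_telescope {V : Type*} [AddCommGroup V] (f : ℤ → V) (z : ℤ) :
    zSum (fun i => f (i + 1) - f i) z = f z - f 0 := by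
  induction z with
  | zero => simp
  | succ n ih => rw [zSum_add_one, ih]; abel
  | pred n ih =>
    have := zSum_add_one (fun i => f (i + 1) - f i) (-(n : ℤ) - 1)
    rw [sub_add_cancel, ih] at this
    rw [eq_sub_of_add_eq this.symm]
    abel

open Classical in
/-- Push-forward of integral functions along a partial map. -/
noncomputable def pushZ {S T : Type} [Fintype S] (φ : S → Option T) : (S → ℤ) →+ (T → ℤ) where
  toFun x t := ∑ s, if φ s = some t then x s else 0
  map_zero' := by ext; simp
  map_add' x y := by
    ext t
    simp only [Pi.add_apply, ← Finset.sum_add_distrib]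
    exact Finset.sum_congr rfl fun s _ => by split_ifs <;> simp

open Classical in
lemma pushZ_apply {S T : Type} [Fintype S] (φ : S → Option T) (x : S → ℤ) (t : T) :
    pushZ φ x t = ∑ s, if φ s = some t then x s else 0 := rfl

lemma pushZ_single {S T : Type} [Fintype S] [DecidableEq S] [DecidableEq T] (φ : S → Option T) (s : S) (z : ℤ) :
    pushZ φ (Pi.single s z) = (φ s).elim 0 fun t => Pi.single t z := by
  ext t
  rw [pushZ_apply, Finset.sum_eq_single s]
  · cases φ s with
    | none => simp
    | some u =>
      by_cases h : u = t
      · subst h; simp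
      · simp [h]
  · intro b _ hb
    simp [Pi.single_eq_of_ne hb]
  · simp

lemma pushZ_id {S : Type} [Fintype S] (x : S → ℤ) : pushZ some x = x := by
  classical
  ext t
  simp [pushZ_apply]

lemma pushZ_comp {S T U : Type} [Fintype S] [Fintype T] (φ : S → Option T) (ψ : T → Option U)
    (x : S → ℤ) : pushZ (fun s => (φ s).bind ψ) x = pushZ ψ (pushZ φ x) := by
  classical
  have : pushZ (fun s => (φ s).bind ψ) = (pushZ ψ).comp (pushZ φ) := by
    refine AddMonoidHom.functions_ext _ _ _ fun s z => ?_
    rw [AddMonoidHom.comp_apply, pushZ_single, pushZ_single]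
    cases φ s with
    | none => simp
    | some u => simp [pushZ_single]
  exact DFunLike.congr_fun this x

lemma pushZ_none {S T : Type} [Fintype S] (x : S → ℤ) :
    pushZ (fun _ => (none : Option T)) x = 0 := by
  ext t
  simp [pushZ_apply]

/-- The simplicial lattice `X ↦ ℤ^(S X)`. -/
noncomputable def latFun : PFin ⥤ Type where
  obj S := S → ℤ
  map φ := ↾(fun x => pushZ φ x)
  map_id S := by ext x; exact congrFun (pushZ_id x) _
  map_comp φ ψ := by ext x; exact congrFun (pushZ_comp φ ψ x) _

variable {F : Type} [Field F]

/-- `single a ↦ single (a + c) - single a`. -/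
noncomputable def zMul (F : Type) [Field F] {C : Type} [DecidableEq C] (c : C) :
    Module.End F ((C → ℤ) →₀ F) :=
  Finsupp.lmapDomain F F (· + Pi.single c 1) - LinearMap.id

/-- `single a ↦ ∑ i between 0 and a c, single (a with value i at c)`. -/
noncomputable def zDiv (F : Type) [Field F] {C : Type} [DecidableEq C] (c : C) :
    Module.End F ((C → ℤ) →₀ F) :=
  Finsupp.lsum F fun a => LinearMap.toSpanSingleton F _
    (zSum (fun i => Finsupp.single (Function.update a c i) (1 : F)) (a c))

/-- `single a ↦ single (a with value 0 at c)`. -/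
noncomputable def zEps (F : Type) [Field F] {C : Type} [DecidableEq C] (c : C) :
    Module.End F ((C → ℤ) →₀ F) :=
  Finsupp.lmapDomain F F (Function.update · c 0)

lemma lat_hom_ext {C : Type} {V : Type*} [AddCommGroup V] [Module F V] {f g : ((C → ℤ) →₀ F) →ₗ[F] V}
    (h : ∀ a, f (Finsupp.single a 1) = g (Finsupp.single a 1)) : f = g :=
  Finsupp.lhom_ext' fun a => LinearMap.ext_ring (h a)

section
variable {C : Type} [DecidableEq C]

@[simp] lemma zMul_single (c : C) (a : C → ℤ) (r : F) :
    zMul F c (Finsupp.single a r) =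
      Finsupp.single (a + Pi.single c 1) r - Finsupp.single a r := by
  simp [zMul]

@[simp] lemma zDiv_single (c : C) (a : C → ℤ) : zDiv F c (Finsupp.single a 1) =
    zSum (fun i => Finsupp.single (Function.update a c i) (1 : F)) (a c) := by
  simp [zDiv]

@[simp] lemma zEps_single (c : C) (a : C → ℤ) (r : F) :
    zEps F c (Finsupp.single a r) = Finsupp.single (Function.update a c 0) r := by
  simp [zEps]

lemma zMul_comm (c d : C) (x : (C → ℤ) →₀ F) : zMul F c (zMul F d x) = zMul F d (zMul F c x) := by
  have : zMul F c * zMul F d = zMul F d * zMul F c := by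
    refine lat_hom_ext fun a => ?_
    simp only [Module.End.mul_apply, zMul_single, map_sub]
    rw [add_right_comm]
    abel
  exact LinearMap.congr_fun this x

lemma zMul_zDiv_of_ne {c d : C} (h : c ≠ d) (x : (C → ℤ) →₀ F) :
    zMul F c (zDiv F d x) = zDiv F d (zMul F c x) := by
  have : zMul F c * zDiv F d = zDiv F d * zMul F c := by
    refine lat_hom_ext fun a => ?_
    simp only [Module.End.mul_apply, zMul_single, map_sub, zDiv_single, map_zSum, zSum_sub]
    rw [Pi.add_apply, Pi.single_eq_of_ne h.symm, add_zero]
    congr 3 with i : 1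
    congr 1
    ext e
    by_cases he : e = d
    · subst he; simp [Pi.single_eq_of_ne h.symm]
    · simp [he]
  exact LinearMap.congr_fun this x

lemma zDiv_zMul (c : C) (x : (C → ℤ) →₀ F) : zDiv F c (zMul F c x) = x := by
  have : zDiv F c * zMul F c = 1 := by
    refine lat_hom_ext fun a => ?_
    simp only [Module.End.mul_apply, zMul_single, map_sub, zDiv_single, Pi.add_apply,
      Pi.single_eq_same, Module.End.one_apply]
    have : ∀ i, Function.update (a + Pi.single c 1) c i = Function.update a c i := fun i => by
      ext e
      by_cases he : e = c
      · subst he; simp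
      · simp [he]
    simp only [this]
    rw [zSum_add_one, add_sub_cancel_left, Function.update_eq_self]
  exact LinearMap.congr_fun this x

lemma zMul_zDiv (c : C) (x : (C → ℤ) →₀ F) : zMul F c (zDiv F c x) = x - zEps F c x := by
  have : zMul F c * zDiv F c = 1 - zEps F c := by
    refine lat_hom_ext fun a => ?_
    simp only [Module.End.mul_apply, zMul_single, zDiv_single, LinearMap.sub_apply,
      Module.End.one_apply, map_zSum, zEps_single]
    have : ∀ i, Function.update a c i + Pi.single c 1 = Function.update a c (i + 1) := fun i => by
      ext e
      by_cases he : e = c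
      · subst he; simp
      · simp [he]
    simp only [this]
    rw [zSum_telescope fun i => Finsupp.single (Function.update a c i) (1 : F),
      Function.update_eq_self]
  exact LinearMap.congr_fun this x

open Classical in
lemma prod_zEps_single {S : Type} (i : S → C) (l : List S) (a : C → ℤ) :
    (l.map fun s => zEps F (i s)).prod (Finsupp.single a 1) =
      Finsupp.single (fun c => if ∃ s ∈ l, i s = c then 0 else a c) 1 := by
  induction l with
  | nil => simp
  | cons s l ih =>
    rw [List.map_cons, List.prod_cons, Module.End.mul_apply, ih, zEps_single]
    congr 1
    ext c
    by_cases hc : c = i s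
    · subst hc; simp
    · simp [hc, Ne.symm hc]

end

lemma IsCofib.pushZ_sec {S C Q : Type} [Fintype C] [Fintype Q] {i : S → C} {r : C → Option Q}
    (h : IsCofib i r) (a : C → ℤ) (c : C) [Decidable (∃ s, i s = c)] :
    pushZ (fun x => some (h.sec x)) (pushZ r a) c = if ∃ s, i s = c then 0 else a c := by
  classical
  rw [pushZ_apply]
  split_ifs with hc
  · obtain ⟨s, rfl⟩ := hc
    refine Finset.sum_eq_zero fun x _ => if_neg fun hx => ?_
    have := h.r_i s
    rw [← Option.some_inj.1 hx, h.r_sec] at this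
    cases this
  · cases hr : r c with
    | none => exact absurd (h.of_none hr) hc
    | some x =>
      rw [Finset.sum_eq_single x, if_pos (congrArg some (h.of_some hr)), pushZ_apply,
        Finset.sum_eq_single c, if_pos hr]
      · exact fun d _ hd => if_neg fun hd' => hd ((h.of_some hd').symm.trans (h.of_some hr))
      · simp
      · refine fun y _ hy => if_neg fun hy' => hy ?_
        have := h.r_sec y
        rw [Option.some_inj.1 hy', hr] at this
        exact (Option.some_inj.1 this).symm
      · simp

/-- Chains on the simplicial lattice. -/
noncomputable def latS (F : Type) [Field F] (S : SimplicialObject PFin) :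
    SimplicialObject (ModuleCat.{0} F) :=
  ((SimplicialObject.whiskering _ _).obj (ModuleCat.free F)).obj
    (((SimplicialObject.whiskering _ _).obj latFun).obj S)

lemma map_zMul {C D : Type} [Fintype C] [DecidableEq C] [DecidableEq D] (φ : C → Option D)
    (c : C) (x : (C → ℤ) →₀ F) :
    Finsupp.lmapDomain F F (pushZ φ) (zMul F c x) =
      (φ c).elim 0 fun d => zMul F d (Finsupp.lmapDomain F F (pushZ φ) x) := by
  have : Finsupp.lmapDomain F F (pushZ φ) ∘ₗ zMul F c =
      (φ c).elim 0 fun d => zMul F d ∘ₗ Finsupp.lmapDomain F F (pushZ φ) := by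
    refine lat_hom_ext fun a => ?_
    rw [LinearMap.comp_apply, zMul_single, map_sub]
    simp only [Finsupp.lmapDomain_apply, Finsupp.mapDomain_single, map_add, pushZ_single]
    cases φ c with
    | none => simp
    | some d => simp
  refine (LinearMap.congr_fun this x).trans ?_
  cases φ c <;> rfl

variable {t : ENNReal}

lemma TensorBound.lat_contr {C : SimplicialObject PFin} (h : PrismHomotopy (𝟙 C) (noneHom C)) :
    TensorBound t (latS F C) 1 := by
  refine (TensorBound.const_field (F := F) t).of_retract
    (f := { app := fun X => ModuleCat.ofHom
              (Finsupp.lsum F fun _ => LinearMap.id : ((C.obj X → ℤ) →₀ F) →ₗ[F] F)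
            naturality := fun X Y u => ?_ })
    (g := { app := fun X => ModuleCat.ofHom
              (Finsupp.lsingle 0 : F →ₗ[F] ((C.obj X → ℤ) →₀ F))
            naturality := fun X Y u => ?_ }) ?_
  · refine ModuleCat.hom_ext (lat_hom_ext (C := C.obj X) fun a => ?_)
    change (Finsupp.lsum F fun _ => LinearMap.id) (Finsupp.lmapDomain F F (pushZ (C.map u))
      (Finsupp.single a 1)) = (Finsupp.lsum F fun _ => LinearMap.id) (Finsupp.single a (1 : F))
    simp
  · refine ModuleCat.hom_ext (LinearMap.ext fun (x : F) => ?_)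
    change Finsupp.single 0 x = Finsupp.lmapDomain F F (pushZ (C.map u)) (Finsupp.single 0 x)
    simp
  · have := (h.whisker latFun).whisker (ModuleCat.free F)
    rw [CategoryTheory.Functor.map_id, CategoryTheory.Functor.map_id] at this
    refine cast (congrArg _ ?_) this
    ext X : 2
    refine lat_hom_ext (C := C.obj X) fun a => ?_
    change Finsupp.lmapDomain F F (pushZ (fun _ => none)) (Finsupp.single a 1) =
      Finsupp.single 0 ((Finsupp.lsum F fun _ => LinearMap.id) (Finsupp.single a (1 : F)))
    simp [pushZ_none]

/-- The chains of the lattice on the quotient are bounded by exterior powers of the base. -/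
theorem TensorBound.lat_succ {S C Q : SimplicialObject PFin} (h : ConeSeq S C Q) (a : ℕ → ENNReal)
    (ha : ∀ j, TensorBound t (extS F j S) (a j)) :
    TensorBound t (latS F Q) (∑' j, t ^ j * a j) := by
  classical
  have key := TensorBound.of_koszul S (fun _ => latS F C) (latS F Q)
    (((SimplicialObject.whiskering _ _).obj (ModuleCat.free F)).map
      (((SimplicialObject.whiskering _ _).obj latFun).map h.ρ))
    (fun _ X s => zMul F (h.i X s)) (fun _ X s => zDiv F (h.i X s)) (fun _ X s => zEps F (h.i X s))
    (fun _ X Y u s x => ?_) (fun _ X s t x => zMul_comm _ _ x)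
    (fun _ X s e hse x => zMul_zDiv_of_ne ((h.cofib X).inj.ne hse) x)
    (fun _ X e x => zDiv_zMul _ x) (fun _ X e x => zMul_zDiv _ x)
    (fun X s x => ?_) (fun X => ?_) (fun X x hx => ?_) a (fun _ => 1) ha
    (fun _ => TensorBound.lat_contr h.contr)
  · simpa using key
  · refine (map_zMul (C.map u) (h.i X s) x).trans ?_
    rw [h.nat]
    cases S.map u s <;> rfl
  · refine (map_zMul (h.ρ.app X) (h.i X s) x).trans ?_
    rw [(h.cofib X).r_i]
    rfl
  · refine Finsupp.mapDomain_surjective fun y => ⟨pushZ (fun x => some ((h.cofib X).sec x)) y, ?_⟩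
    refine (pushZ_comp _ _ _).symm.trans ?_
    simp only [Option.bind_some, (h.cofib X).r_sec]
    exact pushZ_id y
  · have : (Finset.univ.toList.map fun s => zEps F (h.i X s)).prod =
        Finsupp.lmapDomain F F (pushZ fun x => some ((h.cofib X).sec x)) ∘ₗ
          Finsupp.lmapDomain F F (pushZ (h.ρ.app X)) := by
      refine lat_hom_ext fun a => ?_
      rw [prod_zEps_single]
      simp only [LinearMap.comp_apply, Finsupp.lmapDomain_apply, Finsupp.mapDomain_single]
      congr 1
      ext c
      rw [(h.cofib X).pushZ_sec]
      simp
    refine (LinearMap.congr_fun this x).trans ?_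
    exact (congrArg (Finsupp.lmapDomain F F (pushZ fun x => some ((h.cofib X).sec x))) hx).trans
      (map_zero _)

end LatticeAlgebra

section Growth
open ENNReal

/-- The power series with coefficients `c` converges on the open unit disc. -/
def IsSubexp (c : ℕ → ENNReal) : Prop := ∀ v < 1, ∑' k, c k * v ^ k ≠ ∞

lemma IsSubexp.scale {c : ℕ → ENNReal} (h : IsSubexp c) {t : ENNReal} (ht : t ≤ 1) :
    IsSubexp fun k => t ^ k * c k := fun v hv => by
  have := h (t * v) ((mul_le_of_le_one_left' ht).trans_lt hv)
  simpa only [mul_pow, mul_left_comm, mul_assoc] using this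

lemma IsSubexp.of_finite {c : ℕ → ENNReal} (r : ℕ) (hc : ∀ k, c k ≠ ∞)
    (h0 : ∀ k, r ≤ k → c k = 0) : IsSubexp c := fun v hv => by
  rw [tsum_eq_sum (s := Finset.range r)]
  · exact ENNReal.sum_ne_top.2 fun k _ =>
      ENNReal.mul_ne_top (hc k) (ENNReal.pow_ne_top (hv.trans one_lt_top).ne)
  · intro k hk
    rw [h0 k (by simpa using hk), zero_mul]

lemma IsSubexp.of_le_poly {c : ℕ → ENNReal} (q : ℕ) (hc : ∀ k, c k ≤ ((k + 1) ^ q : ℕ)) :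
    IsSubexp c := fun v hv => by
  lift v to NNReal using (hv.trans one_lt_top).ne
  have hv1 : (v : ℝ) < 1 := by exact_mod_cast hv
  have hs : Summable fun k : ℕ => ((k + 1) ^ q : ℕ) * (v : NNReal) ^ k := by
    rcases eq_or_ne v 0 with rfl | hv0
    · refine summable_of_ne_finset_zero (s := {0}) fun k hk => ?_
      simp [show k ≠ 0 by simpa using hk]
    · have h1 : Summable fun k : ℕ => ((k : ℝ) ^ q * (v : ℝ) ^ k) :=
        summable_pow_mul_geometric_of_norm_lt_one q (by simpa using hv1)
      have h2 := (summable_nat_add_iff 1).2 h1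
      rw [← NNReal.summable_coe]
      refine (h2.mul_left ((v : ℝ)⁻¹)).congr fun k => ?_
      have : (v : ℝ) ≠ 0 := by exact_mod_cast hv0
      push_cast
      field_simp
      ring
  refine ne_top_of_le_ne_top (ENNReal.tsum_coe_ne_top_iff_summable.2 hs)
    (ENNReal.tsum_le_tsum fun k => ?_)
  push_cast
  refine mul_le_mul_left ((hc k).trans_eq ?_) _
  push_cast
  rfl

/-- The coefficients of `(∑ a_j (t v^p)^j) (∑ b_k v^k)`. -/
noncomputable def truncBound (t : ENNReal) (p : ℕ) (a b : ℕ → ENNReal) (k : ℤ) : ENNReal :=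
  ∑' j : ℕ, t ^ j * (a j * if p * (j : ℤ) ≤ k then b (k - p * j).toNat else 0)

lemma truncBound_zero {t : ENNReal} {p : ℕ} (hp : 0 < p) {a b : ℕ → ENNReal} (ha : a 0 = 1)
    (hb : b 0 = 1) : truncBound t p a b 0 = 1 := by
  rw [truncBound, tsum_eq_single 0]
  · simp [ha, hb]
  · intro j hj
    rw [if_neg, mul_zero, mul_zero]
    have : 0 < (p : ℤ) * j := by positivity
    omega

lemma isSubexp_truncBound {t : ENNReal} (ht : t ≤ 1) {p : ℕ} (hp : 0 < p) {a b : ℕ → ENNReal}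
    (ha : IsSubexp a) (hb : IsSubexp b) : IsSubexp fun k => truncBound t p a b k := fun v hv => by
  have h1 := ha (t * v ^ p) ((mul_le_of_le_one_left' ht).trans_lt (pow_lt_one₀ bot_le hv hp.ne'))
  refine ne_top_of_le_ne_top (ENNReal.mul_ne_top h1 (hb v hv)) (le_of_eq ?_)
  simp only [truncBound, ← ENNReal.tsum_mul_right]
  rw [ENNReal.tsum_comm]
  refine tsum_congr fun j => ?_
  rw [← ENNReal.tsum_mul_left]
  symm
  refine (Function.Injective.tsum_eq (g := fun k => k + p * j) (add_left_injective _) ?_).symm.trans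
    (tsum_congr fun k => ?_) |>.symm
  · intro k hk
    rw [Function.mem_support] at hk
    have : (p : ℤ) * j ≤ k := by
      by_contra h
      simp [h] at hk
    have h2 : p * j ≤ k := by exact_mod_cast this
    exact ⟨k - p * j, by simp [h2]⟩
  · have h1 : (p : ℤ) * j ≤ (k + p * j : ℕ) := by push_cast; omega
    have h2 : (((k + p * j : ℕ) : ℤ) - p * j).toNat = k := by push_cast; omega
    rw [if_pos h1, h2, pow_add, mul_pow, pow_mul]
    ring

/-- Iterated coefficients of `∏ T(v^(p^i))`. -/
noncomputable def divIter (p : ℕ) (τ : ℤ → ENNReal) : ℕ → ℕ → ENNReal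
  | 0, k => if k = 0 then 1 else 0
  | i + 1, k => ∑ b ∈ Finset.range (k / p + 1), τ (k - p * b) * divIter p τ i b

lemma divIter_mono {p : ℕ} {τ : ℤ → ENNReal} (h0 : τ 0 = 1) (k : ℕ) :
    Monotone fun i => divIter p τ i k := by
  refine monotone_nat_of_le_succ fun i => ?_
  induction i generalizing k with
  | zero =>
    rw [divIter]
    split_ifs with hk
    · subst hk
      simp [divIter, h0]
    · exact bot_le
  | succ i ih => exact Finset.sum_le_sum fun b _ => mul_le_mul_right (ih b) _

lemma tsum_divIter_succ {p : ℕ} (hp : 0 < p) (τ : ℤ → ENNReal) (i : ℕ) (v : ENNReal) :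
    ∑' k, divIter p τ (i + 1) k * v ^ k =
      (∑' k : ℕ, τ k * v ^ k) * ∑' k, divIter p τ i k * (v ^ p) ^ k := by
  have h1 (k : ℕ) : divIter p τ (i + 1) k * v ^ k =
      ∑' b : ℕ, if p * b ≤ k then τ (k - p * b) * divIter p τ i b * v ^ k else 0 := by
    rw [tsum_eq_sum (s := Finset.range (k / p + 1)), divIter, Finset.sum_mul]
    · refine Finset.sum_congr rfl fun b hb => ?_
      rw [if_pos]
      rw [mul_comm]
      exact (Nat.le_div_iff_mul_le hp).1 (Nat.le_of_lt_succ (Finset.mem_range.1 hb))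
    · intro b hb
      refine if_neg fun h => hb (Finset.mem_range.2 (Nat.lt_succ_of_le ?_))
      exact (Nat.le_div_iff_mul_le hp).2 (by rwa [mul_comm])
  simp only [h1]
  rw [ENNReal.tsum_comm, mul_comm, ← ENNReal.tsum_mul_right]
  refine tsum_congr fun j => ?_
  rw [← ENNReal.tsum_mul_left]
  refine (Function.Injective.tsum_eq (g := fun k => k + p * j) (add_left_injective _) ?_).symm.trans
    (tsum_congr fun k => ?_)
  · intro k hk
    rw [Function.mem_support] at hk
    have h2 : p * j ≤ k := by
      by_contra h
      simp [h] at hk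
    exact ⟨k - p * j, by simp [h2]⟩
  · rw [if_pos (by omega), pow_add, pow_mul]
    have : ((k + p * j : ℕ) : ℤ) - p * j = k := by push_cast; ring
    rw [this]
    ring

lemma IsSubexp.divIter {p : ℕ} (hp : 2 ≤ p) {τ : ℤ → ENNReal} (h0 : τ 0 = 1)
    (h : IsSubexp fun k => τ k) : IsSubexp fun k => divIter p τ k k := fun v hv => by
  rcases eq_or_ne v 0 with rfl | hv0
  · rw [tsum_eq_single 0]
    · simp [_root_.divIter]
    · intro k hk
      simp [hk]
  set A := (∑' k : ℕ, τ (k + 1 : ℕ) * v ^ k) with hA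
  have hAtop : A ≠ ∞ := by
    have h1 := h v hv
    rw [tsum_eq_zero_add' ENNReal.summable] at h1
    have h2 : (∑' k : ℕ, τ (k + 1 : ℕ) * v ^ (k + 1)) = v * A := by
      rw [hA, ← ENNReal.tsum_mul_left]
      exact tsum_congr fun k => by ring
    rw [h2] at h1
    intro hA'
    rw [hA', ENNReal.mul_top hv0] at h1
    simp at h1
  have hT (u : ENNReal) (hu : u ≤ v) : ∑' k : ℕ, τ k * u ^ k ≤ 1 + A * u := by
    rw [tsum_eq_zero_add' ENNReal.summable]
    refine add_le_add (by simp [h0]) ?_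
    rw [hA, ← ENNReal.tsum_mul_right]
    refine ENNReal.tsum_le_tsum fun k => ?_
    rw [pow_succ, ← mul_assoc]
    exact mul_le_mul_left (mul_le_mul_right (pow_le_pow_left₀ bot_le hu k) _) _
  clear_value A
  clear hA
  lift A to NNReal using hAtop
  lift v to NNReal using (hv.trans one_lt_top).ne
  have hv1 : (v : ℝ) < 1 := by exact_mod_cast hv
  have key (i : ℕ) : ∀ u : NNReal, u ≤ v → ∑' k, _root_.divIter p τ i k * (u : ENNReal) ^ k ≤
      ENNReal.ofReal (Real.exp (A * u / (1 - v))) := by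
    induction i with
    | zero =>
      intro u _
      rw [tsum_eq_single 0 (fun k hk => by simp [_root_.divIter, hk])]
      simp only [_root_.divIter, if_true, pow_zero, mul_one]
      rw [← ENNReal.ofReal_one]
      refine ENNReal.ofReal_le_ofReal (Real.one_le_exp ?_)
      have : 0 ≤ 1 - (v : ℝ) := by linarith
      positivity
    | succ i ih =>
      intro u hu
      have hu1 : u ≤ 1 := hu.trans (by exact_mod_cast hv1.le)
      have hup : u ^ p ≤ u * v := by
        calc u ^ p ≤ u ^ 2 := pow_le_pow_of_le_one bot_le hu1 hp
          _ = u * u := sq u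
          _ ≤ u * v := mul_le_mul_right hu u
      rw [tsum_divIter_succ (by omega)]
      refine (mul_le_mul' (hT u (by exact_mod_cast hu)) (by
        simpa using ih (u ^ p) (hup.trans (mul_le_of_le_one_left' hu1)))).trans ?_
      have e1 : (1 : ENNReal) + A * u = ENNReal.ofReal (1 + A * u) := by
        rw [ENNReal.ofReal_add zero_le_one (by positivity), ENNReal.ofReal_one,
          ENNReal.ofReal_mul (by positivity)]
        simp
      rw [e1, ← ENNReal.ofReal_mul (by positivity)]
      refine ENNReal.ofReal_le_ofReal ?_
      have hpos : 0 < 1 - (v : ℝ) := by linarith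
      calc (1 + (A : ℝ) * u) * Real.exp (A * (u : ℝ) ^ p / (1 - v))
          ≤ Real.exp (A * u) * Real.exp (A * (u * v) / (1 - v)) := by
            refine mul_le_mul ?_ ?_ (Real.exp_pos _).le (Real.exp_pos _).le
            · rw [add_comm]; exact Real.add_one_le_exp _
            · refine Real.exp_le_exp.2 ?_
              have : (u : ℝ) ^ p ≤ u * v := by exact_mod_cast hup
              gcongr
        _ = Real.exp (A * u / (1 - v)) := by
            rw [← Real.exp_add]
            congr 1
            field_simp
            ring
  refine ne_top_of_le_ne_top (ENNReal.ofReal_ne_top (r := Real.exp (A * v / (1 - v)))) ?_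
  rw [ENNReal.tsum_eq_iSup_nat]
  refine iSup_le fun N => ?_
  refine le_trans ?_ (key N v le_rfl)
  refine le_trans (Finset.sum_le_sum fun k hk => ?_) (ENNReal.sum_le_tsum (Finset.range N))
  exact mul_le_mul_left (divIter_mono h0 k (Finset.mem_range.1 hk).le) _

end Growth

section Iteration
open ENNReal

variable (F : Type) [Field F] (t : ENNReal)

/-- Bounds for exterior and symmetric powers of `S` that converge on the open unit disc. -/
def HasPowBounds (S : SimplicialObject PFin) : Prop :=
  ∃ a b : ℕ → ENNReal, (∀ k, TensorBound t (extS F k S) (a k)) ∧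
    (∀ k : ℕ, TensorBound t (symS F k S) (b k)) ∧ a 0 = 1 ∧ b 0 = 1 ∧ IsSubexp a ∧ IsSubexp b

variable {F t}

lemma TensorBound.trunc_of_bounds (p : ℕ) [NeZero p] {S : SimplicialObject PFin} {a b : ℕ → ENNReal}
    (ha : ∀ k, TensorBound t (extS F k S) (a k)) (hb : ∀ k : ℕ, TensorBound t (symS F k S) (b k))
    (k : ℤ) : TensorBound t (truncS F p k S) (truncBound t p a b k) := by
  refine TensorBound.trunc k S a (fun j => if p * (j : ℤ) ≤ k then b (k - p * j).toNat else 0) ha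
    fun j => ?_
  split_ifs with h
  · have h2 : ((k - p * j).toNat : ℤ) = k - p * j := Int.toNat_of_nonneg (by omega)
    have := hb (k - p * j).toNat
    rwa [h2] at this
  · exact TensorBound.mon_neg _ _ (by omega)

lemma TensorBound.div_of_bounds (p : ℕ) [hp : Fact p.Prime] {S : SimplicialObject PFin}
    {τ : ℤ → ENNReal}
    (hτ : haveI : NeZero p := ⟨hp.out.ne_zero⟩; ∀ k, TensorBound t (truncS F p k S) (τ k)) (i : ℕ)
    {κ : ℕ} (hκ : κ < p ^ i) : TensorBound t (divS F p κ S) (divIter p τ i κ) := by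
  have : NeZero p := ⟨hp.out.ne_zero⟩
  induction i generalizing κ with
  | zero =>
    obtain rfl : κ = 0 := by simpa using hκ
    refine TensorBound.mono (c := 1) ?_ (by simp [divIter])
    exact TensorBound.mon_zero _ _
  | succ i ih =>
    rw [divIter]
    refine TensorBound.div_of_trunc p κ S (fun b => τ (κ - p * b)) (divIter p τ i)
      (fun b => hτ _) fun b hb => ih (hb.trans_lt ?_)
    exact Nat.div_lt_of_lt_mul (by rwa [pow_succ'] at hκ)

theorem HasPowBounds.succ (p : ℕ) [hp : Fact p.Prime] [CharP F p] (ht : t ≤ 1)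
    {S C Q : SimplicialObject PFin} (h : ConeSeq S C Q) (hS : HasPowBounds F t S) :
    HasPowBounds F t Q := by
  have : NeZero p := ⟨hp.out.ne_zero⟩
  obtain ⟨a, b, ha, hb, ha0, hb0, ha', hb'⟩ := hS
  have hτ := TensorBound.trunc_of_bounds p ha hb
  have h0 := truncBound_zero (t := t) hp.out.pos ha0 hb0
  have hg := IsSubexp.divIter hp.out.two_le h0 (isSubexp_truncBound ht hp.out.pos ha' hb')
  refine ⟨fun k => t ^ k * divIter p (truncBound t p a b) k k, fun k => t ^ k * a k, fun k => ?_,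
    fun k => TensorBound.sym_succ h k a ha, by simp [divIter], by simp [ha0], hg.scale ht,
    ha'.scale ht⟩
  cases k with
  | zero =>
    refine TensorBound.mono (c := 1) TensorBound.ext_zero (by simp [divIter])
  | succ k =>
    refine TensorBound.ext_succ p h k _ ?_
    exact_mod_cast TensorBound.div_of_bounds p hτ (k + 1) (Nat.lt_pow_self hp.out.one_lt)

lemma coverSet_zero_subsingleton {q k : ℕ} (f g : coverSet 0 0 q k) (h : f.1.2 = g.1.2) : f = g := by
  refine Subtype.ext (Prod.ext (funext fun i => ?_) h)
  have h1 := f.2.2.1 i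
  have h2 := g.2.2.1 i
  omega

/-- The cover space on one value is discrete. -/
noncomputable def coverZeroTo (q : ℕ) :
    coverSpace 0 0 q ⟶ (SimplicialObject.const PFin).obj (PFin.mk (Fin q)) where
  app X := ⟨fun g => some g.1.2⟩
  naturality X Y φ := by
    refine PFin.hom_ext fun g => ?_
    rw [PFin.comp_apply, PFin.comp_apply]
    have : ((coverSpace 0 0 q).map φ : _ ⟶ _) g = some
        (⟨(g.1.1 ∘ φ.unop.toOrderHom, g.1.2), g.2.1.comp φ.unop.toOrderHom.monotone,
          fun i => g.2.2.1 _, fun v hv => ⟨0, by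
            have := g.2.2.1 (φ.unop.toOrderHom 0)
            simp only [Function.comp_apply]
            omega⟩⟩ : coverSet 0 0 q Y.unop.len) := (coverSpace_map_eq_some φ _ _).2 rfl
    rw [this]
    rfl

/-- The cover space on one value is discrete. -/
noncomputable def coverZeroFrom (q : ℕ) :
    (SimplicialObject.const PFin).obj (PFin.mk (Fin q)) ⟶ coverSpace 0 0 q where
  app X := ⟨fun i => some ⟨(0, i), fun _ _ _ => le_rfl, fun _ => le_rfl, fun v hv =>
    ⟨0, (Nat.le_zero.1 hv).symm⟩⟩⟩
  naturality X Y φ := by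
    refine PFin.hom_ext fun g => ?_
    rw [PFin.comp_apply, PFin.comp_apply]
    exact ((coverSpace_map_eq_some φ _ _).2 rfl).symm

lemma coverZero_comp (q : ℕ) : coverZeroTo q ≫ coverZeroFrom q = 𝟙 _ := by
  refine NatTrans.ext (funext fun X => PFin.hom_ext fun g => ?_)
  exact congrArg some (coverSet_zero_subsingleton (q := q) (k := X.unop.len) _ g rfl)

/-- A functor applied to the discrete cover space is bounded by its dimension. -/
lemma TensorBound.coverZero (q : ℕ) (Φ : PFin ⥤ ModuleCat.{0} F)
    [FiniteDimensional F (Φ.obj (PFin.mk (Fin q)))] :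
    TensorBound t (((SimplicialObject.whiskering _ _).obj Φ).obj (coverSpace 0 0 q))
      (Module.finrank F (Φ.obj (PFin.mk (Fin q)))) := by
  have e : ((SimplicialObject.whiskering _ _).obj Φ).obj
      ((SimplicialObject.const PFin).obj (PFin.mk (Fin q))) ≅
      _root_.constS (Φ.obj (PFin.mk (Fin q))) :=
    NatIso.ofComponents (fun X => Iso.refl _) (fun {X Y} φ => by
      refine (Category.comp_id _).trans (Eq.trans ?_ (Category.id_comp _).symm)
      exact Φ.map_id _)
  refine (TensorBound.const t (Φ.obj (PFin.mk (Fin q)))).of_iso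
    (f := ((SimplicialObject.whiskering _ _).obj Φ).map (coverZeroTo q) ≫ e.hom)
    (g := e.inv ≫ ((SimplicialObject.whiskering _ _).obj Φ).map (coverZeroFrom q)) ?_
  rw [Category.assoc, e.hom_inv_id_assoc, ← Functor.map_comp, coverZero_comp,
    CategoryTheory.Functor.map_id]

lemma isAdm_injective (q k : ℕ) : Function.Injective
    fun (m : {m : Fin q × Unit →₀ ℕ // IsAdm ⊤ (1 : Unit → ℕ) k m}) (i : Fin q) =>
      (⟨m.1 (i, ()), by
        have h1 := le_expWt (1 : Unit → ℕ) m.1 (i, ())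
        have h2 := m.2.2
        simp only [Pi.one_apply, mul_one] at h1
        omega⟩ : Fin (k + 1)) := by
  intro m m' h
  refine Subtype.ext (Finsupp.ext fun x => ?_)
  exact Fin.ext_iff.1 (congrFun h x.1)

theorem hasPowBounds_coverSpace_zero (q : ℕ) : HasPowBounds F t (coverSpace 0 0 q) := by
  have hfin (k : ℕ) : Finite {m : Fin q × Unit →₀ ℕ // IsAdm ⊤ (1 : Unit → ℕ) k m} :=
    Finite.of_injective _ (isAdm_injective q k)
  have hE (k : ℕ) : FiniteDimensional F (ExtPow F k (Fin q)) :=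
    Module.Finite.of_injective (AlternatingMap.toMultilinearMapLM (R := F) (S := F)
      (M := Fin q → F) (N := F) (ι := Fin k)) AlternatingMap.coe_multilinearMap_injective
  refine ⟨fun k => if k = 0 then 1 else Module.finrank F (ExtPow F k (Fin q)),
    fun k => if k = 0 then 1 else ((k + 1) ^ q : ℕ), fun k => ?_, fun k => ?_, if_pos rfl,
    if_pos rfl, ?_, ?_⟩
  · dsimp only
    split_ifs with hk
    · subst hk; exact TensorBound.ext_zero
    · have : FiniteDimensional F ((extFun F k).obj (PFin.mk (Fin q))) := hE k
      exact TensorBound.coverZero q (extFun F k)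
  · dsimp only
    split_ifs with hk
    · subst hk; exact TensorBound.mon_zero _ _
    · have : FiniteDimensional F ((symFun F k).obj (PFin.mk (Fin q))) :=
        inferInstanceAs (Module.Finite F
          ({m : Fin q × Unit →₀ ℕ // IsAdm ⊤ (1 : Unit → ℕ) k m} →₀ F))
      refine (TensorBound.coverZero q (symFun F k)).mono ?_
      refine Nat.cast_le.2 ?_
      have h1 : Module.finrank F ((symFun F k).obj (PFin.mk (Fin q))) =
          Nat.card {m : Fin q × Unit →₀ ℕ // IsAdm ⊤ (1 : Unit → ℕ) k m} := by
        have := Fintype.ofFinite {m : Fin q × Unit →₀ ℕ // IsAdm ⊤ (1 : Unit → ℕ) k m}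
        rw [Nat.card_eq_fintype_card]
        exact Module.finrank_finsupp_self F
      rw [h1]
      refine (Nat.card_le_card_of_injective _ (isAdm_injective q k)).trans_eq ?_
      simp
  · refine IsSubexp.of_finite (q + 1) (fun k => ?_) fun k hk => ?_
    · split_ifs <;> simp
    · have : Subsingleton (ExtPow F k (Fin q)) := subsingleton_of_forall_eq 0 fun f =>
        extPow_eq_zero_of_card_lt (by simpa using hk) f
      rw [if_neg (by omega), Module.finrank_zero_of_subsingleton, Nat.cast_zero]
  · refine IsSubexp.of_le_poly q fun k => ?_
    split_ifs with hk
    · subst hk; simp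
    · exact le_rfl

theorem hasPowBounds_coverSpace (p : ℕ) [Fact p.Prime] [CharP F p] (ht : t ≤ 1) (q n : ℕ) :
    HasPowBounds F t (coverSpace n n q) := by
  induction n with
  | zero => exact hasPowBounds_coverSpace_zero q
  | succ n ih => exact ih.succ p ht (coverConeSeq n q)

lemma truncSeries_constS_le (N : ℕ) :
    truncSeries t N (_root_.constS (ModuleCat.of F F)) ≤ 1 := by
  have h0 (s : ℕ) : hdim (_root_.constS (ModuleCat.of F F)) s = if s = 0 then 1 else 0 := by
    have e : ((alternatingFaceMapComplex (ModuleCat.{0} F)).obj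
        (_root_.constS (ModuleCat.of F F))).homology s ≅
        (ChainComplex.alternatingConst.obj (ModuleCat.of F F)).homology s :=
      (HomologicalComplex.homologyFunctor _ _ s).mapIso
        (alternatingFaceMapComplexConst.app (ModuleCat.of F F))
    rw [hdim, e.toLinearEquiv.rank_eq]
    split_ifs with hs
    · subst hs
      have e' := (ChainComplex.alternatingConstHomologyZero (ModuleCat.of F F)).toLinearEquiv
      rw [e'.rank_eq]
      simp
    · have hz := (ChainComplex.alternatingConst_exactAt (ModuleCat.of F F) s hs).isZero_homology
      have := ModuleCat.subsingleton_of_isZero hz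
      rw [rank_subsingleton']
      simp
  rw [truncSeries]
  cases N with
  | zero => simp
  | succ N =>
    rw [Finset.sum_eq_single 0 (fun s _ hs => by rw [h0, if_neg hs, zero_mul]) (by simp)]
    simp [h0]

lemma TensorBound.truncSeries_le {A : SimplicialObject (ModuleCat.{0} F)} {c : ENNReal}
    (h : TensorBound t A c) (N : ℕ) : truncSeries t N A ≤ c := by
  refine le_trans ?_ (((h (_root_.constS (ModuleCat.of F F)) N).trans
    (mul_le_mul_right (truncSeries_constS_le N) c)).trans_eq (mul_one c))
  refine truncSeries_le_of_retract
    (f := { app := fun X => ModuleCat.ofHom (TensorProduct.rid F (A.obj X)).symm.toLinearMap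
            naturality := fun X Y φ => ?_ })
    (g := { app := fun X => ModuleCat.ofHom (TensorProduct.rid F (A.obj X)).toLinearMap
            naturality := fun X Y φ => ?_ }) (PrismHomotopy.ofEq (Eq.symm ?_)) t N
  · refine ModuleCat.hom_ext (LinearMap.ext fun x => rfl)
  · refine ModuleCat.hom_ext (TensorProduct.ext' fun a b => ?_)
    exact ((A.map φ).hom.map_smul b a).symm
  · ext X : 2
    exact LinearMap.ext fun x => (TensorProduct.rid F _).apply_symm_apply x

/-- The homology of the simplicial lattice grows subexponentially. -/
theorem truncSeries_latS_le (F : Type) [Field F] (p : ℕ) [Fact p.Prime] [CharP F p] (q n : ℕ)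
    {t : ENNReal} (ht : t < 1) : ∃ c : ENNReal, c ≠ ∞ ∧
      ∀ N, truncSeries t N (latS F (coverSpace (n + 1) (n + 1) q)) ≤ c := by
  obtain ⟨a, b, ha, -, -, -, ha', -⟩ := hasPowBounds_coverSpace (F := F) p ht.le q n
  refine ⟨_, ?_, (TensorBound.lat_succ (coverConeSeq n q) a ha).truncSeries_le⟩
  simpa only [mul_comm] using ha' t ht

end Iteration

section CubeHEP
open unitInterval Topology

variable {X : Type*} [TopologicalSpace X] {N : ℕ}

theorem Cube.isClosed_boundary (N : ℕ) : IsClosed (Cube.boundary (Fin N)) := by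
  have : Cube.boundary (Fin N) = ⋃ i, ({y | y i = 0} ∪ {y | y i = 1}) := by
    ext y; simp [Cube.boundary]
  rw [this]
  refine isClosed_iUnion_of_finite fun i => ?_
  exact (isClosed_eq (continuous_apply i) continuous_const).union
    (isClosed_eq (continuous_apply i) continuous_const)

/-- The distance of a point of the cube from the centre, in the sup norm scaled so that
the boundary has distance one. -/
noncomputable def cubeRadius (u : Fin N → I) : ℝ := ‖fun i => 2 * (u i : ℝ) - 1‖

theorem continuous_cubeRadius : Continuous (cubeRadius (N := N)) := by
  unfold cubeRadius; fun_prop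

theorem cubeRadius_le_one (u : Fin N → I) : cubeRadius u ≤ 1 := by
  refine (pi_norm_le_iff_of_nonneg zero_le_one).2 fun i => ?_
  rw [Real.norm_eq_abs, abs_le]
  constructor <;> linarith [(u i).2.1, (u i).2.2]

theorem mem_boundary_of_scaled {u w : Fin N → I} {l : ℝ} (hl : l * cubeRadius u = 1)
    (hl0 : 0 ≤ l) (hw : ∀ i, 2 * (w i : ℝ) - 1 = l * (2 * (u i : ℝ) - 1)) :
    w ∈ Cube.boundary (Fin N) := by
  have hN : Nonempty (Fin N) := by
    by_contra h
    rw [not_nonempty_iff] at h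
    have : cubeRadius u = 0 := by
      rw [cubeRadius, Subsingleton.elim (fun i => 2 * (u i : ℝ) - 1) 0, norm_zero]
    rw [this] at hl; norm_num at hl
  obtain ⟨i, hi⟩ := Finite.exists_max fun i => ‖2 * (u i : ℝ) - 1‖
  have h1 : cubeRadius u = ‖2 * (u i : ℝ) - 1‖ :=
    le_antisymm ((pi_norm_le_iff_of_nonneg (norm_nonneg _)).2 hi)
      (norm_le_pi_norm (fun i => 2 * (u i : ℝ) - 1) i)
  refine ⟨i, ?_⟩
  have h2 : |2 * (w i : ℝ) - 1| = 1 := by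
    rw [hw, abs_mul, abs_of_nonneg hl0, ← Real.norm_eq_abs, ← h1, hl]
  rcases (abs_eq zero_le_one).1 h2 with h | h
  · right; ext; rw [Set.Icc.coe_one]; linarith
  · left; ext; rw [Set.Icc.coe_zero]; linarith

theorem cubeRadius_of_mem_boundary {u : Fin N → I} (hu : u ∈ Cube.boundary (Fin N)) :
    cubeRadius u = 1 := by
  refine le_antisymm (cubeRadius_le_one u) ?_
  obtain ⟨i, hi⟩ := hu
  refine le_trans ?_ (norm_le_pi_norm (fun i => 2 * (u i : ℝ) - 1) i)
  rcases hi with hi | hi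
  · simp [hi]
  · simp only [hi, Set.Icc.coe_one]
    norm_num

/-- The scaling factor of the projection of the prism over the cube from a point above it onto
the bottom and the sides. -/
noncomputable def prismScale (z : (Fin N → I) × I) : ℝ :=
  min (2 / (2 - (z.2 : ℝ))) (1 / max (cubeRadius z.1) (1 / 2))

theorem prismScale_pos (z : (Fin N → I) × I) : 0 < prismScale z := by
  have := z.2.2.2
  refine lt_min (div_pos two_pos (by linarith)) (by positivity)

theorem continuous_prismScale : Continuous (prismScale (N := N)) := by
  unfold prismScale
  refine Continuous.min ?_ ?_
  · refine continuous_const.div (by fun_prop) fun z => ?_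
    have := z.2.2.2
    linarith
  · refine continuous_const.div ((continuous_cubeRadius.comp continuous_fst).max
      continuous_const) fun z => ?_
    positivity

theorem prismScale_mul_radius_le (z : (Fin N → I) × I) : prismScale z * cubeRadius z.1 ≤ 1 := by
  have h : prismScale z ≤ 1 / max (cubeRadius z.1) (1 / 2) := min_le_right _ _
  have h0 : 0 < max (cubeRadius z.1) (1 / 2) := by positivity
  calc prismScale z * cubeRadius z.1 ≤ 1 / max (cubeRadius z.1) (1 / 2) * cubeRadius z.1 := by
        gcongr; exact norm_nonneg _
    _ ≤ 1 / max (cubeRadius z.1) (1 / 2) * max (cubeRadius z.1) (1 / 2) := by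
        gcongr; exact le_max_left _ _
    _ = 1 := by field_simp

theorem prismScale_ge_one (z : (Fin N → I) × I) : 1 ≤ prismScale z := by
  have h1 := z.2.2.2
  have h2 := z.2.2.1
  refine le_min ?_ ?_
  · rw [le_div_iff₀ (by linarith)]; linarith
  · rw [le_div_iff₀ (by positivity), one_mul]
    exact max_le (cubeRadius_le_one _) (by norm_num)

/-- The projection of the prism over the cube onto its bottom and sides. -/
noncomputable def prismRetract (z : (Fin N → I) × I) : (Fin N → I) × I :=
  (fun i => Set.projIcc 0 1 zero_le_one ((1 + prismScale z * (2 * (z.1 i : ℝ) - 1)) / 2),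
    Set.projIcc 0 1 zero_le_one (2 - prismScale z * (2 - (z.2 : ℝ))))

theorem continuous_prismRetract : Continuous (prismRetract (N := N)) := by
  have := continuous_prismScale (N := N)
  refine Continuous.prodMk (continuous_pi fun i => continuous_projIcc.comp ?_)
    (continuous_projIcc.comp ?_)
  · fun_prop
  · fun_prop

theorem prismRetract_fst (z : (Fin N → I) × I) (i : Fin N) :
    2 * ((prismRetract z).1 i : ℝ) - 1 = prismScale z * (2 * (z.1 i : ℝ) - 1) := by
  have h : |prismScale z * (2 * (z.1 i : ℝ) - 1)| ≤ 1 := by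
    rw [abs_mul, abs_of_pos (prismScale_pos z)]
    refine le_trans ?_ (prismScale_mul_radius_le z)
    gcongr
    · exact (prismScale_pos z).le
    · exact norm_le_pi_norm (fun i => 2 * (z.1 i : ℝ) - 1) i
  rw [abs_le] at h
  have : ((prismRetract z).1 i : ℝ) = (1 + prismScale z * (2 * (z.1 i : ℝ) - 1)) / 2 := by
    refine congrArg Subtype.val (Set.projIcc_of_mem zero_le_one (x := _) ⟨?_, ?_⟩) <;> linarith
  rw [this]; ring

theorem prismRetract_snd (z : (Fin N → I) × I) :
    ((prismRetract z).2 : ℝ) = 2 - prismScale z * (2 - (z.2 : ℝ)) := by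
  have h1 := z.2.2.2
  have h2 : prismScale z * (2 - (z.2 : ℝ)) ≤ 2 := by
    have : prismScale z ≤ 2 / (2 - (z.2 : ℝ)) := min_le_left _ _
    rwa [le_div_iff₀ (by linarith)] at this
  have h3 := prismScale_ge_one z
  refine congrArg Subtype.val (Set.projIcc_of_mem zero_le_one (x := _) ⟨?_, ?_⟩)
  · linarith
  · nlinarith

theorem prismRetract_mem (z : (Fin N → I) × I) :
    (prismRetract z).1 ∈ Cube.boundary (Fin N) ∨ (prismRetract z).2 = 0 := by
  have h1 := z.2.2.2
  have h0 := z.2.2.1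
  rcases min_choice (2 / (2 - (z.2 : ℝ))) (1 / max (cubeRadius z.1) (1 / 2)) with h | h
  · right
    ext
    rw [prismRetract_snd, prismScale, h, Set.Icc.coe_zero]
    field_simp [show (2 - (z.2 : ℝ)) ≠ 0 by linarith]
    ring
  · by_cases hr : cubeRadius z.1 ≤ 1 / 2
    · right
      have : prismScale z = 2 := by
        have h' : prismScale z = 1 / max (cubeRadius z.1) (1 / 2) := h
        rw [h', max_eq_right hr]; norm_num
      have h2 : prismScale z ≤ 2 / (2 - (z.2 : ℝ)) := min_le_left _ _
      rw [this, le_div_iff₀ (by linarith)] at h2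
      ext
      rw [prismRetract_snd, this, Set.Icc.coe_zero]; linarith
    · left
      push Not at hr
      refine mem_boundary_of_scaled (u := z.1) (l := prismScale z) ?_ (prismScale_pos z).le
        (prismRetract_fst z)
      have h' : prismScale z = 1 / max (cubeRadius z.1) (1 / 2) := h
      rw [h', max_eq_left hr.le]
      field_simp [show cubeRadius z.1 ≠ 0 by linarith]

theorem prismRetract_eq_self {z : (Fin N → I) × I}
    (hz : z.1 ∈ Cube.boundary (Fin N) ∨ z.2 = 0) : prismRetract z = z := by
  have hs : prismScale z = 1 := by
    refine le_antisymm ?_ (prismScale_ge_one z)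
    rcases hz with hz | hz
    · have := prismScale_mul_radius_le z
      rwa [cubeRadius_of_mem_boundary hz, mul_one] at this
    · refine (min_le_left _ _).trans ?_
      rw [hz]; norm_num
  refine Prod.ext (funext fun i => Subtype.ext ?_) (Subtype.ext ?_)
  · have := prismRetract_fst z i
    rw [hs] at this; linarith
  · rw [prismRetract_snd, hs]; ring

/-- The homotopy extension property of the cube and its boundary. -/
theorem cube_hep (f : C(Fin N → I, X)) (H : (Fin N → I) × I → X)
    (hH : ContinuousOn H {z | z.1 ∈ Cube.boundary (Fin N)})
    (h0 : ∀ u ∈ Cube.boundary (Fin N), H (u, 0) = f u) :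
    ∃ F : C((Fin N → I) × I, X), (∀ u, F (u, 0) = f u) ∧
      ∀ u ∈ Cube.boundary (Fin N), ∀ s, F (u, s) = H (u, s) := by
  classical
  let G : (Fin N → I) × I → X := fun z =>
    if z.1 ∈ Cube.boundary (Fin N) then H z else f z.1
  have hG : ContinuousOn G ({z | z.1 ∈ Cube.boundary (Fin N)} ∪ {z | z.2 = 0}) := by
    refine ContinuousOn.union_of_isClosed ?_ ?_
      ((Cube.isClosed_boundary N).preimage continuous_fst)
      (isClosed_eq continuous_snd continuous_const)
    · exact hH.congr fun z hz => if_pos hz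
    · refine (f.continuous.comp continuous_fst).continuousOn.congr fun z hz => ?_
      by_cases h : z.1 ∈ Cube.boundary (Fin N)
      · have hz' : z = (z.1, 0) := Prod.ext rfl hz
        refine (if_pos h).trans ?_
        rw [hz']; exact h0 _ h
      · exact if_neg h
  refine ⟨⟨G ∘ prismRetract, hG.comp_continuous continuous_prismRetract prismRetract_mem⟩,
    fun u => ?_, fun u hu s => ?_⟩
  · change G (prismRetract (u, 0)) = _
    rw [prismRetract_eq_self (Or.inr rfl)]
    by_cases h : u ∈ Cube.boundary (Fin N)
    · exact (if_pos h).trans (h0 u h)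
    · exact if_neg h
  · change G (prismRetract (u, s)) = _
    rw [prismRetract_eq_self (Or.inl hu)]
    exact if_pos hu

end CubeHEP

section PrismFill
open unitInterval Topology

variable {X : Type*} [TopologicalSpace X] {N : ℕ}

/-- The boundary of the prism over the cube. -/
def prismBoundary (N : ℕ) : Set ((Fin N → I) × I) :=
  {z | z.1 ∈ Cube.boundary (Fin N) ∨ z.2 = 0 ∨ z.2 = 1}

theorem mem_boundary_succ_iff (v : Fin (N + 1) → I) :
    v ∈ Cube.boundary (Fin (N + 1)) ↔ (Fin.init v, v (Fin.last N)) ∈ prismBoundary N := by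
  constructor
  · rintro ⟨i, hi⟩
    induction i using Fin.lastCases with
    | last => exact Or.inr hi
    | cast i => exact Or.inl ⟨i, hi⟩
  · rintro (⟨i, hi⟩ | hi)
    · exact ⟨i.castSucc, hi⟩
    · exact ⟨Fin.last N, hi⟩

/-- The homotopy extension property of the prism over the cube and its boundary. -/
theorem prism_hep (f : C((Fin N → I) × I, X)) (H : ((Fin N → I) × I) × I → X)
    (hH : ContinuousOn H {z | z.1 ∈ prismBoundary N})
    (h0 : ∀ u ∈ prismBoundary N, H (u, 0) = f u) :
    ∃ F : C(((Fin N → I) × I) × I, X), (∀ u, F (u, 0) = f u) ∧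
      ∀ u ∈ prismBoundary N, ∀ s, F (u, s) = H (u, s) := by
  let ψ : (Fin (N + 1) → I) → (Fin N → I) × I := fun v => (Fin.init v, v (Fin.last N))
  have hψ : Continuous ψ :=
    Continuous.prodMk (continuous_pi fun i => continuous_apply _) (continuous_apply _)
  let φ : (Fin N → I) × I → Fin (N + 1) → I := fun z => Fin.snoc (α := fun _ => I) z.1 z.2
  have hφ : Continuous φ := Continuous.finSnoc continuous_fst continuous_snd
  have hψφ : ∀ z, ψ (φ z) = z := fun z => by
    refine Prod.ext ?_ ?_
    · exact Fin.init_snoc (α := fun _ => I) _ _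
    · exact Fin.snoc_last (α := fun _ => I) _ _
  obtain ⟨F, hF0, hF⟩ := cube_hep (f.comp ⟨ψ, hψ⟩) (fun z => H (ψ z.1, z.2))
    (hH.comp (by fun_prop) fun z hz => (mem_boundary_succ_iff z.1).1 hz)
    (fun u hu => h0 _ ((mem_boundary_succ_iff u).1 hu))
  refine ⟨F.comp ⟨fun z => (φ z.1, z.2), by fun_prop⟩, fun u => ?_, fun u hu s => ?_⟩
  · refine (hF0 _).trans ?_
    exact congrArg f (hψφ u)
  · refine (hF _ ((mem_boundary_succ_iff _).2 ?_) s).trans ?_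
    · exact (congrArg (· ∈ prismBoundary N) (hψφ u)).mpr hu
    · exact congrArg (fun z => H (z, s)) (hψφ u)

/-- The top of a prism can be replaced by a homotopic one. -/
theorem exists_prism_adjust (F : C((Fin N → I) × I, X)) {y z : C(Fin N → I, X)}
    (hz : ∀ u, F (u, 1) = z u) (h : z.HomotopicRel y (Cube.boundary (Fin N))) :
    ∃ G : C((Fin N → I) × I, X), (∀ u, G (u, 0) = F (u, 0)) ∧ (∀ u, G (u, 1) = y u) ∧
      ∀ u ∈ Cube.boundary (Fin N), ∀ s, G (u, s) = F (u, s) := by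
  classical
  obtain ⟨k⟩ := h
  let H : ((Fin N → I) × I) × I → X := fun w => if w.1.2 = 1 then k (w.2, w.1.1) else F w.1
  have hk : ∀ u ∈ Cube.boundary (Fin N), ∀ s, k (s, u) = F (u, 1) := fun u hu s =>
    (k.eq_fst s hu).trans (hz u).symm
  have hH : ContinuousOn H {w | w.1 ∈ prismBoundary N} := by
    have : {w : ((Fin N → I) × I) × I | w.1 ∈ prismBoundary N} =
        {w | w.1.1 ∈ Cube.boundary (Fin N) ∨ w.1.2 = 0} ∪ {w | w.1.2 = 1} := by
      ext w; simp [prismBoundary, or_assoc]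
    rw [this]
    refine ContinuousOn.union_of_isClosed ?_ ?_ ?_ (isClosed_eq (by fun_prop) continuous_const)
    · refine (F.continuous.comp continuous_fst).continuousOn.congr fun w hw => ?_
      by_cases h1 : w.1.2 = 1
      · refine (if_pos h1).trans ?_
        rcases hw with hw | hw
        · rw [hk _ hw]
          exact congrArg F (Prod.ext rfl h1.symm)
        · rw [h1] at hw; exact absurd hw one_ne_zero
      · exact if_neg h1
    · refine (k.continuous.comp (f := fun w : ((Fin N → I) × I) × I => (w.2, w.1.1))
        (by fun_prop)).continuousOn.congr fun w hw => if_pos hw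
    · exact ((Cube.isClosed_boundary N).preimage (by fun_prop)).union
        (isClosed_eq (by fun_prop) continuous_const)
  obtain ⟨G, hG0, hG⟩ := prism_hep F H hH fun u hu => by
    by_cases h1 : u.2 = 1
    · refine (if_pos h1).trans ((k.apply_zero _).trans ?_)
      rw [← hz]
      exact congrArg F (Prod.ext rfl h1.symm)
    · exact if_neg h1
  refine ⟨G.comp ⟨fun w => (w, 1), by fun_prop⟩, fun u => ?_, fun u => ?_, fun u hu s => ?_⟩
  · exact (hG (u, 0) (Or.inr (Or.inl rfl)) 1).trans (if_neg zero_ne_one)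
  · refine (hG (u, 1) (Or.inr (Or.inr rfl)) 1).trans ((if_pos rfl).trans (k.apply_one u))
  · refine (hG (u, s) (Or.inl hu) 1).trans ?_
    by_cases h1 : s = 1
    · refine (if_pos h1).trans ?_
      subst h1; exact hk u hu 1
    · exact if_neg h1

/-- All homotopy classes of loops of dimension `N` in `X` are trivial. -/
def TrivialHomotopy (N : ℕ) (X : Type*) [TopologicalSpace X] : Prop :=
  ∀ (v : X) (f : GenLoop (Fin N) X v),
    f.1.HomotopicRel (ContinuousMap.const _ v) (Cube.boundary (Fin N))

/-- If the homotopy groups vanish, maps on the cube agreeing on the boundary are homotopic. -/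
theorem TrivialHomotopy.homotopicRel (hX : TrivialHomotopy N X) {y z : C(Fin N → I, X)}
    (h : ∀ u ∈ Cube.boundary (Fin N), z u = y u) :
    z.HomotopicRel y (Cube.boundary (Fin N)) := by
  classical
  let A : C((Fin N → I) × I, X) := ⟨fun w => z fun i => w.1 i * σ w.2, by fun_prop⟩
  have hA0 : ∀ u, A (u, 0) = z u := fun u => congrArg z (by ext i; simp)
  have hA1 : ∀ u, A (u, 1) = z fun _ => 0 := fun u => congrArg z (by ext i; simp)
  obtain ⟨B, hB0, hB⟩ := cube_hep y A A.continuous.continuousOn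
    (fun u hu => (hA0 u).trans (h u hu))
  let B1 : C(Fin N → I, X) := B.comp ⟨fun u => (u, 1), by fun_prop⟩
  obtain ⟨Y, hY0, hY1, hY⟩ := exists_prism_adjust B (z := B1) (fun _ => rfl)
    (hX (z fun _ => 0) ⟨B1, fun u hu => (hB u hu 1).trans (hA1 u)⟩)
  have hYA : ∀ u ∈ Cube.boundary (Fin N), ∀ s, Y (u, s) = A (u, s) := fun u hu s =>
    (hY u hu s).trans (hB u hu s)
  let hzA : ContinuousMap.Homotopy z (ContinuousMap.const _ (z fun _ => 0)) :=
    ⟨⟨fun w => A (w.2, w.1), by fun_prop⟩, hA0, hA1⟩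
  let hyY : ContinuousMap.Homotopy y (ContinuousMap.const _ (z fun _ => 0)) :=
    ⟨⟨fun w => Y (w.2, w.1), by fun_prop⟩, fun u => (hY0 u).trans (hB0 u), hY1⟩
  let K := hzA.trans hyY.symm
  let τ : I → I := fun s => Set.projIcc 0 1 zero_le_one (1 - |2 * (s : ℝ) - 1|)
  have hτ : Continuous τ := continuous_projIcc.comp (by fun_prop)
  have hτ0 : τ 0 = 0 := by simp [τ]
  have hτ1 : τ 1 = 0 := by
    have : (1 : ℝ) - |2 * ((1 : I) : ℝ) - 1| = 0 := by norm_num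
    change Set.projIcc 0 1 zero_le_one (1 - |2 * ((1 : I) : ℝ) - 1|) = 0
    rw [this]; simp
  have hK : ∀ u ∈ Cube.boundary (Fin N), ∀ s, K (s, u) = A (u, τ s) := fun u hu s => by
    change (hzA.trans hyY.symm) (s, u) = _
    rw [ContinuousMap.Homotopy.trans_apply]
    split_ifs with hs
    · change A (u, _) = _
      refine congrArg (fun r => A (u, r)) (Subtype.ext ?_)
      have h1 : (1 : ℝ) - |2 * (s : ℝ) - 1| = 2 * s := by
        rw [abs_of_nonpos (by linarith)]; ring
      refine Eq.trans ?_ (congrArg Subtype.val (Set.projIcc_of_mem zero_le_one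
        (show (1 : ℝ) - |2 * (s : ℝ) - 1| ∈ Set.Icc (0 : ℝ) 1 from ?_))).symm
      · exact h1.symm
      · rw [h1]; exact ⟨by linarith [s.2.1], by linarith⟩
    · push Not at hs
      rw [ContinuousMap.Homotopy.symm_apply]
      refine (hYA u hu _).trans ?_
      refine congrArg (fun r => A (u, r)) (Subtype.ext ?_)
      have h1 : (1 : ℝ) - |2 * (s : ℝ) - 1| = 2 - 2 * s := by
        rw [abs_of_nonneg (by linarith)]; ring
      refine Eq.trans ?_ (congrArg Subtype.val (Set.projIcc_of_mem zero_le_one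
        (show (1 : ℝ) - |2 * (s : ℝ) - 1| ∈ Set.Icc (0 : ℝ) 1 from ?_))).symm
      · change 1 - (2 * (s : ℝ) - 1) = _
        exact (by rw [h1]; ring : 1 - (2 * (s : ℝ) - 1) = 1 - |2 * (s : ℝ) - 1|)
      · rw [h1]; exact ⟨by linarith [s.2.2], by linarith⟩
  let Kp : C((Fin N → I) × I, X) := ⟨fun w => K (w.2, w.1), by fun_prop⟩
  let H : ((Fin N → I) × I) × I → X := fun w =>
    if w.1.2 = 0 then z w.1.1 else if w.1.2 = 1 then y w.1.1 else A (w.1.1, τ w.1.2 * σ w.2)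
  have hHb : ∀ w, w.1.1 ∈ Cube.boundary (Fin N) → H w = A (w.1.1, τ w.1.2 * σ w.2) := by
    intro w hw
    dsimp only [H]
    split_ifs with h1 h2
    · rw [h1, hτ0, zero_mul, hA0]
    · rw [h2, hτ1, zero_mul, hA0, h _ hw]
    · rfl
  have hH0 : ∀ w, w.1.2 = 0 → H w = z w.1.1 := fun w hw => if_pos hw
  have hH1 : ∀ w, w.1.2 = 1 → H w = y w.1.1 := fun w hw => by
    dsimp only [H]
    rw [if_neg (by rw [hw]; exact one_ne_zero), if_pos hw]
  have hH : ContinuousOn H {w | w.1 ∈ prismBoundary N} := by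
    refine ContinuousOn.union_of_isClosed (s := {w : ((Fin N → I) × I) × I | w.1.1 ∈ Cube.boundary (Fin N)})
      (t := {w : ((Fin N → I) × I) × I | w.1.2 = 0 ∨ w.1.2 = 1}) ?_ ?_
      ((Cube.isClosed_boundary N).preimage (by fun_prop))
      ((isClosed_eq (by fun_prop) continuous_const).union
        (isClosed_eq (by fun_prop) continuous_const))
    · refine (A.continuous.comp (f := fun w : ((Fin N → I) × I) × I =>
        (w.1.1, τ w.1.2 * σ w.2)) (by fun_prop)).continuousOn.congr fun w hw => hHb w hw
    · refine ContinuousOn.union_of_isClosed (s := {w : ((Fin N → I) × I) × I | w.1.2 = 0})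
        (t := {w : ((Fin N → I) × I) × I | w.1.2 = 1}) ?_ ?_ (isClosed_eq (by fun_prop) continuous_const)
        (isClosed_eq (by fun_prop) continuous_const)
      · exact (z.continuous.comp (f := fun w : ((Fin N → I) × I) × I => w.1.1)
          (by fun_prop)).continuousOn.congr hH0
      · exact (y.continuous.comp (f := fun w : ((Fin N → I) × I) × I => w.1.1)
          (by fun_prop)).continuousOn.congr hH1
  obtain ⟨G, -, hG⟩ := prism_hep Kp H hH fun u hu => by
    rcases hu with hu | hu | hu
    · rw [hHb _ hu]
      refine Eq.trans ?_ (hK _ hu _).symm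
      simp
    · rw [hH0 _ hu]
      change _ = K (u.2, u.1)
      rw [hu]; exact (K.apply_zero _).symm
    · rw [hH1 _ hu]
      change _ = K (u.2, u.1)
      rw [hu]; exact (K.apply_one _).symm
  refine ⟨⟨⟨⟨fun w => G ((w.2, w.1), 1), by fun_prop⟩, fun u => ?_, fun u => ?_⟩,
    fun s u hu => ?_⟩⟩
  · exact (hG (u, 0) (Or.inr (Or.inl rfl)) 1).trans (hH0 _ rfl)
  · exact (hG (u, 1) (Or.inr (Or.inr rfl)) 1).trans (hH1 _ rfl)
  · refine (hG (u, s) (Or.inl hu) 1).trans ((hHb _ hu).trans ?_)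
    simp [hA0]

/-- If the homotopy groups vanish, maps on the boundary of the prism extend. -/
theorem TrivialHomotopy.exists_prism_extension (hX : TrivialHomotopy N X) {y z : C(Fin N → I, X)}
    (h : (Fin N → I) × I → X) (hh : ContinuousOn h {w | w.1 ∈ Cube.boundary (Fin N)})
    (h0 : ∀ u ∈ Cube.boundary (Fin N), h (u, 0) = z u)
    (h1 : ∀ u ∈ Cube.boundary (Fin N), h (u, 1) = y u) :
    ∃ F : C((Fin N → I) × I, X), (∀ u, F (u, 0) = z u) ∧ (∀ u, F (u, 1) = y u) ∧
      ∀ u ∈ Cube.boundary (Fin N), ∀ s, F (u, s) = h (u, s) := by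
  obtain ⟨F, hF0, hF⟩ := cube_hep z h hh h0
  obtain ⟨G, hG0, hG1, hG⟩ := exists_prism_adjust F
    (z := F.comp ⟨fun u => (u, 1), by fun_prop⟩) (fun _ => rfl)
    (hX.homotopicRel (y := y) fun u hu => (hF u hu 1).trans (h1 u hu))
  exact ⟨G, fun u => (hG0 u).trans (hF0 u), hG1, fun u hu s => (hG u hu s).trans (hF u hu s)⟩

/-- If the homotopy groups vanish, maps on the boundary of the cube extend. -/
theorem TrivialHomotopy.exists_cube_extension (hX : TrivialHomotopy N X)
    (b : (Fin (N + 1) → I) → X) (hb : ContinuousOn b (Cube.boundary (Fin (N + 1)))) :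
    ∃ F : C(Fin (N + 1) → I, X), ∀ u ∈ Cube.boundary (Fin (N + 1)), F u = b u := by
  let φ : (Fin N → I) × I → Fin (N + 1) → I := fun z => Fin.snoc (α := fun _ => I) z.1 z.2
  have hφ : Continuous φ := Continuous.finSnoc continuous_fst continuous_snd
  have hφi : ∀ v : Fin (N + 1) → I, φ (Fin.init v, v (Fin.last N)) = v := fun v =>
    Fin.snoc_init_self (α := fun _ => I) v
  have hmem : ∀ w, w ∈ prismBoundary N → φ w ∈ Cube.boundary (Fin (N + 1)) := fun w hw => by
    rw [mem_boundary_succ_iff]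
    simpa [φ] using hw
  obtain ⟨F, hF0, hF1, hF⟩ := hX.exists_prism_extension
    (z := ⟨fun u => b (φ (u, 0)), hb.comp_continuous (by fun_prop)
      fun u => hmem _ (Or.inr (Or.inl rfl))⟩)
    (y := ⟨fun u => b (φ (u, 1)), hb.comp_continuous (by fun_prop)
      fun u => hmem _ (Or.inr (Or.inr rfl))⟩) (fun w => b (φ w))
    (hb.comp hφ.continuousOn fun w hw => hmem w (Or.inl hw)) (fun _ _ => rfl) (fun _ _ => rfl)
  refine ⟨⟨fun v => F (Fin.init v, v (Fin.last N)), F.continuous.comp (Continuous.prodMk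
    (continuous_pi fun i => continuous_apply _) (continuous_apply _))⟩, fun v hv => ?_⟩
  change F (Fin.init v, v (Fin.last N)) = b v
  rcases (mem_boundary_succ_iff v).1 hv with h | h | h
  · exact (hF _ h _).trans (congrArg b (hφi v))
  · refine (congrArg (fun r => F (Fin.init v, r)) h).trans ((hF0 _).trans ?_)
    exact congrArg b ((congrArg (fun r => φ (Fin.init v, r)) h.symm).trans (hφi v))
  · refine (congrArg (fun r => F (Fin.init v, r)) h).trans ((hF1 _).trans ?_)
    exact congrArg b ((congrArg (fun r => φ (Fin.init v, r)) h.symm).trans (hφi v))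

end PrismFill

section StickBreaking
open unitInterval Topology

variable {X Y : Type*} [TopologicalSpace X] [TopologicalSpace Y] {N : ℕ}

/-- The coordinates of a point of the cube, extended by zero. -/
noncomputable def stickExt (u : Fin N → I) (i : ℕ) : ℝ := if h : i < N then (u ⟨i, h⟩ : ℝ) else 0

/-- The product of the first `j` coordinates of a point of the cube. -/
noncomputable def stickProd (u : Fin N → I) (j : ℕ) : ℝ := ∏ i ∈ Finset.range j, stickExt u i

theorem stickExt_mem (u : Fin N → I) (i : ℕ) : stickExt u i ∈ Set.Icc (0 : ℝ) 1 := by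
  unfold stickExt; split_ifs
  · exact (u _).2
  · simp

theorem continuous_stickExt (i : ℕ) : Continuous fun u : Fin N → I => stickExt u i := by
  unfold stickExt; split_ifs <;> fun_prop

theorem stickProd_nonneg (u : Fin N → I) (j : ℕ) : 0 ≤ stickProd u j :=
  Finset.prod_nonneg fun i _ => (stickExt_mem u i).1

theorem stickProd_succ (u : Fin N → I) (j : ℕ) :
    stickProd u (j + 1) = stickProd u j * stickExt u j := Finset.prod_range_succ _ _

theorem stickProd_zero (u : Fin N → I) : stickProd u 0 = 1 := Finset.prod_range_zero _

theorem stickProd_of_lt (u : Fin N → I) {j : ℕ} (h : N < j) : stickProd u j = 0 :=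
  Finset.prod_eq_zero (Finset.mem_range.2 h) (by simp [stickExt])

/-- The stick-breaking map from the cube to the simplex, which collapses faces of the cube. -/
noncomputable def stickMap (u : Fin N → I) : stdSimplex ℝ (Fin (N + 1)) :=
  ⟨fun j => stickProd u j - stickProd u (j + 1), fun j => by
    change 0 ≤ stickProd u j - stickProd u (j + 1)
    rw [stickProd_succ]
    nlinarith [stickProd_nonneg u j, (stickExt_mem u j).2], by
    rw [Fin.sum_univ_eq_sum_range (fun j => stickProd u j - stickProd u (j + 1)),
      Finset.sum_range_sub', stickProd_zero, stickProd_of_lt u (Nat.lt_succ_self N), sub_zero]⟩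

theorem stickMap_apply (u : Fin N → I) (j : Fin (N + 1)) :
    stickMap u j = stickProd u j - stickProd u (j + 1) := rfl

theorem continuous_stickMap : Continuous (stickMap (N := N)) := by
  refine Continuous.subtype_mk (continuous_pi fun j => ?_) _
  unfold stickProd
  have := continuous_stickExt (N := N)
  fun_prop

theorem stickProd_eq_one_sub (u : Fin N → I) {j : ℕ} (hj : j ≤ N + 1) :
    stickProd u j = 1 - ∑ i ∈ Finset.range j, if h : i < N + 1 then stickMap u ⟨i, h⟩ else 0 := by
  have : ∑ i ∈ Finset.range j, (if h : i < N + 1 then stickMap u ⟨i, h⟩ else 0) =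
      ∑ i ∈ Finset.range j, (stickProd u i - stickProd u (i + 1)) := by
    refine Finset.sum_congr rfl fun i hi => ?_
    rw [dif_pos ((Finset.mem_range.1 hi).trans_le hj)]; rfl
  rw [this, Finset.sum_range_sub', stickProd_zero]; ring

theorem stickMap_eq_iff {u v : Fin N → I} :
    stickMap u = stickMap v ↔ ∀ j, stickProd u j = stickProd v j := by
  constructor
  · intro h j
    by_cases hj : j ≤ N + 1
    · rw [stickProd_eq_one_sub u hj, stickProd_eq_one_sub v hj, h]
    · rw [stickProd_of_lt u (by omega), stickProd_of_lt v (by omega)]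
  · intro h
    refine stdSimplex.ext (funext fun j => ?_)
    rw [stickMap_apply, stickMap_apply, h, h]

theorem stickProd_ne_zero {u : Fin N → I} (hu : u ∉ Cube.boundary (Fin N)) {j : ℕ} (hj : j ≤ N) :
    stickProd u j ≠ 0 := by
  refine Finset.prod_ne_zero_iff.2 fun i hi => ?_
  have hi' : i < N := (Finset.mem_range.1 hi).trans_le hj
  rw [stickExt, dif_pos hi']
  intro h
  exact hu ⟨⟨i, hi'⟩, Or.inl (Subtype.ext h)⟩

theorem stickMap_injective_of_notMem {u v : Fin N → I} (hu : u ∉ Cube.boundary (Fin N))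
    (h : stickMap u = stickMap v) : u = v := by
  rw [stickMap_eq_iff] at h
  funext i
  have h1 := h (i + 1)
  rw [stickProd_succ, stickProd_succ, ← h i] at h1
  have h2 := mul_left_cancel₀ (stickProd_ne_zero hu i.2.le) h1
  exact Subtype.ext (by simpa [stickExt] using h2)

/-- The boundary of the topological simplex. -/
def simplexBoundary (N : ℕ) : Set (stdSimplex ℝ (Fin (N + 1))) := {t | ∃ i, t i = 0}

theorem stickMap_mem_boundary_iff (u : Fin N → I) :
    stickMap u ∈ simplexBoundary N ↔ u ∈ Cube.boundary (Fin N) := by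
  constructor
  · rintro ⟨i, hi⟩
    by_contra hu
    rw [stickMap_apply, stickProd_succ] at hi
    have h0 := stickProd_ne_zero hu (Nat.lt_succ_iff.1 i.2)
    have h1 : stickExt u i = 1 := by
      have : stickProd u i * (1 - stickExt u i) = 0 := by rw [← hi]; ring
      rcases mul_eq_zero.1 this with h | h
      · exact absurd h h0
      · linarith
    unfold stickExt at h1
    split_ifs at h1 with h
    · exact hu ⟨⟨i, h⟩, Or.inr (Subtype.ext h1)⟩
    · exact zero_ne_one h1
  · rintro ⟨i, hi | hi⟩
    · refine ⟨Fin.last N, ?_⟩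
      rw [stickMap_apply, stickProd_succ]
      have : stickProd u N = 0 := Finset.prod_eq_zero (Finset.mem_range.2 i.2) (by
        simp [stickExt, hi])
      simp [this]
    · refine ⟨i.castSucc, ?_⟩
      rw [stickMap_apply, stickProd_succ]
      simp [stickExt, hi]

theorem stickMap_surjective : Function.Surjective (stickMap (N := N)) := by
  intro t
  let te : ℕ → ℝ := fun i => if h : i < N + 1 then t ⟨i, h⟩ else 0
  have hte0 : ∀ i, 0 ≤ te i := fun i => by
    dsimp only [te]; split_ifs
    · exact t.2.1 _
    · exact le_rfl
  let P : ℕ → ℝ := fun j => 1 - ∑ i ∈ Finset.range j, te i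
  have hPs : ∀ j, P (j + 1) = P j - te j := fun j => by
    simp only [P, Finset.sum_range_succ]; ring
  have hPN : P (N + 1) = 0 := by
    have : ∑ i ∈ Finset.range (N + 1), te i = 1 := by
      rw [← Fin.sum_univ_eq_sum_range, ← t.2.2]
      exact Finset.sum_congr rfl fun i _ => dif_pos i.2
    simp [P, this]
  have hanti : Antitone P := antitone_nat_of_succ_le fun j => by rw [hPs]; linarith [hte0 j]
  have hP0 : ∀ j, j ≤ N + 1 → 0 ≤ P j := fun j hj => hPN ▸ hanti hj
  let u : Fin N → I := fun i => ⟨P (i + 1) / P i,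
    div_nonneg (hP0 _ (by omega)) (hP0 _ (by omega)),
    div_le_one_of_le₀ (hanti (Nat.le_succ _)) (hP0 _ (by omega))⟩
  have hprod : ∀ j, j ≤ N + 1 → stickProd u j = P j := by
    intro j
    induction j with
    | zero => intro _; simp [stickProd_zero, P]
    | succ j ih =>
      intro hj
      rw [stickProd_succ, ih (by omega)]
      by_cases h : j < N
      · rw [stickExt, dif_pos h]
        change P j * (P (j + 1) / P j) = _
        by_cases h0 : P j = 0
        · have : P (j + 1) = 0 :=
            le_antisymm (h0 ▸ hanti (Nat.le_succ j)) (hP0 _ (by omega))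
          rw [this, h0, zero_mul]
        · field_simp
      · have : j = N := by omega
        subst this
        rw [hPN, stickExt, dif_neg (lt_irrefl _), mul_zero]
  refine ⟨u, stdSimplex.ext (funext fun j => ?_)⟩
  rw [stickMap_apply, hprod _ (by omega), hprod _ (by omega), hPs]
  simp only [te, dif_pos j.2]
  ring

theorem isQuotientMap_stickMap : IsQuotientMap (stickMap (N := N)) :=
  continuous_stickMap.isClosedMap.isQuotientMap continuous_stickMap stickMap_surjective

/-- Maps on the cube which factor on the boundary descend to the simplex. -/
theorem exists_descent (F : C(Fin N → I, Y)) (b : stdSimplex ℝ (Fin (N + 1)) → Y)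
    (h : ∀ u ∈ Cube.boundary (Fin N), F u = b (stickMap u)) :
    ∃ w : C(stdSimplex ℝ (Fin (N + 1)), Y), ∀ u, w (stickMap u) = F u := by
  let S : C(Fin N → I, stdSimplex ℝ (Fin (N + 1))) := ⟨stickMap, continuous_stickMap⟩
  have hS : IsQuotientMap S := isQuotientMap_stickMap
  have hfac : Function.FactorsThrough F S := by
    intro u v huv
    change stickMap u = stickMap v at huv
    by_cases hu : u ∈ Cube.boundary (Fin N)
    · have hv : v ∈ Cube.boundary (Fin N) := by
        rwa [← stickMap_mem_boundary_iff, ← huv, stickMap_mem_boundary_iff]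
      rw [h u hu, h v hv, huv]
    · rw [stickMap_injective_of_notMem hu huv]
  exact ⟨hS.lift F hfac, fun u => DFunLike.congr_fun (hS.lift_comp F hfac) u⟩

/-- The faces of the topological simplex. -/
noncomputable def sface (i : Fin (N + 2)) :
    C(stdSimplex ℝ (Fin (N + 1)), stdSimplex ℝ (Fin (N + 2))) :=
  ⟨stdSimplex.map i.succAbove, stdSimplex.continuous_map _⟩

theorem sface_apply_self (i : Fin (N + 2)) (s : stdSimplex ℝ (Fin (N + 1))) : sface i s i = 0 := by
  classical
  change FunOnFinite.linearMap ℝ ℝ i.succAbove s i = 0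
  rw [FunOnFinite.linearMap_apply_apply]
  refine Finset.sum_eq_zero fun j hj => ?_
  simp [Fin.succAbove_ne] at hj

theorem sface_apply_succAbove (i : Fin (N + 2)) (s : stdSimplex ℝ (Fin (N + 1)))
    (j : Fin (N + 1)) : sface i s (i.succAbove j) = s j := by
  classical
  change FunOnFinite.linearMap ℝ ℝ i.succAbove s (i.succAbove j) = s j
  rw [FunOnFinite.linearMap_apply_apply, Finset.sum_eq_single j]
  · intro k hk hkj
    simp at hk
    exact absurd hk hkj
  · simp

theorem sface_injective (i : Fin (N + 2)) : Function.Injective (sface i) := fun s t h =>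
  stdSimplex.ext (funext fun j => by
    rw [← sface_apply_succAbove i s, h, sface_apply_succAbove])

theorem exists_sface_eq {i : Fin (N + 2)} {t : stdSimplex ℝ (Fin (N + 2))} (h : t i = 0) :
    ∃ s, sface i s = t := by
  refine ⟨⟨fun j => t (i.succAbove j), fun j => t.2.1 _, ?_⟩, ?_⟩
  · have := t.2.2
    rw [Fin.sum_univ_succAbove _ i] at this
    rw [← this]
    change _ = t i + _
    rw [h, zero_add]; rfl
  · refine stdSimplex.ext (funext fun j => ?_)
    induction j using Fin.succAboveCases i with
    | x => rw [sface_apply_self, h]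
    | p j => rw [sface_apply_succAbove]; rfl

theorem sface_mem_boundary (i : Fin (N + 2)) (s : stdSimplex ℝ (Fin (N + 1))) :
    sface i s ∈ simplexBoundary (N + 1) := ⟨i, sface_apply_self i s⟩

theorem stickMap_insertNth (j : Fin (N + 1)) (u : Fin N → I) :
    stickMap (j.insertNth (α := fun _ => I) 1 u) = sface j.castSucc (stickMap u) := by
  have hext : ∀ i : ℕ, stickExt (j.insertNth (α := fun _ => I) 1 u) i =
      if i < j then stickExt u i else if i = j then 1 else stickExt u (i - 1) := by
    intro i
    unfold stickExt
    by_cases hi : i < N + 1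
    · rw [dif_pos hi]
      obtain h | h := eq_or_ne (⟨i, hi⟩ : Fin (N + 1)) j
      · subst h; simp
      · obtain ⟨k, hk⟩ := Fin.exists_succAbove_eq h
        rw [← hk, Fin.insertNth_apply_succAbove]
        have hk' := congrArg Fin.val hk
        simp only [Fin.succAbove, Fin.lt_def, Fin.val_castSucc] at hk'
        split_ifs at hk' with h1
        · simp only [Fin.val_castSucc] at hk'
          subst hk'
          simp [h1]
        · simp only [Fin.val_succ] at hk'
          subst hk'
          rw [if_neg (by omega), if_neg (by omega)]
          simp
    · rw [dif_neg hi, if_neg (by omega), if_neg (by omega), dif_neg (by omega)]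
  have hle : ∀ i : ℕ, i ≤ j → stickProd (j.insertNth (α := fun _ => I) 1 u) i = stickProd u i :=
    fun i hi => Finset.prod_congr rfl fun k hk => by
      rw [hext, if_pos ((Finset.mem_range.1 hk).trans_le hi)]
  have hgt : ∀ i : ℕ, stickProd (j.insertNth (α := fun _ => I) 1 u) (j + 1 + i) =
      stickProd u (j + i) := by
    intro i
    induction i with
    | zero =>
      rw [add_zero, add_zero, stickProd_succ, hle _ le_rfl, hext, if_neg (lt_irrefl _),
        if_pos rfl, mul_one]
    | succ i ih =>
      rw [← add_assoc, ← add_assoc, stickProd_succ, ih, stickProd_succ, hext, if_neg (by omega),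
        if_neg (by omega)]
      congr 2
      omega
  refine stdSimplex.ext (funext fun i => ?_)
  induction i using Fin.succAboveCases j.castSucc with
  | x =>
    rw [sface_apply_self, stickMap_apply]
    have := hgt 0
    rw [add_zero, add_zero] at this
    rw [Fin.val_castSucc, this, hle _ le_rfl, sub_self]
  | p i =>
    rw [sface_apply_succAbove, stickMap_apply, stickMap_apply]
    by_cases h : (i : ℕ) < j
    · rw [Fin.succAbove_of_castSucc_lt _ _ (Fin.castSucc_lt_castSucc_iff.2 (Fin.lt_def.2 h)), Fin.val_castSucc,
        hle _ h.le, hle _ h]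
    · obtain ⟨k, hk⟩ := Nat.exists_eq_add_of_le (not_lt.1 h)
      have e1 := hgt k
      have e2 := hgt (k + 1)
      rw [Fin.succAbove_of_le_castSucc _ _ (Fin.castSucc_le_castSucc_iff.2 (Fin.le_def.2 (not_lt.1 h))),
        Fin.val_succ, show (i : ℕ) + 1 = j + 1 + k by omega, e1, ← hk,
        show (j : ℕ) + 1 + k + 1 = j + 1 + (k + 1) by omega, e2, hk]
      congr 2
      omega

theorem stickMap_snoc_zero (u : Fin N → I) :
    stickMap (Fin.snoc (α := fun _ => I) u 0) = sface (Fin.last (N + 1)) (stickMap u) := by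
  have hext : ∀ i : ℕ, stickExt (Fin.snoc (α := fun _ => I) u 0) i = stickExt u i := by
    intro i
    unfold stickExt
    by_cases h : i < N
    · rw [dif_pos h, dif_pos (by omega)]
      exact congrArg Subtype.val (Fin.snoc_castSucc (α := fun _ => I) (0 : I) u ⟨i, h⟩)
    · rw [dif_neg h]
      split_ifs with h1
      · have : (⟨i, h1⟩ : Fin (N + 1)) = Fin.last N := Fin.ext (by simp; omega)
        rw [this, Fin.snoc_last]; rfl
      · rfl
  have hP : ∀ i, stickProd (Fin.snoc (α := fun _ => I) u 0) i = stickProd u i := fun i =>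
    Finset.prod_congr rfl fun k _ => hext k
  refine stdSimplex.ext (funext fun i => ?_)
  induction i using Fin.succAboveCases (Fin.last (N + 1)) with
  | x =>
    rw [sface_apply_self, stickMap_apply, hP, hP, stickProd_of_lt, stickProd_of_lt, sub_self] <;>
    simp
  | p i =>
    rw [sface_apply_succAbove, stickMap_apply, stickMap_apply, hP, hP, Fin.succAbove_last,
      Fin.val_castSucc]

theorem stickMap_eq_of_zero {u v : Fin N → I} {j : Fin N} (hu : u j = 0)
    (h : ∀ i, i ≤ j → u i = v i) : stickMap u = stickMap v := by
  rw [stickMap_eq_iff]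
  intro i
  have hext : ∀ k : ℕ, k ≤ j → stickExt u k = stickExt v k := fun k hk => by
    have hk' : k < N := hk.trans_lt j.2
    simp only [stickExt, dif_pos hk', h ⟨k, hk'⟩ hk]
  by_cases hi : i ≤ j
  · exact Finset.prod_congr rfl fun k hk => hext k ((Finset.mem_range.1 hk).le.trans hi)
  · have h0 : stickExt u j = 0 := by simp [stickExt, hu]
    rw [stickProd, Finset.prod_eq_zero (Finset.mem_range.2 (not_le.1 hi)) h0, stickProd,
      Finset.prod_eq_zero (Finset.mem_range.2 (not_le.1 hi)) ((hext j le_rfl).symm.trans h0)]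

/-- A compatible family of maps on the faces of the simplex glues to the boundary. -/
theorem exists_boundary_glue (y : Fin (N + 2) → C(stdSimplex ℝ (Fin (N + 1)), Y))
    (hy : ∀ i j s t, sface i s = sface j t → y i s = y j t) :
    ∃ b : stdSimplex ℝ (Fin (N + 2)) → Y, ContinuousOn b (simplexBoundary (N + 1)) ∧
      ∀ i s, b (sface i s) = y i s := by
  classical
  let b : stdSimplex ℝ (Fin (N + 2)) → Y := fun t =>
    if h : ∃ i, ∃ s, sface i s = t then y h.choose h.choose_spec.choose
    else y 0 (Classical.arbitrary _)
  have hb : ∀ i s, b (sface i s) = y i s := fun i s => by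
    have h : ∃ j, ∃ t, sface j t = sface i s := ⟨i, s, rfl⟩
    dsimp only [b]
    rw [dif_pos h]
    exact hy _ _ _ _ h.choose_spec.choose_spec
  refine ⟨b, ?_, hb⟩
  have hB : simplexBoundary (N + 1) = ⋃ i, {t : stdSimplex ℝ (Fin (N + 2)) | t i = 0} := by
    ext t; simp [simplexBoundary]
  have hcoord : ∀ i, Continuous fun t : stdSimplex ℝ (Fin (N + 2)) => t i := fun i =>
    (continuous_apply i).comp continuous_subtype_val
  rw [hB]
  refine (locallyFinite_of_finite _).continuousOn_iUnion
    (fun i => isClosed_eq (hcoord i) continuous_const) fun i => ?_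
  let r : Fin (N + 2) → Fin (N + 1) := Function.invFun i.succAbove
  refine ((y i).continuous.comp (stdSimplex.continuous_map r)).continuousOn.congr fun t ht => ?_
  obtain ⟨s, rfl⟩ := exists_sface_eq ht
  rw [hb]
  refine congrArg (y i) ?_
  change s = stdSimplex.map r (stdSimplex.map i.succAbove s)
  rw [stdSimplex.map_comp_apply]
  have : r ∘ i.succAbove = id :=
    funext fun k => Function.leftInverse_invFun Fin.succAbove_right_injective k
  rw [this, stdSimplex.map_id_apply]

end StickBreaking

section SimplexExtension
open unitInterval Topology

variable {X Y : Type*} [TopologicalSpace X] [TopologicalSpace Y] {N : ℕ}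

/-- The topological simplex of dimension `N`. -/
abbrev TopSimplex (N : ℕ) : Type := stdSimplex ℝ (Fin (N + 1))

/-- The stick-breaking map as a continuous map. -/
noncomputable def stick (N : ℕ) : C(Fin N → I, TopSimplex N) := ⟨stickMap, continuous_stickMap⟩

theorem stick_mem_boundary {u : Fin N → I} (hu : u ∈ Cube.boundary (Fin N)) :
    stick N u ∈ simplexBoundary N := (stickMap_mem_boundary_iff u).2 hu

theorem exists_stick_boundary {t : TopSimplex N} (ht : t ∈ simplexBoundary N) :
    ∃ u ∈ Cube.boundary (Fin N), stick N u = t := by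
  obtain ⟨u, rfl⟩ := stickMap_surjective t
  exact ⟨u, (stickMap_mem_boundary_iff u).1 ht, rfl⟩

theorem stick_ext {w w' : C(TopSimplex N, Y)} (h : ∀ u, w (stick N u) = w' (stick N u)) :
    w = w' := by
  ext t
  obtain ⟨u, rfl⟩ := stickMap_surjective t
  exact h u

/-- A map on the prism over a cube descends to a path-valued map on the simplex. -/
theorem exists_prism_descent (F : C((Fin N → I) × I, X)) (b : TopSimplex N → C(I, X))
    (h : ∀ u ∈ Cube.boundary (Fin N), ∀ s, F (u, s) = b (stick N u) s) :
    ∃ w : C(TopSimplex N, C(I, X)), (∀ u s, w (stick N u) s = F (u, s)) ∧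
      ∀ t ∈ simplexBoundary N, w t = b t := by
  obtain ⟨w, hw⟩ := exists_descent F.curry b fun u hu => by ext s; exact h u hu s
  refine ⟨w, fun u s => DFunLike.congr_fun (hw u) s, fun t ht => ?_⟩
  obtain ⟨u, hu, rfl⟩ := exists_stick_boundary ht
  refine (hw u).trans ?_
  ext s; exact h u hu s

theorem continuousOn_prism {b : TopSimplex N → C(I, X)} (hb : ContinuousOn b (simplexBoundary N)) :
    ContinuousOn (fun w : (Fin N → I) × I => b (stick N w.1) w.2)
      {w | w.1 ∈ Cube.boundary (Fin N)} := by
  have h1 : ContinuousOn (fun w : (Fin N → I) × I => b (stick N w.1))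
      {w | w.1 ∈ Cube.boundary (Fin N)} :=
    hb.comp ((stick N).continuous.comp continuous_fst).continuousOn
      fun w hw => stick_mem_boundary hw
  have h2 : ContinuousOn (fun w : (Fin N → I) × I => (b (stick N w.1), w.2))
      {w | w.1 ∈ Cube.boundary (Fin N)} := h1.prodMk continuous_snd.continuousOn
  exact (ContinuousEval.continuous_eval (F := C(I, X))).comp_continuousOn h2

/-- The homotopy extension property of the simplex. -/
theorem simplex_hep (k : C(TopSimplex N, X)) (b : TopSimplex N → C(I, X))
    (hb : ContinuousOn b (simplexBoundary N)) (h0 : ∀ t ∈ simplexBoundary N, b t 0 = k t) :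
    ∃ h : C(TopSimplex N, C(I, X)), (∀ t, h t 0 = k t) ∧ ∀ t ∈ simplexBoundary N, h t = b t := by
  obtain ⟨F, hF0, hF⟩ := cube_hep (k.comp (stick N)) (fun w => b (stick N w.1) w.2)
    (continuousOn_prism hb) fun u hu => h0 _ (stick_mem_boundary hu)
  obtain ⟨w, hw, hwb⟩ := exists_prism_descent F b hF
  refine ⟨w, fun t => ?_, hwb⟩
  obtain ⟨u, rfl⟩ := stickMap_surjective t
  exact (hw u 0).trans (hF0 u)

theorem TrivialHomotopy.exists_simplex_prism (hX : TrivialHomotopy N X) (k k' : C(TopSimplex N, X))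
    (b : TopSimplex N → C(I, X)) (hb : ContinuousOn b (simplexBoundary N))
    (h0 : ∀ t ∈ simplexBoundary N, b t 0 = k t) (h1 : ∀ t ∈ simplexBoundary N, b t 1 = k' t) :
    ∃ h : C(TopSimplex N, C(I, X)), (∀ t, h t 0 = k t) ∧ (∀ t, h t 1 = k' t) ∧
      ∀ t ∈ simplexBoundary N, h t = b t := by
  obtain ⟨F, hF0, hF1, hF⟩ := hX.exists_prism_extension (z := k.comp (stick N))
    (y := k'.comp (stick N)) (fun w => b (stick N w.1) w.2)
    (continuousOn_prism hb) (fun u hu => h0 _ (stick_mem_boundary hu))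
    fun u hu => h1 _ (stick_mem_boundary hu)
  obtain ⟨w, hw, hwb⟩ := exists_prism_descent F b hF
  refine ⟨w, fun t => ?_, fun t => ?_, hwb⟩
  · obtain ⟨u, rfl⟩ := stickMap_surjective t
    exact (hw u 0).trans (hF0 u)
  · obtain ⟨u, rfl⟩ := stickMap_surjective t
    exact (hw u 1).trans (hF1 u)

/-- The top of a homotopy can be replaced by a homotopic simplex. -/
theorem exists_simplex_adjust (h : C(TopSimplex N, C(I, X))) {y z : C(TopSimplex N, X)}
    (hz : ∀ t, h t 1 = z t)
    (hy : (z.comp (stick N)).HomotopicRel (y.comp (stick N)) (Cube.boundary (Fin N))) :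
    ∃ h' : C(TopSimplex N, C(I, X)), (∀ t, h' t 0 = h t 0) ∧ (∀ t, h' t 1 = y t) ∧
      ∀ t ∈ simplexBoundary N, h' t = h t := by
  obtain ⟨G, hG0, hG1, hG⟩ := exists_prism_adjust (z := z.comp (stick N)) (h.comp (stick N)).uncurry
    (fun u => hz (stick N u)) hy
  obtain ⟨w, hw, hwb⟩ := exists_prism_descent G h hG
  refine ⟨w, fun t => ?_, fun t => ?_, hwb⟩
  · obtain ⟨u, rfl⟩ := stickMap_surjective t
    exact (hw u 0).trans (hG0 u)
  · obtain ⟨u, rfl⟩ := stickMap_surjective t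
    exact (hw u 1).trans (hG1 u)

theorem TrivialHomotopy.exists_simplex_extension (hX : TrivialHomotopy N X)
    (b : TopSimplex (N + 1) → X) (hb : ContinuousOn b (simplexBoundary (N + 1))) :
    ∃ w : C(TopSimplex (N + 1), X), ∀ t ∈ simplexBoundary (N + 1), w t = b t := by
  obtain ⟨F, hF⟩ := hX.exists_cube_extension (fun u => b (stick (N + 1) u))
    (hb.comp (stick (N + 1)).continuous.continuousOn fun u hu => stick_mem_boundary hu)
  obtain ⟨w, hw⟩ := exists_descent F b hF
  refine ⟨w, fun t ht => ?_⟩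
  obtain ⟨u, hu, rfl⟩ := exists_stick_boundary ht
  exact (hw u).trans (hF u hu)

theorem exists_simplex_of_genLoop {x : X} (f : GenLoop (Fin N) X x) :
    ∃ w : C(TopSimplex N, X), (∀ u, w (stick N u) = f u) ∧ ∀ t ∈ simplexBoundary N, w t = x := by
  obtain ⟨w, hw⟩ := exists_descent f.1 (fun _ => x) f.2
  refine ⟨w, hw, fun t ht => ?_⟩
  obtain ⟨u, hu, rfl⟩ := exists_stick_boundary ht
  exact (hw u).trans (f.2 u hu)

/-- A simplex with constant boundary determines a generalized loop. -/
noncomputable def simplexLoop {x : X} (w : C(TopSimplex N, X))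
    (hw : ∀ t ∈ simplexBoundary N, w t = x) : GenLoop (Fin N) X x :=
  ⟨w.comp (stick N), fun _ hu => hw _ (stick_mem_boundary hu)⟩

theorem trivialHomotopy_of_subsingleton
    (h : ∀ v : X, Subsingleton (HomotopyGroup (Fin N) X v)) : TrivialHomotopy N X := fun v f => by
  exact Quotient.exact (@Subsingleton.elim _ (h v) ⟦f⟧ ⟦GenLoop.const⟧)

end SimplexExtension

/-- A description of the `n`-th homotopy group by an abelian group. -/
structure LoopClass (n : ℕ) {X : Type*} [TopologicalSpace X] (x : X) (A : Type*) [AddCommGroup A]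
    where
  /-- The class of a generalized loop. -/
  cls : GenLoop (Fin n) X x → A
  surj : Function.Surjective cls
  eq_iff : ∀ f g, cls f = cls g ↔ f.1.HomotopicRel g.1 (Cube.boundary (Fin n))
  trans : ∀ i f g, cls (GenLoop.transAt i f g) = cls f + cls g

section CubeConcat
open unitInterval Topology

variable {X : Type*} [TopologicalSpace X] {n : ℕ}

/-- Cubes can be concatenated along a coordinate. -/
theorem exists_cube_concat (k : Fin (n + 1)) (C C' : C(Fin (n + 1) → I, X))
    (h : ∀ u : Fin n → I, C (k.insertNth (α := fun _ => I) 1 u) =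
      C' (k.insertNth (α := fun _ => I) 0 u)) :
    ∃ D : C(Fin (n + 1) → I, X), ∀ u, D u = if (u k : ℝ) ≤ 1 / 2
      then C (Function.update u k (Set.projIcc 0 1 zero_le_one (2 * u k)))
      else C' (Function.update u k (Set.projIcc 0 1 zero_le_one (2 * u k - 1))) := by
  refine ⟨⟨fun u => if (u k : ℝ) ≤ 1 / 2
      then C (Function.update u k (Set.projIcc 0 1 zero_le_one (2 * u k)))
      else C' (Function.update u k (Set.projIcc 0 1 zero_le_one (2 * u k - 1))), ?_⟩, fun u => rfl⟩
  have hk : Continuous fun u : Fin (n + 1) → I => (u k : ℝ) :=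
    continuous_subtype_val.comp (continuous_apply k)
  refine Continuous.if_le ?_ ?_ hk continuous_const fun u hu => ?_
  · exact C.continuous.comp (continuous_id.update k
      (continuous_projIcc.comp (continuous_const.mul hk)))
  · exact C'.continuous.comp (continuous_id.update k
      (continuous_projIcc.comp ((continuous_const.mul hk).sub continuous_const)))
  · have e1 : Set.projIcc (0 : ℝ) 1 zero_le_one (2 * u k) = 1 := by
      rw [hu]; norm_num [Set.projIcc]
    have e2 : Set.projIcc (0 : ℝ) 1 zero_le_one (2 * u k - 1) = 0 := by
      rw [hu]; norm_num [Set.projIcc]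
    have e3 : ∀ a : I, Function.update u k a =
        k.insertNth (α := fun _ => I) a (fun j => u (k.succAbove j)) := fun a => by
      conv_lhs => rw [← Fin.insertNth_self_removeNth k u]
      exact Fin.update_insertNth k _ _ _
    rw [e1, e2, e3, e3]
    exact h _

theorem transAt_apply {x : X} (l : Fin n) (f g : GenLoop (Fin n) X x) (u : Fin n → I) :
    GenLoop.transAt l f g u = if (u l : ℝ) ≤ 1 / 2
      then f (Function.update u l (Set.projIcc 0 1 zero_le_one (2 * u l)))
      else g (Function.update u l (Set.projIcc 0 1 zero_le_one (2 * u l - 1))) := by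
  rw [GenLoop.transAt, GenLoop.coe_copy]

/-- The concatenation of two cubes has concatenated faces. -/
theorem concat_face {D C C' : C(Fin (n + 1) → I, X)} {k : Fin (n + 1)}
    (hD : ∀ u, D u = if (u k : ℝ) ≤ 1 / 2
      then C (Function.update u k (Set.projIcc 0 1 zero_le_one (2 * u k)))
      else C' (Function.update u k (Set.projIcc 0 1 zero_le_one (2 * u k - 1))))
    {j : Fin (n + 1)} {l : Fin n} (hl : k = j.succAbove l) (e : I) (u : Fin n → I) :
    D (j.insertNth (α := fun _ => I) e u) = if (u l : ℝ) ≤ 1 / 2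
      then C (j.insertNth (α := fun _ => I) e
        (Function.update u l (Set.projIcc 0 1 zero_le_one (2 * u l))))
      else C' (j.insertNth (α := fun _ => I) e
        (Function.update u l (Set.projIcc 0 1 zero_le_one (2 * u l - 1)))) := by
  subst hl
  rw [hD, Fin.insertNth_apply_succAbove, Fin.insertNth_update, Fin.insertNth_update]

theorem concat_zero {D C C' : C(Fin (n + 1) → I, X)} {k : Fin (n + 1)}
    (hD : ∀ u, D u = if (u k : ℝ) ≤ 1 / 2
      then C (Function.update u k (Set.projIcc 0 1 zero_le_one (2 * u k)))
      else C' (Function.update u k (Set.projIcc 0 1 zero_le_one (2 * u k - 1)))) (u : Fin n → I) :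
    D (k.insertNth (α := fun _ => I) 0 u) = C (k.insertNth (α := fun _ => I) 0 u) := by
  rw [hD, Fin.insertNth_apply_same, if_pos (by norm_num), Fin.update_insertNth]
  congr 2
  norm_num [Set.projIcc]

theorem concat_one {D C C' : C(Fin (n + 1) → I, X)} {k : Fin (n + 1)}
    (hD : ∀ u, D u = if (u k : ℝ) ≤ 1 / 2
      then C (Function.update u k (Set.projIcc 0 1 zero_le_one (2 * u k)))
      else C' (Function.update u k (Set.projIcc 0 1 zero_le_one (2 * u k - 1)))) (u : Fin n → I) :
    D (k.insertNth (α := fun _ => I) 1 u) = C' (k.insertNth (α := fun _ => I) 1 u) := by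
  rw [hD, Fin.insertNth_apply_same, if_neg (by norm_num), Fin.update_insertNth]
  congr 2
  norm_num [Set.projIcc]

variable {x : X}

/-- A simplex with prescribed loops as faces. -/
def HasFaces (f : Fin (n + 2) → GenLoop (Fin n) X x) (w : C(TopSimplex (n + 1), X)) : Prop :=
  ∀ i u, w (sface i (stick n u)) = f i u

/-- A cube whose faces are the faces of a simplex. -/
structure HasCubeFaces (f : Fin (n + 2) → GenLoop (Fin n) X x) (C : C(Fin (n + 1) → I, X)) :
    Prop where
  one : ∀ (j : Fin (n + 1)) (u : Fin n → I),
    C (j.insertNth (α := fun _ => I) 1 u) = f j.castSucc u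
  last : ∀ u : Fin n → I, C ((Fin.last n).insertNth (α := fun _ => I) 0 u) = f (Fin.last _) u
  zero : ∀ j, j ≠ Fin.last n → ∀ u : Fin n → I, C (j.insertNth (α := fun _ => I) 0 u) = x

theorem stick_insertNth_last_zero (u : Fin n → I) :
    stick (n + 1) ((Fin.last n).insertNth (α := fun _ => I) 0 u) =
      sface (Fin.last (n + 1)) (stick n u) := by
  rw [Fin.insertNth_last']; exact stickMap_snoc_zero u

theorem stick_insertNth_one (j : Fin (n + 1)) (u : Fin n → I) :
    stick (n + 1) (j.insertNth (α := fun _ => I) 1 u) = sface j.castSucc (stick n u) :=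
  stickMap_insertNth j u

theorem stick_insertNth_zero {j : Fin (n + 1)} (hj : j ≠ Fin.last n) (u : Fin n → I) :
    ∃ u' ∈ Cube.boundary (Fin n), stick (n + 1) (j.insertNth (α := fun _ => I) 0 u) =
      sface (Fin.last (n + 1)) (stick n u') := by
  let v : Fin (n + 1) → I := j.insertNth (α := fun _ => I) 0 u
  have hv : v j = 0 := Fin.insertNth_apply_same (α := fun _ => I) j 0 u
  refine ⟨fun i => v i.castSucc, ⟨j.castPred hj, Or.inl ?_⟩, ?_⟩
  · simpa using hv
  · rw [← stick_insertNth_last_zero]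
    refine stickMap_eq_of_zero (j := j) hv fun i hi => ?_
    have hi' : i ≠ Fin.last n := fun h => hj (Fin.last_le_iff.1 (h ▸ hi))
    obtain ⟨i, rfl⟩ := Fin.exists_castSucc_eq.2 hi'
    rw [Fin.insertNth_last', Fin.snoc_castSucc]

theorem HasFaces.cube {f : Fin (n + 2) → GenLoop (Fin n) X x} {w : C(TopSimplex (n + 1), X)}
    (h : HasFaces f w) : HasCubeFaces f (w.comp (stick (n + 1))) where
  one j u := (congrArg w (stick_insertNth_one j u)).trans (h _ u)
  last u := (congrArg w (stick_insertNth_last_zero u)).trans (h _ u)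
  zero j hj u := by
    obtain ⟨u', hu', e⟩ := stick_insertNth_zero hj u
    exact (congrArg w e).trans ((h _ u').trans ((f _).2 u' hu'))

theorem sface_eq_imp {i j : Fin (n + 2)} {s t : TopSimplex n} (h : sface i s = sface j t)
    (hij : i ≠ j) : s ∈ simplexBoundary n ∧ t ∈ simplexBoundary n := by
  obtain ⟨a, ha⟩ := Fin.exists_succAbove_eq hij.symm
  obtain ⟨b, hb⟩ := Fin.exists_succAbove_eq hij
  exact ⟨⟨a, by rw [← sface_apply_succAbove i, ha, h, sface_apply_self]⟩,
    ⟨b, by rw [← sface_apply_succAbove j, hb, ← h, sface_apply_self]⟩⟩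

/-- Maps on the faces which are constant on their boundaries glue. -/
theorem exists_face_glue {Y : Type*} [TopologicalSpace Y] (y : Fin (n + 2) → C(TopSimplex n, Y))
    (z : Y) (hy : ∀ i, ∀ t ∈ simplexBoundary n, y i t = z) :
    ∃ b : TopSimplex (n + 1) → Y, ContinuousOn b (simplexBoundary (n + 1)) ∧
      ∀ i s, b (sface i s) = y i s := by
  refine exists_boundary_glue y fun i j s t hst => ?_
  obtain rfl | hij := eq_or_ne i j
  · rw [sface_injective i hst]
  · obtain ⟨h1, h2⟩ := sface_eq_imp hst hij
    rw [hy _ _ h1, hy _ _ h2]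

theorem HasCubeFaces.simplex {f : Fin (n + 2) → GenLoop (Fin n) X x} {C : C(Fin (n + 1) → I, X)}
    (h : HasCubeFaces f C) : ∃ w : C(TopSimplex (n + 1), X), HasFaces f w := by
  choose y hy hyb using fun i => exists_simplex_of_genLoop (f i)
  obtain ⟨b, -, hb⟩ := exists_face_glue y x hyb
  have hCb : ∀ u ∈ Cube.boundary (Fin (n + 1)), C u = b (stick (n + 1) u) := by
    rintro u ⟨j, hj⟩
    rw [← Fin.insertNth_self_removeNth j u]
    obtain hj | hj := hj
    · rw [hj]
      by_cases hl : j = Fin.last n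
      · subst hl
        rw [stick_insertNth_last_zero, hb, hy, h.last]
      · obtain ⟨u', hu', e⟩ := stick_insertNth_zero hl (j.removeNth u)
        rw [e, hb, hy, h.zero j hl]
        exact ((f _).2 u' hu').symm
    · rw [hj, stick_insertNth_one, hb, hy, h.one]
  obtain ⟨w, hw⟩ := exists_descent C b hCb
  refine ⟨w, fun i u => ?_⟩
  induction i using Fin.lastCases with
  | last =>
    rw [← stick_insertNth_last_zero]
    exact (hw _).trans (h.last u)
  | cast i =>
    rw [← stick_insertNth_one]
    exact (hw _).trans (h.one i u)

end CubeConcat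

section HomotopyAddition
open unitInterval Topology

variable {X : Type*} [TopologicalSpace X] {n : ℕ} {x : X}

/-- Faces can be replaced by homotopic loops. -/
theorem HasFaces.congr {f g : Fin (n + 2) → GenLoop (Fin n) X x} {w : C(TopSimplex (n + 1), X)}
    (h : HasFaces f w) (hfg : ∀ i, (f i).1.HomotopicRel (g i).1 (Cube.boundary (Fin n))) :
    ∃ w', HasFaces g w' := by
  have key : ∀ i, ∃ y : C(TopSimplex n, C(I, X)), (∀ u, y (stick n u) 0 = f i u) ∧
      (∀ u, y (stick n u) 1 = g i u) ∧
      ∀ t ∈ simplexBoundary n, y t = ContinuousMap.const _ x := by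
    intro i
    obtain ⟨k⟩ := hfg i
    have hk : ∀ u ∈ Cube.boundary (Fin n), ∀ s, k (s, u) = x := fun u hu s =>
      (k.eq_fst s hu).trans ((f i).2 u hu)
    let F : C((Fin n → I) × I, X) := ⟨fun z => k (z.2, z.1), by fun_prop⟩
    obtain ⟨y, hy, hyb⟩ := exists_prism_descent F (fun _ => ContinuousMap.const _ x)
      fun u hu s => hk u hu s
    exact ⟨y, fun u => (hy u 0).trans (k.apply_zero u), fun u => (hy u 1).trans (k.apply_one u),
      hyb⟩
  choose y hy0 hy1 hyb using key
  obtain ⟨b, hbc, hb⟩ := exists_face_glue y _ hyb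
  obtain ⟨H, hH0, hH⟩ := simplex_hep w b hbc fun t ht => by
    obtain ⟨i, hi⟩ := ht
    obtain ⟨s, rfl⟩ := exists_sface_eq hi
    obtain ⟨u, rfl⟩ := stickMap_surjective s
    rw [hb]
    exact (hy0 i u).trans (h i u).symm
  refine ⟨⟨fun t => H t 1, by fun_prop⟩, fun i u => ?_⟩
  change H (sface i (stick n u)) 1 = _
  rw [hH _ (sface_mem_boundary _ _), hb, hy1]

theorem hasFaces_const : HasFaces (fun _ : Fin (n + 2) => (GenLoop.const : GenLoop (Fin n) X x))
    (ContinuousMap.const _ x) := fun _ _ => rfl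

theorem transAt_const (l : Fin n) :
    GenLoop.transAt l (GenLoop.const : GenLoop (Fin n) X x) GenLoop.const = GenLoop.const := by
  ext u
  rw [transAt_apply]
  exact ite_self _

theorem val_predAbove_succAbove (k : Fin (n + 1)) (i : Fin (n + 2)) (l : Fin (n + 1)) :
    (k.predAbove (i.succAbove l) : ℕ) =
      if (l : ℕ) < i then (if (k : ℕ) < l then (l : ℕ) - 1 else l)
      else (if (k : ℕ) < l + 1 then (l : ℕ) else l + 1) := by
  have hs : (i.succAbove l : ℕ) = if (l : ℕ) < i then (l : ℕ) else l + 1 := by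
    unfold Fin.succAbove
    by_cases h : l.castSucc < i
    · rw [if_pos h, if_pos (by exact h)]; rfl
    · rw [if_neg h, if_neg (by exact h)]; rfl
  have hp : ∀ a : Fin (n + 2), (k.predAbove a : ℕ) = if (k : ℕ) < a then (a : ℕ) - 1 else a := by
    intro a
    unfold Fin.predAbove
    by_cases h : k.castSucc < a
    · rw [dif_pos h, if_pos (by exact h)]; rfl
    · rw [dif_neg h, if_neg (by exact h)]; rfl
  rw [hp, hs]
  split_ifs <;> omega

/-- Degenerate simplices have two equal faces and trivial other faces. -/
theorem exists_hasFaces_degenerate (k : Fin (n + 1)) (g : GenLoop (Fin n) X x) :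
    ∃ w : C(TopSimplex (n + 1), X), HasFaces
      (fun i : Fin (n + 2) => if i = k.castSucc ∨ i = k.succ then g else GenLoop.const) w := by
  classical
  obtain ⟨y, hy, hyb⟩ := exists_simplex_of_genLoop g
  refine ⟨y.comp ⟨stdSimplex.map k.predAbove, stdSimplex.continuous_map _⟩, fun i u => ?_⟩
  change y (stdSimplex.map k.predAbove (stdSimplex.map i.succAbove (stick n u))) = _
  rw [stdSimplex.map_comp_apply]
  beta_reduce
  by_cases hi : i = k.castSucc ∨ i = k.succ
  · rw [if_pos hi]
    have : k.predAbove ∘ i.succAbove = id := by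
      funext l
      refine Fin.ext ((val_predAbove_succAbove k i l).trans ?_)
      have hi' : (i : ℕ) = k ∨ (i : ℕ) = k + 1 := hi.imp (congrArg Fin.val) (congrArg Fin.val)
      rw [id]
      split_ifs <;> omega
    rw [this, stdSimplex.map_id_apply, hy]
  · rw [if_neg hi]
    have : ∃ v, ∀ l, k.predAbove (i.succAbove l) ≠ v := by
      have hi' : ¬((i : ℕ) = k ∨ (i : ℕ) = k + 1) :=
        fun h => hi (h.imp (fun h => Fin.ext h) fun h => Fin.ext h)
      by_cases h : (i : ℕ) < k
      · refine ⟨⟨i, by omega⟩, fun l hl => ?_⟩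
        have hl' : _ = (i : ℕ) := (val_predAbove_succAbove k i l).symm.trans (congrArg Fin.val hl)
        split_ifs at hl' <;> omega
      · refine ⟨⟨i - 1, by omega⟩, fun l hl => ?_⟩
        have hl' : _ = (i : ℕ) - 1 :=
          (val_predAbove_succAbove k i l).symm.trans (congrArg Fin.val hl)
        split_ifs at hl' <;> omega
    obtain ⟨v, hv⟩ := this
    refine hyb _ ⟨v, ?_⟩
    change FunOnFinite.linearMap ℝ ℝ (k.predAbove ∘ i.succAbove) (stick n u) v = 0
    rw [FunOnFinite.linearMap_apply_apply]
    refine Finset.sum_eq_zero fun l hl => ?_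
    simp at hl
    exact absurd hl (hv l)

/-- Two simplices, the first with trivial initial face, can be added. -/
theorem HasFaces.add {f f' : Fin (n + 3) → GenLoop (Fin (n + 1)) X x}
    {w w' : C(TopSimplex (n + 2), X)} (h : HasFaces f w) (h' : HasFaces f' w')
    (h0 : f 0 = GenLoop.const) : ∃ w'' : C(TopSimplex (n + 2), X),
      HasFaces (fun i => if i = 0 then f' 0 else GenLoop.transAt 0 (f i) (f' i)) w'' := by
  have hl : (0 : Fin (n + 2)) ≠ Fin.last (n + 1) := (Fin.last_pos).ne
  obtain ⟨D, hD⟩ := exists_cube_concat 0 _ _ fun u => by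
    rw [h.cube.one, h'.cube.zero 0 hl, Fin.castSucc_zero, h0]; rfl
  have hj : ∀ j : Fin (n + 2), j ≠ 0 → (0 : Fin (n + 2)) = j.succAbove 0 := fun j hj =>
    (Fin.succAbove_ne_zero_zero hj).symm
  refine HasCubeFaces.simplex (C := D) ⟨fun j u => ?_, fun u => ?_, fun j hjl u => ?_⟩
  · by_cases hj0 : j = 0
    · subst hj0
      rw [concat_one hD, h'.cube.one, Fin.castSucc_zero, if_pos rfl]
    · rw [concat_face hD (hj j hj0), h.cube.one, h'.cube.one,
        if_neg (Fin.castSucc_ne_zero_iff.2 hj0), transAt_apply]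
  · rw [concat_face hD (hj _ hl.symm), h.cube.last, h'.cube.last, if_neg (Fin.last_pos).ne',
      transAt_apply]
  · by_cases hj0 : j = 0
    · subst hj0
      rw [concat_zero hD, h.cube.zero 0 hl]
    · rw [concat_face hD (hj j hj0), h.cube.zero j hjl, h'.cube.zero j hjl, ite_self]

/-- Two simplices with a common face can be glued along the last coordinate. -/
theorem HasFaces.glue {f f' : Fin (n + 3) → GenLoop (Fin (n + 1)) X x}
    {w w' : C(TopSimplex (n + 2), X)} (h : HasFaces f w) (h' : HasFaces f' w')
    (h0 : f (Fin.last (n + 1)).castSucc = f' (Fin.last (n + 2))) :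
    ∃ w'' : C(TopSimplex (n + 2), X),
      HasFaces (fun i => if i = (Fin.last (n + 1)).castSucc then f' (Fin.last (n + 1)).castSucc
        else if i = Fin.last (n + 2) then f (Fin.last (n + 2))
        else GenLoop.transAt (Fin.last n) (f i) (f' i)) w'' := by
  obtain ⟨D, hD⟩ := exists_cube_concat (Fin.last (n + 1)) _ _ fun u => by
    rw [h.cube.one, h'.cube.last, h0]
  have hj : ∀ j : Fin (n + 2), j ≠ Fin.last _ → Fin.last (n + 1) = j.succAbove (Fin.last n) :=
    fun j hj => (Fin.succAbove_ne_last_last hj).symm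
  refine HasCubeFaces.simplex (C := D) ⟨fun j u => ?_, fun u => ?_, fun j hjl u => ?_⟩
  · by_cases hj0 : j = Fin.last _
    · subst hj0
      rw [concat_one hD, h'.cube.one, if_pos rfl]
    · rw [concat_face hD (hj j hj0), h.cube.one, h'.cube.one,
        if_neg fun h => hj0 (Fin.castSucc_injective _ h), if_neg (Fin.castSucc_ne_last _),
        transAt_apply]
  · rw [concat_zero hD, h.cube.last, if_neg (Fin.castSucc_ne_last _).symm, if_pos rfl]
  · rw [concat_face hD (hj j hjl), h.cube.zero j hjl, h'.cube.zero j hjl, ite_self]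

/-- A simplex with only two nontrivial last faces is a homotopy between these. -/
theorem HasFaces.homotopicRel {f : Fin (n + 2) → GenLoop (Fin n) X x}
    {w : C(TopSimplex (n + 1), X)} (h : HasFaces f w)
    (h0 : ∀ j : Fin n, f j.castSucc.castSucc = GenLoop.const) :
    (f (Fin.last (n + 1))).1.HomotopicRel (f (Fin.last n).castSucc).1 (Cube.boundary (Fin n)) := by
  let C : C(Fin (n + 1) → I, X) := w.comp (stick (n + 1))
  have hC : HasCubeFaces f C := h.cube
  refine ⟨⟨⟨⟨fun z => C ((Fin.last n).insertNth (α := fun _ => I) z.1 z.2), ?_⟩,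
    fun u => hC.last u, fun u => hC.one _ u⟩, ?_⟩⟩
  · exact C.continuous.comp (Continuous.finInsertNth _ continuous_fst continuous_snd)
  · rintro s u ⟨j, hj⟩
    change C ((Fin.last n).insertNth (α := fun _ => I) s u) = f (Fin.last (n + 1)) u
    refine Eq.trans ?_ ((f _).2 u ⟨j, hj⟩).symm
    let v : Fin (n + 1) → I := (Fin.last n).insertNth (α := fun _ => I) s u
    have hv : v j.castSucc = u j := by
      simp only [v, Fin.insertNth_last', Fin.snoc_castSucc]
    change C v = x
    rw [← Fin.insertNth_self_removeNth j.castSucc v, hv]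
    obtain hj | hj := hj
    · rw [hj, hC.zero _ (Fin.castSucc_ne_last j)]
    · rw [hj, hC.one, h0]; rfl

end HomotopyAddition

section HomotopyAddition
open unitInterval Topology

variable {X : Type*} [TopologicalSpace X] {n : ℕ} {x : X} {A : Type*} [AddCommGroup A]

theorem LoopClass.cls_const (L : LoopClass (n + 1) x A) : L.cls GenLoop.const = 0 := by
  have h := L.trans 0 GenLoop.const GenLoop.const
  rw [transAt_const] at h
  exact left_eq_add.1 h

/-- A tuple of classes is realized by the faces of a simplex. -/
def LoopClass.Bounds (L : LoopClass (n + 1) x A) (T : Fin (n + 3) → A) : Prop :=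
  ∀ f : Fin (n + 3) → GenLoop (Fin (n + 1)) X x, (∀ i, L.cls (f i) = T i) → ∃ w, HasFaces f w

theorem LoopClass.bounds_of (L : LoopClass (n + 1) x A) {f : Fin (n + 3) → GenLoop (Fin (n + 1)) X x}
    {w : C(TopSimplex (n + 2), X)} (h : HasFaces f w) : L.Bounds fun i => L.cls (f i) :=
  fun _ hg => h.congr fun i => (L.eq_iff _ _).1 (hg i).symm

theorem LoopClass.exists_rep (L : LoopClass (n + 1) x A) (T : Fin (n + 3) → A) :
    ∃ f : Fin (n + 3) → GenLoop (Fin (n + 1)) X x, (∀ i, L.cls (f i) = T i) ∧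
      ∀ i, T i = 0 → f i = GenLoop.const := by
  classical
  choose r hr using L.surj
  refine ⟨fun i => if T i = 0 then GenLoop.const else r (T i), fun i => ?_, fun i hi => if_pos hi⟩
  beta_reduce
  split_ifs with h
  · rw [h, L.cls_const]
  · exact hr _

theorem LoopClass.bounds_zero (L : LoopClass (n + 1) x A) : L.Bounds fun _ => 0 := by
  have := L.bounds_of hasFaces_const
  simpa only [L.cls_const] using this

theorem LoopClass.bounds_degenerate (L : LoopClass (n + 1) x A) (k : Fin (n + 2)) (a : A) :
    L.Bounds fun i => if i = k.castSucc ∨ i = k.succ then a else 0 := by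
  obtain ⟨g, rfl⟩ := L.surj a
  obtain ⟨w, hw⟩ := exists_hasFaces_degenerate k g
  have := L.bounds_of hw
  simpa only [apply_ite L.cls, L.cls_const] using this

theorem LoopClass.Bounds.add {L : LoopClass (n + 1) x A} {T T' : Fin (n + 3) → A}
    (h : L.Bounds T) (h' : L.Bounds T') (h0 : T 0 = 0) : L.Bounds (T + T') := by
  obtain ⟨f, hf, hf0⟩ := L.exists_rep T
  obtain ⟨f', hf', -⟩ := L.exists_rep T'
  obtain ⟨w, hw⟩ := h f hf
  obtain ⟨w', hw'⟩ := h' f' hf'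
  obtain ⟨w'', hw''⟩ := hw.add hw' (hf0 0 h0)
  have := L.bounds_of hw''
  convert this using 2 with i
  split_ifs with hi
  · rw [hi, Pi.add_apply, h0, zero_add, hf']
  · rw [L.trans, hf, hf', Pi.add_apply]

theorem LoopClass.Bounds.last_eq {L : LoopClass (n + 1) x A} {T : Fin (n + 3) → A}
    (h : L.Bounds T) (h0 : ∀ j : Fin (n + 1), T j.castSucc.castSucc = 0) :
    T (Fin.last (n + 2)) = T (Fin.last (n + 1)).castSucc := by
  obtain ⟨f, hf, hf0⟩ := L.exists_rep T
  obtain ⟨w, hw⟩ := h f hf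
  rw [← hf, ← hf, L.eq_iff]
  exact hw.homotopicRel fun j => hf0 _ (h0 j)

theorem LoopClass.Bounds.glue {L : LoopClass (n + 1) x A} {T T' : Fin (n + 3) → A}
    (h : L.Bounds T) (h' : L.Bounds T')
    (h0 : T (Fin.last (n + 1)).castSucc = T' (Fin.last (n + 2))) :
    L.Bounds fun i => if i = (Fin.last (n + 1)).castSucc then T' (Fin.last (n + 1)).castSucc
        else if i = Fin.last (n + 2) then T (Fin.last (n + 2)) else T i + T' i := by
  classical
  obtain ⟨f, hf, -⟩ := L.exists_rep T
  obtain ⟨f', hf', -⟩ := L.exists_rep T'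
  obtain ⟨w, hw⟩ := h f hf
  obtain ⟨w', hw'⟩ := h' (Function.update f' (Fin.last (n + 2)) (f (Fin.last (n + 1)).castSucc))
    fun i => by
      obtain rfl | hi := eq_or_ne i (Fin.last (n + 2))
      · rw [Function.update_self, hf, h0]
      · rw [Function.update_of_ne hi, hf']
  obtain ⟨w'', hw''⟩ := hw.glue hw'
    (Function.update_self (Fin.last (n + 2)) _ f').symm
  have := L.bounds_of hw''
  convert this using 2 with i
  split_ifs with h1 h2
  · rw [Function.update_of_ne (Fin.castSucc_ne_last _), hf']
  · rw [hf]
  · rw [L.trans, hf, Function.update_of_ne h2, hf']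

/-- The alternating sum of a tuple. -/
def altSum {m : ℕ} (T : Fin m → A) : A := ∑ i : Fin m, (-1 : ℤ) ^ (i : ℕ) • T i

theorem altSum_add {m : ℕ} (T T' : Fin m → A) : altSum (T + T') = altSum T + altSum T' := by
  simp only [altSum, Pi.add_apply, smul_add, Finset.sum_add_distrib]

theorem altSum_single {m : ℕ} (i : Fin m) (a : A) :
    altSum (Pi.single i a : Fin m → A) = (-1 : ℤ) ^ (i : ℕ) • a := by
  rw [altSum, Finset.sum_eq_single i (fun j _ hj => by rw [Pi.single_eq_of_ne hj, smul_zero])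
    (by simp), Pi.single_eq_same]

theorem altSum_neg {m : ℕ} (T : Fin m → A) : altSum (-T) = -altSum T := by
  simp only [altSum, Pi.neg_apply, smul_neg, Finset.sum_neg_distrib]

theorem altSum_degenerate {m : ℕ} (k : Fin (m + 1)) (a : A) :
    altSum (fun i : Fin (m + 2) => if i = k.castSucc ∨ i = k.succ then a else 0) = 0 := by
  have h : ∀ i : Fin (m + 2), (-1 : ℤ) ^ (i : ℕ) • (if i = k.castSucc ∨ i = k.succ then a else 0) =
      (if i = k.castSucc then (-1 : ℤ) ^ (k : ℕ) • a else 0) +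
        if i = k.succ then (-1 : ℤ) ^ (k + 1 : ℕ) • a else 0 := by
    intro i
    by_cases h1 : i = k.castSucc
    · subst h1
      simp [(Fin.castSucc_lt_succ (i := k)).ne]
    · by_cases h2 : i = k.succ
      · subst h2; simp [(Fin.castSucc_lt_succ (i := k)).ne']
      · simp [h1, h2]
  rw [altSum, Finset.sum_congr rfl fun i _ => h i, Finset.sum_add_distrib, Finset.sum_ite_eq',
    Finset.sum_ite_eq', if_pos (Finset.mem_univ _), if_pos (Finset.mem_univ _), pow_succ]
  simp

theorem LoopClass.bounds_of_altSum (L : LoopClass (n + 1) x A) (d : ℕ) :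
    ∀ T : Fin (n + 3) → A, (∀ i : Fin (n + 3), i + d < n + 2 → T i = 0) → altSum T = 0 → L.Bounds T := by
  induction d with
  | zero =>
    intro T h h0
    have hT : ∀ i, i ≠ Fin.last (n + 2) → T i = 0 := fun i hi => h i (Fin.lt_last_iff_ne_last.2 hi)
    have hl : T (Fin.last (n + 2)) = 0 := by
      rw [altSum, Finset.sum_eq_single (Fin.last (n + 2)) (fun i _ hi => by rw [hT i hi, smul_zero])
        (by simp)] at h0
      rcases neg_one_pow_eq_or ℤ (Fin.last (n + 2) : Fin (n + 3)).val with e | e <;>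
        simpa [e] using h0
    have : T = fun _ => 0 := funext fun i => by
      obtain rfl | hi := eq_or_ne i (Fin.last (n + 2))
      exacts [hl, hT i hi]
    rw [this]
    exact L.bounds_zero
  | succ d ih =>
    intro T h h0
    by_cases hd : d < n + 2
    · let k : Fin (n + 2) := ⟨n + 1 - d, by omega⟩
      let E : Fin (n + 3) → A := fun i => if i = k.castSucc ∨ i = k.succ then T k.castSucc else 0
      have hE : altSum E = 0 := altSum_degenerate k _
      have hT' : L.Bounds (T - E) := by
        refine ih _ (fun i hi => ?_) ?_
        · obtain rfl | hik := eq_or_ne i k.castSucc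
          · simp [E]
          · have hlt : (i : ℕ) < n + 1 - d := by
              have : (i : ℕ) ≠ n + 1 - d := fun h => hik (Fin.ext h)
              omega
            have h2 : i ≠ k.succ := fun h => by
              have : (i : ℕ) = n + 1 - d + 1 := congrArg Fin.val h
              omega
            simp only [Pi.sub_apply, E, hik, h2, or_self, if_false, sub_zero]
            exact h i (by omega)
        · have := altSum_add (T - E) E
          rwa [sub_add_cancel, h0, hE, add_zero, eq_comm] at this
      have := hT'.add (L.bounds_degenerate k (T k.castSucc)) (by
        by_cases hk : (0 : Fin (n + 3)) = k.castSucc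
        · simp [E, hk]
        · have hk' : 0 ≠ n + 1 - d := fun h => hk (Fin.ext h)
          have h2 : (0 : Fin (n + 3)) ≠ k.succ := (Fin.succ_ne_zero k).symm
          simp only [Pi.sub_apply, E, hk, h2, or_self, if_false, sub_zero]
          exact h 0 (by simp; omega))
      exact (sub_add_cancel T E) ▸ this
    · exact ih T (fun i hi => h i (by omega)) h0

/-- The homotopy addition theorem. -/
theorem LoopClass.exists_hasFaces_iff (L : LoopClass (n + 1) x A)
    (f : Fin (n + 3) → GenLoop (Fin (n + 1)) X x) :
    (∃ w, HasFaces f w) ↔ altSum (fun i => L.cls (f i)) = 0 := by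
  constructor
  · rintro ⟨w, hw⟩
    have hT := L.bounds_of hw
    set T : Fin (n + 3) → A := fun i => L.cls (f i) with hTdef
    let a : Fin (n + 3) := (Fin.last (n + 1)).castSucc
    let b : Fin (n + 3) := Fin.last (n + 2)
    let k : Fin (n + 2) := Fin.last (n + 1)
    let E : Fin (n + 3) → A := fun i => if i = k.castSucc ∨ i = k.succ then T a + T b else 0
    let S : Fin (n + 3) → A := Pi.single a ((-1 : ℤ) ^ (n + 1) • altSum T)
    have hab : b ≠ a := (Fin.castSucc_ne_last _).symm
    have ha : (-T + E + S) a = T b + (-1 : ℤ) ^ (n + 1) • altSum T := by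
      have h1 : E a = T a + T b := if_pos (Or.inl rfl)
      have h2 : S a = (-1 : ℤ) ^ (n + 1) • altSum T := Pi.single_eq_same _ _
      rw [Pi.add_apply, Pi.add_apply, Pi.neg_apply, h1, h2]; abel
    have hb : (-T + E + S) b = T a := by
      have h1 : E b = T a + T b := if_pos (Or.inr rfl)
      have h2 : S b = 0 := Pi.single_eq_of_ne hab _
      rw [Pi.add_apply, Pi.add_apply, Pi.neg_apply, h1, h2]; abel
    have hi : ∀ i, i ≠ a → i ≠ b → T i + (-T + E + S) i = 0 := fun i h1 h2 => by
      have h3 : E i = 0 := if_neg fun h => h.elim h1 h2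
      have h4 : S i = 0 := Pi.single_eq_of_ne h1 _
      rw [Pi.add_apply, Pi.add_apply, Pi.neg_apply, h3, h4]; abel
    have hT' : L.Bounds (-T + E + S) := L.bounds_of_altSum (n + 2) _ (fun i hi => by omega) (by
      have h1 : altSum E = 0 := altSum_degenerate k _
      have h2 : altSum S = altSum T := by
        rw [altSum_single, smul_smul, ← pow_add]
        have : Even ((a : ℕ) + (n + 1)) := ⟨n + 1, rfl⟩
        rw [this.neg_one_pow, one_smul]
      rw [altSum_add, altSum_add, altSum_neg, h1, h2]; abel)
    have key := (hT.glue hT' hb.symm).last_eq fun j => by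
      have h1 : (j.castSucc.castSucc : Fin (n + 3)) ≠ a := fun h =>
        Fin.castSucc_ne_last j (Fin.castSucc_injective _ h)
      have h2 : (j.castSucc.castSucc : Fin (n + 3)) ≠ b := Fin.castSucc_ne_last _
      rw [if_neg h1, if_neg h2]
      exact hi _ h1 h2
    beta_reduce at key
    rw [if_neg hab, if_pos rfl, if_pos rfl] at key
    have key' := left_eq_add.1 (key.trans ha)
    rcases neg_one_pow_eq_or ℤ (n + 1) with e | e <;> simpa [e] using key'
  · exact fun h => L.bounds_of_altSum (n + 2) _ (fun i hi => by omega) h _ fun i => rfl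

end HomotopyAddition

section EilenbergMacLane

variable {X : Type*} [TopologicalSpace X]

/-- The class of a loop in an abelian group isomorphic to the homotopy group. -/
noncomputable def LoopClass.ofMulEquiv {n : ℕ} {x : X} {A : Type*} [AddCommGroup A]
    (φ : HomotopyGroup (Fin (n + 1)) X x ≃* Multiplicative A) : LoopClass (n + 1) x A where
  cls f := (φ (Quotient.mk _ f)).toAdd
  surj a := by
    obtain ⟨c, hc⟩ := φ.surjective (Multiplicative.ofAdd a)
    obtain ⟨f, rfl⟩ := Quotient.exists_rep c
    exact ⟨f, congrArg Multiplicative.toAdd hc⟩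
  eq_iff f g :=
    ⟨fun h => Quotient.exact (φ.injective (Multiplicative.toAdd.injective h)),
      fun h => congrArg (fun c => (φ c).toAdd) (Quotient.sound h)⟩
  trans i f g := by
    have h := HomotopyGroup.mul_spec (i := i) (p := g) (q := f)
    have h' := congrArg φ h
    refine (congrArg Multiplicative.toAdd h').symm.trans ?_
    refine (congrArg Multiplicative.toAdd (φ.map_mul _ _)).trans ?_
    exact add_comm _ _

end EilenbergMacLane

section Cocycles

open Classical in
/-- The values of an integral function on covers on the sections of the covers. -/
noncomputable def evalCover {n q m : ℕ} (a : coverSet n n q m → ℤ)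
    (ι : Fin (n + 1) → Fin (m + 1)) (l : Fin q) : ℤ :=
  ∑ g : coverSet n n q m, if (fun v => g.1.1 (ι v), g.1.2) = ((fun v : Fin (n + 1) => (v : ℕ)), l)
    then a g else 0

variable {n q m : ℕ}

open Classical in
theorem evalCover_of_not_injective (a : coverSet n n q m → ℤ) {ι : Fin (n + 1) → Fin (m + 1)}
    (hι : ¬ Function.Injective ι) : evalCover a ι = 0 := by
  funext l
  refine Finset.sum_eq_zero fun g _ => if_neg fun h => hι fun v w hvw => ?_
  have h1 := congrFun (congrArg Prod.fst h)
  have hv := h1 v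
  have hw := h1 w
  dsimp only at hv hw
  rw [hvw] at hv
  exact Fin.ext (hv.symm.trans hw)

theorem cover_face_iff {c : Fin (n + 2) → ℕ} (hc : Monotone c) (hn : ∀ i, c i ≤ n)
    {j : Fin (n + 2)} (hj : ∀ v : Fin (n + 1), c (j.succAbove v) = v) :
    ∃ k : Fin (n + 1), ∀ i : Fin (n + 2),
      (∀ v : Fin (n + 1), c (i.succAbove v) = v) ↔ i = k.castSucc ∨ i = k.succ := by
  obtain ⟨k, hk⟩ : ∃ k : Fin (n + 1), ∀ i : Fin (n + 2), c i = if (i : ℕ) ≤ k then (i : ℕ) else i - 1 := by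
    have hlt : ∀ i : Fin (n + 2), i < j → c i = i := fun i hi => by
      have := hj ⟨i, by omega⟩
      rwa [show j.succAbove ⟨i, by omega⟩ = i from
        Fin.succAbove_of_castSucc_lt _ _ hi] at this
    have hgt : ∀ i : Fin (n + 2), j < i → c i = i - 1 := fun i hi => by
      have hi' : (j : ℕ) < i := hi
      have := hj ⟨i - 1, by omega⟩
      rwa [show j.succAbove ⟨i - 1, by omega⟩ = i from
        (Fin.succAbove_of_lt_succ _ _ (Fin.lt_def.2 (by simp; omega))).trans
          (Fin.ext (by simp; omega))] at this
    have hj0 : c j ≤ j := by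
      by_cases h : (j : ℕ) = n + 1
      · have := hn j; omega
      · have h1 := hc (show j ≤ ⟨j + 1, by omega⟩ from Fin.le_def.2 (by simp))
        rw [hgt ⟨j + 1, by omega⟩ (Fin.lt_def.2 (by simp))] at h1
        simpa using h1
    have hj1 : (j : ℕ) - 1 ≤ c j := by
      by_cases h : (j : ℕ) = 0
      · omega
      · have h1 := hc (show (⟨j - 1, by omega⟩ : Fin (n + 2)) ≤ j from Fin.le_def.2 (by simp))
        rwa [hlt ⟨j - 1, by omega⟩ (show (j : ℕ) - 1 < j by omega)] at h1
    by_cases h : c j = j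
    · have hjn : (j : ℕ) ≤ n := h ▸ hn j
      refine ⟨⟨j, by omega⟩, fun i => ?_⟩
      dsimp only
      rcases lt_trichotomy i j with hi | rfl | hi
      · rw [hlt i hi, if_pos (Fin.le_def.1 hi.le)]
      · rw [h, if_pos le_rfl]
      · rw [hgt i hi, if_neg (not_le.2 (Fin.lt_def.1 hi))]
    · refine ⟨⟨j - 1, by omega⟩, fun i => ?_⟩
      dsimp only
      rcases lt_trichotomy i j with hi | rfl | hi
      · rw [hlt i hi, if_pos (by have := Fin.lt_def.1 hi; omega)]
      · rw [if_neg (by omega)]; omega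
      · rw [hgt i hi, if_neg (by have := Fin.lt_def.1 hi; omega)]
  refine ⟨k, fun i => ⟨fun h => ?_, ?_⟩⟩
  · by_contra hne
    push Not at hne
    have h1 : (i : ℕ) ≠ k := fun e => hne.1 (Fin.ext e)
    have h2 : (i : ℕ) ≠ k + 1 := fun e => hne.2 (Fin.ext e)
    obtain ⟨v, hv⟩ := Fin.exists_succAbove_eq hne.1.symm
    obtain ⟨w, hw⟩ := Fin.exists_succAbove_eq hne.2.symm
    have hv' := h v
    have hw' := h w
    rw [hv, hk] at hv'
    rw [hw, hk] at hw'
    have : v = w := Fin.ext (by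
      simp at hv' hw'
      omega)
    rw [this, hw] at hv
    exact absurd hv (Fin.castSucc_lt_succ).ne'
  · rintro (rfl | rfl) v <;> rw [hk] <;> 
      (simp only [Fin.succAbove, Fin.lt_def, Fin.val_castSucc, Fin.val_succ]; split_ifs <;> simp at * <;> omega)

open Classical in
theorem altSum_evalCover (a : coverSet n n q m → ℤ) {κ : Fin (n + 2) → Fin (m + 1)}
    (hκ : Monotone κ) :
    altSum (fun j => evalCover a (fun v => κ (Fin.succAbove j v))) = 0 := by
  funext l
  have h : ∀ g : coverSet n n q m, altSum (fun j : Fin (n + 2) =>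
      if (fun v => g.1.1 (κ (Fin.succAbove j v)), g.1.2) = ((fun v : Fin (n + 1) => (v : ℕ)), l)
      then a g else 0) = 0 := by
    intro g
    by_cases h : ∃ j : Fin (n + 2),
      (fun v => g.1.1 (κ (Fin.succAbove j v)), g.1.2) = ((fun v : Fin (n + 1) => (v : ℕ)), l)
    · obtain ⟨j, hj⟩ := h
      have hl := congrArg Prod.snd hj
      obtain ⟨k, hk⟩ := cover_face_iff (c := fun i => g.1.1 (κ i)) (g.2.1.comp hκ)
        (fun i => g.2.2.1 _) (congrFun (congrArg Prod.fst hj))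
      refine Eq.trans (congrArg altSum (funext fun i => ?_)) (altSum_degenerate k (a g))
      refine if_congr (Iff.trans ?_ (hk i)) rfl rfl
      exact ⟨fun h => congrFun (congrArg Prod.fst h), fun h => Prod.ext (funext h) hl⟩
    · push Not at h
      rw [altSum]
      exact Finset.sum_eq_zero fun j _ => by rw [if_neg (h j), smul_zero]
  have h2 : altSum (fun j => evalCover a (fun v => κ (Fin.succAbove j v))) l =
      altSum (fun j => evalCover a (fun v => κ (Fin.succAbove j v)) l) := by
    simp only [altSum, Finset.sum_apply, Pi.smul_apply]
  rw [h2]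
  simp only [altSum, evalCover, Finset.smul_sum] at h ⊢
  rw [Finset.sum_comm]
  exact Finset.sum_eq_zero fun g _ => h g

end Cocycles

section CocycleExtension
variable {n q m : ℕ}

open Classical in
/-- Unitriangular integral systems of equations are uniquely solvable. -/
theorem bijective_of_unitriangular {S : Type*} [Fintype S] (M : S → S → ℤ) (b : S → ℕ)
    (h1 : ∀ g, M g g = 1) (h2 : ∀ g g', M g g' ≠ 0 → g' = g ∨ b g < b g') :
    Function.Bijective fun a : S → ℤ => fun g => ∑ g', M g g' * a g' := by
  let N : Matrix S S ℤ := M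
  have hN : N.BlockTriangular b := fun i j hij => by
    by_contra h
    rcases h2 i j h with rfl | h
    · exact lt_irrefl _ hij
    · exact lt_asymm hij h
  have hdet : N.det = 1 := by
    rw [hN.det]
    refine Finset.prod_eq_one fun k _ => ?_
    have : N.toSquareBlock b k = 1 := by
      ext ⟨i, hi⟩ ⟨j, hj⟩
      rw [Matrix.one_apply, Matrix.toSquareBlock_def]
      simp only [Matrix.of_apply, Subtype.mk.injEq]
      split_ifs with h
      · subst h; exact h1 i
      · by_contra h'
        rcases h2 i j h' with rfl | h'
        · exact h rfl
        · omega
    rw [this, Matrix.det_one]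
  have hu : IsUnit N := (Matrix.isUnit_iff_isUnit_det N).2 (by rw [hdet]; exact isUnit_one)
  exact ⟨Matrix.mulVec_injective_of_isUnit hu, Matrix.mulVec_surjective_iff_isUnit.2 hu⟩

/-- The first position at which a cover attains a value. -/
noncomputable def firstIdx (g : coverSet n n q m) (v : Fin (n + 1)) : Fin (m + 1) :=
  Finset.min' (Finset.univ.filter fun i => g.1.1 i = v) (by
    obtain ⟨i, hi⟩ := g.2.2.2 v (Nat.lt_succ_iff.1 v.2)
    exact ⟨i, Finset.mem_filter.2 ⟨Finset.mem_univ _, hi⟩⟩)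

theorem apply_firstIdx (g : coverSet n n q m) (v : Fin (n + 1)) : g.1.1 (firstIdx g v) = v :=
  (Finset.mem_filter.1 (Finset.min'_mem (Finset.univ.filter fun i => g.1.1 i = v) _)).2

theorem firstIdx_le (g : coverSet n n q m) {v : Fin (n + 1)} {i : Fin (m + 1)} (h : g.1.1 i = v) :
    firstIdx g v ≤ i :=
  Finset.min'_le (Finset.univ.filter fun i => g.1.1 i = (v : ℕ)) i
    (Finset.mem_filter.2 ⟨Finset.mem_univ i, h⟩)

theorem firstIdx_strictMono (g : coverSet n n q m) : StrictMono (firstIdx g) := fun v w h => by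
  by_contra hle
  have := g.2.1 (not_lt.1 hle)
  rw [apply_firstIdx, apply_firstIdx] at this
  exact absurd h (not_lt.2 this)

/-- A strictly monotone map preserving the first element is given by the first positions of
some cover. -/
theorem exists_firstIdx_eq {ι : Fin (n + 1) → Fin (m + 1)} (hι : StrictMono ι) (h0 : ι 0 = 0)
    (l : Fin q) : ∃ g : coverSet n n q m, firstIdx g = ι ∧ g.1.2 = l := by
  let P : Fin (m + 1) → ℕ → Prop := fun x v => ∃ h : v < n + 1, ι ⟨v, h⟩ ≤ x
  classical
  let c : Fin (m + 1) → ℕ := fun x => Nat.findGreatest (P x) n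
  have hP : ∀ x, P x (c x) := fun x =>
    Nat.findGreatest_spec (Nat.zero_le n) ⟨Nat.succ_pos n, h0.trans_le (Fin.zero_le _)⟩
  have hle : ∀ x, c x ≤ n := fun x => Nat.findGreatest_le n
  have hmax : ∀ x (v : Fin (n + 1)), ι v ≤ x → (v : ℕ) ≤ c x := fun x v h =>
    Nat.le_findGreatest (Nat.lt_succ_iff.1 v.2) ⟨v.2, h⟩
  have hc : ∀ v : Fin (n + 1), c (ι v) = v := fun v => by
    refine le_antisymm ?_ (hmax _ _ le_rfl)
    obtain ⟨h, h'⟩ := hP (ι v)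
    exact hι.le_iff_le.1 h'
  refine ⟨⟨(c, l), fun x y hxy => ?_, hle, fun v hv => ⟨ι ⟨v, by omega⟩, hc _⟩⟩,
    funext fun v => ?_, rfl⟩
  · obtain ⟨h, h'⟩ := hP x
    exact hmax y ⟨_, h⟩ (h'.trans hxy)
  · refine le_antisymm (firstIdx_le _ (hc v)) ?_
    have h1 := apply_firstIdx (⟨(c, l), fun x y hxy => by
      obtain ⟨h, h'⟩ := hP x
      exact hmax y ⟨_, h⟩ (h'.trans hxy), hle, fun v hv => ⟨ι ⟨v, by omega⟩, hc _⟩⟩ :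
      coverSet n n q m) v
    obtain ⟨h, h'⟩ := hP (firstIdx _ v)
    refine le_trans (le_of_eq (congrArg ι (Fin.ext ?_))) h'
    exact h1.symm

/-- An integral function on covers is determined by its values on first positions, which may be
prescribed. -/
theorem evalCover_firstIdx_bijective : Function.Bijective fun a : coverSet n n q m → ℤ =>
    fun g : coverSet n n q m => evalCover a (firstIdx g) g.1.2 := by
  classical
  have := bijective_of_unitriangular (S := coverSet n n q m) (fun g g' =>
    if (fun v => g'.1.1 (firstIdx g v), g'.1.2) = ((fun v : Fin (n + 1) => (v : ℕ)), g.1.2)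
      then 1 else 0) (fun g => ∑ i, g.1.1 i)
    (fun g => if_pos (congrArg (fun c : Fin (n + 1) → ℕ => (c, g.1.2))
      (funext fun v => apply_firstIdx g v))) (fun g g' h => by
      have h := by_contra fun hn => h (if_neg hn)
      have hle : ∀ i, g.1.1 i ≤ g'.1.1 i := fun i => by
        have hi : g.1.1 i < n + 1 := Nat.lt_succ_of_le (g.2.2.1 i)
        have h1 := congrFun (congrArg Prod.fst h) ⟨_, hi⟩
        refine le_of_eq_of_le h1.symm (g'.2.1 (firstIdx_le g rfl))
      have hl : g'.1.2 = g.1.2 := (Prod.ext_iff.1 h).2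
      by_cases heq : ∀ i, g.1.1 i = g'.1.1 i
      · exact Or.inl (Subtype.ext (Prod.ext (funext fun i => (heq i).symm) hl))
      · push Not at heq
        obtain ⟨i, hi⟩ := heq
        exact Or.inr (Finset.sum_lt_sum (fun i _ => hle i)
          ⟨i, Finset.mem_univ _, lt_of_le_of_ne (hle i) hi⟩))
  convert this using 3 with a g
  exact Finset.sum_congr rfl fun g' _ => by split_ifs <;> simp

theorem altSum_zero_cases {A : Type*} [AddCommGroup A] {T : Fin (m + 1) → A} (h : altSum T = 0)
    (hT : ∀ j : Fin m, T j.succ = 0) : T 0 = 0 := by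
  rw [altSum, Fin.sum_univ_succ, Finset.sum_eq_zero fun j _ => by rw [hT j, smul_zero]] at h
  simpa using h

/-- A normalized cocycle vanishing on the simplices through the first vertex vanishes. -/
theorem cocycle_eq_zero {A : Type*} [AddCommGroup A] (z : (Fin (n + 1) → Fin (m + 1)) → A)
    (hn : ∀ ι, ¬ Function.Injective ι → z ι = 0)
    (hz : ∀ κ : Fin (n + 2) → Fin (m + 1), Monotone κ →
      altSum (fun j => z (fun v => κ (Fin.succAbove j v))) = 0)
    (h0 : ∀ ι, StrictMono ι → ι 0 = 0 → z ι = 0) {ι : Fin (n + 1) → Fin (m + 1)}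
    (hι : Monotone ι) : z ι = 0 := by
  have h0' : ∀ ι, Monotone ι → ι 0 = 0 → z ι = 0 := fun ι hι h => by
    by_cases hi : Function.Injective ι
    · exact h0 ι (hι.strictMono_of_injective hi) h
    · exact hn ι hi
  let κ : Fin (n + 2) → Fin (m + 1) := Fin.cons 0 ι
  have hκ : Monotone κ := by
    intro v w
    refine Fin.cases (fun _ => Fin.zero_le _) (fun v => ?_) v
    refine Fin.cases (fun h => absurd h (not_le.2 (Fin.succ_pos _))) (fun w h => ?_) w
    simpa [κ] using hι (Fin.succ_le_succ_iff.1 h)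
  have := altSum_zero_cases (hz κ hκ) (fun j => h0' _ (hκ.comp (Fin.strictMono_succAbove _).monotone)
    (by simp [κ, Fin.succAbove_ne_zero_zero (Fin.succ_ne_zero j)]))
  simpa [κ] using this

theorem evalCover_injective {a b : coverSet n n q m → ℤ}
    (h : ∀ ι, Monotone ι → evalCover a ι = evalCover b ι) : a = b :=
  evalCover_firstIdx_bijective.1 (funext fun g =>
    congrFun (h _ (firstIdx_strictMono g).monotone) g.1.2)

/-- Every normalized cocycle comes from an integral function on covers. -/
theorem exists_evalCover_eq (z : (Fin (n + 1) → Fin (m + 1)) → Fin q → ℤ)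
    (hn : ∀ ι, ¬ Function.Injective ι → z ι = 0)
    (hz : ∀ κ : Fin (n + 2) → Fin (m + 1), Monotone κ →
      altSum (fun j => z (fun v => κ (Fin.succAbove j v))) = 0) :
    ∃ a : coverSet n n q m → ℤ, ∀ ι, Monotone ι → evalCover a ι = z ι := by
  obtain ⟨a, ha⟩ := evalCover_firstIdx_bijective.2
    (fun g : coverSet n n q m => z (firstIdx g) g.1.2)
  refine ⟨a, fun ι hι => sub_eq_zero.1 ?_⟩
  refine cocycle_eq_zero (fun ι => evalCover a ι - z ι) (fun ι hi => ?_) (fun κ hκ => ?_)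
    (fun ι hi h0 => ?_) hι
  · rw [evalCover_of_not_injective a hi, hn ι hi, sub_zero]
  · have h1 := altSum_add (fun j => evalCover a (fun v => κ (Fin.succAbove j v)))
      (-fun j => z (fun v => κ (Fin.succAbove j v)))
    rw [altSum_neg, altSum_evalCover a hκ, hz κ hκ, neg_zero, add_zero] at h1
    refine Eq.trans (congrArg altSum (funext fun j => ?_)) h1
    exact sub_eq_add_neg _ _
  · funext l
    obtain ⟨g, rfl, rfl⟩ := exists_firstIdx_eq hi h0 l
    exact sub_eq_zero.2 (congrFun ha g)

end CocycleExtension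

section Sections
open Opposite Simplicial

/-- A family of simplices which agree on all common faces. -/
def FaceCompat (E : SSet.{0}) {m : ℕ} (e : Fin (m + 2) → E.obj (op ⦋m⦌)) : Prop :=
  ∀ (k : ℕ) (i j : Fin (m + 2)) (α β : ⦋k⦌ ⟶ ⦋m⦌),
    α ≫ SimplexCategory.δ i = β ≫ SimplexCategory.δ j → E.map α.op (e i) = E.map β.op (e j)

/-- A map of simplicial sets along which simplices with prescribed boundary lift has a section. -/
theorem exists_section {E B : SSet.{0}} (f : E ⟶ B)
    (h0 : ∀ b : B.obj (op ⦋0⦌), ∃ e, f.app _ e = b)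
    (h : ∀ (m : ℕ) (b : B.obj (op ⦋m + 1⦌)) (e : Fin (m + 2) → E.obj (op ⦋m⦌)), FaceCompat E e →
      (∀ i, f.app _ (e i) = B.map (SimplexCategory.δ i).op b) →
      ∃ e', (∀ i, E.map (SimplexCategory.δ i).op e' = e i) ∧ f.app _ e' = b) :
    ∃ s : B ⟶ E, s ≫ f = 𝟙 B := by
  have hf : (MorphismProperty.monomorphisms SSet.{0}).rlp f := by
    rw [SSet.rlp_monomorphisms]
    rintro _ _ _ ⟨n⟩
    refine ⟨fun {u v} sq => ?_⟩
    cases n with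
    | zero =>
      obtain ⟨e, he⟩ := h0 (SSet.yonedaEquiv v)
      refine ⟨⟨⟨SSet.yonedaEquiv.symm e, SSet.boundary.hom_ext₀, ?_⟩⟩⟩
      apply SSet.yonedaEquiv.injective
      rw [SSet.yonedaEquiv_comp, Equiv.apply_symm_apply]
      exact he
    | succ m =>
      obtain ⟨e, he, he'⟩ := h m (SSet.yonedaEquiv v)
        (fun i => SSet.yonedaEquiv (SSet.boundary.ι i ≫ u)) (fun k i j α β hαβ => by
          rw [SSet.yonedaEquiv_naturality, SSet.yonedaEquiv_naturality]
          congr 1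
          rw [← Category.assoc, ← Category.assoc]
          congr 1
          rw [← cancel_mono (∂Δ[m + 1]).ι, Category.assoc, Category.assoc, SSet.boundary.ι_ι,
            SSet.boundary.ι_ι]
          exact ((SSet.stdSimplex.map_comp _ _).symm.trans (congrArg _ hαβ)).trans
            (SSet.stdSimplex.map_comp _ _)) (fun i => by
          rw [← SSet.yonedaEquiv_comp, SSet.yonedaEquiv_naturality, Category.assoc, sq.w,
            ← Category.assoc, SSet.boundary.ι_ι]
          rfl)
      refine ⟨⟨⟨SSet.yonedaEquiv.symm e, SSet.boundary.hom_ext fun i => ?_, ?_⟩⟩⟩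
      · rw [← Category.assoc, SSet.boundary.ι_ι]
        refine Eq.trans (SSet.yonedaEquiv_symm_naturality_left (SimplexCategory.δ i) e) ?_
        rw [he, Equiv.symm_apply_apply]
      · apply SSet.yonedaEquiv.injective
        rw [SSet.yonedaEquiv_comp, Equiv.apply_symm_apply]
        exact he'
  have hmono : Mono (Limits.initial.to B) := inferInstance
  have hl : HasLiftingProperty (Limits.initial.to B) f := hf _ hmono
  have sq : CommSq (Limits.initial.to E) (Limits.initial.to B) f (𝟙 B) :=
    ⟨Limits.initial.hom_ext _ _⟩
  exact ⟨sq.lift, sq.fac_right⟩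

end Sections

section LatticeSet
open Opposite Simplicial

lemma FaceCompat.map {E B : SSet.{0}} (f : E ⟶ B) {m : ℕ} {e : Fin (m + 2) → E.obj (op ⦋m⦌)}
    (he : FaceCompat E e) : FaceCompat B fun i => f.app _ (e i) := fun k i j α β h => by
  have h1 := congrArg (f.app _) (he k i j α β h)
  refine Eq.trans ?_ (h1.trans ?_)
  · exact (NatTrans.naturality_apply f α.op (e i)).symm
  · exact NatTrans.naturality_apply f β.op (e j)

/-- The simplicial set underlying the standard simplicial lattice which is a model of
`K(ℤ ^ q, n)`. -/
noncomputable def latSet (n q : ℕ) : SSet.{0} :=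
  ((SimplicialObject.whiskering _ _).obj latFun).obj (coverSpace n n q)

variable {n q : ℕ}

lemma pushZ_cover_eval {m k : ℕ}
    (φ : coverSet n n q m → Option (coverSet n n q k)) (f : Fin (k + 1) → Fin (m + 1))
    (hf : Monotone f)
    (hφ : ∀ g b, φ g = some b ↔ (g.1.1 ∘ f, g.1.2) = b.1) (a : coverSet n n q m → ℤ)
    (ι : Fin (n + 1) → Fin (k + 1)) :
    evalCover (pushZ φ a) ι = evalCover a (f ∘ ι) := by
  classical
  funext l
  simp only [evalCover, pushZ_apply]
  have h1 : ∀ b : coverSet n n q k,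
      (if (fun v => b.1.1 (ι v), b.1.2) = ((fun v : Fin (n + 1) => (v : ℕ)), l)
        then ∑ s, (if φ s = some b then a s else 0) else 0) =
      ∑ s, if (fun v => b.1.1 (ι v), b.1.2) = ((fun v : Fin (n + 1) => (v : ℕ)), l)
        then (if φ s = some b then a s else 0) else 0 := fun b => by
    split_ifs
    · rfl
    · exact Finset.sum_const_zero.symm
  rw [Finset.sum_congr rfl fun b _ => h1 b, Finset.sum_comm]
  refine Finset.sum_congr rfl fun s _ => ?_
  by_cases hs : (fun v => s.1.1 ((f ∘ ι) v), s.1.2) = ((fun v : Fin (n + 1) => (v : ℕ)), l)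
  · rw [if_pos hs]
    have h2 := congrFun (Prod.ext_iff.1 hs).1
    let b : coverSet n n q k := ⟨(s.1.1 ∘ f, s.1.2), s.2.1.comp hf, fun i => s.2.2.1 _,
      fun v hv => ⟨ι ⟨v, by omega⟩, h2 ⟨v, by omega⟩⟩⟩
    have hb : φ s = some b := (hφ s b).2 rfl
    rw [Finset.sum_eq_single b, if_pos hb]
    · exact if_pos hs
    · intro c _ hc
      rw [hb, if_neg (fun h => hc (Option.some_inj.1 h).symm), ite_self]
    · exact fun h => absurd (Finset.mem_univ b) h
  · rw [if_neg hs]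
    refine Finset.sum_eq_zero fun b _ => ?_
    by_cases hb : φ s = some b
    · have h2 := (hφ s b).1 hb
      refine if_neg fun h => hs ?_
      rw [← h2] at h
      exact h
    · rw [if_neg hb, ite_self]

lemma evalCover_map {Y Z : SimplexCategoryᵒᵖ} (φ : Y ⟶ Z) (a : (latSet n q).obj Y)
    (ι : Fin (n + 1) → Fin (Z.unop.len + 1)) :
    evalCover (m := Z.unop.len) ((latSet n q).map φ a) ι =
      evalCover (m := Y.unop.len) a (φ.unop.toOrderHom ∘ ι) :=
  pushZ_cover_eval
    (fun g => ((coverSpace n n q).map φ : _ ⟶ _) g) φ.unop.toOrderHom φ.unop.toOrderHom.monotone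
    (fun g b => coverSpace_map_eq_some φ g b) a ι

lemma latSet_ext {Y : SimplexCategoryᵒᵖ} {a b : (latSet n q).obj Y}
    (h : ∀ ι, Monotone ι → evalCover (m := Y.unop.len) a ι = evalCover (m := Y.unop.len) b ι) :
    a = b :=
  evalCover_injective h

lemma not_injective_of_lt {m : ℕ} (h : m < n) (ι : Fin (n + 1) → Fin (m + 1)) :
    ¬ Function.Injective ι := fun hi => by
  have := Fintype.card_le_of_injective ι hi
  simp at this
  omega

lemma latSet_subsingleton {m : ℕ} (h : m < n) (a b : (latSet n q).obj (op ⦋m⦌)) : a = b :=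
  latSet_ext fun ι _ =>
    (evalCover_of_not_injective (m := m) a (not_injective_of_lt h ι)).trans
      (evalCover_of_not_injective (m := m) b (not_injective_of_lt h ι)).symm

/-- There is a unique family of values on the sections of covers of a sphere. -/
lemma exists_evalCover_id (x : Fin q → ℤ) :
    ∃ a : (latSet n q).obj (op ⦋n⦌), evalCover (m := n) a id = x := by
  classical
  obtain ⟨a, ha⟩ := exists_evalCover_eq (n := n) (m := n) (fun ι => if ι = id then x else 0)
    (fun ι hι => if_neg fun h => hι (by rw [h]; exact Function.injective_id)) (fun κ hκ => by
      by_cases hex : ∃ j : Fin (n + 2), ∀ v : Fin (n + 1), (κ (j.succAbove v) : ℕ) = v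
      · obtain ⟨j, hj⟩ := hex
        obtain ⟨k, hk⟩ := cover_face_iff (c := fun i => (κ i : ℕ)) (fun i j h => hκ h)
          (fun i => Nat.lt_succ_iff.1 (κ i).2) hj
        refine Eq.trans (congrArg altSum (funext fun i => ?_)) (altSum_degenerate k x)
        refine if_congr (Iff.trans ?_ (hk i)) rfl rfl
        exact ⟨fun h v => congrArg Fin.val (congrFun h v), fun h => funext fun v => Fin.ext (h v)⟩
      · refine Finset.sum_eq_zero fun j _ => ?_
        have h : (fun v => κ (j.succAbove v)) ≠ id := fun h =>
          hex ⟨j, fun v => congrArg Fin.val (congrFun h v)⟩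
        beta_reduce
        rw [if_neg h, smul_zero])
  exact ⟨a, (ha id monotone_id).trans (if_pos rfl)⟩

/-- A monotone map which misses a value factors through a face. -/
lemma exists_factor_of_notMem_range {k m : ℕ} {ι : Fin (k + 1) → Fin (m + 2)} (hι : Monotone ι)
    {i : Fin (m + 2)} (hi : ∀ v, ι v ≠ i) :
    ∃ ι' : Fin (k + 1) → Fin (m + 1), Monotone ι' ∧ ι = i.succAbove ∘ ι' := by
  choose ι' h using fun v => Fin.exists_succAbove_eq (hi v)
  refine ⟨ι', fun v w hvw => ?_, funext fun v => (h v).symm⟩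
  rw [← (Fin.strictMono_succAbove i).le_iff_le, h, h]
  exact hι hvw

/-- Compatible families of simplices bound if their values on surjections are cocycles. -/
lemma exists_latSet_filler {m : ℕ} {a : Fin (m + 2) → (latSet n q).obj (op ⦋m⦌)}
    (ha : FaceCompat (latSet n q) a)
    (hs : ∀ z : (Fin (n + 1) → Fin (m + 2)) → Fin q → ℤ,
      (∀ i ι, Monotone ι → z (Fin.succAbove i ∘ ι) = evalCover (m := m) (a i) ι) →
      ∀ κ : Fin (n + 2) → Fin (m + 2), Monotone κ → Function.Surjective κ →
        altSum (fun j => z (fun v => κ (Fin.succAbove j v))) = 0) :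
    ∃ b : (latSet n q).obj (op ⦋m + 1⦌),
      ∀ i, (latSet n q).map (SimplexCategory.δ i).op b = a i := by
  classical
  let z : (Fin (n + 1) → Fin (m + 2)) → Fin q → ℤ := fun ι =>
    if h : ∃ (i : Fin (m + 2)) (ι' : Fin (n + 1) → Fin (m + 1)), Monotone ι' ∧
      ι = i.succAbove ∘ ι' then evalCover (m := m) (a h.choose) h.choose_spec.choose else 0
  have hz : ∀ i ι, Monotone ι → z (Fin.succAbove i ∘ ι) = evalCover (m := m) (a i) ι := by
    intro i ι hι
    have h : ∃ (i' : Fin (m + 2)) (ι' : Fin (n + 1) → Fin (m + 1)), Monotone ι' ∧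
      i.succAbove ∘ ι = i'.succAbove ∘ ι' := ⟨i, ι, hι, rfl⟩
    obtain ⟨h1, h2⟩ := h.choose_spec.choose_spec
    refine (dif_pos h).trans ?_
    generalize h.choose_spec.choose = ι' at h1 h2 ⊢
    generalize h.choose = i' at h2 ⊢
    have e := ha n i' i (SimplexCategory.mkHom ⟨ι', h1⟩) (SimplexCategory.mkHom ⟨ι, hι⟩) (by
      ext v : 3
      exact congrFun h2.symm v)
    have e1 := evalCover_map (SimplexCategory.mkHom ⟨ι', h1⟩ : ⦋n⦌ ⟶ ⦋m⦌).op (a i') id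
    have e2 := evalCover_map (SimplexCategory.mkHom ⟨ι, hι⟩ : ⦋n⦌ ⟶ ⦋m⦌).op (a i) id
    exact e1.symm.trans ((congrArg (fun x => evalCover (m := n) x id) e).trans e2)
  have hcoc := exists_evalCover_eq (n := n) (m := m + 1) z (fun ι hι => by
    by_cases h : ∃ (i : Fin (m + 2)) (ι' : Fin (n + 1) → Fin (m + 1)), Monotone ι' ∧
      ι = i.succAbove ∘ ι'
    · obtain ⟨i, ι', h1, rfl⟩ := h
      rw [hz i ι' h1]
      exact evalCover_of_not_injective _ fun hi => hι ((Fin.succAbove_right_injective).comp hi)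
    · exact dif_neg h) (fun κ hκ => by
    by_cases h : Function.Surjective κ
    · exact hs z hz κ hκ h
    · rw [Function.Surjective] at h
      push Not at h
      obtain ⟨i, hi⟩ := h
      obtain ⟨κ', hκ', rfl⟩ := exists_factor_of_notMem_range hκ hi
      refine Eq.trans (congrArg altSum (funext fun j => ?_)) (altSum_evalCover (m := m) (a i) hκ')
      exact hz i (fun v => κ' (j.succAbove v)) (hκ'.comp (Fin.strictMono_succAbove j).monotone))
  obtain ⟨b, hb⟩ := hcoc
  refine ⟨b, fun i => latSet_ext fun ι hι => ?_⟩
  refine (evalCover_map (SimplexCategory.δ i).op b ι).trans ?_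
  exact (hb _ ((Fin.strictMono_succAbove i).monotone.comp hι)).trans (hz i ι hι)

lemma exists_latSet_filler_of_lt {m : ℕ} (h : n < m) {a : Fin (m + 2) → (latSet n q).obj (op ⦋m⦌)}
    (ha : FaceCompat (latSet n q) a) : ∃ b : (latSet n q).obj (op ⦋m + 1⦌),
      ∀ i, (latSet n q).map (SimplexCategory.δ i).op b = a i :=
  exists_latSet_filler ha fun z _ κ _ hs => by
    have := Fintype.card_le_of_surjective κ hs
    simp at this
    omega

lemma exists_latSet_filler_of_altSum {a : Fin (n + 2) → (latSet n q).obj (op ⦋n⦌)}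
    (ha : FaceCompat (latSet n q) a) (h : altSum (fun i => evalCover (m := n) (a i) id) = 0) :
    ∃ b : (latSet n q).obj (op ⦋n + 1⦌),
      ∀ i, (latSet n q).map (SimplexCategory.δ i).op b = a i :=
  exists_latSet_filler ha fun z hz κ hκ hs => by
    have : κ = id := by
      have hi := Finite.injective_iff_surjective.2 hs
      exact (hκ.strictMono_of_injective hi).range_inj strictMono_id |>.1 (by
        rw [hs.range_eq, Set.range_id])
    subst this
    refine Eq.trans (congrArg altSum (funext fun j => ?_)) h
    exact hz j id monotone_id

end LatticeSet

section SingularSet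
open Opposite Simplicial

/-- The map of topological simplices induced by a map of vertices. -/
noncomputable def smap {m k : ℕ} (f : Fin (m + 1) → Fin (k + 1)) : C(TopSimplex m, TopSimplex k) :=
  ⟨stdSimplex.map f, stdSimplex.continuous_map f⟩

theorem smap_comp {m k l : ℕ} (f : Fin (m + 1) → Fin (k + 1)) (g : Fin (k + 1) → Fin (l + 1))
    (t : TopSimplex m) : smap g (smap f t) = smap (g ∘ f) t :=
  stdSimplex.map_comp_apply f g t

theorem smap_id {m : ℕ} (t : TopSimplex m) : smap id t = t := stdSimplex.map_id_apply t

theorem smap_succAbove {m : ℕ} (i : Fin (m + 2)) (t : TopSimplex m) :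
    smap i.succAbove t = sface i t := rfl

/-- The singular simplicial set. -/
noncomputable def singSet (X : Type) [TopologicalSpace X] : SSet.{0} where
  obj Y := C(TopSimplex Y.unop.len, X)
  map φ := ↾(fun w => w.comp (smap φ.unop.toOrderHom))
  map_id Y := by
    refine ConcreteCategory.hom_ext _ _ fun w => ?_
    exact ContinuousMap.ext fun t => congrArg (show C(TopSimplex Y.unop.len, X) from w) (smap_id t)
  map_comp φ ψ := by
    refine ConcreteCategory.hom_ext _ _ fun w => ?_
    exact ContinuousMap.ext fun t => congrArg (show C(TopSimplex _, X) from w)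
      (smap_comp ψ.unop.toOrderHom φ.unop.toOrderHom t).symm

/-- The map of singular sets induced by a continuous map. -/
noncomputable def singMap {X Y : Type} [TopologicalSpace X] [TopologicalSpace Y] (f : C(X, Y)) :
    singSet X ⟶ singSet Y where
  app _ := ↾(fun w => f.comp w)
  naturality _ _ _ := rfl

variable {X : Type} [TopologicalSpace X]

theorem succAbove_comp_eq {m : ℕ} {i j : Fin (m + 3)} {i' j' : Fin (m + 2)}
    (hj : i.succAbove j' = j) (hi : j.succAbove i' = i) :
    i.succAbove ∘ j'.succAbove = j.succAbove ∘ i'.succAbove := by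
  have hr : ∀ {a b : Fin (m + 3)} {c : Fin (m + 2)}, a.succAbove c = b →
      Set.range (a.succAbove ∘ c.succAbove) = ({a, b} : Set (Fin (m + 3)))ᶜ := by
    rintro a b c rfl
    rw [Set.range_comp, Fin.range_succAbove]
    ext v
    simp only [Set.mem_image, Set.mem_compl_iff, Set.mem_singleton_iff, Set.mem_insert_iff, not_or]
    constructor
    · rintro ⟨w, hw, rfl⟩
      exact ⟨Fin.succAbove_ne a w, fun h => hw (Fin.succAbove_right_injective h)⟩
    · rintro ⟨h1, h2⟩
      obtain ⟨w, rfl⟩ := Fin.exists_succAbove_eq h1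
      exact ⟨w, fun h => h2 (congrArg _ h), rfl⟩
  refine (((Fin.strictMono_succAbove i).comp (Fin.strictMono_succAbove j')).range_inj
    ((Fin.strictMono_succAbove j).comp (Fin.strictMono_succAbove i'))).1 ?_
  rw [hr hj, hr hi, Set.pair_comm]

/-- A compatible family of singular simplices agrees on the intersections of faces. -/
theorem FaceCompat.sface_eq {m : ℕ} {e : Fin (m + 2) → C(TopSimplex m, X)}
    (he : FaceCompat (singSet X) (m := m) e) (i j : Fin (m + 2)) (s t : TopSimplex m)
    (h : sface i s = sface j t) :
    e i s = e j t := by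
  obtain rfl | hij := eq_or_ne i j
  · rw [sface_injective i h]
  obtain ⟨j', hj⟩ := Fin.exists_succAbove_eq hij.symm
  obtain ⟨i', hi⟩ := Fin.exists_succAbove_eq hij
  have hs : s j' = 0 := by
    rw [← sface_apply_succAbove i s j', hj, h, sface_apply_self]
  have ht : t i' = 0 := by
    rw [← sface_apply_succAbove j t i', hi, ← h, sface_apply_self]
  cases m with
  | zero =>
    have := s.2.2
    rw [Fin.sum_univ_one, Subsingleton.elim (0 : Fin 1) j'] at this
    exact absurd (hs.symm.trans this) zero_ne_one
  | succ m =>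
    obtain ⟨r, rfl⟩ := exists_sface_eq hs
    obtain ⟨r', rfl⟩ := exists_sface_eq ht
    have hc := succAbove_comp_eq hj hi
    have hr : r = r' := by
      refine sface_injective i' (sface_injective j ?_)
      rw [← h]
      simp only [← smap_succAbove, smap_comp, hc]
    subst hr
    have key := he m i j (SimplexCategory.δ j') (SimplexCategory.δ i') (by
      ext v : 3
      exact congrFun hc v)
    exact congrArg (fun w : C(TopSimplex m, X) => w r) key

/-- A compatible family of singular simplices is given by a map on the boundary. -/
theorem FaceCompat.exists_glue {m : ℕ} {e : Fin (m + 2) → C(TopSimplex m, X)}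
    (he : FaceCompat (singSet X) (m := m) e) :
    ∃ b : TopSimplex (m + 1) → X, ContinuousOn b (simplexBoundary (m + 1)) ∧
      ∀ i s, b (sface i s) = e i s :=
  exists_boundary_glue e (FaceCompat.sface_eq he)

/-- The pairs of simplices satisfying a relation. -/
def relSet (A B : SSet.{0}) (P : ∀ Y, A.obj Y → B.obj Y → Prop)
    (hP : ∀ {Y Z : SimplexCategoryᵒᵖ} (φ : Y ⟶ Z) (a : A.obj Y) (b : B.obj Y), P Y a b →
      P Z (A.map φ a) (B.map φ b)) : SSet.{0} where
  obj Y := {p : A.obj Y × B.obj Y // P Y p.1 p.2}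
  map φ := ↾(fun p => ⟨(A.map φ p.1.1, B.map φ p.1.2), hP φ _ _ p.2⟩)
  map_id Y := by
    refine ConcreteCategory.hom_ext _ _ fun p => ?_
    exact Subtype.ext (Prod.ext (Functor.map_id_apply A _ p.1.1)
      (Functor.map_id_apply B _ p.1.2))
  map_comp φ ψ := by
    refine ConcreteCategory.hom_ext _ _ fun p => ?_
    exact Subtype.ext (Prod.ext (Functor.map_comp_apply A φ ψ p.1.1)
      (Functor.map_comp_apply B φ ψ p.1.2))

section
variable {A B : SSet.{0}} {P : ∀ Y, A.obj Y → B.obj Y → Prop}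
  {hP : ∀ {Y Z : SimplexCategoryᵒᵖ} (φ : Y ⟶ Z) (a : A.obj Y) (b : B.obj Y), P Y a b →
      P Z (A.map φ a) (B.map φ b)}

/-- The first component of a related pair. -/
def relFst : relSet A B P hP ⟶ A where
  app _ := ↾(fun p => p.1.1)
  naturality _ _ _ := rfl

/-- The second component of a related pair. -/
def relSnd : relSet A B P hP ⟶ B where
  app _ := ↾(fun p => p.1.2)
  naturality _ _ _ := rfl

end

end SingularSet

section Realization
open Opposite Simplicial

variable {X : Type} [TopologicalSpace X] {n q : ℕ} {x : X}

/-- A singular simplex realizes a simplex of the simplicial lattice if its `n`-dimensional faces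
are constant and its `n + 1`-dimensional faces represent the prescribed classes. -/
structure Realizes (L : LoopClass (n + 1) x (Fin q → ℤ)) {m : ℕ}
    (a : coverSet (n + 1) (n + 1) q m → ℤ) (w : C(TopSimplex m, X)) : Prop where
  const : ∀ ι : Fin (n + 1) → Fin (m + 1), Monotone ι → ∀ t, w (smap ι t) = x
  cls : ∀ ι : Fin (n + 2) → Fin (m + 1), Monotone ι → ∃ f : GenLoop (Fin (n + 1)) X x,
    (∀ u, f u = w (smap ι (stick (n + 1) u))) ∧ L.cls f = evalCover a ι

variable {L : LoopClass (n + 1) x (Fin q → ℤ)}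

theorem Realizes.map {Y Z : SimplexCategoryᵒᵖ} (φ : Y ⟶ Z) (a : (latSet (n + 1) q).obj Y)
    (w : (singSet X).obj Y) (h : Realizes L (m := Y.unop.len) a w) :
    Realizes L (m := Z.unop.len) ((latSet (n + 1) q).map φ a) ((singSet X).map φ w) where
  const ι hι t := (congrArg (show C(TopSimplex Y.unop.len, X) from w) (smap_comp _ _ t)).trans
    (h.const _ (φ.unop.toOrderHom.monotone.comp hι) t)
  cls ι hι := by
    obtain ⟨f, h1, h2⟩ := h.cls _ (φ.unop.toOrderHom.monotone.comp hι)
    exact ⟨f, fun u => (h1 u).trans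
      (congrArg (show C(TopSimplex Y.unop.len, X) from w) (smap_comp _ _ _).symm),
      h2.trans (evalCover_map φ a ι).symm⟩

theorem Realizes.eq_const {m : ℕ} {a : coverSet (n + 1) (n + 1) q m → ℤ} {w : C(TopSimplex m, X)}
    (h : Realizes L a w) (hm : m ≤ n) (t : TopSimplex m) : w t = x := by
  let ι : Fin (n + 1) → Fin (m + 1) := fun v => ⟨min v m, by omega⟩
  let σ : Fin (m + 1) → Fin (n + 1) := Fin.castLE (by omega)
  have hι : Monotone ι := fun v v' hv => min_le_min (show (v : ℕ) ≤ v' from hv) le_rfl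
  have hσ : ι ∘ σ = id := funext fun v => Fin.ext (min_eq_left (Nat.lt_succ_iff.1 v.2))
  have := h.const ι hι (smap σ t)
  rwa [smap_comp, hσ, smap_id] at this

theorem realizes_const {m : ℕ} (hm : m ≤ n) (a : coverSet (n + 1) (n + 1) q m → ℤ) :
    Realizes L a (ContinuousMap.const _ x) where
  const _ _ _ := rfl
  cls ι _ := ⟨GenLoop.const, fun _ => rfl, L.cls_const.trans
    (evalCover_of_not_injective a (not_injective_of_lt (by omega) ι)).symm⟩

theorem exists_factor_of_not_surjective {k m : ℕ} {ι : Fin (k + 1) → Fin (m + 2)}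
    (hι : Monotone ι) (hs : ¬ Function.Surjective ι) :
    ∃ (i : Fin (m + 2)) (ι' : Fin (k + 1) → Fin (m + 1)), Monotone ι' ∧
      ι = i.succAbove ∘ ι' := by
  rw [Function.Surjective] at hs
  push Not at hs
  obtain ⟨i, hi⟩ := hs
  obtain ⟨ι', h⟩ := exists_factor_of_notMem_range hι hi
  exact ⟨i, ι', h⟩

theorem not_surjective_of_lt {k m : ℕ} (h : k < m) (ι : Fin (k + 1) → Fin (m + 1)) :
    ¬ Function.Surjective ι := fun hs => by
  have := Fintype.card_le_of_surjective ι hs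
  simp only [Fintype.card_fin] at this
  omega

theorem realizes_of_boundary {a : coverSet (n + 1) (n + 1) q (n + 1) → ℤ}
    {w : C(TopSimplex (n + 1), X)} (hw : ∀ t ∈ simplexBoundary (n + 1), w t = x)
    (h : L.cls (simplexLoop w hw) = evalCover a id) : Realizes L a w where
  const ι hι t := by
    obtain ⟨i, ι', -, rfl⟩ := exists_factor_of_not_surjective hι
      (not_surjective_of_lt (Nat.lt_succ_self n) ι)
    rw [← smap_comp]
    exact hw _ (sface_mem_boundary i _)
  cls ι hι := by
    by_cases hs : Function.Surjective ι
    · have : ι = id :=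
        (hι.strictMono_of_injective (Finite.injective_iff_surjective.2 hs)).range_inj strictMono_id
          |>.1 (by rw [hs.range_eq, Set.range_id])
      subst this
      exact ⟨simplexLoop w hw, fun u => congrArg w (smap_id _).symm, h⟩
    · have hi : ¬ Function.Injective ι := fun h => hs (Finite.injective_iff_surjective.1 h)
      obtain ⟨i, ι', -, rfl⟩ := exists_factor_of_not_surjective hι hs
      refine ⟨GenLoop.const, fun u => ?_, L.cls_const.trans
        (evalCover_of_not_injective a hi).symm⟩
      rw [← smap_comp]
      exact (hw _ (sface_mem_boundary i _)).symm

theorem realizes_of_faces {m : ℕ} (hm : n + 1 ≤ m) {a : (latSet (n + 1) q).obj (op ⦋m + 1⦌)}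
    {w : C(TopSimplex (m + 1), X)} (h : ∀ i : Fin (m + 2), Realizes L (m := m)
      ((latSet (n + 1) q).map (SimplexCategory.δ i).op a) (w.comp (sface i))) :
    Realizes L (m := m + 1) a w where
  const ι hι t := by
    obtain ⟨i, ι', hι', rfl⟩ := exists_factor_of_not_surjective hι
      (not_surjective_of_lt (by omega) ι)
    rw [← smap_comp]
    exact (h i).const ι' hι' t
  cls ι hι := by
    obtain ⟨i, ι', hι', rfl⟩ := exists_factor_of_not_surjective hι
      (not_surjective_of_lt (by omega) ι)
    obtain ⟨f, h1, h2⟩ := (h i).cls ι' hι'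
    refine ⟨f, fun u => ?_, h2.trans (evalCover_map (SimplexCategory.δ i).op a ι')⟩
    rw [← smap_comp]
    exact h1 u

theorem Realizes.exists_loop {a : coverSet (n + 1) (n + 1) q (n + 1) → ℤ}
    {w : C(TopSimplex (n + 1), X)} (h : Realizes L a w) :
    ∃ f : GenLoop (Fin (n + 1)) X x, (∀ u, f u = w (stick (n + 1) u)) ∧
      L.cls f = evalCover a id := by
  obtain ⟨f, h1, h2⟩ := h.cls id monotone_id
  exact ⟨f, fun u => (h1 u).trans (congrArg w (smap_id _)), h2⟩

/-- Lifting along the projection from the set of realizations. -/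
theorem exists_realizes_filler (hT : ∀ m, n + 1 < m → TrivialHomotopy m X) {m : ℕ}
    (b : (latSet (n + 1) q).obj (op ⦋m + 1⦌)) (w : Fin (m + 2) → C(TopSimplex m, X))
    (hw : FaceCompat (singSet X) (m := m) w)
    (hr : ∀ i, Realizes L (m := m) ((latSet (n + 1) q).map (SimplexCategory.δ i).op b) (w i)) :
    ∃ w' : C(TopSimplex (m + 1), X), (∀ i, w'.comp (sface i) = w i) ∧
      Realizes L (m := m + 1) b w' := by
  rcases lt_trichotomy m n with hm | rfl | hm
  · refine ⟨ContinuousMap.const _ x, fun i => ContinuousMap.ext fun t => ?_, realizes_const hm b⟩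
    exact ((hr i).eq_const hm.le t).symm
  · obtain ⟨f, hf⟩ := L.surj (evalCover (m := m + 1) b id)
    obtain ⟨w', h1, h2⟩ := exists_simplex_of_genLoop f
    refine ⟨w', fun i => ContinuousMap.ext fun t => ?_, realizes_of_boundary h2 ?_⟩
    · exact (h2 _ (sface_mem_boundary i t)).trans ((hr i).eq_const le_rfl t).symm
    · rw [← hf]
      exact congrArg L.cls (GenLoop.ext _ _ h1)
  · suffices h : ∃ w' : C(TopSimplex (m + 1), X), ∀ i, w'.comp (sface i) = w i by
      obtain ⟨w', h⟩ := h
      exact ⟨w', h, realizes_of_faces hm fun i => by rw [h i]; exact hr i⟩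
    rcases (Nat.succ_le_of_lt hm).eq_or_lt with rfl | hm'
    · choose f hf hc using fun i => (hr i).exists_loop
      obtain ⟨w', hw'⟩ := (L.exists_hasFaces_iff f).2 (by
        refine Eq.trans (congrArg altSum (funext fun i => ?_))
          (altSum_evalCover (m := n + 2) b (monotone_id (α := Fin (n + 3))))
        exact (hc i).trans (evalCover_map (SimplexCategory.δ i).op b id))
      refine ⟨w', fun i => stick_ext fun u => (hw' i u).trans (hf i u)⟩
    · obtain ⟨y, hy, hyw⟩ := hw.exists_glue
      obtain ⟨w', hw'⟩ := (hT m hm').exists_simplex_extension y hy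
      exact ⟨w', fun i => ContinuousMap.ext fun t =>
        (hw' _ (sface_mem_boundary i t)).trans (hyw i t)⟩

/-- The simplicial lattice maps to the singular set of a space with a single nontrivial homotopy
group. -/
theorem exists_realization (L : LoopClass (n + 1) x (Fin q → ℤ))
    (hT : ∀ m, n + 1 < m → TrivialHomotopy m X) :
    ∃ g : latSet (n + 1) q ⟶ singSet X, ∀ Y a, Realizes L (m := Y.unop.len) a (g.app Y a) := by
  let P : ∀ Y, (latSet (n + 1) q).obj Y → (singSet X).obj Y → Prop :=
    fun Y a w => Realizes L (m := Y.unop.len) a w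
  let E := relSet (latSet (n + 1) q) (singSet X) P Realizes.map
  let f : E ⟶ latSet (n + 1) q := relFst
  obtain ⟨s, hs⟩ := exists_section f
    (fun b => ⟨⟨(b, ContinuousMap.const _ x), realizes_const (Nat.zero_le n) b⟩, rfl⟩)
    (fun m b e he heb => by
      obtain ⟨w, h1, h2⟩ := exists_realizes_filler (L := L) hT b (fun i => (e i).1.2)
        (he.map (relSnd : E ⟶ singSet X)) fun i => by
          rw [← heb i]
          exact (e i).2
      exact ⟨⟨(b, w), h2⟩, fun i => Subtype.ext (Prod.ext (heb i).symm (h1 i)), rfl⟩)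
  refine ⟨s ≫ relSnd, fun Y a => ?_⟩
  have h := (s.app Y a).2
  have h' : (s.app Y a).1.1 = a := congrArg (fun φ : latSet (n + 1) q ⟶ latSet (n + 1) q =>
    φ.app Y a) hs
  exact (congrArg (fun a' => P Y a' (s.app Y a).1.2) h').mp h

end Realization

section SingularRetract
open Opposite Simplicial unitInterval

variable {X : Type} [TopologicalSpace X] {n q : ℕ} {x : X} {L : LoopClass (n + 1) x (Fin q → ℤ)}
  {g : latSet (n + 1) q ⟶ singSet X}

/-- A map from the simplicial lattice as a family of singular simplices. -/
def latSimplex (g : latSet (n + 1) q ⟶ singSet X) {m : ℕ}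
    (a : (latSet (n + 1) q).obj (op ⦋m⦌)) : C(TopSimplex m, X) :=
  g.app (op ⦋m⦌) a

theorem latSimplex_face (g : latSet (n + 1) q ⟶ singSet X) {m : ℕ} (i : Fin (m + 2))
    (a : (latSet (n + 1) q).obj (op ⦋m + 1⦌)) (t : TopSimplex m) :
    latSimplex g ((latSet (n + 1) q).map (SimplexCategory.δ i).op a) t =
      latSimplex g a (sface i t) :=
  congrArg (fun w : C(TopSimplex m, X) => w t)
    (NatTrans.naturality_apply g (SimplexCategory.δ i).op a)

/-- Prescribed homotopies of the faces of a simplex into the image of the simplicial lattice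
extend to the simplex. -/
theorem exists_deformation_filler (hg : ∀ Y a, Realizes L (m := Y.unop.len) a (g.app Y a))
    (hT : ∀ m, m ≠ n + 1 → TrivialHomotopy m X) {m : ℕ} (k : C(TopSimplex (m + 1), X))
    (a : Fin (m + 2) → (latSet (n + 1) q).obj (op ⦋m⦌)) (ha : FaceCompat (latSet (n + 1) q) a)
    (h : Fin (m + 2) → C(TopSimplex m, C(I, X)))
    (hh : FaceCompat (singSet C(I, X)) (m := m) h)
    (h0 : ∀ i t, h i t 0 = k (sface i t)) (h1 : ∀ i t, h i t 1 = latSimplex g (a i) t) :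
    ∃ (a' : (latSet (n + 1) q).obj (op ⦋m + 1⦌)) (h' : C(TopSimplex (m + 1), C(I, X))),
      (∀ i, (latSet (n + 1) q).map (SimplexCategory.δ i).op a' = a i) ∧
      (∀ i, h'.comp (sface i) = h i) ∧ (∀ t, h' t 0 = k t) ∧
      ∀ t, h' t 1 = latSimplex g a' t := by
  obtain ⟨b, hb, hbh⟩ := hh.exists_glue
  have hb0 : ∀ t ∈ simplexBoundary (m + 1), b t 0 = k t := by
    rintro t ⟨i, hi⟩
    obtain ⟨s, rfl⟩ := exists_sface_eq hi
    rw [hbh, h0]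
  have hface : ∀ {h' : C(TopSimplex (m + 1), C(I, X))},
      (∀ t ∈ simplexBoundary (m + 1), h' t = b t) → ∀ i, h'.comp (sface i) = h i :=
    fun hb' i => ContinuousMap.ext fun t => (hb' _ (sface_mem_boundary i t)).trans (hbh i t)
  obtain ⟨h₀, hh0, hhb⟩ := simplex_hep k b hb hb0
  have hend : ∀ i t, h₀ (sface i t) 1 = latSimplex g (a i) t := fun i t =>
    (congrArg (fun w : C(TopSimplex m, C(I, X)) => w t 1) (hface hhb i)).trans (h1 i t)
  let z : C(TopSimplex (m + 1), X) := ⟨fun t => h₀ t 1, by fun_prop⟩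
  rcases eq_or_ne m n with rfl | hm
  · have hz : ∀ t ∈ simplexBoundary (m + 1), z t = x := by
      rintro t ⟨i, hi⟩
      obtain ⟨s, rfl⟩ := exists_sface_eq hi
      exact (hend i s).trans ((hg (op ⦋m⦌) (a i)).eq_const le_rfl s)
    obtain ⟨a', ha'⟩ := exists_evalCover_id (n := m + 1) (L.cls (simplexLoop z hz))
    obtain ⟨f, hf, hc⟩ := (hg (op ⦋m + 1⦌) a').exists_loop
    have hL := (L.eq_iff (simplexLoop z hz) f).1 (ha'.symm.trans hc.symm)
    have hfg : f.1 = (latSimplex g a').comp (stick (m + 1)) := ContinuousMap.ext hf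
    rw [hfg] at hL
    obtain ⟨h', e0, e1, eb⟩ := exists_simplex_adjust h₀ (fun t => rfl) hL
    exact ⟨a', h', fun i => latSet_subsingleton (Nat.lt_succ_self m) _ _,
      hface fun t ht => (eb t ht).trans (hhb t ht), fun t => (e0 t).trans (hh0 t), e1⟩
  · obtain ⟨a', ha'⟩ : ∃ a' : (latSet (n + 1) q).obj (op ⦋m + 1⦌),
        ∀ i, (latSet (n + 1) q).map (SimplexCategory.δ i).op a' = a i := by
      rcases lt_trichotomy m (n + 1) with hlt | rfl | hlt
      · exact ⟨(0 : coverSet (n + 1) (n + 1) q (m + 1) → ℤ),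
          fun i => latSet_subsingleton hlt _ _⟩
      · choose f hf hc using fun i => (hg (op ⦋n + 1⦌) (a i)).exists_loop
        refine exists_latSet_filler_of_altSum ha ?_
        have := (L.exists_hasFaces_iff f).1 ⟨z, fun i u => (hend i _).trans (hf i u).symm⟩
        exact (congrArg altSum (funext hc)).symm.trans this
      · exact exists_latSet_filler_of_lt hlt ha
    obtain ⟨h', e0, e1, eb⟩ := (hT (m + 1) (by omega)).exists_simplex_prism k (latSimplex g a')
      b hb hb0 (by
        rintro t ⟨i, hi⟩
        obtain ⟨s, rfl⟩ := exists_sface_eq hi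
        rw [hbh, h1, ← ha', latSimplex_face])
    exact ⟨a', h', ha', hface eb, e0, e1⟩

/-- The evaluation at the start of a path. -/
def pathStart (X : Type) [TopologicalSpace X] : C(C(I, X), X) :=
  ⟨fun γ => γ 0, by fun_prop⟩

/-- The singular set deforms into the image of the simplicial lattice. -/
theorem exists_deformation (hg : ∀ Y a, Realizes L (m := Y.unop.len) a (g.app Y a))
    (hT : ∀ m, m ≠ n + 1 → TrivialHomotopy m X) :
    ∃ (f : singSet X ⟶ latSet (n + 1) q) (H : singSet X ⟶ singSet C(I, X)),
      H ≫ singMap (pathStart X) = 𝟙 _ ∧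
      ∀ (Y : SimplexCategoryᵒᵖ) (k : C(TopSimplex Y.unop.len, X)) (t : TopSimplex Y.unop.len),
        (show C(TopSimplex Y.unop.len, C(I, X)) from H.app Y k) t 1 =
          (show C(TopSimplex Y.unop.len, X) from g.app Y (f.app Y k)) t := by
  let P : ∀ Y, (latSet (n + 1) q).obj Y → (singSet C(I, X)).obj Y → Prop :=
    fun Y a h => ∀ t : TopSimplex Y.unop.len,
      (show C(TopSimplex Y.unop.len, C(I, X)) from h) t 1 =
        (show C(TopSimplex Y.unop.len, X) from g.app Y a) t
  let E := relSet (latSet (n + 1) q) (singSet C(I, X)) P fun {Y Z} φ a h hP t =>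
    (hP (smap φ.unop.toOrderHom t)).trans
      (congrArg (fun w : C(TopSimplex Z.unop.len, X) => w t) (NatTrans.naturality_apply g φ a)).symm
  let r : E ⟶ singSet C(I, X) := relSnd
  obtain ⟨s, hs⟩ := exists_section (r ≫ singMap (pathStart X))
    (fun k => by
      have hb : ∀ t : TopSimplex 0, t ∉ simplexBoundary 0 := by
        rintro t ⟨i, hi⟩
        have := t.2.2
        rw [Fin.sum_univ_one, Subsingleton.elim (0 : Fin 1) i] at this
        exact zero_ne_one (hi.symm.trans this)
      let a : (latSet (n + 1) q).obj (op ⦋0⦌) := (0 : coverSet (n + 1) (n + 1) q 0 → ℤ)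
      obtain ⟨h, h0, h1, -⟩ := (hT 0 (by omega)).exists_simplex_prism k (latSimplex g a)
        (fun _ => ContinuousMap.const _ x) continuousOn_const (fun t ht => absurd ht (hb t))
        (fun t ht => absurd ht (hb t))
      exact ⟨⟨(a, h), h1⟩, ContinuousMap.ext h0⟩)
    (fun m k e he hek => by
      obtain ⟨a', h', h1, h2, h3, h4⟩ := exists_deformation_filler hg hT k (fun i => (e i).1.1)
        (he.map (relFst : E ⟶ latSet (n + 1) q)) (fun i => (e i).1.2) (he.map r)
        (fun i t => congrArg (fun w : C(TopSimplex m, X) => w t) (hek i)) fun i t => (e i).2 t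
      exact ⟨⟨(a', h'), h4⟩, fun i => Subtype.ext (Prod.ext (h1 i) (h2 i)),
        ContinuousMap.ext h3⟩)
  exact ⟨s ≫ relFst, s ≫ r, hs, fun Y k t => (s.app Y k).2 t⟩

/-- The time coordinate of a point of a prism. -/
noncomputable def prismTime {m : ℕ} (τ : Fin (m + 1) → Fin 2) : C(TopSimplex m, I) :=
  ⟨fun t => stdSimplexHomeomorphUnitInterval (smap τ t), by fun_prop⟩

theorem prismTime_eq_zero {m : ℕ} {τ : Fin (m + 1) → Fin 2} (hτ : ∀ i, τ i = 0)
    (t : TopSimplex m) : prismTime τ t = 0 := by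
  have h : τ = Fin.succAbove (1 : Fin 2) ∘ fun _ => (0 : Fin 1) := funext hτ
  subst h
  refine Subtype.ext ?_
  change smap _ t 1 = 0
  rw [← smap_comp]
  exact sface_apply_self 1 _

theorem prismTime_eq_one {m : ℕ} {τ : Fin (m + 1) → Fin 2} (hτ : ∀ i, τ i = 1)
    (t : TopSimplex m) : prismTime τ t = 1 := by
  have h : τ = Fin.succAbove (0 : Fin 2) ∘ fun _ => (0 : Fin 1) := funext hτ
  subst h
  refine Subtype.ext ?_
  change smap (m := m) (k := 1) _ t 1 = 1
  have h1 := (smap (m := m) (k := 1) (Fin.succAbove (0 : Fin 2) ∘ fun _ => (0 : Fin 1)) t).2.2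
  have h0 : smap (m := m) (k := 1) (Fin.succAbove (0 : Fin 2) ∘ fun _ => (0 : Fin 1)) t 0 = 0 := by
    rw [← smap_comp]
    exact sface_apply_self 0 _
  rw [Fin.sum_univ_two] at h1
  exact (add_eq_right.2 h0).symm.trans h1

/-- A deformation of singular simplices is a simplicial homotopy. -/
noncomputable def prismOfDeformation {f : singSet X ⟶ singSet X}
    (H : singSet X ⟶ singSet C(I, X)) (h0 : H ≫ singMap (pathStart X) = 𝟙 _)
    (h1 : ∀ (Y : SimplexCategoryᵒᵖ) (k : C(TopSimplex Y.unop.len, X)) (t : TopSimplex Y.unop.len),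
        (show C(TopSimplex Y.unop.len, C(I, X)) from H.app Y k) t 1 =
          (show C(TopSimplex Y.unop.len, X) from f.app Y k) t) :
    PrismHomotopy (𝟙 (singSet X)) f where
  h Y τ := ↾(fun k => (⟨fun t => (show C(TopSimplex Y.unop.len, C(I, X)) from H.app Y k) t
    (prismTime τ.toOrderHom t), by fun_prop⟩ : C(TopSimplex Y.unop.len, X)))
  nat {Y Z} φ τ := by
    refine ConcreteCategory.hom_ext _ _ fun k => ContinuousMap.ext fun t => ?_
    have e := congrArg (fun w : C(TopSimplex Z.unop.len, C(I, X)) => w t)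
      (NatTrans.naturality_apply H φ k)
    have e' : prismTime (φ.unop ≫ τ).toOrderHom t =
        prismTime τ.toOrderHom (smap φ.unop.toOrderHom t) :=
      congrArg stdSimplexHomeomorphUnitInterval (smap_comp φ.unop.toOrderHom τ.toOrderHom t).symm
    exact (congrArg (fun γ : C(I, X) => γ _) e).trans
      (congrArg ((show C(TopSimplex Y.unop.len, C(I, X)) from H.app Y k)
        (smap φ.unop.toOrderHom t)) e')
  left Y τ hτ := by
    refine ConcreteCategory.hom_ext _ _ fun k => ContinuousMap.ext fun t => ?_
    have e := congrArg (fun φ : singSet X ⟶ singSet X =>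
      (show C(TopSimplex Y.unop.len, X) from φ.app Y k) t) h0
    exact (congrArg _ (prismTime_eq_zero hτ t)).trans e
  right Y τ hτ := by
    refine ConcreteCategory.hom_ext _ _ fun k => ContinuousMap.ext fun t => ?_
    exact (congrArg _ (prismTime_eq_one hτ t)).trans (h1 Y k t)

end SingularRetract
section EilenbergMacLaneHomology
open Opposite Simplicial

/-- Singular simplices as maps from the topological simplices. -/
noncomputable def toSSetIso (X : TopCat.{0}) : TopCat.toSSet.obj X ≅ singSet X :=
  NatIso.ofComponents (fun Y => (X.toSSetObjEquiv Y).toIso) fun _ => rfl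

/-- The free simplicial vector space on a simplicial set. -/
noncomputable def linearize (F : Type) [Field F] : SSet.{0} ⥤ SimplicialObject (ModuleCat.{0} F) :=
  (SimplicialObject.whiskering _ _).obj (ModuleCat.free F)

theorem hdim_linearize_toSSet_le (F : Type) [Field F] (X : TopCat.{0}) (s : ℕ) :
    hdim ((linearize F).obj (TopCat.toSSet.obj X)) s ≤ hdim ((linearize F).obj (singSet X)) s :=
  hdim_le_of_retract (PrismHomotopy.ofEq ((linearize F).mapIso (toSSetIso X)).hom_inv_id.symm) s

theorem hdim_linearize_singSet_le (F : Type) [Field F] {X : Type} [TopologicalSpace X] {n q : ℕ}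
    {x : X} (L : LoopClass (n + 1) x (Fin q → ℤ)) (hT : ∀ m, m ≠ n + 1 → TrivialHomotopy m X)
    (s : ℕ) : hdim ((linearize F).obj (singSet X)) s ≤
      hdim (latS F (coverSpace (n + 1) (n + 1) q)) s := by
  obtain ⟨g, hg⟩ := exists_realization L fun m hm => hT m hm.ne'
  obtain ⟨f, H, h0, h1⟩ := exists_deformation hg hT
  have K := (prismOfDeformation (f := f ≫ g) H h0 h1).whisker (ModuleCat.free F)
  refine hdim_le_of_retract (f := (linearize F).map f) (g := (linearize F).map g) ?_ s
  rw [← Functor.map_comp, ← CategoryTheory.Functor.map_id]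
  exact K

theorem IsEilenbergMacLane.hdim_le (F : Type) [Field F] {X : TopCat.{0}} {q n : ℕ}
    (hX : IsEilenbergMacLane X q (n + 1)) (s : ℕ) :
    hdim ((linearize F).obj (TopCat.toSSet.obj X)) s ≤
      hdim (latS F (coverSpace (n + 1) (n + 1) q)) s := by
  obtain ⟨⟨x⟩, -, htriv, hn⟩ := hX
  obtain ⟨m, hm, ⟨φ⟩⟩ := hn x
  obtain rfl : n = m := Nat.succ.inj hm
  refine (hdim_linearize_toSSet_le F X s).trans
    (hdim_linearize_singSet_le F (LoopClass.ofMulEquiv φ) (fun m hm => ?_) s)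
  exact trivialHomotopy_of_subsingleton fun v => by
    obtain ⟨e⟩ := htriv v m hm
    exact e.subsingleton

theorem finrank_eq_hdim (F : Type) [Field F] (A : SimplicialObject (ModuleCat.{0} F)) (s : ℕ)
    (h : hdim A s ≠ ⊤) :
    FiniteDimensional F (((alternatingFaceMapComplex (ModuleCat.{0} F)).obj A).homology s) ∧
      ((Module.finrank F (((alternatingFaceMapComplex (ModuleCat.{0} F)).obj A).homology s) : ℕ) :
        ENNReal) = hdim A s := by
  rw [hdim, ne_eq, ENat.toENNReal_eq_top, Cardinal.toENat_eq_top, not_le] at h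
  have hfin := Module.rank_lt_aleph0_iff.1 h
  refine ⟨hfin, ?_⟩
  refine Eq.symm ?_
  rw [hdim, ← Module.finrank_eq_rank, Cardinal.toENat_nat, ENat.toENNReal_coe]

/-- A power series of dimensions with bounded partial sums. -/
theorem summable_of_truncSeries_le (F : Type) [Field F] (A : SimplicialObject (ModuleCat.{0} F))
    (h : ∀ s, hdim A s ≠ ⊤) {t : ℝ} (ht : 0 ≤ t) {c : ENNReal} (hc : c ≠ ⊤)
    (hle : ∀ N, truncSeries (ENNReal.ofReal t) N A ≤ c) :
    Summable fun s : ℕ => (Module.finrank F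
      (((alternatingFaceMapComplex (ModuleCat.{0} F)).obj A).homology s) : ℝ) * t ^ s := by
  refine summable_of_sum_range_le (c := c.toReal) (fun s => by positivity) fun N => ?_
  rw [← ENNReal.ofReal_le_iff_le_toReal hc, ENNReal.ofReal_sum_of_nonneg fun s _ => by positivity]
  refine le_trans (le_of_eq (Finset.sum_congr rfl fun s _ => ?_)) (hle N)
  rw [ENNReal.ofReal_mul (Nat.cast_nonneg _), ENNReal.ofReal_natCast, ENNReal.ofReal_pow ht,
    (finrank_eq_hdim F A s (h s)).2]

end EilenbergMacLaneHomology

/-!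
STATEMENT 5: For `F` a field of characteristic `p > 0` and `Π = ℤ^q` a
finitely generated free abelian group, `n ≥ 1`, the Poincaré series
`θ(Π,n,t) = Σ_s dim_F H_s(K(Π,n); F) t^s` has radius of convergence at
least 1: each `H_s(K(Π,n); F)` is finite dimensional and the series converges
on the open unit disc.
-/
theorem poincare_series_EM_space_converges
    (F : Type) [Field F] (p : ℕ) (hp : p.Prime) [CharP F p]
    (q n : ℕ) (hn : 1 ≤ n) (X : TopCat) (hX : IsEilenbergMacLane X q n) :
    (∀ s : ℕ, FiniteDimensional F (singularHomologyF F X s)) ∧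
      ∀ t : ℝ, 0 ≤ t → t < 1 →
        Summable (fun s : ℕ =>
          (Module.finrank F (singularHomologyF F X s) : ℝ) * t ^ s) := by
  obtain ⟨n, rfl⟩ : ∃ m, n = m + 1 := ⟨n - 1, by omega⟩
  have : Fact p.Prime := ⟨hp⟩
  let A := (linearize F).obj (TopCat.toSSet.obj X)
  have hA : ∀ {t : ENNReal}, t < 1 → ∃ c : ENNReal, c ≠ ⊤ ∧ ∀ N, truncSeries t N A ≤ c := by
    intro t ht
    obtain ⟨c, hc, h⟩ := truncSeries_latS_le F p q n ht
    exact ⟨c, hc, fun N => le_trans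
      (Finset.sum_le_sum fun s _ => mul_le_mul_left (hX.hdim_le F s) _) (h N)⟩
  have hdim_ne_top : ∀ s, hdim A s ≠ ⊤ := by
    intro s hs
    obtain ⟨c, hc, h⟩ := hA (t := 2⁻¹) (by simp)
    refine hc (top_le_iff.1 (le_trans (top_le_iff.2 ?_) (h (s + 1))))
    refine ENNReal.sum_eq_top.2 ⟨s, Finset.self_mem_range_succ s, ?_⟩
    rw [hs, ENNReal.top_mul (by simp)]
  refine ⟨fun s => (finrank_eq_hdim F A s (hdim_ne_top s)).1, fun t ht0 ht1 => ?_⟩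
  obtain ⟨c, hc, h⟩ := hA (ENNReal.ofReal_lt_one.2 ht1)
  exact summable_of_truncSeries_le F A hdim_ne_top ht0 hc h
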